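/- Under the Setup with M = 11, assume in addition that f has infinite order or infinitely many poles. Call an integer m ∈ {1, …, 10} defective if K_m and K_{m+1} are both rational functions. Then, if 1 ≤ m < m' ≤ 10 and both m and m' are defective, it follows that m' ≤ m + 2. -/

import Mathlib

open Complex Filter Topology MeasureTheory
open scoped Classical

noncomputable section

/-- `mtilde f` is the function `z ↦ conj (f (conj z))`, denoted `f̃` in the paper. -/
def mtilde (f : ℂ → ℂ) : ℂ → ℂ := fun z => (starRingEnd ℂ) (f ((starRingEnd ℂ) z))

/-- Equality of meromorphic functions: near every point of `ℂ`, the two functions agree on a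
punctured neighbourhood (so the set where they disagree is closed and discrete). -/
def MeroEq (h₁ h₂ : ℂ → ℂ) : Prop := ∀ z : ℂ, ∀ᶠ w in 𝓝[≠] z, h₁ w = h₂ w

/-- `f` is strictly non-real: `f̃` is not a constant multiple of `f`. -/
def StrictlyNonReal (f : ℂ → ℂ) : Prop := ¬ ∃ c : ℂ, MeroEq (mtilde f) (fun z => c * f z)

/-- A rational function, as a meromorphic function on `ℂ`. -/
def IsRatFn (h : ℂ → ℂ) : Prop :=
  ∃ p q : Polynomial ℂ, q ≠ 0 ∧ MeroEq h (fun z => p.eval z / q.eval z)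

/-- The order of vanishing (negative at a pole) of a function at a point, when the function is
meromorphic there; junk value `0` otherwise. -/
def meroOrder (h : ℂ → ℂ) (z : ℂ) : WithTop ℤ :=
  if hh : MeromorphicAt h z then meromorphicOrderAt h z else 0

/-- The positive part of the logarithm. -/
def logPlus (x : ℝ) : ℝ := max (Real.log x) 0

/-- The Nevanlinna proximity function `m(r, h)`. -/
def proximity (h : ℂ → ℂ) (r : ℝ) : ℝ :=
  (2 * Real.pi)⁻¹ * ∫ θ in (0:ℝ)..(2 * Real.pi),
    logPlus ‖h ((r : ℂ) * Complex.exp (θ * Complex.I))‖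

/-- The multiplicity of a pole of `h` at `z` (0 if not a pole). -/
def poleMult (h : ℂ → ℂ) (z : ℂ) : ℕ := (-((meroOrder h z).untopD 0)).toNat

/-- The number of poles, counted with multiplicity, in the closed disc of radius `t`. -/
def poleCount (h : ℂ → ℂ) (t : ℝ) : ℝ := ∑ᶠ z ∈ Metric.closedBall (0:ℂ) t, (poleMult h z : ℝ)

/-- The integrated counting function `N(r, h)` of the poles of `h` (with multiplicity). -/
def NCount (h : ℂ → ℂ) (r : ℝ) : ℝ := ∫ t in (1:ℝ)..r, poleCount h t / t

/-- The Nevanlinna characteristic `T(r, h) = m(r, h) + N(r, h)`. -/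
def TChar (h : ℂ → ℂ) (r : ℝ) : ℝ := proximity h r + NCount h r

/-- The number of points of `S` in the closed disc of radius `t`. -/
def distinctCount (S : Set ℂ) (t : ℝ) : ℝ := (S ∩ Metric.closedBall (0:ℂ) t).ncard

/-- The integrated counting function `N̄(r, h)` of the distinct poles of `h`. -/
def NbarPoles (h : ℂ → ℂ) (r : ℝ) : ℝ :=
  ∫ t in (1:ℝ)..r, distinctCount {z | meroOrder h z < 0} t / t

/-- The integrated counting function `N̄(r, 1/h)` of the distinct zeros of `h`. -/
def NbarZeros (h : ℂ → ℂ) (r : ℝ) : ℝ :=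
  ∫ t in (1:ℝ)..r, distinctCount {z | 0 < meroOrder h z} t / t

/-- `h` has finite (Nevanlinna) order: `T(r, h) ≤ r ^ C` for all large `r`. -/
def FiniteOrder (h : ℂ → ℂ) : Prop := ∃ C : ℝ, ∀ᶠ r in atTop, TChar h r ≤ r ^ C

/-- `h` has finite lower order: `T(r, h) ≤ r ^ C` for arbitrarily large `r`. -/
def FiniteLowerOrder (h : ℂ → ℂ) : Prop := ∃ C : ℝ, ∃ᶠ r in atTop, TChar h r ≤ r ^ C

/-- The Setup of Section 3 of the paper: `M ≥ 4` and `f` is a strictly non-real meromorphic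
function in the plane such that `f, f', …, f^(M+3)` all have finitely many non-real zeros. -/
def Setup (M : ℕ) (f : ℂ → ℂ) : Prop :=
  4 ≤ M ∧ (∀ z, MeromorphicAt f z) ∧ StrictlyNonReal f ∧
    ∀ m, m ≤ M + 3 → {z : ℂ | 0 < meroOrder (iteratedDeriv m f) z ∧ z.im ≠ 0}.Finite

/-- The function `F_m(z) = z - f^(m)(z) / f^(m+1)(z)`. -/
def Fm (f : ℂ → ℂ) (m : ℕ) : ℂ → ℂ :=
  fun z => z - iteratedDeriv m f z / iteratedDeriv (m + 1) f z

/-- `Km` is the meromorphic function with finitely many zeros and poles satisfying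
`F_m' = K_m G_m'`, where `G_m` is the analogue of `F_m` for `g = f̃`. -/
def IsKm (f : ℂ → ℂ) (m : ℕ) (Km : ℂ → ℂ) : Prop :=
  (∀ z, MeromorphicAt Km z) ∧ {z | 0 < meroOrder Km z}.Finite ∧
    {z | meroOrder Km z < 0}.Finite ∧
    MeroEq (deriv (Fm f m)) (fun z => Km z * deriv (Fm (mtilde f) m) z)

end

open Metric

/-! Ultralimits of locally bounded holomorphic families. -/

def LocBdd (𝒰 : Ultrafilter ℕ) (h : ℕ → ℂ → ℂ) (U : Set ℂ) : Prop :=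
  ∀ ζ ∈ U, ∃ r > 0, ∃ M : ℝ, ∀ᶠ k in (𝒰 : Filter ℕ),
    DifferentiableOn ℂ (h k) (ball ζ r) ∧ ∀ w ∈ ball ζ r, ‖h k w‖ ≤ M

def LimOn (𝒰 : Ultrafilter ℕ) (h : ℕ → ℂ → ℂ) (H : ℂ → ℂ) (U : Set ℂ) : Prop :=
  ∀ ζ ∈ U, ∃ r > 0, (∀ᶠ k in (𝒰 : Filter ℕ), DifferentiableOn ℂ (h k) (ball ζ r)) ∧
    TendstoUniformlyOn h H 𝒰 (ball ζ r)

lemma ultra_lim_of_bdd {E : Type*} [NormedAddCommGroup E] [ProperSpace E]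
    (𝒰 : Ultrafilter ℕ) (a : ℕ → E) (M : ℝ)
    (h : ∀ᶠ k in (𝒰 : Filter ℕ), ‖a k‖ ≤ M) : ∃ l : E, ‖l‖ ≤ M ∧ Tendsto a 𝒰 (𝓝 l) := by
  have hc : IsCompact (closedBall (0:E) M) := isCompact_closedBall 0 M
  have := hc.ultrafilter_le_nhds (𝒰.map a) (by
    simp only [le_principal_iff, Ultrafilter.coe_map, mem_map]
    filter_upwards [h] with k hk
    simpa using hk)
  obtain ⟨x, hx, hxx⟩ := this
  exact ⟨x, by simpa using hx, by simpa [Tendsto] using hxx⟩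

lemma lip_of_bdd {g : ℂ → ℂ} {ζ : ℂ} {r M : ℝ} (hr : 0 < r)
    (hd : DifferentiableOn ℂ g (ball ζ r)) (hb : ∀ w ∈ ball ζ r, ‖g w‖ ≤ M) :
    ∀ x ∈ ball ζ (r/2), ∀ y ∈ ball ζ (r/2), ‖g x - g y‖ ≤ M / (r/4) * ‖x - y‖ := by
  intro x hx y hy
  refine (convex_ball ζ (r/2)).norm_image_sub_le_of_norm_deriv_le (𝕜 := ℂ) ?_ ?_ hy hx
  · intro z hz
    exact hd.differentiableAt (isOpen_ball.mem_nhds (ball_subset_ball (by linarith) hz))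
  · intro z hz
    have hsub : closedBall z (r/4) ⊆ ball ζ r := by
      intro w hw
      simp only [mem_ball, mem_closedBall] at *
      calc dist w ζ ≤ dist w z + dist z ζ := dist_triangle _ _ _
        _ < r := by linarith
    refine Complex.norm_deriv_le_of_forall_mem_sphere_norm_le (by linarith) ?_ ?_
    · exact (hd.mono (closure_ball_subset_closedBall.trans hsub)).diffContOnCl
    · intro w hw
      exact hb w (hsub (sphere_subset_closedBall hw))

lemma LocBdd.exists_lim {𝒰 : Ultrafilter ℕ} {h : ℕ → ℂ → ℂ} {U : Set ℂ}
    (hb : LocBdd 𝒰 h U) : ∃ H, LimOn 𝒰 h H U := by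
  have hpt : ∀ ζ ∈ U, ∀ r > 0, ∀ M : ℝ, (∀ᶠ k in (𝒰 : Filter ℕ),
    DifferentiableOn ℂ (h k) (ball ζ r) ∧ ∀ w ∈ ball ζ r, ‖h k w‖ ≤ M) →
      ∀ w ∈ ball ζ r, ∃ l, Tendsto (fun k => h k w) 𝒰 (𝓝 l) := by
    intro ζ _ r _ M hM w hw
    obtain ⟨l, _, hl⟩ := ultra_lim_of_bdd 𝒰 (fun k => h k w) M
      (hM.mono fun k hk => hk.2 w hw)
    exact ⟨l, hl⟩
  refine ⟨fun w => limUnder (𝒰 : Filter ℕ) (fun k => h k w), ?_⟩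
  intro ζ hζ
  obtain ⟨r, hr, M, hM⟩ := hb ζ hζ
  refine ⟨r/2, by linarith, ?_, ?_⟩
  · filter_upwards [hM] with k hk
    exact hk.1.mono (ball_subset_ball (by linarith))
  set H := fun w => limUnder (𝒰 : Filter ℕ) (fun k => h k w) with hH
  have hlim : ∀ w ∈ ball ζ r, Tendsto (fun k => h k w) 𝒰 (𝓝 (H w)) := by
    intro w hw
    exact tendsto_nhds_limUnder (hpt ζ hζ r hr M hM w hw)
  set L := |M| / (r/4) with hL
  have hL0 : 0 ≤ L := by positivity
  have hlipk : ∀ᶠ k in (𝒰 : Filter ℕ), ∀ x ∈ ball ζ (r/2), ∀ y ∈ ball ζ (r/2),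
      ‖h k x - h k y‖ ≤ L * ‖x - y‖ := by
    filter_upwards [hM] with k hk
    exact lip_of_bdd hr hk.1 (fun w hw => (hk.2 w hw).trans (le_abs_self M))
  have hlipH : ∀ x ∈ ball ζ (r/2), ∀ y ∈ ball ζ (r/2), ‖H x - H y‖ ≤ L * ‖x - y‖ := by
    intro x hx y hy
    have h1 := hlim x (ball_subset_ball (by linarith) hx)
    have h2 := hlim y (ball_subset_ball (by linarith) hy)
    exact le_of_tendsto (h1.sub h2).norm (hlipk.mono fun k hk => hk x hx y hy)
  rw [Metric.tendstoUniformlyOn_iff]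
  intro ε hε
  set δ := ε / (4 * (L + 1)) with hδ
  have hδ0 : 0 < δ := by positivity
  have htb : TotallyBounded (ball ζ (r/2)) :=
    (isCompact_closedBall ζ (r/2)).totallyBounded.subset ball_subset_closedBall
  obtain ⟨t, ht1, htf, ht2⟩ := Metric.finite_approx_of_totallyBounded htb δ hδ0
  have hev : ∀ᶠ k in (𝒰 : Filter ℕ), ∀ c ∈ t, dist (H c) (h k c) < ε/4 := by
    rw [Filter.eventually_all_finite htf]
    intro c hc
    have := hlim c (ball_subset_ball (by linarith) (ht1 hc))
    filter_upwards [(Metric.tendsto_nhds.1 this) (ε/4) (by linarith)] with k hk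
    rwa [dist_comm]
  filter_upwards [hev, hlipk] with k hk hlk x hx
  have := ht2 hx
  simp only [Set.mem_iUnion, mem_ball, exists_prop] at this
  obtain ⟨c, hc, hxc⟩ := this
  have e1 := hlipH x hx c (ht1 hc)
  have e2 := hlk c (ht1 hc) x hx
  have e3 := hk c hc
  rw [← dist_eq_norm] at e1 e2
  rw [← dist_eq_norm] at e1 e2
  have hLd : L * dist x c ≤ ε/4 := by
    calc L * dist x c ≤ (L+1) * δ := by gcongr; linarith
      _ = ε/4 := by rw [hδ]; field_simp
  have hLd' : L * dist c x ≤ ε/4 := by rw [dist_comm]; exact hLd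
  calc dist (H x) (h k x) ≤ dist (H x) (H c) + dist (H c) (h k c) + dist (h k c) (h k x) :=
        dist_triangle4 _ _ _ _
    _ < ε := by linarith

lemma LimOn.differentiableOn {𝒰 : Ultrafilter ℕ} {h : ℕ → ℂ → ℂ} {H : ℂ → ℂ} {U : Set ℂ}
    (hl : LimOn 𝒰 h H U) : ∀ ζ ∈ U, AnalyticAt ℂ H ζ := by
  intro ζ hζ
  obtain ⟨r, hr, hd, ht⟩ := hl ζ hζ
  have : DifferentiableOn ℂ H (ball ζ r) :=
    ht.tendstoLocallyUniformlyOn.differentiableOn hd isOpen_ball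
  exact this.analyticAt (isOpen_ball.mem_nhds (mem_ball_self hr))

lemma LimOn.tendsto {𝒰 : Ultrafilter ℕ} {h : ℕ → ℂ → ℂ} {H : ℂ → ℂ} {U : Set ℂ}
    (hl : LimOn 𝒰 h H U) {ζ : ℂ} (hζ : ζ ∈ U) : Tendsto (fun k => h k ζ) 𝒰 (𝓝 (H ζ)) := by
  obtain ⟨r, hr, hd, ht⟩ := hl ζ hζ
  exact ht.tendsto_at (mem_ball_self hr)

lemma LimOn.eventually_analyticAt {𝒰 : Ultrafilter ℕ} {h : ℕ → ℂ → ℂ} {H : ℂ → ℂ} {U : Set ℂ}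
    (hl : LimOn 𝒰 h H U) {ζ : ℂ} (hζ : ζ ∈ U) : ∀ᶠ k in (𝒰 : Filter ℕ), AnalyticAt ℂ (h k) ζ := by
  obtain ⟨r, hr, hd, ht⟩ := hl ζ hζ
  filter_upwards [hd] with k hk
  exact hk.analyticAt (isOpen_ball.mem_nhds (mem_ball_self hr))

lemma LimOn.derivs {𝒰 : Ultrafilter ℕ} {h : ℕ → ℂ → ℂ} {H : ℂ → ℂ} {U : Set ℂ}
    (hl : LimOn 𝒰 h H U) : LimOn 𝒰 (fun k => deriv (h k)) (deriv H) U := by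
  intro ζ hζ
  obtain ⟨r, hr, hd, ht⟩ := hl ζ hζ
  refine ⟨r/2, by linarith, ?_, ?_⟩
  · filter_upwards [hd] with k hk
    exact (hk.deriv isOpen_ball).mono (ball_subset_ball (by linarith))
  · have h1 := ht.tendstoLocallyUniformlyOn.deriv hd isOpen_ball
    have h2 := (tendstoLocallyUniformlyOn_iff_forall_isCompact isOpen_ball).1 h1
      (closedBall ζ (r/2)) (closedBall_subset_ball (by linarith)) (isCompact_closedBall _ _)
    exact h2.mono ball_subset_closedBall

lemma LimOn.mono {𝒰 : Ultrafilter ℕ} {h : ℕ → ℂ → ℂ} {H : ℂ → ℂ} {U V : Set ℂ}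
    (hl : LimOn 𝒰 h H U) (hVU : V ⊆ U) : LimOn 𝒰 h H V := fun ζ hζ => hl ζ (hVU hζ)

lemma LimOn.tendsto_seq {𝒰 : Ultrafilter ℕ} {h : ℕ → ℂ → ℂ} {H : ℂ → ℂ} {U : Set ℂ}
    (hl : LimOn 𝒰 h H U) {ζ : ℂ} (hζ : ζ ∈ U) {z : ℕ → ℂ} (hz : Tendsto z 𝒰 (𝓝 ζ)) :
    Tendsto (fun k => h k (z k)) 𝒰 (𝓝 (H ζ)) := by
  obtain ⟨r, hr, hd, ht⟩ := hl ζ hζ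
  have hc : ContinuousAt H ζ := (hl.differentiableOn ζ hζ).continuousAt
  have hc' : ContinuousWithinAt H (ball ζ r) ζ := hc.continuousWithinAt
  refine ht.tendsto_comp hc' ?_
  rw [tendsto_nhdsWithin_iff]
  exact ⟨hz, hz.eventually (isOpen_ball.mem_nhds (mem_ball_self hr))⟩

/-- Hurwitz: zeros of the limit are limits of zeros. -/
lemma LimOn.hurwitz {𝒰 : Ultrafilter ℕ} (hU : (𝒰 : Filter ℕ) ≤ atTop) {h : ℕ → ℂ → ℂ} {H : ℂ → ℂ} {U : Set ℂ}
    (hl : LimOn 𝒰 h H U) {ζ : ℂ} (hζ : ζ ∈ U) (h0 : H ζ = 0) (hne : ¬ ∀ᶠ w in 𝓝 ζ, H w = 0) :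
    ∃ z : ℕ → ℂ, Tendsto z 𝒰 (𝓝 ζ) ∧ ∀ᶠ k in (𝒰 : Filter ℕ), h k (z k) = 0 := by
  have key : ∀ ε > 0, ∀ᶠ k in (𝒰 : Filter ℕ), ∃ w, dist w ζ ≤ ε ∧ h k w = 0 := by
    intro ε hε
    obtain ⟨r, hr, hd, ht⟩ := hl ζ hζ
    have han := hl.differentiableOn ζ hζ
    have hiso := (han.eventually_eq_zero_or_eventually_ne_zero).resolve_left hne
    rw [eventually_nhdsWithin_iff, Metric.eventually_nhds_iff] at hiso
    obtain ⟨r2, hr2, hiso⟩ := hiso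
    set s := min ε (min (r/2) (r2/2)) with hs
    have hs0 : 0 < s := by positivity
    have hse : s ≤ ε := min_le_left _ _
    have hsr : s ≤ r/2 := (min_le_right _ _).trans (min_le_left _ _)
    have hsr2 : s ≤ r2/2 := (min_le_right _ _).trans (min_le_right _ _)
    have hcH : ContinuousOn H (ball ζ r) :=
      (ht.tendstoLocallyUniformlyOn.differentiableOn hd isOpen_ball).continuousOn
    have hsub : sphere ζ s ⊆ ball ζ r := by
      intro w hw; rw [mem_sphere] at hw; rw [mem_ball]; linarith
    have hcs : ContinuousOn (fun w => ‖H w‖) (sphere ζ s) := (hcH.mono hsub).norm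
    have hnes : (sphere ζ s).Nonempty := NormedSpace.sphere_nonempty.2 hs0.le
    obtain ⟨w0, hw0, hmin⟩ := (isCompact_sphere ζ s).exists_isMinOn hnes hcs
    set δ := ‖H w0‖ with hδ
    have hδ0 : 0 < δ := by
      rw [hδ, norm_pos_iff]
      refine hiso ?_ ?_
      · rw [mem_sphere] at hw0; linarith
      · rintro rfl; simp at hw0; linarith
    rw [Metric.tendstoUniformlyOn_iff] at ht
    filter_upwards [ht (δ/4) (by linarith), hd] with k hk hdk
    by_contra hcon
    push Not at hcon
    have hnz : ∀ w ∈ closedBall ζ s, h k w ≠ 0 := fun w hw =>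
      hcon w ((mem_closedBall.1 hw).trans hse)
    have hcb : closedBall ζ s ⊆ ball ζ r := closedBall_subset_ball (by linarith)
    have hdinv : DiffContOnCl ℂ (fun w => (h k w)⁻¹) (ball ζ s) := by
      refine DifferentiableOn.diffContOnCl ?_
      rw [closure_ball ζ hs0.ne']
      exact (hdk.mono hcb).inv hnz
    have hbound := Complex.norm_le_of_forall_mem_frontier_norm_le isBounded_ball hdinv
      (C := (3*δ/4)⁻¹) (by
        intro z hz
        rw [frontier_ball ζ hs0.ne'] at hz
        rw [norm_inv]
        refine inv_anti₀ (by linarith) ?_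
        have h1 : δ ≤ ‖H z‖ := hmin hz
        have h2 := hk z (hsub hz)
        rw [dist_eq_norm] at h2
        have h3 := norm_sub_norm_le (H z) (h k z)
        linarith) (z := ζ) (subset_closure (mem_ball_self hs0))
    have h2 := hk ζ (mem_ball_self hr)
    rw [h0, dist_zero_left] at h2
    rw [norm_inv] at hbound
    have hpos : 0 < ‖h k ζ‖ := norm_pos_iff.2 (hnz ζ (mem_closedBall_self hs0.le))
    rw [inv_le_inv₀ hpos (by linarith)] at hbound
    linarith
  -- choose near-optimal zeros
  have hch : ∀ k, ∃ w : ℂ, (∃ w', h k w' = 0) →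
      (h k w = 0 ∧ dist w ζ ≤ sInf ((fun v => dist v ζ) '' {v | h k v = 0}) + 1/((k:ℝ)+1)) := by
    intro k
    by_cases hex : ∃ w', h k w' = 0
    · have hne' : ((fun v => dist v ζ) '' {v | h k v = 0}).Nonempty := by
        obtain ⟨w', hw'⟩ := hex; exact ⟨_, w', hw', rfl⟩
      obtain ⟨x, ⟨w, hw, rfl⟩, hx⟩ := exists_lt_of_csInf_lt hne'
        (lt_add_of_pos_right (sInf ((fun v => dist v ζ) '' {v | h k v = 0}))
          (show (0:ℝ) < 1/((k:ℝ)+1) by positivity))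
      exact ⟨w, fun _ => ⟨hw, hx.le⟩⟩
    · exact ⟨0, fun hh => absurd hh hex⟩
  choose z hz using hch
  refine ⟨z, ?_, ?_⟩
  · rw [Metric.tendsto_nhds]
    intro ε hε
    have ht : Tendsto (fun k:ℕ => 1/((k:ℝ)+1)) atTop (𝓝 0) := tendsto_one_div_add_atTop_nhds_zero_nat
    have := (ht.mono_left hU).eventually (gt_mem_nhds (show (0:ℝ) < ε/2 by linarith))
    filter_upwards [key (ε/2) (by linarith), this] with k hk1 hk2
    obtain ⟨w, hw1, hw2⟩ := hk1
    have h3 := (hz k ⟨w, hw2⟩).2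
    have h4 : sInf ((fun v => dist v ζ) '' {v | h k v = 0}) ≤ ε/2 :=
      by
      refine le_trans (csInf_le ?_ (Set.mem_image_of_mem _ hw2)) hw1
      exact ⟨0, by rintro _ ⟨v, _, rfl⟩; exact dist_nonneg⟩
    linarith
  · filter_upwards [key 1 one_pos] with k hk
    obtain ⟨w, hw1, hw2⟩ := hk
    exact (hz k ⟨w, hw2⟩).1

lemma LimOn.congr {𝒰 : Ultrafilter ℕ} {h : ℕ → ℂ → ℂ} {H G : ℂ → ℂ} {U : Set ℂ} (hUo : IsOpen U)
    (hl : LimOn 𝒰 h H U) (hG : Set.EqOn H G U) : LimOn 𝒰 h G U := by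
  intro ζ hζ
  obtain ⟨r, hr, hd, ht⟩ := hl ζ hζ
  obtain ⟨r', hr', hrU⟩ := Metric.isOpen_iff.1 hUo ζ hζ
  refine ⟨min r r', lt_min hr hr', ?_, ?_⟩
  · filter_upwards [hd] with k hk
    exact hk.mono (ball_subset_ball (min_le_left _ _))
  · refine (ht.mono (ball_subset_ball (min_le_left _ _))).congr_right ?_
    intro w hw
    exact hG (hrU (ball_subset_ball (min_le_right _ _) hw))

lemma LimOn.locBdd {𝒰 : Ultrafilter ℕ} {h : ℕ → ℂ → ℂ} {H : ℂ → ℂ} {U : Set ℂ}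
    (hl : LimOn 𝒰 h H U) : LocBdd 𝒰 h U := by
  intro ζ hζ
  obtain ⟨r, hr, hd, ht⟩ := hl ζ hζ
  have hc := (hl.differentiableOn ζ hζ).continuousAt
  obtain ⟨r', hr', hb⟩ := Metric.continuousAt_iff.1 hc 1 one_pos
  refine ⟨min r r', lt_min hr hr', ‖H ζ‖ + 2, ?_⟩
  filter_upwards [hd, (Metric.tendstoUniformlyOn_iff.1 ht) 1 one_pos] with k hk hk2
  refine ⟨hk.mono (ball_subset_ball (min_le_left _ _)), fun w hw => ?_⟩
  have h1 := hb (mem_ball.1 (ball_subset_ball (min_le_right _ _) hw))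
  have h2 := hk2 w (ball_subset_ball (min_le_left _ _) hw)
  rw [dist_eq_norm] at h1 h2
  have h3 := norm_sub_norm_le (H w) (H ζ)
  have h4 := norm_sub_norm_le (h k w) (H w)
  rw [norm_sub_rev] at h2
  linarith

/-- Removing a convergent sequence of zeros. -/
lemma LimOn.deflate {𝒰 : Ultrafilter ℕ} {h : ℕ → ℂ → ℂ} {H : ℂ → ℂ} {U : Set ℂ} (hUo : IsOpen U)
    (hl : LimOn 𝒰 h H U) {ρ : ℂ} (hρ : ρ ∈ U) {z : ℕ → ℂ} (hz : Tendsto z 𝒰 (𝓝 ρ))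
    (hz0 : ∀ᶠ k in (𝒰 : Filter ℕ), h k (z k) = 0) :
    LimOn 𝒰 (fun k => dslope (h k) (z k)) (dslope H ρ) U := by
  have hHρ : H ρ = 0 := by
    have h1 := hl.tendsto_seq hρ hz
    have h2 : Tendsto (fun k => h k (z k)) 𝒰 (𝓝 0) :=
      tendsto_const_nhds.congr' (hz0.mono fun k hk => hk.symm)
    exact tendsto_nhds_unique h1 h2
  have hlb : LocBdd 𝒰 (fun k => dslope (h k) (z k)) U := by
    intro ζ hζ
    obtain ⟨r, hr, M, hM⟩ := hl.locBdd ζ hζ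
    by_cases hζρ : ζ = ρ
    · subst hζρ
      refine ⟨r/2, by linarith, |M| / (r/4), ?_⟩
      filter_upwards [hM, hz0, hz (ball_mem_nhds ζ (show 0 < r/4 by linarith))] with k hk hk0 hkz
      simp only [Set.mem_preimage, mem_ball] at hkz
      have hdd : DifferentiableOn ℂ (dslope (h k) (z k)) (ball ζ r) := by
        rw [Complex.differentiableOn_dslope (isOpen_ball.mem_nhds (by rw [mem_ball]; linarith))]
        exact hk.1
      refine ⟨hdd.mono (ball_subset_ball (by linarith)), fun w hw => ?_⟩
      have hcb : closedBall ζ (r/2) ⊆ ball ζ r := closedBall_subset_ball (by linarith)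
      refine Complex.norm_le_of_forall_mem_frontier_norm_le (U := ball ζ (r/2)) isBounded_ball
        ((hdd.mono (closure_ball_subset_closedBall.trans hcb)).diffContOnCl) ?_ (subset_closure hw)
      intro v hv
      rw [frontier_ball ζ (by linarith), mem_sphere] at hv
      have hvz : r/4 ≤ ‖v - z k‖ := by
        rw [← dist_eq_norm]
        have := dist_triangle v (z k) ζ
        linarith
      have hne : v ≠ z k := by
        rintro rfl; simp at hvz; linarith
      rw [dslope_of_ne _ hne, slope_def_field, hk0, sub_zero, norm_div]
      gcongr
      exact (hk.2 v (by rw [mem_ball]; linarith)).trans (le_abs_self M)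
    · have hd : 0 < dist ζ ρ := dist_pos.2 hζρ
      refine ⟨min r (dist ζ ρ / 4), by positivity, |M| / (dist ζ ρ / 4), ?_⟩
      filter_upwards [hM, hz0, hz (ball_mem_nhds ρ (show 0 < dist ζ ρ / 4 by linarith))] with k hk hk0 hkz
      simp only [Set.mem_preimage, mem_ball] at hkz
      have hfar : ∀ v ∈ ball ζ (min r (dist ζ ρ / 4)), dist ζ ρ / 4 ≤ ‖v - z k‖ := by
        intro v hv
        have hv' : dist v ζ < dist ζ ρ / 4 := lt_of_lt_of_le (mem_ball.1 hv) (min_le_right _ _)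
        rw [← dist_eq_norm]
        have h1 := dist_triangle ζ v ρ
        have h2 := dist_triangle v (z k) ρ
        rw [dist_comm ζ v] at h1
        linarith
      have hnot : z k ∉ ball ζ (min r (dist ζ ρ / 4)) := by
        intro hh; have := hfar _ hh; simp at this; linarith
      refine ⟨?_, fun v hv => ?_⟩
      · rw [differentiableOn_dslope_of_notMem hnot]
        exact hk.1.mono (ball_subset_ball (min_le_left _ _))
      · have hne : v ≠ z k := by rintro rfl; exact hnot hv
        rw [dslope_of_ne _ hne, slope_def_field, hk0, sub_zero, norm_div]
        gcongr
        · exact (hk.2 v (ball_subset_ball (min_le_left _ _) hv)).trans (le_abs_self M)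
        · exact hfar v hv
  obtain ⟨G, hG⟩ := hlb.exists_lim
  refine hG.congr hUo ?_
  have hoff : ∀ w ∈ U, w ≠ ρ → G w = dslope H ρ w := by
    intro w hw hwρ
    refine tendsto_nhds_unique (hG.tendsto hw) ?_
    rw [dslope_of_ne _ hwρ, slope_def_field, hHρ, sub_zero]
    have h1 : Tendsto (fun k => h k w / (w - z k)) 𝒰 (𝓝 (H w / (w - ρ))) :=
      (hl.tendsto hw).div (tendsto_const_nhds.sub hz) (sub_ne_zero.2 hwρ)
    refine h1.congr' ?_
    have hne : ∀ᶠ k in (𝒰 : Filter ℕ), z k ≠ w := hz.eventually_ne hwρ.symm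
    filter_upwards [hz0, hne] with k hk hkn
    rw [dslope_of_ne _ hkn.symm, slope_def_field, hk, sub_zero]
  intro w hw
  by_cases hwρ : w = ρ
  · subst hwρ
    have c1 : ContinuousAt G w := (hG.differentiableOn w hw).continuousAt
    have c2 : ContinuousAt (dslope H w) w :=
      continuousAt_dslope_same.2 (hl.differentiableOn w hw).differentiableAt
    have e : G =ᶠ[𝓝[≠] w] dslope H w := by
      have hUn : ∀ᶠ v in 𝓝[≠] w, v ∈ U := nhdsWithin_le_nhds (hUo.mem_nhds hw)
      filter_upwards [hUn, self_mem_nhdsWithin] with v hv1 hv2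
      exact hoff v hv1 hv2
    exact tendsto_nhds_unique ((c1.tendsto.mono_left nhdsWithin_le_nhds).congr' e)
      (c2.tendsto.mono_left nhdsWithin_le_nhds)
  · exact hoff w hw hwρ

/-- If the limit is `(w - ρ₁)(w - ρ₂) E w`, with `E` zero-free at the `ρ`s, there are zeros of
`h k` at which the derivatives are nearly opposite up to the factor `E`. -/
lemma LimOn.two_zeros {𝒰 : Ultrafilter ℕ} (hU : (𝒰 : Filter ℕ) ≤ atTop)
    {h : ℕ → ℂ → ℂ} {H E : ℂ → ℂ} {U : Set ℂ} (hUo : IsOpen U)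
    (hl : LimOn 𝒰 h H U) {ρ₁ ρ₂ : ℂ} (h1 : ρ₁ ∈ U) (h2 : ρ₂ ∈ U)
    (hE : ∀ w ∈ U, ContinuousAt E w) (hH : ∀ w ∈ U, H w = (w - ρ₁) * (w - ρ₂) * E w)
    (hE1 : E ρ₁ ≠ 0) (hE2 : E ρ₂ ≠ 0) :
    ∃ z z' e e' : ℕ → ℂ, Tendsto z 𝒰 (𝓝 ρ₁) ∧ Tendsto z' 𝒰 (𝓝 ρ₂) ∧
      Tendsto e 𝒰 (𝓝 (E ρ₁)) ∧ Tendsto e' 𝒰 (𝓝 (E ρ₂)) ∧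
      ∀ᶠ k in (𝒰 : Filter ℕ), h k (z k) = 0 ∧ h k (z' k) = 0 ∧
        deriv (h k) (z k) = (z k - z' k) * e k ∧ deriv (h k) (z' k) = (z' k - z k) * e' k := by
  have nz : ∀ ρ ∈ U, ∀ σ ∈ U, ∀ G : ℂ → ℂ, E ρ ≠ 0 →
      (∀ᶠ w in 𝓝[≠] ρ, G w = 0 → w = σ ∨ E w = 0) → ¬ ∀ᶠ w in 𝓝 ρ, G w = 0 := by
    intro ρ hρ σ _ G hEρ hG hcon
    have e1 : ∀ᶠ w in 𝓝[≠] ρ, E w ≠ 0 :=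
      nhdsWithin_le_nhds ((hE ρ hρ).eventually_ne hEρ)
    have e2 : ∀ᶠ w in 𝓝[≠] ρ, w ≠ σ := by
      by_cases hh : ρ = σ
      · subst hh; exact self_mem_nhdsWithin
      · exact nhdsWithin_le_nhds (isOpen_ne.mem_nhds hh)
    have e3 : ∀ᶠ w in 𝓝[≠] ρ, G w = 0 := nhdsWithin_le_nhds hcon
    obtain ⟨w, hw1, hw2, hw3, hw4⟩ := (e1.and (e2.and (e3.and hG))).exists
    exact (hw4 hw3).elim hw2 hw1
  obtain ⟨z, hz, hz0⟩ := hl.hurwitz hU h1 (by rw [hH _ h1]; ring) (by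
    refine nz ρ₁ h1 ρ₂ h2 H hE1 ?_
    filter_upwards [self_mem_nhdsWithin, nhdsWithin_le_nhds (hUo.mem_nhds h1)] with w hw hwU h0
    rw [hH w hwU] at h0
    rcases mul_eq_zero.1 h0 with h0 | h0
    · rcases mul_eq_zero.1 h0 with h0 | h0
      · exact absurd (sub_eq_zero.1 h0) hw
      · exact Or.inl (sub_eq_zero.1 h0)
    · exact Or.inr h0)
  have hl1 := hl.deflate hUo h1 hz hz0
  have hHρ1 : H ρ₁ = 0 := by rw [hH _ h1]; ring
  have hD1 : ∀ w ∈ U, dslope H ρ₁ w = (w - ρ₂) * E w := by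
    have hoff : ∀ w ∈ U, w ≠ ρ₁ → dslope H ρ₁ w = (w - ρ₂) * E w := by
      intro w hw hne
      rw [dslope_of_ne _ hne, slope_def_field, hHρ1, sub_zero, hH w hw]
      have := sub_ne_zero.2 hne
      field_simp
    intro w hw
    by_cases hne : w = ρ₁
    · subst hne
      have c1 : ContinuousAt (dslope H w) w := (hl1.differentiableOn w hw).continuousAt
      have c2 : ContinuousAt (fun v => (v - ρ₂) * E v) w :=
        (continuousAt_id.sub continuousAt_const).mul (hE w hw)
      have e : dslope H w =ᶠ[𝓝[≠] w] (fun v => (v - ρ₂) * E v) := by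
        filter_upwards [self_mem_nhdsWithin, nhdsWithin_le_nhds (hUo.mem_nhds hw)] with v hv hvU
        exact hoff v hvU hv
      exact tendsto_nhds_unique ((c1.tendsto.mono_left nhdsWithin_le_nhds).congr' e)
        (c2.tendsto.mono_left nhdsWithin_le_nhds)
    · exact hoff w hw hne
  obtain ⟨z', hz', hz0'⟩ := hl1.hurwitz hU h2 (by rw [hD1 _ h2]; ring) (by
    refine nz ρ₂ h2 ρ₂ h2 _ hE2 ?_
    filter_upwards [nhdsWithin_le_nhds (hUo.mem_nhds h2)] with w hwU h0
    rw [hD1 w hwU] at h0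
    rcases mul_eq_zero.1 h0 with h0 | h0
    · exact Or.inl (sub_eq_zero.1 h0)
    · exact Or.inr h0)
  have hl2 := hl1.deflate hUo h2 hz' hz0'
  have hD2 : ∀ w ∈ U, dslope (dslope H ρ₁) ρ₂ w = E w := by
    have hz00 : dslope H ρ₁ ρ₂ = 0 := by rw [hD1 _ h2]; ring
    have hoff : ∀ w ∈ U, w ≠ ρ₂ → dslope (dslope H ρ₁) ρ₂ w = E w := by
      intro w hw hne
      rw [dslope_of_ne _ hne, slope_def_field, hz00, sub_zero, hD1 w hw]
      have := sub_ne_zero.2 hne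
      field_simp
    intro w hw
    by_cases hne : w = ρ₂
    · subst hne
      have c1 : ContinuousAt (dslope (dslope H ρ₁) w) w := (hl2.differentiableOn w hw).continuousAt
      have e : dslope (dslope H ρ₁) w =ᶠ[𝓝[≠] w] E := by
        filter_upwards [self_mem_nhdsWithin, nhdsWithin_le_nhds (hUo.mem_nhds hw)] with v hv hvU
        exact hoff v hvU hv
      exact tendsto_nhds_unique ((c1.tendsto.mono_left nhdsWithin_le_nhds).congr' e)
        ((hE w hw).tendsto.mono_left nhdsWithin_le_nhds)
    · exact hoff w hw hne
  refine ⟨z, z', fun k => dslope (dslope (h k) (z k)) (z' k) (z k),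
    fun k => dslope (dslope (h k) (z k)) (z' k) (z' k), hz, hz', ?_, ?_, ?_⟩
  · rw [← hD2 _ h1]; exact hl2.tendsto_seq h1 hz
  · rw [← hD2 _ h2]; exact hl2.tendsto_seq h2 hz'
  · have da : ∀ᶠ k in (𝒰 : Filter ℕ), DifferentiableAt ℂ (dslope (h k) (z k)) (z' k) := by
      obtain ⟨r, hr, hd, _⟩ := hl1 ρ₂ h2
      filter_upwards [hd, hz' (ball_mem_nhds ρ₂ hr)] with k hk hkz
      exact hk.differentiableAt (isOpen_ball.mem_nhds hkz)
    filter_upwards [hz0, hz0', da] with k hk hk' hda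
    have key : ∀ w, h k w = (w - z k) * dslope (h k) (z k) w := by
      intro w
      have := sub_smul_dslope (h k) (z k) w
      rw [smul_eq_mul, hk, sub_zero] at this
      exact this.symm
    have key2 : ∀ w, dslope (h k) (z k) w = (w - z' k) * dslope (dslope (h k) (z k)) (z' k) w := by
      intro w
      have := sub_smul_dslope (dslope (h k) (z k)) (z' k) w
      rw [smul_eq_mul, hk', sub_zero] at this
      exact this.symm
    refine ⟨hk, by rw [key, hk', mul_zero], ?_, ?_⟩
    · rw [← key2, dslope_same]
    · rw [dslope_same]
      have hfun : h k = fun w => (w - z k) * dslope (h k) (z k) w := funext key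
      have hda' : HasDerivAt (fun w => (w - z k) * dslope (h k) (z k) w)
          (1 * dslope (h k) (z k) (z' k) + (z' k - z k) * deriv (dslope (h k) (z k)) (z' k)) (z' k) :=
        ((hasDerivAt_id (z' k)).sub_const (z k)).mul hda.hasDerivAt
      have h3 : HasDerivAt (h k)
          (1 * dslope (h k) (z k) (z' k) + (z' k - z k) * deriv (dslope (h k) (z k)) (z' k)) (z' k) :=
        hda'.congr_of_eventuallyEq (Eventually.of_forall key)
      rw [h3.deriv, hk']; ring

/-- Zalcman-type point selection. -/
lemma select_point (q : ℂ → ℝ) (z0 : ℂ) (r0 Λ : ℝ) (hr0 : 0 < r0)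
    (hq : ContinuousOn q (closedBall z0 r0)) (hΛ : 0 < Λ) (h : Λ ≤ r0 * q z0) :
    ∃ z1 r, 0 < r ∧ dist z1 z0 + r = r0 ∧ Λ ≤ r * q z1 ∧ 0 < q z1 ∧
      ∀ z ∈ closedBall z1 (r/2), q z ≤ 2 * q z1 := by
  have hc : ContinuousOn (fun z => (r0 - dist z z0) * q z) (closedBall z0 r0) :=
    (continuousOn_const.sub (continuous_id.dist continuous_const).continuousOn).mul hq
  obtain ⟨z1, hz1, hmax⟩ := (isCompact_closedBall z0 r0).exists_isMaxOn
    ⟨z0, mem_closedBall_self hr0.le⟩ hc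
  have h0 : Λ ≤ (r0 - dist z1 z0) * q z1 := by
    have := hmax (mem_closedBall_self hr0.le : z0 ∈ closedBall z0 r0)
    simp only [Set.mem_setOf_eq, dist_self, sub_zero] at this
    linarith
  have hr : 0 < r0 - dist z1 z0 := by
    rcases (sub_nonneg.2 (mem_closedBall.1 hz1)).eq_or_lt with h1 | h1
    · rw [← h1] at h0; linarith
    · exact h1
  have hq1 : 0 < q z1 := by
    by_contra hcon
    have := mul_nonpos_of_nonneg_of_nonpos hr.le (not_lt.1 hcon)
    linarith
  refine ⟨z1, r0 - dist z1 z0, hr, by ring, h0, hq1, fun z hz => ?_⟩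
  have hd : dist z z0 ≤ dist z z1 + dist z1 z0 := dist_triangle _ _ _
  rw [mem_closedBall] at hz
  have hzb : z ∈ closedBall z0 r0 := by rw [mem_closedBall]; linarith
  have h2 := hmax hzb
  simp only [Set.mem_setOf_eq] at h2
  by_contra hcon
  push Not at hcon
  have h3 : (r0 - dist z1 z0)/2 ≤ r0 - dist z z0 := by linarith
  have h4 : (r0 - dist z1 z0)/2 * q z ≤ (r0 - dist z z0) * q z := by
    apply mul_le_mul_of_nonneg_right h3; linarith
  nlinarith

lemma gronwall_le {δ K ε x : ℝ} (hK : 0 ≤ K) (hε : 0 ≤ ε) (hx : 0 ≤ x) :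
    gronwallBound δ K ε x ≤ (δ + ε * x) * Real.exp (K * x) := by
  by_cases hK0 : K = 0
  · subst hK0; simp [gronwallBound_K0]
  · rw [gronwallBound_of_K_ne_0 hK0, add_mul]
    have hKp : 0 < K := lt_of_le_of_ne hK (Ne.symm hK0)
    have : Real.exp (K*x) - 1 ≤ K * x * Real.exp (K*x) := by
      have h1 := Real.add_one_le_exp (-(K*x))
      rw [Real.exp_neg] at h1
      have h2 := Real.exp_pos (K*x)
      have h3 : (-(K*x)+1) * Real.exp (K*x) ≤ 1 := by
        calc _ ≤ (Real.exp (K*x))⁻¹ * Real.exp (K*x) := by gcongr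
          _ = 1 := inv_mul_cancel₀ h2.ne'
      linarith
    have h4 : ε / K * (Real.exp (K*x) - 1) ≤ ε / K * (K * x * Real.exp (K*x)) := by gcongr
    have h5 : ε / K * (K * x * Real.exp (K*x)) = ε * x * Real.exp (K*x) := by
      field_simp
    linarith

/-- Gronwall on a path. -/
lemma gronwall_path {φ : ℝ → ℂ} {φ' : ℝ → ℂ} {T A B : ℝ} (hT : 0 ≤ T) (hA : 0 ≤ A) (hB : 0 ≤ B)
    (hd : ∀ t ∈ Set.Icc 0 T, HasDerivAt φ (φ' t) t)
    (hb : ∀ t ∈ Set.Icc 0 T, ‖φ' t‖ ≤ B * ‖φ t‖ + A) :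
    ‖φ T‖ ≤ (‖φ 0‖ + A * T) * Real.exp (B * T) := by
  have := norm_le_gronwallBound_of_norm_deriv_right_le (f := φ) (f' := φ') (δ := ‖φ 0‖)
    (K := B) (ε := A) (a := 0) (b := T)
    (fun t ht => (hd t ht).continuousAt.continuousWithinAt)
    (fun t ht => (hd t ⟨ht.1, ht.2.le⟩).hasDerivWithinAt) le_rfl
    (fun t ht => hb t ⟨ht.1, ht.2.le⟩) T ⟨hT, le_rfl⟩
  rw [sub_zero] at this
  exact this.trans (gronwall_le hB hA hT)

lemma growth_ball {h : ℂ → ℂ} {c : ℂ} {r A B : ℝ} (hA : 0 ≤ A) (hB : 0 ≤ B)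
    (hd : DifferentiableOn ℂ h (ball c r))
    (hb : ∀ w ∈ ball c r, ‖deriv h w‖ ≤ A + B * ‖h w‖) :
    ∀ w ∈ ball c r, ‖h w‖ ≤ (‖h c‖ + A * r) * Real.exp (B * r) := by
  intro w hw
  have hr : dist w c < r := hw
  have hr0 : 0 < r := lt_of_le_of_lt dist_nonneg hr
  have hseg : ∀ t ∈ Set.Icc (0:ℝ) 1, c + t * (w - c) ∈ ball c r := by
    intro t ht
    rw [mem_ball, dist_eq_norm, add_sub_cancel_left, norm_mul, Complex.norm_real, Real.norm_eq_abs,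
      abs_of_nonneg ht.1, ← dist_eq_norm]
    nlinarith [ht.2, @dist_nonneg _ _ w c]
  have := gronwall_path (φ := fun t : ℝ => h (c + t * (w - c)))
    (φ' := fun t : ℝ => deriv h (c + t * (w - c)) * (w - c)) (T := 1) (A := A * r) (B := B * r)
    zero_le_one (by positivity) (by positivity) ?_ ?_
  · simpa using this
  · intro t ht
    have h1 := (hd.differentiableAt (isOpen_ball.mem_nhds (hseg t ht))).hasDerivAt
    have h2 : HasDerivAt (fun t : ℝ => c + (t:ℂ) * (w - c)) (w - c) t := by
      have := ((Complex.ofRealCLM.hasDerivAt (x := t)).mul_const (w - c)).const_add c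
      simpa using this
    exact h1.comp t h2
  · intro t ht
    rw [norm_mul, ← dist_eq_norm]
    have h1 := hb _ (hseg t ht)
    calc _ ≤ (A + B * ‖h (c + t * (w - c))‖) * r := by gcongr
      _ = _ := by ring

/-- Linear differential inequality near infinity gives polynomial growth. -/
lemma poly_growth {y : ℂ → ℂ} {R A B : ℝ} (hR : 0 < R) (hA : 0 ≤ A) (hB : 0 ≤ B)
    (hd : ∀ z : ℂ, R < ‖z‖ → DifferentiableAt ℂ y z)
    (hb : ∀ z : ℂ, R < ‖z‖ → ‖deriv y z‖ ≤ A + B * (‖y z‖ / ‖z‖)) :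
    ∃ C : ℝ, ∃ n : ℕ, ∃ R' : ℝ, ∀ z : ℂ, R' < ‖z‖ → ‖y z‖ ≤ C * ‖z‖ ^ n := by
  set R1 := R + 1 with hR1
  have hcs : ContinuousOn y (sphere 0 R1) := fun z hz =>
    (hd z (by rw [mem_sphere_zero_iff_norm] at hz; linarith)).continuousAt.continuousWithinAt
  obtain ⟨M, hM⟩ := (isCompact_sphere (0:ℂ) R1).exists_bound_of_continuousOn hcs
  obtain ⟨n, hn⟩ := exists_nat_ge B
  refine ⟨|M| + A, n + 2, R1, fun z hz => ?_⟩
  have hR1p : 1 ≤ R1 := by linarith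
  have hzp : 0 < ‖z‖ := by linarith
  set T := Real.log (‖z‖ / R1) with hT
  have hquot : 1 ≤ ‖z‖ / R1 := by rw [le_div_iff₀ (by linarith)]; linarith
  have hT0 : 0 ≤ T := Real.log_nonneg hquot
  have hexpT : Real.exp T = ‖z‖ / R1 := Real.exp_log (by linarith)
  set z1 : ℂ := z / ‖z‖ * R1 with hz1
  have hz1n : ‖z1‖ = R1 := by
    rw [hz1, norm_mul, norm_div, Complex.norm_real, norm_norm, div_self hzp.ne', one_mul,
      Complex.norm_real, Real.norm_of_nonneg (by linarith)]
  have hend : z1 * Complex.exp (T:ℂ) = z := by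
    rw [← Complex.ofReal_exp, hexpT, hz1]
    push_cast
    have : (R1:ℂ) ≠ 0 := by exact_mod_cast (by linarith : R1 ≠ 0)
    have : (‖z‖:ℂ) ≠ 0 := by exact_mod_cast hzp.ne'
    field_simp
  have hnorm : ∀ t : ℝ, ‖z1 * Complex.exp (t:ℂ)‖ = R1 * Real.exp t := by
    intro t; rw [norm_mul, hz1n, Complex.norm_exp, Complex.ofReal_re]
  have hin : ∀ t ∈ Set.Icc 0 T, R < ‖z1 * Complex.exp (t:ℂ)‖ ∧ ‖z1 * Complex.exp (t:ℂ)‖ ≤ ‖z‖ := by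
    intro t ht
    rw [hnorm]
    have h1 : 1 ≤ Real.exp t := Real.one_le_exp ht.1
    have h2 : Real.exp t ≤ ‖z‖ / R1 := hexpT ▸ Real.exp_le_exp.2 ht.2
    constructor
    · nlinarith
    · rw [le_div_iff₀ (by linarith)] at h2; linarith
  have key := gronwall_path (φ := fun t : ℝ => y (z1 * Complex.exp t))
    (φ' := fun t : ℝ => deriv y (z1 * Complex.exp t) * (z1 * Complex.exp t)) (T := T)
    (A := A * ‖z‖) (B := B) hT0 (by positivity) hB ?_ ?_
  · simp only [Complex.ofReal_zero, Complex.exp_zero, mul_one, hend] at key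
    have h1 : ‖y z1‖ ≤ |M| := (hM z1 (by simpa using hz1n)).trans (le_abs_self _)
    have h2 : Real.exp (B * T) ≤ ‖z‖ ^ n := by
      calc Real.exp (B*T) ≤ Real.exp (n * T) := Real.exp_le_exp.2 (by gcongr)
        _ = (Real.exp T)^n := by rw [← Real.exp_nat_mul]
        _ ≤ ‖z‖^n := by
          rw [hexpT]; gcongr
          exact div_le_self hzp.le hR1p
    have h3 : T ≤ ‖z‖ := by
      have h4 : T ≤ Real.exp T := by linarith [Real.add_one_le_exp T]
      rw [hexpT] at h4
      exact h4.trans (div_le_self hzp.le hR1p)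
    have hz1' : 1 ≤ ‖z‖ := by linarith
    calc ‖y z‖ ≤ (‖y z1‖ + A * ‖z‖ * T) * Real.exp (B * T) := key
      _ ≤ (|M| * ‖z‖^2 + A * ‖z‖ * ‖z‖) * ‖z‖^n := by
        gcongr
        calc ‖y z1‖ ≤ |M| * 1 := by linarith
          _ ≤ |M| * ‖z‖^2 := by gcongr; nlinarith
      _ = _ := by ring
  · intro t ht
    have h1 := (hd _ (hin t ht).1).hasDerivAt
    have h2 : HasDerivAt (fun t : ℝ => z1 * Complex.exp (t:ℂ)) (z1 * Complex.exp t) t := by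
      have h3 : HasDerivAt (fun s : ℂ => z1 * Complex.exp s) (z1 * Complex.exp t) (t:ℂ) :=
        (Complex.hasDerivAt_exp _).const_mul z1
      exact h3.comp_ofReal
    exact h1.comp t h2
  · intro t ht
    rw [norm_mul]
    have h1 := hb _ (hin t ht).1
    have hp : 0 < ‖z1 * Complex.exp (t:ℂ)‖ := hR.trans (hin t ht).1
    calc _ ≤ (A + B * (‖y (z1 * Complex.exp t)‖ / ‖z1 * Complex.exp (t:ℂ)‖)) * ‖z1 * Complex.exp (t:ℂ)‖ := by
          gcongr
      _ = B * ‖y (z1 * Complex.exp t)‖ + A * ‖z1 * Complex.exp (t:ℂ)‖ := by field_simp; ring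
      _ ≤ _ := by gcongr; exact (hin t ht).2

/-- Regular behaviour of nonzero rational functions near infinity. -/
def Slow (r : ℂ → ℂ) : Prop :=
  ∃ d : ℤ, ∃ c : ℂ, c ≠ 0 ∧ Tendsto (fun z => r z / z ^ d) (Bornology.cobounded ℂ) (𝓝 c) ∧
    Tendsto (fun z => deriv r z * z / r z) (Bornology.cobounded ℂ) (𝓝 d) ∧
    ∀ᶠ z in Bornology.cobounded ℂ, AnalyticAt ℂ r z ∧ r z ≠ 0

lemma poly_asymp (p : Polynomial ℂ) :
    Tendsto (fun z => p.eval z / z ^ p.natDegree) (Bornology.cobounded ℂ) (𝓝 p.leadingCoeff) := by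
  have h1 : Tendsto (fun z : ℂ => p.reverse.eval z⁻¹) (Bornology.cobounded ℂ)
      (𝓝 (p.reverse.eval 0)) :=
    (p.reverse.continuous.tendsto 0).comp tendsto_inv₀_cobounded
  rw [← Polynomial.coeff_zero_eq_eval_zero, Polynomial.coeff_zero_reverse] at h1
  refine h1.congr' ?_
  filter_upwards [Bornology.eventually_ne_cobounded (0:ℂ)] with z hz
  let _ := invertibleOfNonzero hz
  have := Polynomial.eval₂_reverse_mul_pow (RingHom.id ℂ) z p
  simp only [Polynomial.eval₂_id, invOf_eq_inv] at this
  rw [← this]; field_simp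

lemma poly_ev_ne {p : Polynomial ℂ} (hp : p ≠ 0) :
    ∀ᶠ z in Bornology.cobounded ℂ, p.eval z ≠ 0 := by
  have h := (poly_asymp p).eventually_ne (Polynomial.leadingCoeff_ne_zero.2 hp)
  filter_upwards [h] with z hz h0
  simp [h0] at hz

lemma poly_logder {p : Polynomial ℂ} (hp : p ≠ 0) :
    Tendsto (fun z => p.derivative.eval z * z / p.eval z) (Bornology.cobounded ℂ)
      (𝓝 p.natDegree) := by
  have h1 := poly_asymp p
  have hl := Polynomial.leadingCoeff_ne_zero.2 hp
  have h2 : Tendsto (fun z => p.derivative.eval z * z / z ^ p.natDegree) (Bornology.cobounded ℂ)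
      (𝓝 (p.natDegree * p.leadingCoeff)) := by
    rcases Nat.eq_zero_or_pos p.natDegree with h0 | h0
    · have : p.derivative = 0 := Polynomial.derivative_of_natDegree_zero h0
      simp [this, h0]
    · have h3 := poly_asymp p.derivative
      have hd : p.derivative.natDegree = p.natDegree - 1 := Polynomial.natDegree_derivative p
      have hc : p.derivative.leadingCoeff = p.natDegree * p.leadingCoeff := by
        rw [Polynomial.leadingCoeff, hd, Polynomial.coeff_derivative, Nat.sub_add_cancel h0,
          Polynomial.leadingCoeff, mul_comm]
        congr 1
        rw [← Nat.cast_succ, Nat.succ_eq_add_one, Nat.sub_add_cancel h0]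
      rw [hc, hd] at h3
      refine h3.congr' ?_
      filter_upwards [Bornology.eventually_ne_cobounded (0:ℂ)] with z hz
      obtain ⟨n, hn⟩ : ∃ n, p.natDegree = n + 1 := ⟨p.natDegree - 1, by omega⟩
      rw [hn]; simp only [Nat.add_sub_cancel, pow_succ]
      field_simp
  have h3 := h2.div h1 hl
  rw [mul_div_cancel_right₀ _ hl] at h3
  refine h3.congr' ?_
  filter_upwards [Bornology.eventually_ne_cobounded (0:ℂ), poly_ev_ne hp] with z hz hz2
  have : z ^ p.natDegree ≠ 0 := pow_ne_zero _ hz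
  simp only [Pi.div_apply]
  field_simp

lemma slow_rat {p q : Polynomial ℂ} (hp : p ≠ 0) (hq : q ≠ 0) :
    Slow (fun z => p.eval z / q.eval z) := by
  refine ⟨(p.natDegree : ℤ) - q.natDegree, p.leadingCoeff / q.leadingCoeff,
    div_ne_zero (Polynomial.leadingCoeff_ne_zero.2 hp) (Polynomial.leadingCoeff_ne_zero.2 hq),
    ?_, ?_, ?_⟩
  · refine ((poly_asymp p).div (poly_asymp q) (Polynomial.leadingCoeff_ne_zero.2 hq)).congr' ?_
    filter_upwards [Bornology.eventually_ne_cobounded (0:ℂ), poly_ev_ne hq] with z hz hz2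
    rw [zpow_sub₀ hz]
    have : z ^ p.natDegree ≠ 0 := pow_ne_zero _ hz
    have : z ^ q.natDegree ≠ 0 := pow_ne_zero _ hz
    simp only [zpow_natCast, Pi.div_apply]
    field_simp
  · have h := (poly_logder hp).sub (poly_logder hq)
    push_cast
    refine h.congr' ?_
    filter_upwards [poly_ev_ne hq, poly_ev_ne hp] with z hz hz2
    have hd : deriv (fun z => p.eval z / q.eval z) z = _ :=
      ((p.hasDerivAt z).div (q.hasDerivAt z) hz).deriv
    rw [hd]; field_simp
  · filter_upwards [poly_ev_ne hq, poly_ev_ne hp] with z hz hz2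
    refine ⟨?_, div_ne_zero hz2 hz⟩
    exact ((Differentiable.analyticAt p.differentiable z)).div
      (Differentiable.analyticAt q.differentiable z) hz

/-- Ratio of values of a slow function at comparable points. -/
lemma Slow.ratio {r : ℂ → ℂ} (hr : Slow r) {ι : Type*} {l : Filter ι} {z w : ι → ℂ}
    (hz : Tendsto z l (Bornology.cobounded ℂ)) (hw : Tendsto w l (Bornology.cobounded ℂ))
    (hwz : Tendsto (fun k => w k / z k) l (𝓝 1)) :
    Tendsto (fun k => r (w k) / r (z k)) l (𝓝 1) := by
  obtain ⟨d, c, hc, h1, h2, h3⟩ := hr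
  have ha := (h1.comp hw).div (h1.comp hz) hc
  have hb : Tendsto (fun k => (w k / z k) ^ d) l (𝓝 (1 ^ d)) := hwz.zpow₀ d (Or.inl one_ne_zero)
  have hcc := ha.mul hb
  rw [div_self hc, one_zpow, mul_one] at hcc
  refine hcc.congr' ?_
  filter_upwards [hz.eventually (Bornology.eventually_ne_cobounded (0:ℂ)),
    hw.eventually (Bornology.eventually_ne_cobounded (0:ℂ))] with k hzk hwk
  have e1 : z k ^ d ≠ 0 := zpow_ne_zero _ hzk
  have e2 : w k ^ d ≠ 0 := zpow_ne_zero _ hwk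
  simp only [Function.comp, div_zpow, Pi.div_apply]
  field_simp

lemma Slow.dratio {r : ℂ → ℂ} (hr : Slow r) {ι : Type*} {l : Filter ι} {z w ρ : ι → ℂ}
    (hz : Tendsto z l (Bornology.cobounded ℂ)) (hw : Tendsto w l (Bornology.cobounded ℂ))
    (hwz : Tendsto (fun k => w k / z k) l (𝓝 1)) (hρ : Tendsto (fun k => ρ k / z k) l (𝓝 0)) :
    Tendsto (fun k => deriv r (w k) * ρ k / r (z k)) l (𝓝 0) := by
  have h0 := hr.ratio hz hw hwz
  obtain ⟨d, c, hc, h1, h2, h3⟩ := hr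
  have ha := (((h2.comp hw).mul h0).mul hρ).mul (hwz.inv₀ one_ne_zero)
  rw [mul_zero, zero_mul] at ha
  refine ha.congr' ?_
  filter_upwards [hz.eventually (Bornology.eventually_ne_cobounded (0:ℂ)),
    hw.eventually (Bornology.eventually_ne_cobounded (0:ℂ)), hw.eventually h3, hz.eventually h3]
    with k hzk hwk hk hk2
  have := hk.2
  have := hk2.2
  simp only [Function.comp]
  field_simp

/-- pointwise spherical derivative bound -/
def MB (y : ℂ → ℂ) (C : ℝ) (w : ℂ) : Prop :=
  (AnalyticAt ℂ y w ∧ ‖deriv y w‖ ≤ C * (1 + ‖y w‖ ^ 2)) ∨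
  (¬ AnalyticAt ℂ y w ∧ AnalyticAt ℂ (fun z => (y z)⁻¹) w ∧ y w = 0 ∧
    ‖deriv (fun z => (y z)⁻¹) w‖ ≤ C)

/-- near a pole, `y` is analytic and non-zero off the pole. -/
lemma pole_punctured {y : ℂ → ℂ} {w : ℂ} (h1 : ¬ AnalyticAt ℂ y w)
    (h2 : AnalyticAt ℂ (fun z => (y z)⁻¹) w) (_h3 : y w = 0) :
    ∀ᶠ z in 𝓝[≠] w, AnalyticAt ℂ y z ∧ y z ≠ 0 := by
  rcases h2.eventually_eq_zero_or_eventually_ne_zero with h | h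
  · exfalso
    apply h1
    have : y =ᶠ[𝓝 w] fun _ => 0 := by
      filter_upwards [h] with z hz
      simpa using hz
    exact analyticAt_const.congr this.symm
  · have h4 := h2.eventually_analyticAt
    filter_upwards [h, nhdsWithin_le_nhds h4] with z hz hz4
    refine ⟨?_, by simpa using hz⟩
    have := hz4.inv hz
    refine this.congr ?_
    filter_upwards with t
    simp

noncomputable def sig (y : ℂ → ℂ) (w : ℂ) : ℝ := if AnalyticAt ℂ y w then (1 + ‖y w‖ ^ 2)⁻¹ else 0

lemma hasDerivAt_normsq {φ : ℝ → ℂ} {φ' : ℂ} {t : ℝ} (h : HasDerivAt φ φ' t) :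
    HasDerivAt (fun t => ‖φ t‖ ^ 2) (2 * inner ℝ (φ t) φ') t := h.norm_sq

lemma sig_deriv {y : ℂ → ℂ} {C : ℝ} {c v : ℂ} {t : ℝ} (h : MB y C (c + t * v)) :
    ∃ d : ℝ, HasDerivAt (fun s : ℝ => sig y (c + s * v)) d t ∧ |d| ≤ C * ‖v‖ := by
  have hline : HasDerivAt (fun s : ℝ => c + (s:ℂ) * v) v t := by
    have := ((Complex.ofRealCLM.hasDerivAt (x := t)).mul_const v).const_add c
    simpa using this
  have hcont : ContinuousAt (fun s : ℝ => c + (s:ℂ) * v) t := hline.continuousAt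
  rcases h with ⟨h1, h2⟩ | ⟨h1, h2, h3, h4⟩
  · have hd : HasDerivAt (fun s : ℝ => y (c + s * v)) (deriv y (c + t * v) * v) t :=
      h1.differentiableAt.hasDerivAt.comp t hline
    have hd2 := ((hasDerivAt_normsq hd).const_add 1).inv (by positivity)
    refine ⟨_, hd2.congr_of_eventuallyEq ?_, ?_⟩
    · filter_upwards [hcont.eventually h1.eventually_analyticAt] with s hs
      simp [sig, hs]
    · set Y := y (c + t * v)
      rw [abs_div, abs_neg, abs_mul, abs_of_nonneg (by norm_num : (0:ℝ) ≤ 2),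
        abs_of_nonneg (by positivity : (0:ℝ) ≤ (1 + ‖Y‖^2)^2), div_le_iff₀ (by positivity)]
      have e1 : |inner ℝ Y (deriv y (c + t * v) * v)| ≤ ‖Y‖ * (C * (1 + ‖Y‖ ^ 2) * ‖v‖) := by
        refine (abs_real_inner_le_norm _ _).trans ?_
        rw [norm_mul]; gcongr
      have hC : 0 ≤ C * (1 + ‖Y‖ ^ 2) * ‖v‖ := by
        have := (norm_nonneg _).trans h2
        positivity
      nlinarith [mul_nonneg hC (sq_nonneg (‖Y‖ - 1))]
  · have hd : HasDerivAt (fun s : ℝ => (y (c + s * v))⁻¹) (deriv (fun z => (y z)⁻¹) (c + t * v) * v) t :=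
      HasDerivAt.comp (h₂ := fun z => (y z)⁻¹) (h := fun s : ℝ => c + (s:ℂ) * v) t
        h2.differentiableAt.hasDerivAt hline
    have hd1 := hasDerivAt_normsq hd
    have hd2 := hd1.div (hd1.const_add 1) (by positivity)
    have hC : 0 ≤ C := (norm_nonneg _).trans h4
    refine ⟨0, ?_, by simp; positivity⟩
    simp only [h3, inv_zero, norm_zero, inner_zero_left, mul_zero, zero_mul, sub_zero, zero_div] at hd2
    refine hd2.congr_of_eventuallyEq ?_
    have hp := pole_punctured h1 h2 h3
    rw [eventually_nhdsWithin_iff] at hp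
    filter_upwards [hcont.eventually hp] with s hs
    by_cases hsw : c + (s:ℂ) * v = c + t * v
    · simp only [Pi.div_apply, hsw]; simp [sig, h1, h3]
    · obtain ⟨ha, hb⟩ := hs hsw
      simp only [sig, ha, if_true, norm_inv, Pi.div_apply]
      have : ‖y (c + s * v)‖ ≠ 0 := norm_ne_zero_iff.2 hb
      field_simp
      ring

lemma chart_dichotomy {y : ℂ → ℂ} {C r : ℝ} {c : ℂ} (hC : 0 < C) (hr : C * r ≤ 1/4)
    (h : ∀ w ∈ ball c r, MB y C w) :
    (∀ w ∈ ball c r, AnalyticAt ℂ y w ∧ ‖y w‖ ≤ 2) ∨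
    (∀ w ∈ ball c r, AnalyticAt ℂ (fun z => (y z)⁻¹) w ∧ ‖(y w)⁻¹‖ ≤ 2 ∧
      (y w = 0 → ¬ AnalyticAt ℂ y w)) := by
  have key : ∀ w ∈ ball c r, |sig y w - sig y c| ≤ 1/4 := by
    intro w hw
    have hmem : ∀ t ∈ Set.Icc (0:ℝ) 1, MB y C (c + t * (w - c)) := by
      intro t ht
      apply h
      rw [mem_ball, dist_eq_norm] at hw ⊢
      rw [add_sub_cancel_left, norm_mul, Complex.norm_real, Real.norm_of_nonneg ht.1]
      nlinarith [ht.2, norm_nonneg (w - c)]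
    choose! d hd hd2 using fun t ht => sig_deriv (hmem t ht)
    have := (convex_Icc (0:ℝ) 1).norm_image_sub_le_of_norm_hasDerivWithin_le
      (f := fun s : ℝ => sig y (c + s * (w - c))) (f' := d) (C := C * ‖w - c‖)
      (fun t ht => (hd t ht).hasDerivWithinAt) (fun t ht => by simpa using hd2 t ht)
      (x := 0) (y := 1) (by simp) (by simp)
    simp only [Complex.ofReal_one, one_mul, add_sub_cancel, Complex.ofReal_zero, zero_mul, add_zero,
      Real.norm_eq_abs, sub_zero, abs_one, mul_one] at this
    refine this.trans (le_trans ?_ hr)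
    gcongr
    rw [mem_ball, dist_eq_norm] at hw; exact hw.le
  by_cases hs : 1/2 ≤ sig y c
  · left
    intro w hw
    have h1 := abs_le.1 (key w hw)
    have h2 : 1/4 ≤ sig y w := by linarith [h1.1]
    unfold sig at h2
    split_ifs at h2 with ha
    · refine ⟨ha, ?_⟩
      have hp : 0 < 1 + ‖y w‖^2 := by positivity
      have h3 : 1 + ‖y w‖^2 ≤ 4 := by
        have := mul_le_mul_of_nonneg_right h2 hp.le
        rw [inv_mul_cancel₀ hp.ne'] at this
        linarith
      nlinarith [norm_nonneg (y w)]
    · norm_num at h2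
  · right
    intro w hw
    have h1 := abs_le.1 (key w hw)
    have h2 : sig y w ≤ 3/4 := by linarith [h1.2]
    rcases h w hw with ⟨ha, hb⟩ | ⟨ha, hb, hc, hd⟩
    · simp only [sig, ha, if_true] at h2
      have hp : 0 < 1 + ‖y w‖^2 := by positivity
      have h3 : 1 ≤ 3/4 * (1 + ‖y w‖^2) := by
        have := mul_le_mul_of_nonneg_right h2 hp.le
        rwa [inv_mul_cancel₀ hp.ne'] at this
      have h4 : 1/2 ≤ ‖y w‖ := by nlinarith [norm_nonneg (y w)]
      have h5 : y w ≠ 0 := by intro h0; rw [h0, norm_zero] at h4; norm_num at h4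
      refine ⟨ha.inv h5, ?_, fun h0 => absurd h0 h5⟩
      rw [norm_inv]
      calc ‖y w‖⁻¹ ≤ (1/2 : ℝ)⁻¹ := inv_anti₀ (by norm_num) h4
        _ = 2 := by norm_num
    · exact ⟨hb, by simp [hc], fun _ => ha⟩

def ChI (𝒰 : Ultrafilter ℕ) (Y : ℕ → ℂ → ℂ) (ζ : ℂ) (r : ℝ) : Prop :=
  ∀ᶠ k in (𝒰 : Filter ℕ), ∀ w ∈ ball ζ r, AnalyticAt ℂ (Y k) w ∧ ‖Y k w‖ ≤ 2

def ChII (𝒰 : Ultrafilter ℕ) (Y : ℕ → ℂ → ℂ) (ζ : ℂ) (r : ℝ) : Prop :=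
  ∀ᶠ k in (𝒰 : Filter ℕ), ∀ w ∈ ball ζ r, AnalyticAt ℂ (fun z => (Y k z)⁻¹) w ∧
    ‖(Y k w)⁻¹‖ ≤ 2 ∧ (Y k w = 0 → ¬ AnalyticAt ℂ (Y k) w)

def Charts (𝒰 : Ultrafilter ℕ) (Y : ℕ → ℂ → ℂ) (U : Set ℂ) : Prop :=
  ∀ ζ ∈ U, ∃ r > 0, ball ζ r ⊆ U ∧ (ChI 𝒰 Y ζ r ∨ ChII 𝒰 Y ζ r)

lemma charts_of_MB {𝒰 : Ultrafilter ℕ} {Y : ℕ → ℂ → ℂ} {U : Set ℂ} (hU : IsOpen U)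
    (h : ∀ ζ ∈ U, ∃ C > 0, ∃ r > 0, ∀ᶠ k in (𝒰 : Filter ℕ), ∀ w ∈ ball ζ r, MB (Y k) C w) :
    Charts 𝒰 Y U := by
  intro ζ hζ
  obtain ⟨C, hC, r, hr, hk⟩ := h ζ hζ
  obtain ⟨r', hr', hrU⟩ := Metric.isOpen_iff.1 hU ζ hζ
  set s := min (min r r') (1/(4*C))
  have hs : 0 < s := by positivity
  have h1 : s ≤ r := (min_le_left _ _).trans (min_le_left _ _)
  have h2 : s ≤ r' := (min_le_left _ _).trans (min_le_right _ _)
  have h3 : C * s ≤ 1/4 := by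
    calc C * s ≤ C * (1/(4*C)) := by gcongr; exact min_le_right _ _
      _ = 1/4 := by field_simp
  refine ⟨s, hs, (ball_subset_ball h2).trans hrU, ?_⟩
  unfold ChI ChII
  rw [← Ultrafilter.eventually_or]
  filter_upwards [hk] with k hk
  exact chart_dichotomy hC h3 (fun w hw => hk w (ball_subset_ball h1 hw))

lemma ChI.exists_lim {𝒰 : Ultrafilter ℕ} {Y : ℕ → ℂ → ℂ} {ζ : ℂ} {r : ℝ} (h : ChI 𝒰 Y ζ r) :
    ∃ H, LimOn 𝒰 Y H (ball ζ r) := by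
  apply LocBdd.exists_lim
  intro w hw
  obtain ⟨r', hr', hs⟩ := Metric.isOpen_iff.1 isOpen_ball w hw
  refine ⟨r', hr', 2, ?_⟩
  filter_upwards [h] with k hk
  exact ⟨fun x hx => (hk x (hs hx)).1.differentiableAt.differentiableWithinAt,
    fun x hx => (hk x (hs hx)).2⟩

lemma ChII.exists_lim {𝒰 : Ultrafilter ℕ} {Y : ℕ → ℂ → ℂ} {ζ : ℂ} {r : ℝ} (h : ChII 𝒰 Y ζ r) :
    ∃ P, LimOn 𝒰 (fun k z => (Y k z)⁻¹) P (ball ζ r) := by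
  apply LocBdd.exists_lim
  intro w hw
  obtain ⟨r', hr', hs⟩ := Metric.isOpen_iff.1 isOpen_ball w hw
  refine ⟨r', hr', 2, ?_⟩
  filter_upwards [h] with k hk
  exact ⟨fun x hx => (hk x (hs hx)).1.differentiableAt.differentiableWithinAt,
    fun x hx => (hk x (hs hx)).2.1⟩

lemma ChII.mono {𝒰 : Ultrafilter ℕ} {Y : ℕ → ℂ → ℂ} {ζ ζ' : ℂ} {r r' : ℝ} (h : ChII 𝒰 Y ζ r)
    (hs : ball ζ' r' ⊆ ball ζ r) : ChII 𝒰 Y ζ' r' := by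
  filter_upwards [h] with k hk w hw using hk w (hs hw)

lemma lim_prod {𝒰 : Ultrafilter ℕ} {Y : ℕ → ℂ → ℂ} {H P : ℂ → ℂ} {U V : Set ℂ} {ζ w : ℂ} {r : ℝ}
    (hH : LimOn 𝒰 Y H U) (hc : ChII 𝒰 Y ζ r) (hP : LimOn 𝒰 (fun k z => (Y k z)⁻¹) P V)
    (h1 : w ∈ U) (h2 : w ∈ V) (h3 : w ∈ ball ζ r) : H w * P w = 1 := by
  have t1 := (hH.tendsto h1).mul (hP.tendsto h2)
  refine tendsto_nhds_unique t1 (tendsto_const_nhds.congr' ?_)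
  filter_upwards [hc, hH.eventually_analyticAt h1] with k hk ha
  have : Y k w ≠ 0 := fun h0 => (hk w h3).2.2 h0 ha
  rw [mul_inv_cancel₀ this]

def GRel (𝒰 : Ultrafilter ℕ) (Y : ℕ → ℂ → ℂ) (A D : ℂ → ℂ) (ζ : ℂ) : Prop :=
  ∃ r > 0, (∃ H, LimOn 𝒰 Y H (ball ζ r) ∧ ∀ w ∈ ball ζ r, D w * H w = A w) ∨
    (∃ P, ChII 𝒰 Y ζ r ∧ LimOn 𝒰 (fun k z => (Y k z)⁻¹) P (ball ζ r) ∧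
      ∀ w ∈ ball ζ r, D w = A w * P w)

lemma rel_open (𝒰 : Ultrafilter ℕ) (Y : ℕ → ℂ → ℂ) (A D : ℂ → ℂ) : IsOpen {ζ | GRel 𝒰 Y A D ζ} := by
  rw [Metric.isOpen_iff]
  rintro ζ ⟨r, hr, h⟩
  refine ⟨r, hr, fun w hw => ?_⟩
  obtain ⟨r', hr', hs⟩ := Metric.isOpen_iff.1 isOpen_ball w hw
  refine ⟨r', hr', ?_⟩
  rcases h with ⟨H, h1, h2⟩ | ⟨P, h1, h2, h3⟩
  · exact Or.inl ⟨H, h1.mono hs, fun x hx => h2 x (hs hx)⟩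
  · exact Or.inr ⟨P, h1.mono hs, h2.mono hs, fun x hx => h3 x (hs hx)⟩

lemma rel_propagate {𝒰 : Ultrafilter ℕ} {Y : ℕ → ℂ → ℂ} {A D : ℂ → ℂ} {U : Set ℂ}
    (hUc : IsPreconnected U) (hch : Charts 𝒰 Y U)
    (hA : ∀ z, AnalyticAt ℂ A z) (hD : ∀ z, AnalyticAt ℂ D z) {ζb : ℂ} (hb : ζb ∈ U)
    (hrel : GRel 𝒰 Y A D ζb) : ∀ ζ ∈ U, GRel 𝒰 Y A D ζ := by
  refine hUc.subset_of_closure_inter_subset (rel_open 𝒰 Y A D) ⟨ζb, hb, hrel⟩ ?_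
  rintro ζ0 ⟨hcl, hU0⟩
  obtain ⟨r, hr, hrU, hc⟩ := hch ζ0 hU0
  obtain ⟨ζ, hζ, hζr⟩ := Metric.mem_closure_iff.1 hcl r hr
  have hζr' : ζ ∈ ball ζ0 r := by rw [mem_ball, dist_comm]; exact hζr
  obtain ⟨r', hr', h⟩ := hζ
  have hnear : ∀ᶠ w in 𝓝 ζ, w ∈ ball ζ r' ∧ w ∈ ball ζ0 r :=
    (isOpen_ball.eventually_mem (mem_ball_self hr')).and (isOpen_ball.eventually_mem hζr')
  refine ⟨r, hr, ?_⟩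
  rcases hc with hc | hc
  · left
    obtain ⟨H, hH⟩ := hc.exists_lim
    refine ⟨H, hH, ?_⟩
    have hev : (fun w => D w * H w) =ᶠ[𝓝 ζ] A := by
      filter_upwards [hnear] with w hw
      rcases h with ⟨H', h1, h2⟩ | ⟨P, h1, h2, h3⟩
      · rw [tendsto_nhds_unique (hH.tendsto hw.2) (h1.tendsto hw.1)]; exact h2 w hw.1
      · rw [h3 w hw.1, mul_assoc, mul_comm (P w), lim_prod hH h1 h2 hw.2 hw.1 hw.1, mul_one]
    have han : AnalyticOnNhd ℂ (fun w => D w * H w) (ball ζ0 r) := fun w hw =>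
      (hD w).mul (hH.differentiableOn w hw)
    exact han.eqOn_of_preconnected_of_eventuallyEq (fun w _ => hA w)
      (convex_ball _ _).isPreconnected hζr' hev
  · right
    obtain ⟨P, hP⟩ := hc.exists_lim
    refine ⟨P, hc, hP, ?_⟩
    have hev : D =ᶠ[𝓝 ζ] (fun w => A w * P w) := by
      filter_upwards [hnear] with w hw
      rcases h with ⟨H', h1, h2⟩ | ⟨P', h1, h2, h3⟩
      · rw [← h2 w hw.1, mul_assoc, lim_prod h1 hc hP hw.1 hw.2 hw.2, mul_one]
      · rw [tendsto_nhds_unique (hP.tendsto hw.2) (h2.tendsto hw.1)]; exact h3 w hw.1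
    have han : AnalyticOnNhd ℂ (fun w => A w * P w) (ball ζ0 r) := fun w hw =>
      (hA w).mul (hP.differentiableOn w hw)
    have hDn : AnalyticOnNhd ℂ D (ball ζ0 r) := fun w _ => hD w
    exact hDn.eqOn_of_preconnected_of_eventuallyEq han
      (convex_ball _ _).isPreconnected hζr' hev

/-- inversion of a limit -/
lemma lim_of_inv {𝒰 : Ultrafilter ℕ} {Y : ℕ → ℂ → ℂ} {P : ℂ → ℂ} {U : Set ℂ}
    (hP : LimOn 𝒰 (fun k z => (Y k z)⁻¹) P U) {ζ : ℂ} (hζ : ζ ∈ U) (h0 : P ζ ≠ 0) :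
    ∃ r > 0, (∀ᶠ k in (𝒰 : Filter ℕ), DifferentiableOn ℂ (Y k) (ball ζ r)) ∧
      TendstoUniformlyOn Y (fun w => (P w)⁻¹) 𝒰 (ball ζ r) := by
  obtain ⟨r, hr, h1, h2⟩ := hP ζ hζ
  have hc := (hP.differentiableOn ζ hζ).continuousAt
  set ε := ‖P ζ‖ / 2 with hε
  have hεp : 0 < ε := by have := norm_pos_iff.2 h0; positivity
  obtain ⟨r2, hr2, h3⟩ := Metric.continuousAt_iff.1 hc (ε/2) (by positivity)
  refine ⟨min r r2, lt_min hr hr2, ?_, ?_⟩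
  all_goals
    have hPb : ∀ w ∈ ball ζ (min r r2), 3/2 * ε ≤ ‖P w‖ := by
      intro w hw
      have h4 := h3 (mem_ball.1 (ball_subset_ball (min_le_right _ _) hw))
      rw [dist_eq_norm] at h4
      have : ‖P ζ‖ ≤ ‖P w‖ + ‖P w - P ζ‖ := by
        calc ‖P ζ‖ = ‖P w - (P w - P ζ)‖ := by congr 1; ring
          _ ≤ _ := norm_sub_le _ _
      linarith
    have hYb : ∀ᶠ k in (𝒰 : Filter ℕ), ∀ w ∈ ball ζ (min r r2), ε ≤ ‖(Y k w)⁻¹‖ := by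
      filter_upwards [Metric.tendstoUniformlyOn_iff.1 h2 (ε/2) (by positivity)] with k hk w hw
      have h4 := hk w (ball_subset_ball (min_le_left _ _) hw)
      rw [dist_eq_norm] at h4
      have : ‖P w‖ ≤ ‖(Y k w)⁻¹‖ + ‖P w - (Y k w)⁻¹‖ := by
        calc ‖P w‖ = ‖(Y k w)⁻¹ + (P w - (Y k w)⁻¹)‖ := by congr 1; ring
          _ ≤ _ := norm_add_le _ _
      linarith [hPb w hw]
  · filter_upwards [h1, hYb] with k hk hk2
    have : DifferentiableOn ℂ (fun z => ((Y k z)⁻¹)⁻¹) (ball ζ (min r r2)) :=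
      (hk.mono (ball_subset_ball (min_le_left _ _))).inv (fun w hw h0 => by
        have := hk2 w hw; rw [h0, norm_zero] at this; linarith)
    simpa using this
  · rw [Metric.tendstoUniformlyOn_iff]
    intro δ hδ
    filter_upwards [Metric.tendstoUniformlyOn_iff.1 h2 (δ * ε^2) (by positivity), hYb] with k hk hk2 w hw
    have h4 := hk w (ball_subset_ball (min_le_left _ _) hw)
    have h5 := hk2 w hw
    have h6 := hPb w hw
    have hY : Y k w ≠ 0 := by intro h0; simp [h0] at h5; linarith
    have hPw : P w ≠ 0 := by intro h0; rw [h0, norm_zero] at h6; linarith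
    have hYi : (Y k w)⁻¹ ≠ 0 := inv_ne_zero hY
    rw [dist_eq_norm] at h4 ⊢
    have e : (P w)⁻¹ - Y k w = -(P w - (Y k w)⁻¹) * ((P w)⁻¹ * ((Y k w)⁻¹)⁻¹) := by
      field_simp
      ring
    rw [e, norm_mul, norm_neg, norm_mul, norm_inv, norm_inv (Y k w)⁻¹]
    have h7 : ‖P w‖⁻¹ ≤ ε⁻¹ := inv_anti₀ hεp (by linarith)
    have h8 : ‖(Y k w)⁻¹‖⁻¹ ≤ ε⁻¹ := inv_anti₀ hεp h5
    calc _ ≤ ‖P w - (Y k w)⁻¹‖ * (ε⁻¹ * ε⁻¹) := by gcongr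
      _ < δ * ε^2 * (ε⁻¹ * ε⁻¹) := by gcongr
      _ = δ := by field_simp

lemma rel_limOn {𝒰 : Ultrafilter ℕ} {Y : ℕ → ℂ → ℂ} {A D : ℂ → ℂ} {U : Set ℂ}
    (hD : ∀ z, AnalyticAt ℂ D z)
    (hrel : ∀ ζ ∈ U, GRel 𝒰 Y A D ζ) : LimOn 𝒰 Y (fun z => A z / D z) {z | z ∈ U ∧ D z ≠ 0} := by
  rintro ζ ⟨hζ, hDζ⟩
  obtain ⟨r, hr, h⟩ := hrel ζ hζ
  obtain ⟨r3, hr3, hDne⟩ := Metric.eventually_nhds_iff_ball.1 ((hD ζ).continuousAt.eventually_ne hDζ)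
  rcases h with ⟨H, h1, h2⟩ | ⟨P, h1, h2, h3⟩
  · obtain ⟨r2, hr2, h4, h5⟩ := h1 ζ (mem_ball_self hr)
    set s := min r (min r2 r3)
    have s1 : ball ζ s ⊆ ball ζ r := ball_subset_ball (min_le_left _ _)
    have s2 : ball ζ s ⊆ ball ζ r2 := ball_subset_ball ((min_le_right _ _).trans (min_le_left _ _))
    have s3 : ball ζ s ⊆ ball ζ r3 := ball_subset_ball ((min_le_right _ _).trans (min_le_right _ _))
    refine ⟨s, by positivity, ?_, ?_⟩
    · filter_upwards [h4] with k hk using hk.mono s2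
    · refine (h5.mono s2).congr_right ?_
      intro w hw
      have := hDne w (s3 hw)
      simp only
      rw [← h2 w (s1 hw)]; field_simp
  · have hP0 : P ζ ≠ 0 := by
      intro h0
      have := h3 ζ (mem_ball_self hr)
      rw [h0, mul_zero] at this; exact hDζ this
    obtain ⟨r2, hr2, h4, h5⟩ := lim_of_inv h2 (mem_ball_self hr) hP0
    set s := min r (min r2 r3)
    have s1 : ball ζ s ⊆ ball ζ r := ball_subset_ball (min_le_left _ _)
    have s2 : ball ζ s ⊆ ball ζ r2 := ball_subset_ball ((min_le_right _ _).trans (min_le_left _ _))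
    have s3 : ball ζ s ⊆ ball ζ r3 := ball_subset_ball ((min_le_right _ _).trans (min_le_right _ _))
    refine ⟨s, by positivity, ?_, ?_⟩
    · filter_upwards [h4] with k hk using hk.mono s2
    · refine (h5.mono s2).congr_right ?_
      intro w hw
      have h6 := hDne w (s3 hw)
      have h7 := h3 w (s1 hw)
      simp only
      have hA : A w ≠ 0 := by intro h0; rw [h0, zero_mul] at h7; exact h6 h7
      have hPw : P w ≠ 0 := by intro h0; rw [h0, mul_zero] at h7; exact h6 h7
      rw [h7]; field_simp

def Mer (y : ℂ → ℂ) (z : ℂ) : Prop :=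
  AnalyticAt ℂ y z ∨ (¬ AnalyticAt ℂ y z ∧ AnalyticAt ℂ (fun w => (y w)⁻¹) z ∧ y z = 0)

def MartyAt (y : ℂ → ℂ) (C : ℝ) (z : ℂ) : Prop :=
  (AnalyticAt ℂ y z ∧ ‖deriv y z‖ ≤ 2 * (1 + C * ‖y z‖ ^ 2)) ∨
  (¬ AnalyticAt ℂ y z ∧ AnalyticAt ℂ (fun w => (y w)⁻¹) z ∧ y z = 0 ∧
    ‖deriv (fun w => (y w)⁻¹) z‖ ≤ 2 * C)

noncomputable def Qg (y : ℂ → ℂ) (z : ℂ) : ℝ :=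
  if AnalyticAt ℂ y z then max (‖deriv y z‖ / 2 - 1) 0 / ‖y z‖ ^ 2
  else ‖deriv (fun w => (y w)⁻¹) z‖ / 2

lemma Qg_nonneg (y : ℂ → ℂ) (z : ℂ) : 0 ≤ Qg y z := by
  unfold Qg; split_ifs <;> positivity

lemma continuousAt_Qg {y : ℂ → ℂ} {z : ℂ} (h : Mer y z)
    (hs : AnalyticAt ℂ y z → y z = 0 → ‖deriv y z‖ < 2) : ContinuousAt (Qg y) z := by
  rcases h with h | ⟨h1, h2, h3⟩
  · have hev : ∀ᶠ w in 𝓝 z, Qg y w = max (‖deriv y w‖ / 2 - 1) 0 / ‖y w‖ ^ 2 := by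
      filter_upwards [h.eventually_analyticAt] with w hw
      simp [Qg, hw]
    have hdc : ContinuousAt (deriv y) z := h.deriv.continuousAt
    by_cases h0 : y z = 0
    · have h2 := hs h h0
      have : ∀ᶠ w in 𝓝 z, Qg y w = 0 := by
        filter_upwards [hev, hdc.norm.eventually_lt continuousAt_const h2] with w hw hw2
        rw [hw, max_eq_right (by linarith), zero_div]
      exact (continuousAt_const (y := (0:ℝ))).congr (by filter_upwards [this] with w hw using hw.symm)
    · refine ContinuousAt.congr ?_ (by filter_upwards [hev] with w hw using hw.symm)
      exact (((hdc.norm.div_const 2).sub continuousAt_const).max continuousAt_const).div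
        (h.continuousAt.norm.pow 2) (by simpa using h0)
  · have hp := pole_punctured h1 h2 h3
    rw [eventually_nhdsWithin_iff] at hp
    have hdc : ContinuousAt (deriv (fun w => (y w)⁻¹)) z := h2.deriv.continuousAt
    have hev : ∀ᶠ w in 𝓝 z, Qg y w = max (‖deriv (fun w => (y w)⁻¹) w‖ / 2 - ‖(y w)⁻¹‖^2) 0 := by
      filter_upwards [hp] with w hw
      by_cases hwz : w = z
      · subst hwz
        simp only [Qg, h1, if_false, h3]
        simp
        positivity
      · obtain ⟨ha, hb⟩ := hw hwz
        have hd : deriv (fun w => (y w)⁻¹) w = -deriv y w / y w ^ 2 :=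
          (ha.differentiableAt.hasDerivAt.fun_inv hb).deriv
        simp only [Qg, ha, if_true, hd, norm_div, norm_neg, norm_pow, norm_inv]
        have hn : 0 < ‖y w‖ := norm_pos_iff.2 hb
        rw [← max_div_div_right (by positivity), zero_div]
        congr 1
        field_simp
    refine ContinuousAt.congr ?_ (by filter_upwards [hev] with w hw using hw.symm)
    exact ((hdc.norm.div_const 2).sub (h2.continuousAt.norm.pow 2)).max continuousAt_const

lemma marty_of_Qg {y : ℂ → ℂ} {z : ℂ} {C : ℝ} (h : Mer y z)
    (hs : AnalyticAt ℂ y z → y z = 0 → ‖deriv y z‖ < 2) (hQ : Qg y z ≤ C) : MartyAt y C z := by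
  rcases h with h | ⟨h1, h2, h3⟩
  · left
    refine ⟨h, ?_⟩
    simp only [Qg, h, if_true] at hQ
    by_cases h0 : y z = 0
    · have := hs h h0
      simp [h0]; exact this.le
    · have hn : 0 < ‖y z‖ := norm_pos_iff.2 h0
      rw [div_le_iff₀ (by positivity)] at hQ
      have := (le_max_left _ _).trans hQ
      linarith
  · right
    refine ⟨h1, h2, h3, ?_⟩
    simp only [Qg, h1, if_false] at hQ
    linarith

noncomputable def rsc (y : ℂ → ℂ) (c : ℂ) (ρ : ℝ) : ℂ → ℂ := fun ζ => y (c + ρ * ζ) / ρ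

lemma rsc_analytic {y : ℂ → ℂ} {c : ℂ} {ρ : ℝ} (hρ : 0 < ρ) {ζ : ℂ} :
    AnalyticAt ℂ (rsc y c ρ) ζ ↔ AnalyticAt ℂ y (c + ρ * ζ) := by
  have hρ' : (ρ:ℂ) ≠ 0 := by exact_mod_cast hρ.ne'
  constructor
  · intro h
    have h1 : AnalyticAt ℂ (fun z : ℂ => (z - c) / ρ) (c + ρ * ζ) := by fun_prop (disch := exact hρ')
    have e : ((c + ρ * ζ) - c) / ρ = ζ := by field_simp; ring
    have h2 : AnalyticAt ℂ (fun z => ρ * rsc y c ρ ((z - c) / ρ)) (c + ρ * ζ) := by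
      refine analyticAt_const.mul (AnalyticAt.fun_comp ?_ h1)
      rw [e]; exact h
    refine h2.congr ?_
    filter_upwards with z
    simp only [rsc]
    have : c + ρ * ((z - c) / ρ) = z := by field_simp; ring
    rw [this]; field_simp
  · intro h
    have h1 : AnalyticAt ℂ (fun z : ℂ => c + ρ * z) ζ := by fun_prop
    exact (AnalyticAt.fun_comp (g := y) (f := fun z : ℂ => c + ρ * z) h h1).div analyticAt_const hρ'

lemma rsc_deriv {y : ℂ → ℂ} {c : ℂ} {ρ : ℝ} (hρ : 0 < ρ) (ζ : ℂ) :
    deriv (rsc y c ρ) ζ = deriv y (c + ρ * ζ) := by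
  have hρ' : (ρ:ℂ) ≠ 0 := by exact_mod_cast hρ.ne'
  have h1 : rsc y c ρ = fun ζ => (fun x => y (c + x)) (ρ * ζ) / ρ := rfl
  rw [h1, deriv_div_const, deriv_comp_mul_left (f := fun x => y (c + x))]
  rw [deriv_comp_const_add, smul_eq_mul]
  field_simp

lemma rsc_inv_deriv {y : ℂ → ℂ} {c : ℂ} {ρ : ℝ} (ζ : ℂ) :
    deriv (fun z => (rsc y c ρ z)⁻¹) ζ = ρ^2 * deriv (fun z => (y z)⁻¹) (c + ρ * ζ) := by
  have h1 : (fun z => (rsc y c ρ z)⁻¹) = fun ζ => ρ * (fun x => (y (c + x))⁻¹) (ρ * ζ) := by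
    funext z; simp [rsc, div_eq_mul_inv, mul_comm]
  rw [h1, deriv_const_mul_field, deriv_comp_mul_left (f := fun x => (y (c + x))⁻¹)]
  rw [deriv_comp_const_add (f := fun z => (y z)⁻¹), smul_eq_mul]
  ring

lemma rsc_inv_analytic {y : ℂ → ℂ} {c : ℂ} {ρ : ℝ} {ζ : ℂ}
    (h : AnalyticAt ℂ (fun z => (y z)⁻¹) (c + ρ * ζ)) : AnalyticAt ℂ (fun z => (rsc y c ρ z)⁻¹) ζ := by
  have h1 : (fun z => (rsc y c ρ z)⁻¹) = fun ζ => ρ * (fun x => (y x)⁻¹) (c + ρ * ζ) := by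
    funext z; simp [rsc, div_eq_mul_inv, mul_comm]
  rw [h1]
  have h2 : AnalyticAt ℂ (fun z : ℂ => c + ρ * z) ζ := by fun_prop
  exact analyticAt_const.mul (AnalyticAt.fun_comp (g := fun z => (y z)⁻¹) (f := fun z : ℂ => c + ρ * z) h h2)

lemma rsc_marty {y : ℂ → ℂ} {c : ℂ} {ρ C : ℝ} (hρ : 0 < ρ) {ζ : ℂ}
    (h : MartyAt y (C / ρ^2) (c + ρ * ζ)) : MartyAt (rsc y c ρ) C ζ := by
  have hρ' : (ρ:ℂ) ≠ 0 := by exact_mod_cast hρ.ne'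
  rcases h with ⟨h1, h2⟩ | ⟨h1, h2, h3, h4⟩
  · left
    refine ⟨(rsc_analytic hρ).2 h1, ?_⟩
    rw [rsc_deriv hρ]
    refine h2.trans (le_of_eq ?_)
    simp only [rsc, norm_div, Complex.norm_real, Real.norm_of_nonneg hρ.le]
    field_simp
  · right
    refine ⟨fun h => h1 ((rsc_analytic hρ).1 h), rsc_inv_analytic h2, by simp [rsc, h3], ?_⟩
    rw [rsc_inv_deriv, norm_mul, norm_pow, Complex.norm_real, Real.norm_of_nonneg hρ.le]
    calc _ ≤ ρ^2 * (2 * (C / ρ^2)) := by gcongr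
      _ = 2 * C := by field_simp

lemma MartyAt.mb {y : ℂ → ℂ} {C : ℝ} {z : ℂ} (hC : 0 ≤ C) (h : MartyAt y C z) :
    MB y (2 * (1 + C)) z := by
  rcases h with ⟨h1, h2⟩ | ⟨h1, h2, h3, h4⟩
  · refine Or.inl ⟨h1, h2.trans ?_⟩
    nlinarith [mul_nonneg hC (sq_nonneg ‖y z‖), sq_nonneg ‖y z‖]
  · exact Or.inr ⟨h1, h2, h3, h4.trans (by linarith)⟩

lemma MartyAt.mono {y : ℂ → ℂ} {C C' : ℝ} {z : ℂ} (hC : C ≤ C') (h : MartyAt y C z) :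
    MartyAt y C' z := by
  rcases h with ⟨h1, h2⟩ | ⟨h1, h2, h3, h4⟩
  · exact Or.inl ⟨h1, h2.trans (by gcongr)⟩
  · exact Or.inr ⟨h1, h2, h3, h4.trans (by linarith)⟩

/-- Data produced by rescaling. -/
structure Zal (𝒰 : Ultrafilter ℕ) (y : ℂ → ℂ) (z : ℕ → ℂ) (ρ : ℕ → ℝ) : Prop where
  hU : (𝒰 : Filter ℕ) ≤ atTop
  hρ : ∀ k, 0 < ρ k
  hz : Tendsto z 𝒰 (Bornology.cobounded ℂ)
  hρz : Tendsto (fun k => (ρ k : ℂ) / z k) 𝒰 (𝓝 0)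
  charts : Charts 𝒰 (fun k => rsc y (z k) (ρ k)) Set.univ
  h0 : ∀ k, AnalyticAt ℂ (rsc y (z k) (ρ k)) 0 →
    ‖deriv (rsc y (z k) (ρ k)) 0‖ = 2 * (1 + ‖rsc y (z k) (ρ k) 0‖ ^ 2)
  h0' : ∀ k, ¬ AnalyticAt ℂ (rsc y (z k) (ρ k)) 0 →
    ‖deriv (fun w => (rsc y (z k) (ρ k) w)⁻¹) 0‖ = 2

lemma zalcman {y : ℂ → ℂ} {R : ℝ} (hR : 0 < R) (hy : ∀ z, R < ‖z‖ → Mer y z)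
    (hs : ∀ z, R < ‖z‖ → AnalyticAt ℂ y z → y z = 0 → ‖deriv y z‖ < 2)
    (hneg : ¬ ∃ C R' : ℝ, ∀ z, R' < ‖z‖ → MartyAt y (C / ‖z‖ ^ 2) z) :
    ∃ 𝒰 z ρ, Zal 𝒰 y z ρ := by
  push Not at hneg
  have step : ∀ k : ℕ, ∃ z1 : ℂ, ∃ ρ : ℝ, 0 < ρ ∧ (k:ℝ) ≤ ‖z1‖ ∧ ρ * (k+1) ≤ ‖z1‖ ∧
      (∀ ζ, ‖ζ‖ < (k+1)/2 → MartyAt (rsc y z1 ρ) 4 ζ) ∧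
      (AnalyticAt ℂ (rsc y z1 ρ) 0 → ‖deriv (rsc y z1 ρ) 0‖ = 2 * (1 + ‖rsc y z1 ρ 0‖ ^ 2)) ∧
      (¬ AnalyticAt ℂ (rsc y z1 ρ) 0 → ‖deriv (fun w => (rsc y z1 ρ w)⁻¹) 0‖ = 2) := by
    intro k
    obtain ⟨z0, hz0, hM⟩ := hneg (4 * (k+1)^2) (2 * (R + k))
    have hk0 : (0:ℝ) ≤ k := Nat.cast_nonneg k
    have hz0p : 0 < ‖z0‖ := by linarith
    have hin : ∀ z ∈ closedBall z0 (‖z0‖/2), R + k < ‖z‖ := by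
      intro z hz
      rw [mem_closedBall, dist_eq_norm] at hz
      have : ‖z0‖ ≤ ‖z‖ + ‖z - z0‖ := by
        calc ‖z0‖ = ‖z - (z - z0)‖ := by congr 1; ring
          _ ≤ _ := norm_sub_le _ _
      linarith
    have hz0R : R < ‖z0‖ := by linarith
    have hQ0 : 4 * (k+1)^2 / ‖z0‖^2 < Qg y z0 := by
      by_contra hcon
      exact hM (marty_of_Qg (hy z0 hz0R) (hs z0 hz0R) (not_lt.1 hcon))
    have hcont : ContinuousOn (fun z => Real.sqrt (Qg y z)) (closedBall z0 (‖z0‖/2)) := by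
      intro z hz
      have hzR : R < ‖z‖ := by linarith [hin z hz]
      exact (continuousAt_Qg (hy z hzR) (hs z hzR)).sqrt.continuousWithinAt
    obtain ⟨z1, r, hr, hd, hΛ, hq, hmax⟩ := select_point (fun z => Real.sqrt (Qg y z)) z0 (‖z0‖/2)
      (k+1) (by positivity) hcont (by positivity) (by
        have : (2 * (k+1) / ‖z0‖) ≤ Real.sqrt (Qg y z0) := by
          apply Real.le_sqrt_of_sq_le
          rw [div_pow, mul_pow]; norm_num; exact hQ0.le
        calc (k+1:ℝ) = ‖z0‖/2 * (2 * (k+1) / ‖z0‖) := by field_simp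
          _ ≤ _ := by gcongr)
    set q := Real.sqrt (Qg y z1) with hqdef
    have hqsq : q^2 = Qg y z1 := Real.sq_sqrt (Qg_nonneg y z1)
    have hz1 : z1 ∈ closedBall z0 (‖z0‖/2) := by rw [mem_closedBall]; linarith
    have hz1b : ‖z0‖ / 2 ≤ ‖z1‖ := by
      rw [mem_closedBall, dist_eq_norm] at hz1
      have : ‖z0‖ ≤ ‖z1‖ + ‖z1 - z0‖ := by
        calc ‖z0‖ = ‖z1 - (z1 - z0)‖ := by congr 1; ring
          _ ≤ _ := norm_sub_le _ _
      linarith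
    have hz1R : R < ‖z1‖ := by linarith [hin z1 hz1]
    have hρ : 0 < q⁻¹ := inv_pos.2 hq
    have hρr : q⁻¹ * (k+1) ≤ r := by
      rw [inv_mul_le_iff₀ hq]; linarith
    refine ⟨z1, q⁻¹, hρ, by linarith [hin z1 hz1], ?_, ?_, ?_, ?_⟩
    · have : r ≤ ‖z0‖/2 := by linarith [dist_nonneg (x := z1) (y := z0)]
      linarith
    · intro ζ hζ
      apply rsc_marty hρ
      have hmem : z1 + (q⁻¹ : ℝ) * ζ ∈ closedBall z1 (r/2) := by
        rw [mem_closedBall, dist_eq_norm, add_sub_cancel_left, norm_mul, Complex.norm_real,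
          Real.norm_of_nonneg hρ.le]
        nlinarith
      have hmem2 : z1 + (q⁻¹ : ℝ) * ζ ∈ closedBall z0 (‖z0‖/2) := by
        rw [mem_closedBall] at hmem ⊢
        linarith [dist_triangle (z1 + (q⁻¹ : ℝ) * ζ) z1 z0]
      have hwR : R < ‖z1 + (q⁻¹ : ℝ) * ζ‖ := by linarith [hin _ hmem2]
      refine marty_of_Qg (hy _ hwR) (hs _ hwR) ?_
      have h5 := hmax _ hmem
      rw [inv_pow, div_inv_eq_mul]
      have h6 : Qg y (z1 + (q⁻¹ : ℝ) * ζ) = Real.sqrt (Qg y (z1 + (q⁻¹ : ℝ) * ζ)) ^ 2 :=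
        (Real.sq_sqrt (Qg_nonneg _ _)).symm
      rw [h6]
      calc _ ≤ (2 * q)^2 := by gcongr
        _ = 4 * q^2 := by ring
    · intro ha
      have ha' := (rsc_analytic hρ).1 ha
      rw [mul_zero, add_zero] at ha'
      rw [rsc_deriv hρ, mul_zero, add_zero]
      simp only [Qg, ha', if_true] at hqsq
      have hq2 : 0 < q^2 := by positivity
      have hyne : ‖y z1‖ ≠ 0 := by
        intro h0; rw [h0] at hqsq; simp at hqsq; exact hq.ne' hqsq
      have hmx : q^2 * ‖y z1‖^2 = max (‖deriv y z1‖ / 2 - 1) 0 := by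
        rw [hqsq]; field_simp
      have hpos : 0 < max (‖deriv y z1‖ / 2 - 1) 0 := by
        rw [← hmx]; positivity
      rcases max_choice (‖deriv y z1‖ / 2 - 1) 0 with h | h
      · rw [h] at hmx
        simp only [rsc, mul_zero, add_zero, norm_div, Complex.norm_real, Real.norm_of_nonneg hρ.le]
        rw [div_inv_eq_mul, mul_pow]
        linarith
      · rw [h] at hpos; exact absurd hpos (lt_irrefl _)
    · intro ha
      have ha' : ¬ AnalyticAt ℂ y z1 := by
        intro h; apply ha; rw [rsc_analytic hρ, mul_zero, add_zero]; exact h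
      rw [rsc_inv_deriv, mul_zero, add_zero, norm_mul, norm_pow, Complex.norm_real,
        Real.norm_of_nonneg hρ.le]
      simp only [Qg, ha', if_false] at hqsq
      have : ‖deriv (fun w => (y w)⁻¹) z1‖ = 2 * q^2 := by linarith
      rw [this]; field_simp
  choose z ρ hρ hzk hρz hM h0 h0' using step
  have hU : ((hyperfilter ℕ : Ultrafilter ℕ) : Filter ℕ) ≤ atTop := by
    rw [← Nat.cofinite_eq_atTop]; exact hyperfilter_le_cofinite
  refine ⟨hyperfilter ℕ, z, ρ, hU, hρ, ?_, ?_, ?_, h0, h0'⟩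
  · rw [← tendsto_norm_atTop_iff_cobounded]
    exact (tendsto_atTop_mono hzk tendsto_natCast_atTop_atTop).mono_left hU
  · rw [tendsto_zero_iff_norm_tendsto_zero]
    refine (squeeze_zero (fun _ => norm_nonneg _) (g := fun k : ℕ => 1 / ((k:ℝ) + 1)) ?_
      tendsto_one_div_add_atTop_nhds_zero_nat).mono_left hU
    intro k
    rw [norm_div, Complex.norm_real, Real.norm_of_nonneg (hρ k).le]
    have h1 : (0:ℝ) < k + 1 := by positivity
    have h2 : 0 < ‖z k‖ := lt_of_lt_of_le (mul_pos (hρ k) h1) (hρz k)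
    rw [div_le_div_iff₀ h2 h1]; linarith [hρz k]
  · apply charts_of_MB isOpen_univ
    intro ζ _
    refine ⟨10, by norm_num, 1, one_pos, ?_⟩
    have : ∀ᶠ k : ℕ in atTop, 2 * (‖ζ‖ + 1) ≤ (k:ℝ) :=
      tendsto_natCast_atTop_atTop.eventually_ge_atTop _
    filter_upwards [hU this] with k hk w hw
    have h1 := (hM k w ?_).mb (by norm_num)
    · norm_num at h1; exact h1
    · rw [mem_ball, dist_eq_norm] at hw
      have : ‖w‖ ≤ ‖ζ‖ + ‖w - ζ‖ := by
        calc ‖w‖ = ‖ζ + (w - ζ)‖ := by congr 1; ring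
          _ ≤ _ := norm_add_le _ _
      linarith

lemma Zal.base {𝒰 : Ultrafilter ℕ} {y : ℂ → ℂ} {z : ℕ → ℂ} {ρ : ℕ → ℝ} (h : Zal 𝒰 y z ρ) :
    ∃ ζ : ℂ, ∃ r > 0, ∃ H, LimOn 𝒰 (fun k => rsc y (z k) (ρ k)) H (ball ζ r) := by
  obtain ⟨r, hr, -, hc | hc⟩ := h.charts 0 (Set.mem_univ _)
  · obtain ⟨H, hH⟩ := hc.exists_lim
    exact ⟨0, r, hr, H, hH⟩
  · obtain ⟨P, hP⟩ := hc.exists_lim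
    by_cases hP0 : ∀ w ∈ ball (0:ℂ) r, P w = 0
    · exfalso
      have t := (hP.derivs.tendsto (mem_ball_self hr)).norm
      have hz : deriv P 0 = 0 := by
        have : P =ᶠ[𝓝 0] fun _ => 0 := by
          filter_upwards [isOpen_ball.eventually_mem (mem_ball_self hr)] with w hw using hP0 w hw
        rw [this.deriv_eq]; simp
      rw [hz, norm_zero] at t
      have t2 := t.eventually_lt_const (by norm_num : (0:ℝ) < 1)
      have t3 : ∀ᶠ k in (𝒰 : Filter ℕ), False := by
        filter_upwards [t2, hc] with k hk hck
        by_cases ha : AnalyticAt ℂ (rsc y (z k) (ρ k)) 0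
        · have hne : rsc y (z k) (ρ k) 0 ≠ 0 := fun h0 => (hck 0 (mem_ball_self hr)).2.2 h0 ha
          have hd : deriv (fun w => (rsc y (z k) (ρ k) w)⁻¹) 0
              = -deriv (rsc y (z k) (ρ k)) 0 / rsc y (z k) (ρ k) 0 ^ 2 :=
            (ha.differentiableAt.hasDerivAt.fun_inv hne).deriv
          rw [hd, norm_div, norm_neg, h.h0 k ha, norm_pow] at hk
          have hn : 0 < ‖rsc y (z k) (ρ k) 0‖ := norm_pos_iff.2 hne
          rw [div_lt_one (by positivity)] at hk
          nlinarith
        · rw [h.h0' k ha] at hk; norm_num at hk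
      exact t3.exists.elim (fun _ h => h)
    · push Not at hP0
      obtain ⟨w, hw, hPw⟩ := hP0
      obtain ⟨s, hs, h1, h2⟩ := lim_of_inv hP hw hPw
      refine ⟨w, s, hs, fun w => (P w)⁻¹, ?_⟩
      intro x hx
      obtain ⟨s', hs', hss⟩ := Metric.isOpen_iff.1 isOpen_ball x hx
      exact ⟨s', hs', by filter_upwards [h1] with k hk using hk.mono hss, h2.mono hss⟩

/-- If all functions are analytic, local boundedness propagates. -/
lemma lim_univ_of_analytic {𝒰 : Ultrafilter ℕ} (hU : (𝒰 : Filter ℕ) ≤ atTop) {Y : ℕ → ℂ → ℂ}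
    {U : Set ℂ} (hUc : IsPreconnected U)
    (hch : Charts 𝒰 Y U)
    (han : ∀ ζ ∈ U, ∃ r > 0, ∀ᶠ k in (𝒰 : Filter ℕ), ∀ w ∈ ball ζ r, AnalyticAt ℂ (Y k) w)
    (hb : ∃ ζ ∈ U, ∃ r > 0, ∃ H, LimOn 𝒰 Y H (ball ζ r)) : ∃ H, LimOn 𝒰 Y H U := by
  apply LocBdd.exists_lim
  set G := {ζ : ℂ | ∃ r > 0, ∃ H, LimOn 𝒰 Y H (ball ζ r)} with hG
  have hGo : IsOpen G := by
    rw [Metric.isOpen_iff]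
    rintro ζ ⟨r, hr, H, hH⟩
    refine ⟨r, hr, fun w hw => ?_⟩
    obtain ⟨r', hr', hs⟩ := Metric.isOpen_iff.1 isOpen_ball w hw
    exact ⟨r', hr', H, hH.mono hs⟩
  have hsub : U ⊆ G := by
    obtain ⟨ζb, hbU, hbG⟩ := hb
    refine hUc.subset_of_closure_inter_subset hGo ⟨ζb, hbU, hbG⟩ ?_
    rintro ζ0 ⟨hcl, hU0⟩
    obtain ⟨r, hr, hrU, hc⟩ := hch ζ0 hU0
    rcases hc with hc | hc
    · obtain ⟨H, hH⟩ := hc.exists_lim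
      exact ⟨r, hr, H, hH⟩
    · obtain ⟨P, hP⟩ := hc.exists_lim
      obtain ⟨ζ, hζ, hζr⟩ := Metric.mem_closure_iff.1 hcl r hr
      have hζr' : ζ ∈ ball ζ0 r := by rw [mem_ball, dist_comm]; exact hζr
      obtain ⟨r', hr', H, hH⟩ := hζ
      have hPζ : P ζ ≠ 0 := by
        intro h0
        have := lim_prod hH hc hP (mem_ball_self hr') hζr' hζr'
        rw [h0, mul_zero] at this; exact zero_ne_one this
      have hP0 : P ζ0 ≠ 0 := by
        intro h0
        have hne : ¬ ∀ᶠ w in 𝓝 ζ0, P w = 0 := by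
          intro hev
          have hPan : AnalyticOnNhd ℂ P (ball ζ0 r) := hP.differentiableOn
          exact hPζ (hPan.eqOn_zero_of_preconnected_of_eventuallyEq_zero
            (convex_ball _ _).isPreconnected (mem_ball_self hr) hev hζr')
        obtain ⟨x, hx, hx0⟩ := hP.hurwitz hU (mem_ball_self hr) h0 hne
        obtain ⟨r2, hr2, ha⟩ := han ζ0 hU0
        have t3 : ∀ᶠ k in (𝒰 : Filter ℕ), False := by
          filter_upwards [hx0, ha, hc, hx.eventually (ball_mem_nhds ζ0 hr2),
            hx.eventually (ball_mem_nhds ζ0 hr)] with k h1 h2 h3 h4 h5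
          exact (h3 _ h5).2.2 (by simpa using h1) (h2 _ h4)
        exact t3.exists.elim (fun _ h => h)
      obtain ⟨s, hs, h1, h2⟩ := lim_of_inv hP (mem_ball_self hr) hP0
      refine ⟨s, hs, fun w => (P w)⁻¹, ?_⟩
      intro x hx
      obtain ⟨s', hs', hss⟩ := Metric.isOpen_iff.1 isOpen_ball x hx
      exact ⟨s', hs', by filter_upwards [h1] with k hk using hk.mono hss, h2.mono hss⟩
  intro ζ hζ
  obtain ⟨r, hr, H, hH⟩ := hsub hζ
  exact hH.locBdd ζ (mem_ball_self hr)

lemma const_of_deriv_zero {V : ℂ → ℂ} (hV : Differentiable ℂ V) (h : ∀ z, deriv V z = 0) (x y : ℂ) :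
    V x = V y := is_const_of_deriv_eq_zero hV h x y

lemma quad_of_deriv2 {H : ℂ → ℂ} (hH : Differentiable ℂ H) {c : ℂ}
    (h : ∀ z, deriv (deriv H) z = c) : ∀ z, H z = H 0 + deriv H 0 * z + c / 2 * z^2 := by
  have hH' : Differentiable ℂ (deriv H) := fun z => (hH.analyticAt z).deriv.differentiableAt
  have h1 : ∀ z, deriv H z = deriv H 0 + c * z := by
    intro z
    have := is_const_of_deriv_eq_zero (f := fun z => deriv H z - c * z) (by fun_prop) (by
      intro x
      have : HasDerivAt (fun z => deriv H z - c * z) (deriv (deriv H) x - c * 1) x :=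
        (hH' x).hasDerivAt.sub ((hasDerivAt_id x).const_mul c)
      rw [this.deriv, h]; ring) z 0
    simp only [mul_zero, sub_zero] at this
    linear_combination this
  intro z
  have := is_const_of_deriv_eq_zero (f := fun z => H z - deriv H 0 * z - c / 2 * z^2) (by fun_prop) (by
      intro x
      have : HasDerivAt (fun z => H z - deriv H 0 * z - c / 2 * z^2)
          (deriv H x - deriv H 0 * 1 - c / 2 * (2 * x)) x := by
        have h2 := ((hH x).hasDerivAt.sub ((hasDerivAt_id x).const_mul (deriv H 0))).sub
          ((hasDerivAt_pow 2 x).const_mul (c/2))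
        refine (HasDerivAt.congr_deriv (f := fun z => H z - deriv H 0 * z - c / 2 * z^2) h2 ?_)
        simp
      rw [this.deriv, h1]; ring) z 0
  simp only [mul_zero, sub_zero] at this
  linear_combination this

lemma ode_F {H : ℂ → ℂ} (hH : Differentiable ℂ H) {C A B : ℂ} (hne : ¬ (C = 0 ∧ A = 0 ∧ B = 0))
    (h : ∀ᶠ z in 𝓝 (0:ℂ), (-A - B * deriv H z) * (1 - deriv H z)
      + (C - A * z - B * H z) * deriv (deriv H) z = -B * (1 - deriv H z)^2) :
    ∃ c, ∀ z, deriv (deriv H) z = c := by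
  have hH' : Differentiable ℂ (deriv H) := fun z => (hH.analyticAt z).deriv.differentiableAt
  have hH'' : Differentiable ℂ (deriv (deriv H)) := fun z => (hH'.analyticAt z).deriv.differentiableAt
  have ext : ∀ (F G : ℂ → ℂ), Differentiable ℂ F → Differentiable ℂ G → ∀ x, F =ᶠ[𝓝 x] G → ∀ z, F z = G z := by
    intro F G hF hG x hx z
    exact AnalyticOnNhd.eqOn_of_preconnected_of_eventuallyEq (U := Set.univ) (fun z _ => hF.analyticAt z)
      (fun z _ => hG.analyticAt z) isPreconnected_univ (Set.mem_univ x) hx (Set.mem_univ z)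
  have hode := ext _ _ (by fun_prop) (by fun_prop) 0 h
  by_cases hS : ∀ z, deriv H z = 1
  · refine ⟨0, fun z => ?_⟩
    have : deriv H = fun _ => 1 := funext hS
    rw [this]; simp
  push Not at hS
  obtain ⟨x, hx⟩ := hS
  have hSx : 1 - deriv H x ≠ 0 := sub_ne_zero.2 (Ne.symm hx)
  set N := fun z => C - A * z - B * H z with hN
  have hNd : Differentiable ℂ N := by fun_prop
  have hN' : ∀ z, HasDerivAt N (-A - B * deriv H z) z := by
    intro z
    have := (((hasDerivAt_id z).const_mul A).const_sub C).sub ((hH z).hasDerivAt.const_mul B)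
    refine (HasDerivAt.congr_deriv (f := N) this ?_)
    simp
  have hS' : ∀ z, HasDerivAt (fun z => 1 - deriv H z) (-deriv (deriv H) z) z := fun z =>
    (hH' z).hasDerivAt.const_sub 1
  -- N = (D - B z) S
  obtain ⟨r, hr, hball⟩ := Metric.eventually_nhds_iff_ball.1
    (((continuous_const.sub hH'.continuous).continuousAt (x := x)).eventually_ne hSx)
  replace hball : ∀ y ∈ ball x r, 1 - deriv H y ≠ 0 := hball
  obtain ⟨D, hD⟩ : ∃ D, ∀ z, N z = (D - B * z) * (1 - deriv H z) := by
    refine ⟨N x / (1 - deriv H x) + B * x, ext _ _ hNd (by fun_prop) x ?_⟩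
    have hd : ∀ w ∈ ball x r, HasDerivAt (fun z => N z / (1 - deriv H z) + B * z) 0 w := by
      intro w hw
      have h1 := ((hN' w).div (hS' w) (hball w hw)).add ((hasDerivAt_id w).const_mul B)
      refine h1.congr_deriv ?_
      have h2 := hball w hw
      have h3 := hode w
      simp only [hN]
      field_simp
      linear_combination h3
    have hc : ∀ w ∈ ball x r, N w / (1 - deriv H w) + B * w = N x / (1 - deriv H x) + B * x := by
      intro w hw
      refine (convex_ball x r).is_const_of_fderivWithin_eq_zero (𝕜 := ℂ)
        (f := fun z => N z / (1 - deriv H z) + B * z)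
        (fun z hz => (hd z hz).differentiableAt.differentiableWithinAt) ?_ hw (mem_ball_self hr)
      intro z hz
      rw [fderivWithin_of_isOpen isOpen_ball hz]
      ext; simp [(hd z hz).deriv]
    filter_upwards [isOpen_ball.eventually_mem (mem_ball_self hr)] with w hw
    have := hc w hw
    have h2 := hball w hw
    rw [← this]; field_simp; ring
  have key : ∀ z, (D - B * z) * (-deriv (deriv H) z) = 2 * B * (1 - deriv H z) - (A + B) := by
    intro z
    have h1 : HasDerivAt N (-B * (1 - deriv H z) + (D - B * z) * (-deriv (deriv H) z)) z := by
      have h2 := (((hasDerivAt_id z).const_mul B).const_sub D).mul (hS' z)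
      have h3 : N = (fun z => D - B * z) * (fun z => 1 - deriv H z) := funext hD
      rw [h3]
      simpa using h2
    have h2 := h1.unique (hN' z)
    linear_combination h2
  by_cases hB : B = 0
  · have hD0 : D ≠ 0 := by
      intro h0
      have h1 : ∀ z, C - A * z = 0 := by
        intro z; have := hD z; simpa [hN, hB, h0] using this
      have hC : C = 0 := by simpa using h1 0
      have hA : A = 0 := by have := h1 1; simpa [hC] using this
      exact hne ⟨hC, hA, hB⟩
    refine ⟨A / D, fun z => ?_⟩
    have := key z
    simp only [hB, zero_mul, sub_zero, mul_zero, add_zero, zero_sub] at this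
    rw [eq_div_iff hD0]; linear_combination -this
  · set e := D / B
    set m := (A + B) / (2 * B)
    have hV : ∀ z, (z - e)^2 * ((1 - deriv H z) - m) = 0 := by
      have hd : ∀ z, HasDerivAt (fun z => (z - e)^2 * ((1 - deriv H z) - m)) 0 z := by
        intro z
        have h1 := (((hasDerivAt_id z).sub_const e).pow 2).mul ((hS' z).sub_const m)
        refine h1.congr_deriv ?_
        have h2 := key z
        have h3 : (z - e) * (-deriv (deriv H) z) = -2 * ((1 - deriv H z) - m) := by
          simp only [e, m]
          field_simp
          linear_combination -h2
        simp only [id, Pi.pow_apply]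
        push_cast
        linear_combination (z - e) * h3
      intro z
      have := is_const_of_deriv_eq_zero (f := fun z => (z - e)^2 * ((1 - deriv H z) - m))
        (by fun_prop) (fun z => (hd z).deriv) z e
      simpa using this
    have hSc : ∀ z, 1 - deriv H z = m := by
      refine ext (fun z => 1 - deriv H z) (fun _ => m) (by fun_prop) (by fun_prop) (e + 1) ?_
      filter_upwards [isOpen_ne.eventually_mem (show e + 1 ≠ e by simp)] with w hw
      have h1 := hV w
      have h2 : (w - e)^2 ≠ 0 := pow_ne_zero _ (sub_ne_zero.2 hw)
      exact sub_eq_zero.1 ((mul_eq_zero.1 h1).resolve_left h2)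
    refine ⟨0, fun z => ?_⟩
    have : deriv H = fun _ => 1 - m := by
      funext w; linear_combination -hSc w
    rw [this]; simp

/-- allowed slopes in case F -/
def SlF (σ : ℂ) : Prop := σ = 1 ∨ ∃ n : ℕ, 2 ≤ n ∧ σ = -1 / n

lemma SlF.ne {σ : ℂ} (h : SlF σ) : σ ≠ 0 := by
  rcases h with h | ⟨n, hn, h⟩
  · simp [h]
  · have : (n:ℂ) ≠ 0 := by exact_mod_cast (by omega : n ≠ 0)
    rw [h]; exact div_ne_zero (by norm_num) this

lemma SlF.norm_le {σ : ℂ} (h : SlF σ) : ‖σ‖ ≤ 1 := by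
  rcases h with h | ⟨n, hn, h⟩
  · simp [h]
  · rw [h, norm_div, norm_neg, norm_one, Complex.norm_natCast]
    have : (1:ℝ) ≤ n := by exact_mod_cast (by omega : 1 ≤ n)
    rw [div_le_one (by linarith)]; exact this

lemma SlF.ratio {σ τ : ℂ} (h : SlF σ) (h' : SlF τ) : 1/2 ≤ ‖σ / τ + 1‖ := by
  rcases h with h | ⟨n, hn, h⟩ <;> rcases h' with h' | ⟨p, hp, h'⟩
  · rw [h, h']; norm_num
  · have hp2 : (2:ℝ) ≤ p := by exact_mod_cast hp
    have hp0 : (p:ℂ) ≠ 0 := by exact_mod_cast (by omega : p ≠ 0)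
    have e : σ / τ + 1 = ((1 - p : ℝ) : ℂ) := by
      rw [h, h']; push_cast; field_simp; ring
    rw [e, Complex.norm_real, Real.norm_eq_abs, abs_of_nonpos (by linarith)]; linarith
  · have hp2 : (2:ℝ) ≤ n := by exact_mod_cast hn
    have e : σ / τ + 1 = ((1 - 1 / n : ℝ) : ℂ) := by
      rw [h, h']; push_cast; ring
    have : (1:ℝ) / n ≤ 1/2 := by apply one_div_le_one_div_of_le <;> linarith
    rw [e, Complex.norm_real, Real.norm_eq_abs, abs_of_nonneg (by linarith)]; linarith
  · have hn0 : (n:ℂ) ≠ 0 := by exact_mod_cast (by omega : n ≠ 0)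
    have hp0 : (p:ℂ) ≠ 0 := by exact_mod_cast (by omega : p ≠ 0)
    have e : σ / τ + 1 = ((p / n + 1 : ℝ) : ℂ) := by
      rw [h, h']; push_cast; field_simp
    have : (0:ℝ) ≤ p / n := by positivity
    rw [e, Complex.norm_real, Real.norm_eq_abs, abs_of_nonneg (by linarith)]; linarith

lemma quad_contra {𝒰 : Ultrafilter ℕ} (hU : (𝒰 : Filter ℕ) ≤ atTop) {Y : ℕ → ℂ → ℂ} {p0 p1 p2 : ℂ}
    (hl : LimOn 𝒰 Y (fun z => p0 + p1 * z + p2 * z^2) Set.univ) (hp1 : 2 ≤ ‖p1‖)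
    (hs : ∀ x : ℕ → ℂ, ∀ x0 : ℂ, Tendsto x 𝒰 (𝓝 x0) → ∀ᶠ k in (𝒰 : Filter ℕ), Y k (x k) = 0 →
      SlF (deriv (Y k) (x k))) : False := by
  have hp1' : p1 ≠ 0 := by intro h; rw [h, norm_zero] at hp1; linarith
  have fin : ¬ ∀ᶠ k in (𝒰 : Filter ℕ), False := by
    intro h; exact h.exists.elim (fun _ h => h)
  by_cases hp2 : p2 = 0
  · subst hp2
    obtain ⟨x, hx, hx0⟩ := hl.hurwitz hU (ζ := -p0 / p1) (Set.mem_univ _) (by field_simp; ring) (by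
      intro hev
      have h2 : (fun z : ℂ => p0 + p1 * z + 0 * z^2) =ᶠ[𝓝 (-p0/p1)] fun _ => 0 := hev
      have h3 := h2.deriv_eq
      have h4 : HasDerivAt (fun z : ℂ => p0 + p1 * z + 0 * z^2) p1 (-p0/p1) := by
        have := ((hasDerivAt_id (-p0/p1)).const_mul p1).const_add p0
        simpa using this
      rw [h4.deriv] at h3; simp at h3; exact hp1' h3)
    have t := (hl.derivs.tendsto_seq (Set.mem_univ (-p0/p1)) hx).norm
    have h4 : deriv (fun z : ℂ => p0 + p1 * z + 0 * z^2) (-p0/p1) = p1 := by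
      have := ((hasDerivAt_id (-p0/p1)).const_mul p1).const_add p0
      simpa using this.deriv
    rw [h4] at t
    have t2 := t.eventually_const_lt (show (1:ℝ) < ‖p1‖ by linarith)
    apply fin
    filter_upwards [t2, hx0, hs x _ hx] with k h1 h2 h3
    linarith [(h3 h2).norm_le]
  · obtain ⟨d, hd⟩ := IsAlgClosed.exists_pow_nat_eq (p1^2 - 4 * p2 * p0) (n := 2) (by norm_num)
    set r1 := (-p1 + d) / (2 * p2)
    set r2 := (-p1 - d) / (2 * p2)
    obtain ⟨x, x', e, e', hx, hx', he, he', hk⟩ := hl.two_zeros hU isOpen_univ (ρ₁ := r1) (ρ₂ := r2)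
      (E := fun _ => p2) (Set.mem_univ _) (Set.mem_univ _) (fun _ _ => continuousAt_const) (by
        intro w _
        simp only [r1, r2]
        field_simp
        linear_combination hd) hp2 hp2
    have t := (he.div he' hp2).neg
    rw [div_self hp2] at t
    have t2 := (t.add_const 1).norm
    simp only [neg_add_cancel, norm_zero] at t2
    have t3 := t2.eventually_lt_const (show (0:ℝ) < 1/2 by norm_num)
    apply fin
    filter_upwards [t3, hk, hs x _ hx, hs x' _ hx'] with k h1 h2 h3 h4
    obtain ⟨a1, a2, a3, a4⟩ := h2
    have s1 := h3 a1
    have s2 := h4 a2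
    have h5 := s1.ratio s2
    have hne := s2.ne
    rw [a3, a4] at h5
    rw [a4] at hne
    have hz : x' k - x k ≠ 0 := left_ne_zero_of_mul hne
    have he0 : e' k ≠ 0 := right_ne_zero_of_mul hne
    have e1 : (x k - x' k) * e k / ((x' k - x k) * e' k) = -(e k / e' k) := by
      field_simp; ring
    rw [e1] at h5
    simp only [Pi.div_apply] at h1
    linarith

lemma unif_of_seq {𝒰 : Ultrafilter ℕ} {S : Set ℂ} {P : ℕ → ℂ → Prop}
    (h : ∀ x : ℕ → ℂ, (∀ k, x k ∈ S) → ∀ᶠ k in (𝒰 : Filter ℕ), P k (x k)) :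
    ∀ᶠ k in (𝒰 : Filter ℕ), ∀ x ∈ S, P k x := by
  rcases S.eq_empty_or_nonempty with hS | ⟨s, hs⟩
  · simp [hS]
  have := h (fun k => if hk : ∃ x ∈ S, ¬ P k x then hk.choose else s) (by
    intro k
    by_cases hk : ∃ x ∈ S, ¬ P k x
    · simp only [dif_pos hk]; exact hk.choose_spec.1
    · simp only [dif_neg hk]; exact hs)
  filter_upwards [this] with k hk x hx
  by_contra hc
  have he : ∃ x ∈ S, ¬ P k x := ⟨x, hx, hc⟩
  simp only [dif_pos he] at hk
  exact he.choose_spec.2 hk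

lemma mv_seq {𝒰 : Ultrafilter ℕ} {z : ℕ → ℂ} {ρ : ℕ → ℝ}
    (hz : Tendsto z 𝒰 (Bornology.cobounded ℂ)) (hρz : Tendsto (fun k => (ρ k : ℂ) / z k) 𝒰 (𝓝 0))
    {ζ : ℕ → ℂ} {r : ℝ} (hb : ∀ k, ‖ζ k‖ ≤ r) :
    Tendsto (fun k => z k + ρ k * ζ k) 𝒰 (Bornology.cobounded ℂ) ∧
    Tendsto (fun k => (z k + ρ k * ζ k) / z k) 𝒰 (𝓝 1) := by
  have hn : Tendsto (fun k => ‖z k‖) 𝒰 atTop := tendsto_norm_atTop_iff_cobounded.2 hz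
  have hz0 : ∀ᶠ k in (𝒰 : Filter ℕ), z k ≠ 0 := by
    filter_upwards [hn.eventually_gt_atTop 0] with k hk
    exact norm_pos_iff.1 hk
  have h2 : Tendsto (fun k => (z k + ρ k * ζ k) / z k) 𝒰 (𝓝 1) := by
    have h3 : Tendsto (fun k => (ρ k : ℂ) / z k * ζ k) 𝒰 (𝓝 0) := by
      rw [tendsto_zero_iff_norm_tendsto_zero] at hρz ⊢
      have h4 := hρz.mul_const r
      rw [zero_mul] at h4
      refine squeeze_zero (fun k => norm_nonneg _) (fun k => ?_) h4
      rw [norm_mul]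
      exact mul_le_mul_of_nonneg_left (hb k) (norm_nonneg _)
    have h5 := h3.const_add 1
    rw [add_zero] at h5
    refine h5.congr' ?_
    filter_upwards [hz0] with k hk
    field_simp
  refine ⟨?_, h2⟩
  rw [← tendsto_norm_atTop_iff_cobounded]
  have h6 := hn.atTop_mul_pos (C := 1) one_pos (by simpa using h2.norm)
  refine h6.congr' ?_
  filter_upwards [hz0] with k hk
  have := norm_ne_zero_iff.2 hk
  field_simp

lemma const_ball {F : ℂ → ℂ} {x : ℂ} {r : ℝ} (hd : ∀ w ∈ ball x r, HasDerivAt F 0 w) :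
    ∀ w ∈ ball x r, F w = F x := by
  intro w hw
  have hr : 0 < r := pos_of_mem_ball hw
  refine (convex_ball x r).is_const_of_fderivWithin_eq_zero (𝕜 := ℂ) (f := F)
    (fun z hz => (hd z hz).differentiableAt.differentiableWithinAt) ?_ hw (mem_ball_self hr)
  intro z hz
  rw [fderivWithin_of_isOpen isOpen_ball hz]
  ext; simp [(hd z hz).deriv]

lemma rsc_deriv2 {y : ℂ → ℂ} {c : ℂ} {ρ : ℝ} (hρ : 0 < ρ) (ζ : ℂ) :
    deriv (deriv (rsc y c ρ)) ζ = ρ * deriv (deriv y) (c + ρ * ζ) := by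
  have h1 : deriv (rsc y c ρ) = fun ζ => deriv y (c + ρ * ζ) := funext fun ζ => rsc_deriv hρ ζ
  have hρ' : (ρ : ℂ) ≠ 0 := by exact_mod_cast hρ.ne'
  have h2 : (fun ζ : ℂ => deriv y (c + ρ * ζ)) = fun ζ => (ρ : ℂ) * rsc (deriv y) c ρ ζ := by
    funext ζ; simp only [rsc]; field_simp
  rw [h1, h2, deriv_const_mul_field, rsc_deriv hρ]

/-- limits of the coefficient functions -/
lemma slow_lims {𝒰 : Ultrafilter ℕ} {z : ℕ → ℂ} {ρ : ℕ → ℝ}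
    (hz : Tendsto z 𝒰 (Bornology.cobounded ℂ)) (hρz : Tendsto (fun k => (ρ k : ℂ) / z k) 𝒰 (𝓝 0))
    {ζ : ℕ → ℂ} {r : ℝ} (hb : ∀ k, ‖ζ k‖ ≤ r) {a : ℂ → ℂ} (ha : Slow a) {ν : ℕ → ℂ} {A : ℂ}
    (hA : Tendsto (fun k => a (z k) / ν k) 𝒰 (𝓝 A)) :
    Tendsto (fun k => a (z k + ρ k * ζ k) / ν k) 𝒰 (𝓝 A) ∧
    Tendsto (fun k => deriv a (z k + ρ k * ζ k) * ρ k / ν k) 𝒰 (𝓝 0) := by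
  obtain ⟨h1, h2⟩ := mv_seq hz hρz hb
  have h3 : ∀ᶠ k in (𝒰 : Filter ℕ), a (z k) ≠ 0 := by
    obtain ⟨d, c, hc, _, _, h⟩ := ha
    filter_upwards [hz.eventually h] with k hk using hk.2
  have h4 := (ha.ratio hz h1 h2).mul hA
  have h5 := (ha.dratio hz h1 h2 hρz).mul hA
  rw [one_mul] at h4
  rw [zero_mul] at h5
  constructor
  · refine h4.congr' ?_
    filter_upwards [h3] with k hk
    field_simp
  · refine h5.congr' ?_
    filter_upwards [h3] with k hk
    field_simp

lemma tF1 {y η a b K : ℂ → ℂ} {R : ℝ} (hR : 0 < R)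
    (hy : ∀ z, R < ‖z‖ → AnalyticAt ℂ y z) (hη : ∀ z, R < ‖z‖ → AnalyticAt ℂ η z)
    (hK0 : ∀ z, R < ‖z‖ → K z ≠ 0)
    (ha : Slow a) (hK : Slow K) (hb : Slow b ∨ ∀ z, b z = 0)
    (e1 : ∀ z, R < ‖z‖ → deriv η z = -a z - deriv a z * y z)
    (e2 : ∀ z, R < ‖z‖ → (deriv η z / K z - η z * deriv K z / K z ^ 2 - deriv b z * y z - b z * deriv y z)
        * (1 - deriv y z) + (η z / K z - b z * y z) * deriv (deriv y) z
      = - b z * (1 - deriv y z)^2 - deriv b z * y z * (1 - deriv y z))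
    (hs : ∀ z, R < ‖z‖ → y z = 0 → SlF (deriv y z)) :
    ∃ C R' : ℝ, ∀ z, R' < ‖z‖ → MartyAt y (C / ‖z‖ ^ 2) z := by
  by_contra hneg
  obtain ⟨𝒰, z, ρ, hZ⟩ := zalcman hR (fun z hz => Or.inl (hy z hz))
    (fun z hz _ h0 => lt_of_le_of_lt (hs z hz h0).norm_le (by norm_num)) hneg
  have hz := hZ.hz
  have hρz := hZ.hρz
  have hρ0 : ∀ k, (ρ k : ℂ) ≠ 0 := fun k => by exact_mod_cast (hZ.hρ k).ne'
  have large : ∀ r : ℝ, ∀ᶠ k in (𝒰 : Filter ℕ), ∀ ζ ∈ closedBall (0:ℂ) r, R < ‖z k + ρ k * ζ‖ := by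
    intro r
    apply unif_of_seq
    intro x hx
    have := (mv_seq hz hρz (ζ := x) (r := r) (fun k => by simpa using hx k)).1
    rw [← tendsto_norm_atTop_iff_cobounded] at this
    exact this.eventually_gt_atTop R
  obtain ⟨ζb, rb, hrb, Hb, hHb⟩ := hZ.base
  obtain ⟨H, hH⟩ := lim_univ_of_analytic hZ.hU isPreconnected_univ hZ.charts (by
    intro ζ _
    refine ⟨1, one_pos, ?_⟩
    filter_upwards [large (‖ζ‖ + 1)] with k hk w hw
    rw [rsc_analytic (hZ.hρ k)]
    apply hy _ (hk w _)
    rw [mem_closedBall_zero_iff]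
    rw [mem_ball_iff_norm] at hw
    have := norm_le_norm_add_norm_sub' w ζ
    linarith) ⟨ζb, Set.mem_univ _, rb, hrb, Hb, hHb⟩
  have hHd : Differentiable ℂ H := fun w => (hH.differentiableOn w (Set.mem_univ _)).differentiableAt
  -- normalisation
  have ha0 : ∀ᶠ k in (𝒰 : Filter ℕ), a (z k) ≠ 0 := by
    obtain ⟨d, c, hc, _, _, h⟩ := ha
    filter_upwards [hz.eventually h] with k hk using hk.2
  have hKz0 : ∀ᶠ k in (𝒰 : Filter ℕ), K (z k) ≠ 0 := by
    obtain ⟨d, c, hc, _, _, h⟩ := hK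
    filter_upwards [hz.eventually h] with k hk using hk.2
  set μ : ℕ → ℝ := fun k => ‖η (z k) / (ρ k * K (z k))‖ + ‖a (z k) / K (z k)‖ + ‖b (z k)‖ with hμ
  have hμ0 : ∀ᶠ k in (𝒰 : Filter ℕ), 0 < μ k := by
    filter_upwards [ha0, hKz0] with k h1 h2
    have := norm_pos_iff.2 (div_ne_zero h1 h2)
    have h3 := norm_nonneg (η (z k) / (ρ k * K (z k)))
    have h4 := norm_nonneg (b (z k))
    simp only [hμ]; linarith
  have hμ0' : ∀ᶠ k in (𝒰 : Filter ℕ), (μ k : ℂ) ≠ 0 := by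
    filter_upwards [hμ0] with k hk
    exact_mod_cast hk.ne'
  have bd : ∀ v : ℕ → ℂ, (∀ k, ‖v k‖ ≤ μ k) → ∃ l : ℂ, Tendsto (fun k => v k / μ k) 𝒰 (𝓝 l) := by
    intro v hv
    obtain ⟨l, _, hl⟩ := ultra_lim_of_bdd 𝒰 (fun k => v k / μ k) 1 (by
      filter_upwards [hμ0] with k hk
      rw [norm_div, Complex.norm_real, Real.norm_eq_abs, abs_of_pos hk, div_le_one hk]; exact hv k)
    exact ⟨l, hl⟩
  obtain ⟨C, hC⟩ := bd (fun k => η (z k) / (ρ k * K (z k))) (fun k => by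
    have h3 := norm_nonneg (a (z k) / K (z k))
    have h4 := norm_nonneg (b (z k))
    simp only [hμ]; linarith)
  obtain ⟨A, hA⟩ := bd (fun k => a (z k) / K (z k)) (fun k => by
    have h3 := norm_nonneg (η (z k) / (ρ k * K (z k)))
    have h4 := norm_nonneg (b (z k))
    simp only [hμ]; linarith)
  obtain ⟨B, hB⟩ := bd (fun k => b (z k)) (fun k => by
    have h3 := norm_nonneg (η (z k) / (ρ k * K (z k)))
    have h4 := norm_nonneg (a (z k) / K (z k))
    simp only [hμ]; linarith)
  have hne : ¬ (C = 0 ∧ A = 0 ∧ B = 0) := by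
    rintro ⟨rfl, rfl, rfl⟩
    have h := (hC.norm.add hA.norm).add hB.norm
    simp only [norm_zero, add_zero] at h
    have h1 : Tendsto (fun _ : ℕ => (1:ℝ)) 𝒰 (𝓝 0) := by
      refine h.congr' ?_
      filter_upwards [hμ0] with k hk
      simp only [norm_div, Complex.norm_real, Real.norm_eq_abs, abs_of_pos hk]
      rw [← add_div, ← add_div]
      rw [div_eq_one_iff_eq hk.ne']
      simp only [hμ, norm_div, norm_mul, Complex.norm_real, Real.norm_eq_abs]
    have := tendsto_nhds_unique h1 tendsto_const_nhds
    norm_num at this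
  -- coefficient limits
  have hA' : Tendsto (fun k => a (z k) / (K (z k) * μ k)) 𝒰 (𝓝 A) :=
    hA.congr fun k => by rw [div_div]
  have hC' : Tendsto (fun k => η (z k) / (ρ k * K (z k) * μ k)) 𝒰 (𝓝 C) :=
    hC.congr fun k => by rw [div_div]
  have hKK : Tendsto (fun k => K (z k) / K (z k)) 𝒰 (𝓝 1) :=
    tendsto_const_nhds.congr' (by
      filter_upwards [hKz0] with k hk
      rw [div_self hk])
  have bl : ∀ (ζ : ℕ → ℂ) (r : ℝ), (∀ k, ‖ζ k‖ ≤ r) →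
      Tendsto (fun k => b (z k + ρ k * ζ k) / μ k) 𝒰 (𝓝 B) ∧
      Tendsto (fun k => deriv b (z k + ρ k * ζ k) * ρ k / μ k) 𝒰 (𝓝 0) := by
    intro ζ r hζ
    rcases hb with hb | hb
    · exact slow_lims hz hρz hζ hb hB
    · have hb' : b = fun _ => 0 := funext hb
      rw [hb'] at hB ⊢
      simp only [zero_div] at hB ⊢
      exact ⟨hB, by simp⟩
  -- the functions η_k near 0
  obtain ⟨r0, hr0, M, hYM⟩ := hH.locBdd 0 (Set.mem_univ _)
  set E : ℕ → ℂ → ℂ := fun k ζ => η (z k + ρ k * ζ) / (ρ k * K (z k) * μ k) with hE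
  have hEd : ∀ k ζ, R < ‖z k + ρ k * ζ‖ → HasDerivAt (E k)
      (-(a (z k + ρ k * ζ) / (K (z k) * μ k)) -
        (deriv a (z k + ρ k * ζ) * ρ k / (K (z k) * μ k)) * rsc y (z k) (ρ k) ζ) ζ := by
    intro k ζ hζ
    have h1 : HasDerivAt (fun ζ : ℂ => z k + ρ k * ζ) (ρ k : ℂ) ζ := by
      simpa using ((hasDerivAt_id ζ).const_mul (ρ k : ℂ)).const_add (z k)
    have h2 := ((hη _ hζ).differentiableAt.hasDerivAt.comp ζ h1).div_const (ρ k * K (z k) * μ k)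
    refine h2.congr_deriv ?_
    rw [e1 _ hζ]
    simp only [rsc]
    have := hρ0 k
    field_simp
  have hEb : LocBdd 𝒰 E (ball 0 r0) := by
    have hder : ∀ᶠ k in (𝒰 : Filter ℕ), ∀ ζ ∈ ball (0:ℂ) r0, ‖rsc y (z k) (ρ k) ζ‖ ≤ M →
       ‖(-(a (z k + ρ k * ζ) / (K (z k) * μ k)) -
        (deriv a (z k + ρ k * ζ) * ρ k / (K (z k) * μ k)) * rsc y (z k) (ρ k) ζ)‖ ≤ (‖A‖ + 1) + 1 * |M| := by
      apply unif_of_seq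
      intro x hx
      obtain ⟨l1, l2⟩ := slow_lims hz hρz (ζ := x) (r := r0)
        (fun k => by have := hx k; rw [mem_ball_zero_iff] at this; exact this.le) ha hA'
      have l2' := l2.norm
      rw [norm_zero] at l2'
      filter_upwards [l1.norm.eventually_lt_const (show ‖A‖ < ‖A‖ + 1 by linarith),
        l2'.eventually_lt_const (show (0:ℝ) < 1 by norm_num)] with k h1 h2 h3
      refine (norm_sub_le _ _).trans ?_
      rw [norm_neg, norm_mul]
      have h4 : ‖rsc y (z k) (ρ k) (x k)‖ ≤ |M| := h3.trans (le_abs_self M)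
      gcongr
    have hC'' := hC'.norm.eventually_lt_const (show ‖C‖ < ‖C‖ + 1 by linarith)
    have fin : ∀ᶠ k in (𝒰 : Filter ℕ), DifferentiableOn ℂ (E k) (ball 0 r0) ∧
        ∀ w ∈ ball (0:ℂ) r0, ‖E k w‖ ≤ (‖C‖ + 1) + ((‖A‖ + 1) + 1 * |M|) * r0 := by
      filter_upwards [hder, hYM, hC'', large r0] with k h1 h2 h3 h4
      have h4' : ∀ w ∈ ball (0:ℂ) r0, R < ‖z k + ρ k * w‖ := fun w hw => h4 w (ball_subset_closedBall hw)
      refine ⟨fun w hw => (hEd k w (h4' w hw)).differentiableAt.differentiableWithinAt, fun w hw => ?_⟩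
      have h5 := (convex_ball (0:ℂ) r0).norm_image_sub_le_of_norm_hasDerivWithin_le (𝕜 := ℂ)
        (fun x hx => (hEd k x (h4' x hx)).hasDerivWithinAt)
        (fun x hx => h1 x hx (h2.2 x hx)) (mem_ball_self hr0) hw
      have h6 : E k 0 = η (z k) / (ρ k * K (z k) * μ k) := by simp [hE]
      have h7 : ‖E k w‖ ≤ ‖E k 0‖ + ‖E k w - E k 0‖ := norm_le_norm_add_norm_sub' _ _
      rw [← h6] at h3
      have h8 : ‖w - 0‖ ≤ r0 := by rw [sub_zero]; rw [mem_ball_zero_iff] at hw; exact hw.le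
      have h9 : ((‖A‖ + 1) + 1 * |M|) * ‖w - 0‖ ≤ ((‖A‖ + 1) + 1 * |M|) * r0 := by gcongr
      linarith
    intro ζ hζ
    obtain ⟨r', hr', hs'⟩ := Metric.isOpen_iff.1 isOpen_ball ζ hζ
    refine ⟨r', hr', (‖C‖ + 1) + ((‖A‖ + 1) + 1 * |M|) * r0, ?_⟩
    filter_upwards [fin] with k hk
    exact ⟨hk.1.mono hs', fun w hw => hk.2 w (hs' hw)⟩
  obtain ⟨G, hG⟩ := hEb.exists_lim
  have hG0 : G 0 = C := by
    have h1 := hG.tendsto (mem_ball_self hr0)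
    refine tendsto_nhds_unique h1 (hC'.congr fun k => ?_)
    simp [hE]
  have hGd : ∀ w ∈ ball (0:ℂ) r0, deriv G w = -A := by
    intro w hw
    obtain ⟨l1, l2⟩ := slow_lims hz hρz (ζ := fun _ => w) (r := ‖w‖) (fun k => le_rfl) ha hA'
    have h1 := hG.derivs.tendsto hw
    have h2 := l1.neg.sub (l2.mul (hH.tendsto (Set.mem_univ w)))
    rw [zero_mul, sub_zero] at h2
    refine tendsto_nhds_unique h1 (h2.congr' ?_)
    filter_upwards [large ‖w‖] with k hk
    exact (hEd k w (hk w (by simp))).deriv.symm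
  have hGe : ∀ w ∈ ball (0:ℂ) r0, G w = C - A * w := by
    have h1 : ∀ w ∈ ball (0:ℂ) r0, HasDerivAt (fun z => G z + A * z) 0 w := by
      intro w hw
      have h2 := ((hG.differentiableOn w hw).differentiableAt.hasDerivAt).add
        ((hasDerivAt_id w).const_mul A)
      refine HasDerivAt.congr_deriv (f := fun z => G z + A * z) h2 ?_
      rw [hGd w hw]; simp
    intro w hw
    have := const_ball h1 w hw
    simp only [mul_zero, add_zero, hG0] at this
    linear_combination this
  -- the limiting equation
  have hode : ∀ᶠ w in 𝓝 (0:ℂ), (-A - B * deriv H w) * (1 - deriv H w)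
      + (C - A * w - B * H w) * deriv (deriv H) w = -B * (1 - deriv H w)^2 := by
    filter_upwards [isOpen_ball.eventually_mem (mem_ball_self hr0)] with w hw
    have hw' : ∀ k : ℕ, ‖(fun _ : ℕ => w) k‖ ≤ ‖w‖ := fun k => le_rfl
    obtain ⟨l1, l2⟩ := slow_lims hz hρz (ζ := fun _ => w) hw' ha hA'
    obtain ⟨l3, l4⟩ := bl (fun _ => w) _ hw'
    obtain ⟨l5, l6⟩ := slow_lims hz hρz (ζ := fun _ => w) hw' hK hKK
    have hl1 := hH.tendsto (Set.mem_univ w)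
    have hl2 := hH.derivs.tendsto (Set.mem_univ w)
    have hl3 := hH.derivs.derivs.tendsto (Set.mem_univ w)
    have hg := hG.tendsto hw
    rw [hGe w hw] at hg
    have l7 := l5.inv₀ one_ne_zero
    rw [inv_one] at l7
    have L := (((((l1.neg.sub (l2.mul hl1)).mul l7).sub ((hg.mul l7).mul (l6.mul l7))).sub
      (l4.mul hl1)).sub (l3.mul hl2)).mul (hl2.const_sub 1) |>.add
        (((hg.mul l7).sub (l3.mul hl1)).mul hl3)
    have Rr := ((l3.neg).mul ((hl2.const_sub 1).pow 2)).sub ((l4.mul hl1).mul (hl2.const_sub 1))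
    have key := tendsto_nhds_unique (L.congr' ?_) Rr
    · linear_combination key
    · filter_upwards [large ‖w‖, hKz0, hμ0'] with k h1 h2 h3
      have h4 := h1 w (by simp)
      have h5 := e2 _ h4
      have h6 := hK0 _ h4
      have h7 := hρ0 k
      rw [e1 _ h4] at h5
      simp only [rsc_deriv (hZ.hρ k), rsc_deriv2 (hZ.hρ k), rsc, hE]
      generalize z k + ρ k * w = W at *
      field_simp
      field_simp at h5
      linear_combination h5
  obtain ⟨c, hc⟩ := ode_F hHd hne hode
  have hq := quad_of_deriv2 hHd hc
  have hn : 2 ≤ ‖deriv H 0‖ := by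
    have h1 := (hH.derivs.tendsto (Set.mem_univ 0)).norm
    refine ge_of_tendsto h1 ?_
    filter_upwards [hH.eventually_analyticAt (Set.mem_univ 0)] with k hk
    rw [hZ.h0 k hk]
    have := sq_nonneg ‖rsc y (z k) (ρ k) 0‖
    linarith
  refine quad_contra (p0 := H 0) (p1 := deriv H 0) (p2 := c/2) hZ.hU
    (hH.congr isOpen_univ (fun w _ => hq w)) hn ?_
  intro x x0 hx
  obtain ⟨r1, hr1⟩ : ∃ r1, r1 = ‖x0‖ + 1 := ⟨_, rfl⟩
  filter_upwards [large r1, hx.norm.eventually_lt_const (show ‖x0‖ < r1 by linarith)] with k h1 h2 h3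
  rw [rsc_deriv (hZ.hρ k)]
  apply hs _ (h1 _ (by simpa using h2.le))
  simp only [rsc] at h3
  exact (div_eq_zero_iff.1 h3).resolve_right (hρ0 k)

lemma annulus_max {h : ℂ → ℂ} {R r1 r2 M : ℝ} (hh : ∀ z, R < ‖z‖ → AnalyticAt ℂ h z) (hr1 : R < r1)
    (hb1 : ∀ z, ‖z‖ = r1 → ‖h z‖ ≤ M) (hb2 : ∀ z, ‖z‖ = r2 → ‖h z‖ ≤ M) :
    ∀ z, r1 ≤ ‖z‖ → ‖z‖ ≤ r2 → ‖h z‖ ≤ M := by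
  intro z hz1 hz2
  set U : Set ℂ := {z | r1 < ‖z‖ ∧ ‖z‖ < r2} with hU
  have hcl : closure U ⊆ {z | r1 ≤ ‖z‖ ∧ ‖z‖ ≤ r2} := by
    apply closure_minimal
    · intro w hw; exact ⟨hw.1.le, hw.2.le⟩
    · exact (isClosed_le continuous_const continuous_norm).inter
        (isClosed_le continuous_norm continuous_const)
  have hUo : IsOpen U := (isOpen_lt continuous_const continuous_norm).inter
        (isOpen_lt continuous_norm continuous_const)
  rcases hz1.eq_or_lt with h | h
  · exact hb1 z h.symm
  rcases hz2.eq_or_lt with h' | h'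
  · exact hb2 z h'
  refine Complex.norm_le_of_forall_mem_frontier_norm_le (U := U) ?_ ?_ ?_ (subset_closure ⟨h, h'⟩)
  · exact (isBounded_ball (x := (0:ℂ)) (r := r2)).subset (fun w hw => by simpa using hw.2)
  · apply DifferentiableOn.diffContOnCl
    intro w hw
    exact (hh w (hr1.trans_le (hcl hw).1)).differentiableAt.differentiableWithinAt
  · intro w hw
    rw [hUo.frontier_eq] at hw
    have h1 := hcl hw.1
    by_cases h2 : ‖w‖ = r1
    · exact hb1 w h2
    · by_cases h3 : ‖w‖ = r2
      · exact hb2 w h3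
      · exact absurd ⟨lt_of_le_of_ne h1.1 (Ne.symm h2), lt_of_le_of_ne h1.2 h3⟩ hw.2

lemma circles_bound {h : ℂ → ℂ} {R M : ℝ} (hR : 0 ≤ R) (hh : ∀ z, R < ‖z‖ → AnalyticAt ℂ h z)
    (hc : ∀ r0 : ℝ, ∃ r, r0 < r ∧ ∀ z, ‖z‖ = r → ‖h z‖ ≤ M) :
    ∃ M', ∀ z, R + 1 < ‖z‖ → ‖h z‖ ≤ M' := by
  have hcont : ContinuousOn h (sphere 0 (R+1)) := by
    intro w hw
    rw [mem_sphere_zero_iff_norm] at hw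
    exact (hh w (by linarith)).continuousAt.continuousWithinAt
  obtain ⟨M1, hM1⟩ := (isCompact_sphere (0:ℂ) (R+1)).exists_bound_of_continuousOn hcont
  refine ⟨max M M1, fun z hz => ?_⟩
  obtain ⟨r, hr, hr2⟩ := hc ‖z‖
  refine annulus_max (r1 := R + 1) (r2 := r) hh (by linarith) ?_ ?_ z hz.le hr.le
  · intro w hw; exact (hM1 w (by simpa using hw)).trans (le_max_right _ _)
  · intro w hw; exact (hr2 w hw).trans (le_max_left _ _)

lemma preconn_star : IsPreconnected ({0}ᶜ : Set ℂ) :=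
  (isConnected_compl_singleton_of_one_lt_rank (by
    rw [Complex.rank_real_complex]; norm_num) 0).isPreconnected

lemma star_charts {𝒰 : Ultrafilter ℕ} {y : ℂ → ℂ} {C R : ℝ} {t : ℕ → ℝ} (ht : ∀ k, 0 < t k)
    (htt : Tendsto t 𝒰 atTop) (hm : ∀ z, R < ‖z‖ → MartyAt y (C / ‖z‖^2) z) :
    Charts 𝒰 (fun k => rsc y 0 (t k)) ({0}ᶜ : Set ℂ) := by
  apply charts_of_MB isOpen_compl_singleton
  intro ζ hζ
  have hζ0 : 0 < ‖ζ‖ := norm_pos_iff.2 hζ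
  refine ⟨2 * (1 + 4 * |C| / ‖ζ‖^2), by positivity, ‖ζ‖/2, by linarith, ?_⟩
  filter_upwards [htt.eventually_gt_atTop (2 * |R| / ‖ζ‖)] with k hk w hw
  have hwn : ‖ζ‖/2 < ‖w‖ := by
    rw [mem_ball_iff_norm] at hw
    have := norm_le_norm_add_norm_sub' ζ w
    rw [norm_sub_rev] at hw
    linarith
  have hw0 : 0 < ‖w‖ := by linarith
  have htk := ht k
  have hn : ‖(0:ℂ) + t k * w‖ = t k * ‖w‖ := by
    rw [zero_add, norm_mul, Complex.norm_real, Real.norm_eq_abs, abs_of_pos htk]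
  apply MartyAt.mb (by positivity)
  apply rsc_marty htk
  have h1 : R < ‖(0:ℂ) + t k * w‖ := by
    rw [hn]
    rw [div_lt_iff₀ hζ0] at hk
    have : t k * (‖ζ‖/2) < t k * ‖w‖ := by gcongr
    have := le_abs_self R
    linarith
  refine (hm _ h1).mono ?_
  rw [hn, mul_pow, div_le_div_iff₀ (by positivity) (by positivity)]
  have h2 : 4 * |C| / ‖ζ‖ ^ 2 * (t k ^ 2 * ‖w‖ ^ 2) = (|C| * t k ^ 2) * (4 * ‖w‖^2 / ‖ζ‖^2) := by
    field_simp
  rw [h2]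
  have h3 : 1 ≤ 4 * ‖w‖^2 / ‖ζ‖^2 := by
    rw [le_div_iff₀ (by positivity)]; nlinarith
  have h4 : C * t k ^ 2 ≤ |C| * t k ^ 2 := by gcongr; exact le_abs_self C
  have h5 : 0 ≤ |C| * t k ^ 2 := by positivity
  nlinarith

lemma unit_lim (𝒰 : Ultrafilter ℕ) {z : ℕ → ℂ} (hz : ∀ k, z k ≠ 0) :
    ∃ ζ : ℂ, ζ ≠ 0 ∧ Tendsto (fun k => z k / ‖z k‖) 𝒰 (𝓝 ζ) := by
  have hn : ∀ k, ‖z k / ‖z k‖‖ = 1 := fun k => by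
    rw [norm_div, Complex.norm_real, norm_norm, div_self (norm_ne_zero_iff.2 (hz k))]
  obtain ⟨ζ, _, h⟩ := ultra_lim_of_bdd 𝒰 (fun k => z k / ‖z k‖) 1 (Eventually.of_forall fun k => (hn k).le)
  refine ⟨ζ, ?_, h⟩
  rintro rfl
  have := h.norm
  simp only [hn, norm_zero] at this
  have := tendsto_nhds_unique this tendsto_const_nhds
  norm_num at this

lemma tF2 {y : ℂ → ℂ} {C R : ℝ} (hR : 0 < R) (hy : ∀ z, R < ‖z‖ → AnalyticAt ℂ y z)
    (hm : ∀ z, R < ‖z‖ → MartyAt y (C / ‖z‖^2) z) :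
    ∃ M R' : ℝ, (∀ z, R' < ‖z‖ → ‖y z‖ ≤ M * ‖z‖) ∨ (∀ z, R' < ‖z‖ → 1 ≤ ‖y z‖) := by
  by_cases hc : ∃ R' : ℝ, ∀ z, R' < ‖z‖ → 1 * ‖z‖ < ‖y z‖
  · obtain ⟨R', h⟩ := hc
    refine ⟨0, max R' 1, Or.inr fun z hz => ?_⟩
    have h1 := h z ((le_max_left _ _).trans_lt hz)
    have h2 := (le_max_right R' 1).trans_lt hz
    linarith
  push Not at hc
  choose z hz hzy using fun k : ℕ => hc (max R 0 + k)
  set 𝒰 : Ultrafilter ℕ := hyperfilter ℕ with h𝒰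
  have hU : (𝒰 : Filter ℕ) ≤ atTop := by
    rw [← Nat.cofinite_eq_atTop]; exact hyperfilter_le_cofinite
  have hzn : ∀ k : ℕ, (k:ℝ) < ‖z k‖ := fun k => by
    have := hz k; have := le_max_right R 0; linarith
  have htt : Tendsto (fun k => ‖z k‖) 𝒰 atTop :=
    (tendsto_atTop_mono (fun k => (hzn k).le) tendsto_natCast_atTop_atTop).mono_left hU
  have ht : ∀ k, 0 < ‖z k‖ := fun k => lt_of_le_of_lt (Nat.cast_nonneg k) (hzn k)
  have hch := star_charts ht htt hm
  obtain ⟨ζ0, hζ0, hlim⟩ := unit_lim 𝒰 (fun k => norm_pos_iff.1 (ht k))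
  have han : ∀ ζ ∈ ({0}ᶜ : Set ℂ), ∃ r > 0, ∀ᶠ k in (𝒰 : Filter ℕ), ∀ w ∈ ball ζ r,
      AnalyticAt ℂ (rsc y 0 ‖z k‖) w := by
    intro ζ hζ
    have hζ0 : 0 < ‖ζ‖ := norm_pos_iff.2 hζ
    refine ⟨‖ζ‖/2, by linarith, ?_⟩
    filter_upwards [htt.eventually_gt_atTop (2 * R / ‖ζ‖)] with k hk w hw
    have hwn : ‖ζ‖/2 < ‖w‖ := by
      rw [mem_ball_iff_norm] at hw
      have := norm_le_norm_add_norm_sub' ζ w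
      rw [norm_sub_rev] at hw
      linarith
    rw [rsc_analytic (ht k)]
    apply hy
    rw [zero_add, norm_mul, Complex.norm_real, norm_norm]
    rw [div_lt_iff₀ hζ0] at hk
    have : ‖z k‖ * (‖ζ‖/2) < ‖z k‖ * ‖w‖ := by have := ht k; gcongr
    linarith
  have hval : ∀ k, ‖rsc y 0 ‖z k‖ (z k / ‖z k‖)‖ ≤ 1 := by
    intro k
    have h0 : (‖z k‖ : ℂ) ≠ 0 := by exact_mod_cast (ht k).ne'
    simp only [rsc, zero_add]
    rw [mul_div_cancel₀ _ h0, norm_div, Complex.norm_real, norm_norm, div_le_one (ht k)]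
    linarith [hzy k]
  have hbase : ∃ ζ ∈ ({0}ᶜ : Set ℂ), ∃ r > 0, ∃ H, LimOn 𝒰 (fun k => rsc y 0 ‖z k‖) H (ball ζ r) := by
    refine ⟨ζ0, hζ0, ?_⟩
    obtain ⟨r, hr, hrU, hc⟩ := hch ζ0 hζ0
    rcases hc with hc | hc
    · obtain ⟨H, hH⟩ := hc.exists_lim
      exact ⟨r, hr, H, hH⟩
    · obtain ⟨P, hP⟩ := hc.exists_lim
      have hP0 : P ζ0 ≠ 0 := by
        intro h0
        have h1 := (hP.tendsto_seq (mem_ball_self hr) hlim).norm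
        rw [h0, norm_zero] at h1
        have h2 := h1.eventually_lt_const (show (0:ℝ) < 1 by norm_num)
        obtain ⟨r2, hr2, ha⟩ := han ζ0 hζ0
        have t3 : ∀ᶠ k in (𝒰 : Filter ℕ), False := by
          filter_upwards [h2, ha, hc, hlim.eventually (ball_mem_nhds ζ0 hr2),
            hlim.eventually (ball_mem_nhds ζ0 hr)] with k h1 h2 h3 h4 h5
          have h6 : rsc y 0 ‖z k‖ (z k / ‖z k‖) ≠ 0 := fun h => (h3 _ h5).2.2 h (h2 _ h4)
          rw [norm_inv, inv_lt_one₀ (norm_pos_iff.2 h6)] at h1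
          linarith [hval k]
        exact t3.exists.elim (fun _ h => h)
      obtain ⟨s, hs, h1, h2⟩ := lim_of_inv hP (mem_ball_self hr) hP0
      refine ⟨s, hs, fun w => (P w)⁻¹, ?_⟩
      intro x hx
      obtain ⟨s', hs', hss⟩ := Metric.isOpen_iff.1 isOpen_ball x hx
      exact ⟨s', hs', by filter_upwards [h1] with k hk using hk.mono hss, h2.mono hss⟩
  obtain ⟨H, hH⟩ := lim_univ_of_analytic hU preconn_star hch han hbase
  have hHc : ContinuousOn H (sphere 0 1) := by
    intro w hw
    refine (hH.differentiableOn w ?_).continuousAt.continuousWithinAt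
    rintro rfl; simp at hw
  obtain ⟨M1, hM1⟩ := (isCompact_sphere (0:ℂ) 1).exists_bound_of_continuousOn hHc
  have hunif : ∀ᶠ k in (𝒰 : Filter ℕ), ∀ x ∈ sphere (0:ℂ) 1, ‖rsc y 0 ‖z k‖ x‖ ≤ M1 + 1 := by
    apply unif_of_seq
    intro x hx
    have hx' : ∀ k, ‖x k‖ = 1 := fun k => by simpa using hx k
    have hx0 : ∀ k, x k ≠ 0 := fun k h => by have := hx' k; rw [h] at this; simp at this
    obtain ⟨l, hl0, hl⟩ := unit_lim 𝒰 hx0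
    simp only [hx', Complex.ofReal_one, div_one] at hl
    have hl1 : ‖l‖ = 1 := by
      refine tendsto_nhds_unique hl.norm ?_
      simp [hx']
    have h1 := (hH.tendsto_seq (ζ := l) hl0 hl).norm
    filter_upwards [h1.eventually_lt_const (show ‖H l‖ < M1 + 1 by
      have := hM1 l (by simpa using hl1); linarith)] with k hk using hk.le
  have hcirc : ∀ r0 : ℝ, ∃ r, r0 < r ∧ ∀ z, ‖z‖ = r → ‖y z / z‖ ≤ M1 + 1 := by
    intro r0
    obtain ⟨k, h1, h2⟩ := (hunif.and (htt.eventually_gt_atTop r0)).exists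
    refine ⟨‖z k‖, h2, fun w hw => ?_⟩
    have h0 : (‖z k‖ : ℂ) ≠ 0 := by exact_mod_cast (ht k).ne'
    have h3 := h1 (w / ‖z k‖) (by
      rw [mem_sphere_zero_iff_norm, norm_div, Complex.norm_real, norm_norm, hw, div_self (ht k).ne'])
    simp only [rsc, zero_add] at h3
    rw [mul_div_cancel₀ _ h0, norm_div, Complex.norm_real, norm_norm] at h3
    rw [norm_div, hw]; exact h3
  obtain ⟨M', hM'⟩ := circles_bound (h := fun z => y z / z) hR.le (fun z hz =>
    (hy z hz).div analyticAt_id (norm_pos_iff.1 (by linarith))) hcirc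
  refine ⟨M', R + 1, Or.inl fun z hz => ?_⟩
  have h1 := hM' z hz
  rw [norm_div, div_le_iff₀ (by linarith)] at h1
  exact h1

lemma ball_ext {F G : ℂ → ℂ} {c : ℂ} {r : ℝ} (hF : ∀ z ∈ ball c r, AnalyticAt ℂ F z)
    (hG : ∀ z ∈ ball c r, AnalyticAt ℂ G z) {x : ℂ} (hx : x ∈ ball c r) (h : F =ᶠ[𝓝 x] G) :
    ∀ z ∈ ball c r, F z = G z := fun z hz =>
  AnalyticOnNhd.eqOn_of_preconnected_of_eventuallyEq (U := ball c r) hF hG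
    (convex_ball c r).isPreconnected hx h hz

lemma affine_ball {H : ℂ → ℂ} {c p : ℂ} {r : ℝ} (hH : ∀ z ∈ ball c r, AnalyticAt ℂ H z)
    (h : ∀ z ∈ ball c r, deriv H z = p) : ∀ z ∈ ball c r, H z = (H c - p * c) + p * z := by
  have h1 : ∀ w ∈ ball c r, HasDerivAt (fun z => H z - p * z) 0 w := by
    intro w hw
    have h2 := ((hH w hw).differentiableAt.hasDerivAt).sub ((hasDerivAt_id w).const_mul p)
    refine HasDerivAt.congr_deriv (f := fun z => H z - p * z) h2 ?_
    rw [h w hw]; simp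
  intro z hz
  have := const_ball h1 z hz
  linear_combination this

lemma ode_M {H : ℂ → ℂ} {c : ℂ} {r : ℝ} (hr : 0 < r) (hH : ∀ z ∈ ball c r, AnalyticAt ℂ H z) {C B : ℂ}
    (hne : ¬ (C = 0 ∧ B = 0))
    (h : ∀ z ∈ ball c r, (C - B * H z) * deriv (deriv H) z
      = -(1 - deriv H z) * (B * (1 - 2 * deriv H z))) :
    (∃ p0 p1 : ℂ, ∀ z ∈ ball c r, H z = p0 + p1 * z) ∨
    (∃ ζ1 γ e : ℂ, γ ≠ 0 ∧ ∀ z ∈ ball c r, (z - ζ1) * H z = (z - ζ1)^2 / 2 + e * (z - ζ1) + γ) := by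
  have hH' : ∀ z ∈ ball c r, AnalyticAt ℂ (deriv H) z := fun z hz => (hH z hz).deriv
  by_cases hB : B = 0
  · left
    have hC : C ≠ 0 := fun h => hne ⟨h, hB⟩
    have h2 : ∀ z ∈ ball c r, deriv (deriv H) z = 0 := by
      intro z hz
      have := h z hz
      rw [hB] at this
      simpa [hC] using this
    have h3 := affine_ball hH' h2
    refine ⟨_, _, affine_ball hH (p := deriv H c) fun z hz => ?_⟩
    have := h3 z hz
    simpa using this
  by_cases hS : ∀ z ∈ ball c r, deriv H z = 1
  · exact Or.inl ⟨_, _, affine_ball hH hS⟩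
  push Not at hS
  obtain ⟨x, hx, hx1⟩ := hS
  set e := C / B with he
  have hSx : 1 - deriv H x ≠ 0 := sub_ne_zero.2 (Ne.symm hx1)
  obtain ⟨r1, hr1, hball⟩ := Metric.eventually_nhds_iff_ball.1
    (((continuousAt_const.sub (hH' x hx).continuousAt).eventually_ne hSx).and
      (isOpen_ball.eventually_mem hx))
  replace hball : ∀ y ∈ ball x r1, 1 - deriv H y ≠ 0 ∧ y ∈ ball c r := hball
  have hU : ∀ z ∈ ball c r, (H z - e) * deriv (deriv H) z = (1 - deriv H z) * (1 - 2 * deriv H z) := by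
    intro z hz
    have h1 := h z hz
    have h2 : B * ((H z - e) * deriv (deriv H) z) = B * ((1 - deriv H z) * (1 - 2 * deriv H z)) := by
      rw [he]; field_simp; linear_combination -h1
    exact mul_left_cancel₀ hB h2
  have hJ : ∀ w ∈ ball x r1, HasDerivAt (fun z => (H z - e) / (1 - deriv H z) - z) 0 w := by
    intro w hw
    obtain ⟨h1, h2⟩ := hball w hw
    have h3 := (((hH w h2).differentiableAt.hasDerivAt.sub_const e).div
      ((hH' w h2).differentiableAt.hasDerivAt.const_sub 1) h1).sub (hasDerivAt_id w)
    refine h3.congr_deriv ?_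
    have h4 := hU w h2
    field_simp
    linear_combination h4
  have hJc := const_ball hJ
  set ζ1 := -((H x - e) / (1 - deriv H x) - x) with hζ1
  have hJ2 : ∀ w ∈ ball x r1, H w - e = (w - ζ1) * (1 - deriv H w) := by
    intro w hw
    have h1 := hJc w hw
    obtain ⟨h2, _⟩ := hball w hw
    have h3 : (H w - e) / (1 - deriv H w) = w - ζ1 := by rw [hζ1]; linear_combination h1
    rw [← h3]; field_simp
  have hV : ∀ w ∈ ball x r1, HasDerivAt (fun z => (z - ζ1) * (H z - e) - (z - ζ1)^2 / 2) 0 w := by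
    intro w hw
    obtain ⟨h1, h2⟩ := hball w hw
    have h3 := (((hasDerivAt_id w).sub_const ζ1).mul ((hH w h2).differentiableAt.hasDerivAt.sub_const e)).sub
      ((((hasDerivAt_id w).sub_const ζ1).pow 2).div_const 2)
    refine h3.congr_deriv ?_
    simp only [id, Pi.pow_apply]
    push_cast
    linear_combination hJ2 w hw
  have hVc := const_ball hV
  set γ := (x - ζ1) * (H x - e) - (x - ζ1)^2 / 2 with hγ
  have rel : ∀ z ∈ ball c r, (z - ζ1) * H z = (z - ζ1)^2 / 2 + e * (z - ζ1) + γ := by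
    refine ball_ext (F := fun z => (z - ζ1) * H z) (G := fun z => (z - ζ1)^2 / 2 + e * (z - ζ1) + γ)
      (fun z hz => ?_) (fun z hz => ?_) hx ?_
    · exact (analyticAt_id.sub analyticAt_const).mul (hH z hz)
    · fun_prop
    · filter_upwards [isOpen_ball.eventually_mem (mem_ball_self hr1)] with w hw
      have := hVc w hw
      linear_combination this
  by_cases hγ0 : γ = 0
  · left
    refine ⟨-ζ1/2 + e, 1/2, ?_⟩
    -- pick a point different from ζ1
    obtain ⟨x', hx', hxne⟩ : ∃ x' ∈ ball c r, x' ≠ ζ1 := by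
      by_cases hc : c = ζ1
      · refine ⟨c + (r/2 : ℝ), ?_, ?_⟩
        · rw [mem_ball_iff_norm, add_sub_cancel_left, Complex.norm_real, Real.norm_eq_abs,
            abs_of_pos (by linarith)]; linarith
        · rw [hc]; intro h
          have h2 : ((r/2 : ℝ) : ℂ) = 0 := by linear_combination h
          have h3 : r / 2 = 0 := by exact_mod_cast h2
          linarith
      · exact ⟨c, mem_ball_self hr, hc⟩
    refine ball_ext (F := H) (G := fun z => -ζ1/2 + e + 1/2 * z) hH (fun z hz => by fun_prop) hx' ?_
    filter_upwards [isOpen_ball.eventually_mem hx', isOpen_ne.eventually_mem hxne] with w hw1 hw2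
    have h1 := rel w hw1
    rw [hγ0] at h1
    have h2 : w - ζ1 ≠ 0 := sub_ne_zero.2 hw2
    apply mul_left_cancel₀ h2
    linear_combination h1
  · exact Or.inr ⟨ζ1, γ, e, hγ0, rel⟩

/-- allowed slopes in case M -/
def SlM (σ : ℂ) : Prop := ∃ n : ℕ, 2 ≤ n ∧ σ = -1 / n

lemma SlM.slF {σ : ℂ} (h : SlM σ) : SlF σ := Or.inr h

lemma SlM.ratio {σ τ : ℂ} (h : SlM σ) (h' : SlM τ) : 1 ≤ ‖σ / τ + 1‖ := by
  obtain ⟨n, hn, h⟩ := h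
  obtain ⟨p, hp, h'⟩ := h'
  have hn0 : (n:ℂ) ≠ 0 := by exact_mod_cast (by omega : n ≠ 0)
  have hp0 : (p:ℂ) ≠ 0 := by exact_mod_cast (by omega : p ≠ 0)
  have e : σ / τ + 1 = ((p / n + 1 : ℝ) : ℂ) := by
    rw [h, h']; push_cast; field_simp
  have : (0:ℝ) ≤ p / n := by positivity
  rw [e, Complex.norm_real, Real.norm_eq_abs, abs_of_nonneg (by linarith)]; linarith

lemma SlM.inv_sum {σ τ : ℂ} (h : SlM σ) (h' : SlM τ) : 1 ≤ ‖σ⁻¹ + τ⁻¹ - 2‖ := by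
  obtain ⟨n, hn, h⟩ := h
  obtain ⟨p, hp, h'⟩ := h'
  have hn0 : (n:ℂ) ≠ 0 := by exact_mod_cast (by omega : n ≠ 0)
  have hp0 : (p:ℂ) ≠ 0 := by exact_mod_cast (by omega : p ≠ 0)
  have e : σ⁻¹ + τ⁻¹ - 2 = ((-(n + p + 2) : ℝ) : ℂ) := by
    rw [h, h']; push_cast; field_simp; ring
  have h1 : (0:ℝ) ≤ n := by positivity
  have h2 : (0:ℝ) ≤ p := by positivity
  rw [e, Complex.norm_real, Real.norm_eq_abs, abs_neg, abs_of_nonneg (by linarith)]; linarith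

lemma pole_contra {𝒰 : Ultrafilter ℕ} (hU : (𝒰 : Filter ℕ) ≤ atTop) {Y : ℕ → ℂ → ℂ} {ζ1 γ e : ℂ}
    (hγ : γ ≠ 0)
    (hl : LimOn 𝒰 Y (fun z => ((z - ζ1)^2 / 2 + e * (z - ζ1) + γ) / (z - ζ1)) {z | z ≠ ζ1})
    (hs : ∀ x : ℕ → ℂ, ∀ x0 : ℂ, x0 ≠ ζ1 → Tendsto x 𝒰 (𝓝 x0) → ∀ᶠ k in (𝒰 : Filter ℕ), Y k (x k) = 0 →
      SlM (deriv (Y k) (x k))) : False := by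
  have fin : ¬ ∀ᶠ k in (𝒰 : Filter ℕ), False := by
    intro h; exact h.exists.elim (fun _ h => h)
  obtain ⟨d, hd⟩ := IsAlgClosed.exists_pow_nat_eq (e^2 - 2 * γ) (n := 2) (by norm_num)
  set v1 := -e + d
  set v2 := -e - d
  have hv : v1 * v2 = 2 * γ := by simp only [v1, v2]; linear_combination -hd
  have hv1 : v1 ≠ 0 := by
    intro h; rw [h, zero_mul] at hv; exact hγ (by simpa using hv.symm)
  have hv2 : v2 ≠ 0 := by
    intro h; rw [h, mul_zero] at hv; exact hγ (by simpa using hv.symm)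
  have n1 : ζ1 + v1 ≠ ζ1 := by simpa using hv1
  have n2 : ζ1 + v2 ≠ ζ1 := by simpa using hv2
  obtain ⟨x, x', f, f', hx, hx', hf, hf', hk⟩ := hl.two_zeros hU isOpen_ne (ρ₁ := ζ1 + v1) (ρ₂ := ζ1 + v2)
    (E := fun w => 1 / (2 * (w - ζ1))) n1 n2 (by
      intro w hw
      have : w - ζ1 ≠ 0 := sub_ne_zero.2 hw
      apply ContinuousAt.div continuousAt_const (by fun_prop)
      simpa using this) (by
      intro w hw
      have : w - ζ1 ≠ 0 := sub_ne_zero.2 hw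
      field_simp
      simp only [v1, v2]
      linear_combination hd) (by simpa using hv1) (by simpa using hv2)
  simp only [add_sub_cancel_left] at hf hf'
  by_cases hvv : v1 = v2
  · rw [← hvv] at hf'
    have hne : 1 / (2 * v1) ≠ 0 := by simpa using hv1
    have t := (hf.div hf' hne).neg
    rw [div_self hne] at t
    have t2 := (t.add_const 1).norm
    simp only [neg_add_cancel, norm_zero] at t2
    have t3 := t2.eventually_lt_const (show (0:ℝ) < 1 by norm_num)
    apply fin
    filter_upwards [t3, hk, hs x _ n1 hx, hs x' _ n2 hx'] with k h1 h2 h3 h4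
    obtain ⟨a1, a2, a3, a4⟩ := h2
    have s1 := h3 a1
    have s2 := h4 a2
    have h5 := s1.ratio s2
    have hne := s2.slF.ne
    rw [a3, a4] at h5
    rw [a4] at hne
    have hz : x' k - x k ≠ 0 := left_ne_zero_of_mul hne
    have he0 : f' k ≠ 0 := right_ne_zero_of_mul hne
    have e1 : (x k - x' k) * f k / ((x' k - x k) * f' k) = -(f k / f' k) := by
      field_simp; ring
    rw [e1] at h5
    simp only [Pi.div_apply] at h1
    linarith
  · have hd12 : v1 - v2 ≠ 0 := sub_ne_zero.2 hvv
    have hd21 : v2 - v1 ≠ 0 := sub_ne_zero.2 (Ne.symm hvv)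
    have t1 := ((hx.sub hx').mul hf).inv₀ (by
      rw [add_sub_add_left_eq_sub]; exact mul_ne_zero hd12 (by simpa using hv1))
    have t2 := ((hx'.sub hx).mul hf').inv₀ (by
      rw [add_sub_add_left_eq_sub]; exact mul_ne_zero hd21 (by simpa using hv2))
    have t3 := ((t1.add t2).sub_const 2).norm
    have e0 : ((ζ1 + v1 - (ζ1 + v2)) * (1 / (2 * v1)))⁻¹ + ((ζ1 + v2 - (ζ1 + v1)) * (1 / (2 * v2)))⁻¹ - 2 = 0 := by
      rw [add_sub_add_left_eq_sub, add_sub_add_left_eq_sub]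
      have : v2 - v1 = -(v1 - v2) := by ring
      rw [this]
      field_simp
      ring
    rw [e0, norm_zero] at t3
    apply fin
    filter_upwards [t3.eventually_lt_const (show (0:ℝ) < 1 by norm_num), hk, hs x _ n1 hx,
      hs x' _ n2 hx'] with k h1 h2 h3 h4
    obtain ⟨a1, a2, a3, a4⟩ := h2
    have h5 := (h3 a1).inv_sum (h4 a2)
    rw [a3, a4] at h5
    linarith

lemma tM1 {y ℓ b : ℂ → ℂ} {R : ℝ} (hR : 0 < R)
    (hy : ∀ z, R < ‖z‖ → Mer y z)
    (hℓ : Slow ℓ) (hb : Slow b ∨ ∀ z, b z = 0)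
    (e2 : ∀ z, R < ‖z‖ → AnalyticAt ℂ y z → (ℓ z - b z * y z) * deriv (deriv y) z
      = - (1 - deriv y z) * (deriv ℓ z + b z * (1 - 2 * deriv y z)))
    (hs : ∀ z, R < ‖z‖ → AnalyticAt ℂ y z → y z = 0 → SlM (deriv y z)) :
    ∃ C R' : ℝ, ∀ z, R' < ‖z‖ → MartyAt y (C / ‖z‖ ^ 2) z := by
  by_contra hneg
  obtain ⟨𝒰, z, ρ, hZ⟩ := zalcman hR hy
    (fun z hz han h0 => lt_of_le_of_lt (hs z hz han h0).slF.norm_le (by norm_num)) hneg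
  have hz := hZ.hz
  have hρz := hZ.hρz
  have hρ0 : ∀ k, (ρ k : ℂ) ≠ 0 := fun k => by exact_mod_cast (hZ.hρ k).ne'
  have large : ∀ r : ℝ, ∀ᶠ k in (𝒰 : Filter ℕ), ∀ ζ ∈ closedBall (0:ℂ) r, R < ‖z k + ρ k * ζ‖ := by
    intro r
    apply unif_of_seq
    intro x hx
    have := (mv_seq hz hρz (ζ := x) (r := r) (fun k => by simpa using hx k)).1
    rw [← tendsto_norm_atTop_iff_cobounded] at this
    exact this.eventually_gt_atTop R
  obtain ⟨ζb, rb, hrb, H, hH⟩ := hZ.base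
  have hℓ0 : ∀ᶠ k in (𝒰 : Filter ℕ), ℓ (z k) ≠ 0 := by
    obtain ⟨d, c, hc, _, _, h⟩ := hℓ
    filter_upwards [hz.eventually h] with k hk using hk.2
  set μ : ℕ → ℝ := fun k => ‖ℓ (z k) / ρ k‖ + ‖b (z k)‖ with hμ
  have hμ0 : ∀ᶠ k in (𝒰 : Filter ℕ), 0 < μ k := by
    filter_upwards [hℓ0] with k h1
    have := norm_pos_iff.2 (div_ne_zero h1 (hρ0 k))
    have h4 := norm_nonneg (b (z k))
    simp only [hμ]; linarith
  have hμ0' : ∀ᶠ k in (𝒰 : Filter ℕ), (μ k : ℂ) ≠ 0 := by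
    filter_upwards [hμ0] with k hk
    exact_mod_cast hk.ne'
  have bd : ∀ v : ℕ → ℂ, (∀ k, ‖v k‖ ≤ μ k) → ∃ l : ℂ, Tendsto (fun k => v k / μ k) 𝒰 (𝓝 l) := by
    intro v hv
    obtain ⟨l, _, hl⟩ := ultra_lim_of_bdd 𝒰 (fun k => v k / μ k) 1 (by
      filter_upwards [hμ0] with k hk
      rw [norm_div, Complex.norm_real, Real.norm_eq_abs, abs_of_pos hk, div_le_one hk]; exact hv k)
    exact ⟨l, hl⟩
  obtain ⟨C, hC⟩ := bd (fun k => ℓ (z k) / ρ k) (fun k => by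
    have h4 := norm_nonneg (b (z k))
    simp only [hμ]; linarith)
  obtain ⟨B, hB⟩ := bd (fun k => b (z k)) (fun k => by
    have h3 := norm_nonneg (ℓ (z k) / ρ k)
    simp only [hμ]; linarith)
  have hne : ¬ (C = 0 ∧ B = 0) := by
    rintro ⟨rfl, rfl⟩
    have h := hC.norm.add hB.norm
    simp only [norm_zero, add_zero] at h
    have h1 : Tendsto (fun _ : ℕ => (1:ℝ)) 𝒰 (𝓝 0) := by
      refine h.congr' ?_
      filter_upwards [hμ0] with k hk
      simp only [norm_div, Complex.norm_real, Real.norm_eq_abs, abs_of_pos hk]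
      rw [← add_div]
      rw [div_eq_one_iff_eq hk.ne']
      simp only [hμ, norm_div, Complex.norm_real, Real.norm_eq_abs]
    have := tendsto_nhds_unique h1 tendsto_const_nhds
    norm_num at this
  have hC' : Tendsto (fun k => ℓ (z k) / (ρ k * μ k)) 𝒰 (𝓝 C) :=
    hC.congr fun k => by rw [div_div]
  have bl : ∀ (ζ : ℕ → ℂ) (r : ℝ), (∀ k, ‖ζ k‖ ≤ r) →
      Tendsto (fun k => b (z k + ρ k * ζ k) / μ k) 𝒰 (𝓝 B) := by
    intro ζ r hζ
    rcases hb with hb | hb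
    · exact (slow_lims hz hρz hζ hb hB).1
    · have hb' : b = fun _ => 0 := funext hb
      rw [hb'] at hB ⊢
      simpa using hB
  have hode : ∀ w ∈ ball ζb rb, (C - B * H w) * deriv (deriv H) w
      = -(1 - deriv H w) * (B * (1 - 2 * deriv H w)) := by
    intro w hw
    have hw' : ∀ k : ℕ, ‖(fun _ : ℕ => w) k‖ ≤ ‖w‖ := fun k => le_rfl
    obtain ⟨l1, l2⟩ := slow_lims hz hρz (ζ := fun _ => w) hw' hℓ hC'
    have l3 := bl (fun _ => w) _ hw'
    have hl1 := hH.tendsto hw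
    have hl2 := hH.derivs.tendsto hw
    have hl3 := hH.derivs.derivs.tendsto hw
    have L := (l1.sub (l3.mul hl1)).mul hl3
    have Rr := (hl2.const_sub 1).neg.mul (l2.add (l3.mul ((hl2.const_mul 2).const_sub 1)))
    have key := tendsto_nhds_unique (L.congr' ?_) Rr
    · linear_combination key
    · filter_upwards [large ‖w‖, hμ0', hH.eventually_analyticAt hw] with k h1 h3 h8
      have h4 := h1 w (by simp)
      rw [rsc_analytic (hZ.hρ k)] at h8
      have h5 := e2 _ h4 h8
      have h7 := hρ0 k
      simp only [rsc_deriv (hZ.hρ k), rsc_deriv2 (hZ.hρ k), rsc]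
      generalize z k + ρ k * w = W at *
      field_simp
      linear_combination h5
  have slopes : ∀ x : ℕ → ℂ, ∀ x0 : ℂ, (∃ r > 0, ∃ G, LimOn 𝒰 (fun k => rsc y (z k) (ρ k)) G (ball x0 r)) →
      Tendsto x 𝒰 (𝓝 x0) → ∀ᶠ k in (𝒰 : Filter ℕ), rsc y (z k) (ρ k) (x k) = 0 →
      SlM (deriv (rsc y (z k) (ρ k)) (x k)) := by
    rintro x x0 ⟨r, hr, G, hG⟩ hx
    obtain ⟨r', hr', hd, _⟩ := hG x0 (mem_ball_self hr)
    filter_upwards [large (‖x0‖ + 1), hx.norm.eventually_lt_const (show ‖x0‖ < ‖x0‖ + 1 by linarith), hd,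
      hx.eventually (ball_mem_nhds x0 hr')] with k h1 h2 h3 h4 h5
    have han := h3.analyticAt (isOpen_ball.mem_nhds h4)
    rw [rsc_analytic (hZ.hρ k)] at han
    rw [rsc_deriv (hZ.hρ k)]
    apply hs _ (h1 _ (by simpa using h2.le)) han
    simp only [rsc] at h5
    exact (div_eq_zero_iff.1 h5).resolve_right (hρ0 k)
  rcases ode_M hrb hH.differentiableOn hne hode with ⟨p0, p1, hp⟩ | ⟨ζ1, γ, e, hγ, hrel⟩
  · have hg : GRel 𝒰 (fun k => rsc y (z k) (ρ k)) (fun z => p0 + p1 * z + 0 * z^2) (fun _ => 1) ζb :=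
      ⟨rb, hrb, Or.inl ⟨H, hH, fun w hw => by rw [hp w hw]; ring⟩⟩
    have hall := rel_propagate isPreconnected_univ hZ.charts (fun z => by fun_prop)
      (fun z => by fun_prop) (Set.mem_univ ζb) hg
    have hlim := rel_limOn (fun z => by fun_prop) hall
    simp only [Set.mem_univ, ne_eq, one_ne_zero, not_false_eq_true, and_self, Set.setOf_true, div_one] at hlim
    refine quad_contra hZ.hU hlim ?_ ?_
    · have h1 := (hlim.derivs.tendsto (Set.mem_univ 0)).norm
      have h2 : deriv (fun z : ℂ => p0 + p1 * z + 0 * z^2) 0 = p1 := by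
        have := ((hasDerivAt_id (0:ℂ)).const_mul p1).const_add p0
        simpa using this.deriv
      rw [h2] at h1
      refine ge_of_tendsto h1 ?_
      filter_upwards [hlim.eventually_analyticAt (Set.mem_univ 0)] with k hk
      rw [hZ.h0 k hk]
      have := sq_nonneg ‖rsc y (z k) (ρ k) 0‖
      linarith
    · intro x x0 hx
      filter_upwards [slopes x x0 ⟨1, one_pos, _, hlim.mono (Set.subset_univ _)⟩ hx] with k hk h0
      exact (hk h0).slF
  · have hg : GRel 𝒰 (fun k => rsc y (z k) (ρ k)) (fun z => (z - ζ1)^2 / 2 + e * (z - ζ1) + γ)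
        (fun z => z - ζ1) ζb :=
      ⟨rb, hrb, Or.inl ⟨H, hH, hrel⟩⟩
    have hall := rel_propagate isPreconnected_univ hZ.charts (fun z => by fun_prop)
      (fun z => by fun_prop) (Set.mem_univ ζb) hg
    have hlim := rel_limOn (fun z => by fun_prop) hall
    simp only [Set.mem_univ, true_and, sub_ne_zero] at hlim
    refine pole_contra hZ.hU hγ hlim ?_
    intro x x0 hx0 hx
    obtain ⟨r, hr, hrs⟩ := Metric.isOpen_iff.1 (isOpen_ne (x := ζ1)) x0 hx0
    exact slopes x x0 ⟨r, hr, _, hlim.mono hrs⟩ hx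

lemma circle_low {𝒰 : Ultrafilter ℕ} {Y : ℕ → ℂ → ℂ} (hch : Charts 𝒰 Y ({0}ᶜ : Set ℂ))
    (hn : ∀ ζ : ℂ, ζ ≠ 0 → ¬ GRel 𝒰 Y (fun _ => 0) (fun _ => 1) ζ) :
    ∃ s : ℝ, 1 ≤ s ∧ s ≤ 2 ∧ ∃ c > 0, ∀ᶠ k in (𝒰 : Filter ℕ), ∀ w ∈ sphere (0:ℂ) s,
      AnalyticAt ℂ (Y k) w → c ≤ ‖Y k w‖ := by
  set Z : Set ℂ := {ζ | ∃ r > 0, ∃ H, LimOn 𝒰 Y H (ball ζ r) ∧ H ζ = 0} with hZ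
  have hloc : ∀ ζ : ℂ, ζ ≠ 0 → ∃ V ∈ 𝓝 ζ, (Z ∩ V).Finite := by
    intro ζ hζ
    obtain ⟨r, hr, hrU, hc⟩ := hch ζ hζ
    rcases hc with hc | hc
    · obtain ⟨H, hH⟩ := hc.exists_lim
      have hHa := hH.differentiableOn ζ (mem_ball_self hr)
      rcases hHa.eventually_eq_zero_or_eventually_ne_zero with h | h
      · exfalso
        obtain ⟨r2, hr2, h2⟩ := Metric.eventually_nhds_iff_ball.1 h
        refine hn ζ hζ ⟨min r r2, lt_min hr hr2, Or.inl ⟨H, hH.mono (ball_subset_ball (min_le_left _ _)), ?_⟩⟩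
        intro w hw
        rw [one_mul]
        exact h2 w (ball_subset_ball (min_le_right _ _) hw)
      · rw [eventually_nhdsWithin_iff] at h
        refine ⟨_, h.and (ball_mem_nhds ζ hr), (Set.finite_singleton ζ).subset ?_⟩
        rintro w ⟨⟨r', hr', H', hH', h0⟩, hw1, hw2⟩
        by_contra hne
        apply hw1 hne
        have := tendsto_nhds_unique (hH.tendsto hw2) (hH'.tendsto (mem_ball_self hr'))
        rw [this, h0]
    · obtain ⟨P, hP⟩ := hc.exists_lim
      refine ⟨ball ζ r, ball_mem_nhds ζ hr, ?_⟩
      convert Set.finite_empty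
      rw [Set.eq_empty_iff_forall_notMem]
      rintro w ⟨⟨r', hr', H', hH', h0⟩, hw2⟩
      have := lim_prod hH' hc hP (mem_ball_self hr') hw2 hw2
      rw [h0] at this; simp at this
  have hK : IsCompact {ζ : ℂ | 1 ≤ ‖ζ‖ ∧ ‖ζ‖ ≤ 2} := by
    refine (isCompact_closedBall (0:ℂ) 2).of_isClosed_subset ?_ ?_
    · exact (isClosed_le continuous_const continuous_norm).inter
        (isClosed_le continuous_norm continuous_const)
    · intro w hw; simpa using hw.2
  have hfin : (Z ∩ {ζ : ℂ | 1 ≤ ‖ζ‖ ∧ ‖ζ‖ ≤ 2}).Finite := by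
    refine hK.induction_on (p := fun S => (Z ∩ S).Finite) ?_ ?_ ?_ ?_
    · simp
    · intro s t hst ht; exact ht.subset (Set.inter_subset_inter_right _ hst)
    · intro s t hs ht; rw [Set.inter_union_distrib_left]; exact hs.union ht
    · intro x hx
      obtain ⟨V, hV, h⟩ := hloc x (by rintro rfl; have := hx.1; simp at this; linarith)
      exact ⟨V, mem_nhdsWithin_of_mem_nhds hV, h⟩
  obtain ⟨s, hs, hsn⟩ := ((Set.Icc_infinite (show (1:ℝ) < 2 by norm_num)).diff (hfin.image norm)).nonempty
  refine ⟨s, hs.1, hs.2, ?_⟩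
  refine (isCompact_sphere (0:ℂ) s).induction_on (p := fun S => ∃ c > 0, ∀ᶠ k in (𝒰 : Filter ℕ), ∀ w ∈ S,
      AnalyticAt ℂ (Y k) w → c ≤ ‖Y k w‖) ?_ ?_ ?_ ?_
  · exact ⟨1, one_pos, by simp⟩
  · rintro S T hST ⟨c, hc, h⟩
    exact ⟨c, hc, h.mono fun k hk w hw => hk w (hST hw)⟩
  · rintro S T ⟨c, hc, h⟩ ⟨c', hc', h'⟩
    refine ⟨min c c', lt_min hc hc', ?_⟩
    filter_upwards [h, h'] with k h1 h2 w hw ha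
    rcases hw with hw | hw
    · exact (min_le_left _ _).trans (h1 w hw ha)
    · exact (min_le_right _ _).trans (h2 w hw ha)
  · intro ζ hζ
    rw [mem_sphere_zero_iff_norm] at hζ
    have hζ0 : ζ ≠ 0 := by rintro rfl; simp at hζ; have := hs.1; linarith
    obtain ⟨r, hr, hrU, hc⟩ := hch ζ hζ0
    rcases hc with hc | hc
    · obtain ⟨H, hH⟩ := hc.exists_lim
      have hH0 : H ζ ≠ 0 := by
        intro h0
        apply hsn
        refine ⟨ζ, ⟨⟨r, hr, H, hH, h0⟩, ?_⟩, hζ⟩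
        rw [Set.mem_setOf_eq, hζ]; exact hs
      have hp := norm_pos_iff.2 hH0
      obtain ⟨r1, hr1, h1, h2⟩ := hH ζ (mem_ball_self hr)
      have hcont := (hH.differentiableOn ζ (mem_ball_self hr)).continuousAt.norm
      have h3 := hcont.eventually_const_lt (show ‖H ζ‖ / 2 < ‖H ζ‖ by linarith)
      rw [Metric.tendstoUniformlyOn_iff] at h2
      refine ⟨_, mem_nhdsWithin_of_mem_nhds (h3.and (ball_mem_nhds ζ hr1)), ‖H ζ‖ / 4, by positivity, ?_⟩
      filter_upwards [h2 (‖H ζ‖/4) (by positivity)] with k hk w hw _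
      have h4 := hk w hw.2
      rw [dist_eq_norm] at h4
      have h5 := norm_le_norm_add_norm_sub' (H w) (Y k w)
      have h6 : ‖H ζ‖ / 2 < ‖H w‖ := hw.1
      linarith
    · refine ⟨ball ζ r, mem_nhdsWithin_of_mem_nhds (ball_mem_nhds ζ hr), 1/2, by norm_num, ?_⟩
      filter_upwards [hc] with k hk w hw ha
      obtain ⟨_, h2, h3⟩ := hk w hw
      have h0 : Y k w ≠ 0 := fun h => h3 h ha
      rw [norm_inv] at h2
      have := norm_pos_iff.2 h0
      rw [inv_le_comm₀ this (by norm_num)] at h2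
      linarith

lemma tM2 {y : ℂ → ℂ} {C R : ℝ} (hm : ∀ z, R < ‖z‖ → MartyAt y (C / ‖z‖^2) z) :
    (∃ R' : ℝ, ∀ z, R' < ‖z‖ → AnalyticAt ℂ y z ∧ ‖y z‖ ≤ ‖z‖) ∨
    ∃ c > 0, ∀ r0 : ℝ, ∃ r, r0 < r ∧ ∀ z, ‖z‖ = r → AnalyticAt ℂ y z → c * ‖z‖ ≤ ‖y z‖ := by
  by_cases hc : ∃ R' : ℝ, ∀ z, R' < ‖z‖ → AnalyticAt ℂ y z ∧ ‖y z‖ ≤ ‖z‖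
  · exact Or.inl hc
  right
  push Not at hc
  choose z hz hzy using fun k : ℕ => hc k
  set 𝒰 : Ultrafilter ℕ := hyperfilter ℕ with h𝒰
  have hU : (𝒰 : Filter ℕ) ≤ atTop := by
    rw [← Nat.cofinite_eq_atTop]; exact hyperfilter_le_cofinite
  have htt : Tendsto (fun k => ‖z k‖) 𝒰 atTop :=
    (tendsto_atTop_mono (fun k => (hz k).le) tendsto_natCast_atTop_atTop).mono_left hU
  have ht : ∀ k, 0 < ‖z k‖ := fun k => lt_of_le_of_lt (Nat.cast_nonneg k) (hz k)
  have hch := star_charts ht htt hm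
  obtain ⟨ζ0, hζ0, hlim⟩ := unit_lim 𝒰 (fun k => norm_pos_iff.1 (ht k))
  have h0 : ∀ k, (‖z k‖ : ℂ) ≠ 0 := fun k => by exact_mod_cast (ht k).ne'
  have hn : ∀ ζ : ℂ, ζ ≠ 0 → ¬ GRel 𝒰 (fun k => rsc y 0 ‖z k‖) (fun _ => 0) (fun _ => 1) ζ := by
    intro ζ hζ hrel
    have hall := rel_propagate (U := ({0}ᶜ : Set ℂ)) (𝒰 := 𝒰) (Y := fun k => rsc y 0 ‖z k‖)
      (A := fun _ => 0) (D := fun _ => 1) preconn_star hch (fun _ => analyticAt_const) (fun _ => analyticAt_const) hζ hrel ζ0 hζ0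
    obtain ⟨r, hr, ⟨H, hH, h2⟩ | ⟨P, _, _, h3⟩⟩ := hall
    · have hH0 : H ζ0 = 0 := by simpa using h2 ζ0 (mem_ball_self hr)
      have h1 := (hH.tendsto_seq (mem_ball_self hr) hlim).norm
      rw [hH0, norm_zero] at h1
      obtain ⟨r1, hr1, h4, _⟩ := hH ζ0 (mem_ball_self hr)
      obtain ⟨k, h5, h6, h7⟩ := ((h1.eventually_lt_const (show (0:ℝ) < 1 by norm_num)).and
        (h4.and (hlim.eventually (ball_mem_nhds ζ0 hr1)))).exists
      have h8 := h6.analyticAt (isOpen_ball.mem_nhds h7)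
      rw [rsc_analytic (ht k), zero_add, mul_div_cancel₀ _ (h0 k)] at h8
      have h9 := hzy k h8
      simp only [rsc, zero_add] at h5
      rw [mul_div_cancel₀ _ (h0 k), norm_div, Complex.norm_real, norm_norm, div_lt_one (ht k)] at h5
      linarith
    · have := h3 ζ0 (mem_ball_self hr)
      simp at this
  obtain ⟨s, hs1, hs2, c, hc, hev⟩ := circle_low hch hn
  refine ⟨c / 2, by positivity, fun r0 => ?_⟩
  obtain ⟨k, h1, h2⟩ := (hev.and (htt.eventually_gt_atTop |r0|)).exists
  have hk := ht k
  refine ⟨s * ‖z k‖, ?_, fun w hw ha => ?_⟩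
  · have := le_abs_self r0
    nlinarith
  · have hws : ‖w / ‖z k‖‖ = s := by
      rw [norm_div, Complex.norm_real, norm_norm, hw, mul_div_cancel_right₀ _ hk.ne']
    have h3 := h1 (w / ‖z k‖) (by rw [mem_sphere_zero_iff_norm, hws]) (by
      rw [rsc_analytic hk, zero_add, mul_div_cancel₀ _ (h0 k)]; exact ha)
    simp only [rsc, zero_add] at h3
    rw [mul_div_cancel₀ _ (h0 k), norm_div, Complex.norm_real, norm_norm, le_div_iff₀ hk] at h3
    rw [hw]
    have : c * (s * ‖z k‖) ≤ c * (2 * ‖z k‖) := by gcongr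
    linarith

lemma left_max_deriv {φ : ℝ → ℝ} {d t0 : ℝ} (h : HasDerivAt φ d t0)
    (hm : ∀ᶠ t in 𝓝[<] t0, φ t ≤ φ t0) : 0 ≤ d := by
  have h1 : Tendsto (slope φ t0) (𝓝[<] t0) (𝓝 d) := (hasDerivAt_iff_tendsto_slope.1 h).mono_left
    (nhdsWithin_mono t0 (fun x (hx : x < t0) => hx.ne))
  refine ge_of_tendsto h1 ?_
  filter_upwards [hm, self_mem_nhdsWithin] with t ht1 ht2
  rw [slope_def_field]
  have : t < t0 := ht2
  exact div_nonneg_of_nonpos (by linarith) (by linarith)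

lemma circ_growth {E : ℂ → ℂ} {R C : ℝ} (hR : 0 ≤ R) (hE : ∀ z, R < ‖z‖ → AnalyticAt ℂ E z)
    (hc : ∀ r0 : ℝ, ∃ r, r0 < r ∧ ∀ z, ‖z‖ = r → ‖z * deriv E z‖ ≤ C * ‖E z‖) :
    ∃ (M : ℝ) (N : ℕ), ∀ z, R + 1 < ‖z‖ → ‖E z‖ ≤ M * ‖z‖ ^ N := by
  obtain ⟨N, hN⟩ := exists_nat_gt C
  set h : ℂ → ℂ := fun z => E z / z ^ N with hh
  have hz0 : ∀ z : ℂ, R < ‖z‖ → z ≠ 0 := fun z hz => norm_pos_iff.1 (by linarith)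
  have hha : ∀ z, R < ‖z‖ → AnalyticAt ℂ h z := fun z hz =>
    (hE z hz).div (analyticAt_id.pow N) (pow_ne_zero _ (hz0 z hz))
  have hcont : ContinuousOn h (sphere 0 (R+1)) := by
    intro w hw
    rw [mem_sphere_zero_iff_norm] at hw
    exact (hha w (by linarith)).continuousAt.continuousWithinAt
  obtain ⟨M1, hM1⟩ := (isCompact_sphere (0:ℂ) (R+1)).exists_bound_of_continuousOn hcont
  have hM1' : ∀ z, ‖z‖ = R + 1 → ‖h z‖ ≤ M1 := fun z hz => hM1 z (by simpa using hz)
  have hM0 : 0 ≤ M1 := (norm_nonneg _).trans (hM1' ((R+1 : ℝ) : ℂ) (by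
    rw [Complex.norm_real, Real.norm_eq_abs, abs_of_nonneg (by linarith)]))
  have key : ∀ r, R + 1 < r → (∀ z, ‖z‖ = r → ‖z * deriv E z‖ ≤ C * ‖E z‖) →
      ∀ z, ‖z‖ = r → ‖h z‖ ≤ M1 := by
    intro r hr hCr
    have hcr : ContinuousOn (fun z => ‖h z‖) (sphere 0 r) := by
      intro w hw
      rw [mem_sphere_zero_iff_norm] at hw
      exact (hha w (by linarith)).continuousAt.norm.continuousWithinAt
    obtain ⟨z0, hz0s, hmax⟩ := (isCompact_sphere (0:ℂ) r).exists_isMaxOn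
      ⟨(r:ℂ), by rw [mem_sphere_zero_iff_norm, Complex.norm_real, Real.norm_eq_abs, abs_of_nonneg (by linarith)]⟩ hcr
    rw [mem_sphere_zero_iff_norm] at hz0s
    have hmax' : ∀ z, ‖z‖ = r → ‖h z‖ ≤ ‖h z0‖ := fun z hz => hmax (by simpa using hz)
    intro z hz
    refine (hmax' z hz).trans ?_
    by_contra hcon
    push Not at hcon
    have hall := annulus_max hha (by linarith : R < R + 1) (fun z hz => (hM1' z hz).trans hcon.le) hmax'
    have hne : h z0 ≠ 0 := norm_pos_iff.1 (by linarith)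
    have hz00 : z0 ≠ 0 := hz0 z0 (by linarith)
    have hEd := (hE z0 (by linarith)).differentiableAt.hasDerivAt
    have hd : HasDerivAt (fun t : ℝ => h ((t:ℂ) * z0)) (deriv h z0 * z0) 1 := by
      have h1 : HasDerivAt (fun t : ℝ => (t:ℂ) * z0) z0 1 := by
        have := (Complex.ofRealCLM.hasDerivAt (x := 1)).mul_const z0
        simpa using this
      have h2 : HasDerivAt h (deriv h z0) (((1:ℝ):ℂ) * z0) := by
        simpa using (hha z0 (by linarith)).differentiableAt.hasDerivAt
      exact h2.comp (1:ℝ) h1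
    have hder : deriv h z0 * z0 = h z0 * (z0 * deriv E z0 / E z0 - N) := by
      have hE0 : E z0 ≠ 0 := by
        intro h0; apply hne; simp [hh, h0]
      have h3 := (hEd.div (hasDerivAt_pow N z0) (pow_ne_zero N hz00)).deriv
      have h4 : deriv h z0 = _ := h3
      rw [h4]
      simp only [hh]
      rcases Nat.eq_zero_or_pos N with hN0 | hN0
      · subst hN0; simp; field_simp
      · obtain ⟨n, rfl⟩ := Nat.exists_eq_succ_of_ne_zero hN0.ne'
        simp only [Nat.succ_eq_add_one, Nat.add_sub_cancel]
        field_simp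
        push_cast
        ring
    have h5 := left_max_deriv hd.norm_sq (by
      have hct : ContinuousAt (fun t : ℝ => ‖(t:ℂ) * z0‖) 1 := by fun_prop
      have h6 : ∀ᶠ t : ℝ in 𝓝 (1:ℝ), R + 1 < ‖(t:ℂ) * z0‖ :=
        Tendsto.eventually_const_lt (v := ‖((1:ℝ):ℂ) * z0‖) (by simpa [hz0s] using hr) hct
      filter_upwards [nhdsWithin_le_nhds h6, nhdsWithin_le_nhds (eventually_gt_nhds (show (0:ℝ) < 1 by norm_num)),
        self_mem_nhdsWithin] with t ht1 ht2 ht3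
      have ht3' : t < 1 := ht3
      have h7 : ‖(t:ℂ) * z0‖ ≤ r := by
        rw [norm_mul, Complex.norm_real, Real.norm_eq_abs, abs_of_pos ht2, hz0s]
        have : 0 < r := by linarith
        nlinarith
      have h8 := hall _ ht1.le h7
      simp only [Complex.ofReal_one, one_mul]
      gcongr)
    rw [hder] at h5
    simp only [Complex.ofReal_one, one_mul] at h5
    have h9 : inner ℝ (h z0) (h z0 * (z0 * deriv E z0 / E z0 - N)) =
        ‖h z0‖^2 * (z0 * deriv E z0 / E z0 - N).re := by
      generalize (z0 * deriv E z0 / E z0 - N) = Q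
      rw [Complex.sq_norm, Complex.normSq_apply, Complex.inner]
      simp only [Complex.mul_re, Complex.mul_im, Complex.conj_re, Complex.conj_im]
      ring
    rw [h9] at h5
    have h10 : (z0 * deriv E z0 / E z0 - N).re < 0 := by
      have h11 := (Complex.re_le_norm (z0 * deriv E z0 / E z0))
      have hE0 : E z0 ≠ 0 := by
        intro h0; apply hne; simp [hh, h0]
      have h12 := hCr z0 hz0s
      have h13 : ‖z0 * deriv E z0 / E z0‖ ≤ C := by
        rw [norm_div, div_le_iff₀ (norm_pos_iff.2 hE0)]; exact h12
      simp only [Complex.sub_re, Complex.natCast_re]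
      linarith
    have := mul_neg_of_pos_of_neg (show 0 < ‖h z0‖^2 by have := norm_pos_iff.2 hne; positivity) h10
    linarith
  refine ⟨M1, N, fun z hz => ?_⟩
  obtain ⟨r, hr, hr2⟩ := hc ‖z‖
  have h1 := annulus_max hha (by linarith : R < R + 1) hM1' (key r (by linarith) hr2) z hz.le hr.le
  simp only [hh, norm_div, norm_pow] at h1
  rwa [div_le_iff₀ (by have := (by linarith : 0 < ‖z‖); positivity)] at h1

lemma hopf {Ψ : ℂ → ℂ} (hΨ : Differentiable ℂ Ψ) {z0 ξ : ℂ} {d : ℝ} (hd : 0 < d)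
    (hpos : ∀ z ∈ ball z0 d, 0 < (Ψ z).re) (hξ : ‖ξ - z0‖ = d) (h0 : (Ψ ξ).re = 0) :
    (Ψ z0).re ≤ 2 * d * ‖deriv Ψ ξ‖ := by
  set q : ℂ → ℂ := fun ζ => Ψ (z0 + ζ) - Ψ ξ with hq
  have hqre : ∀ ζ ∈ ball (0:ℂ) d, 0 < (q ζ).re := by
    intro ζ hζ
    have := hpos (z0 + ζ) (by simpa [mem_ball_iff_norm] using hζ)
    simp [hq, h0, this]
  have hqne : ∀ ζ ∈ ball (0:ℂ) d, q ζ ≠ 0 := fun ζ hζ h => by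
    have := hqre ζ hζ; rw [h] at this; simp at this
  have hqd : Differentiable ℂ q := by
    intro x; exact ((hΨ _).comp x (by fun_prop)).sub_const _
  set p : ℂ := q 0 with hp
  have h0d : (0:ℂ) ∈ ball (0:ℂ) d := mem_ball_self hd
  have hpre := hqre 0 h0d
  have hpne := hqne 0 h0d
  have hpn : 0 < ‖p‖ := norm_pos_iff.2 hpne
  set M : ℝ := p.re / ‖p‖^2 with hM
  have hMp : 0 < M := by positivity
  have hre : ∀ x : ℂ, (x⁻¹).re = x.re / ‖x‖^2 := by
    intro x; rw [Complex.inv_re, Complex.sq_norm]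
  have hbc : ∀ ζ ∈ ball (0:ℂ) d, ‖p⁻¹ - (q ζ)⁻¹‖ ≤ 2 * M * ‖ζ‖ / (d - ‖ζ‖) := by
    intro ζ hζ
    refine Complex.borelCaratheodory_zero (f := fun ζ => p⁻¹ - (q ζ)⁻¹) hMp ?_ ?_ hd hζ (by simp [hp])
    · intro x hx
      exact ((hqd x).inv (hqne x hx)).const_sub _ |>.differentiableWithinAt
    · intro x hx
      simp only [Set.mem_setOf_eq, Complex.sub_re, hre]
      have := hqre x hx
      have : 0 ≤ (q x).re / ‖q x‖^2 := by positivity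
      linarith
  -- along the radius
  have hkey : ∀ t : ℝ, 0 < t → t < 1 →
      1 ≤ ‖q (t * (ξ - z0))‖ / (1 - t) * ((1 - t) / ‖p‖ + 2 * M * t) := by
    intro t ht0 ht1
    have hnt : ‖(t:ℂ) * (ξ - z0)‖ = t * d := by
      rw [norm_mul, Complex.norm_real, Real.norm_eq_abs, abs_of_pos ht0, hξ]
    have hmem : (t:ℂ) * (ξ - z0) ∈ ball (0:ℂ) d := by
      rw [mem_ball_zero_iff, hnt]; nlinarith
    have h1 := hbc _ hmem
    rw [hnt] at h1
    have h2 : 2 * M * (t * d) / (d - t * d) = 2 * M * t / (1 - t) := by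
      have : 1 - t ≠ 0 := by linarith
      have : d - t * d ≠ 0 := by
        have : d - t * d = d * (1 - t) := by ring
        rw [this]; positivity
      field_simp
    rw [h2] at h1
    have hqn : 0 < ‖q (t * (ξ - z0))‖ := norm_pos_iff.2 (hqne _ hmem)
    have h3 : ‖(q (t * (ξ - z0)))⁻¹‖ ≤ ‖p⁻¹‖ + ‖p⁻¹ - (q (t * (ξ - z0)))⁻¹‖ := by
      have := norm_le_norm_add_norm_sub' (q (t * (ξ - z0)))⁻¹ p⁻¹
      rw [norm_sub_rev] at this
      exact this
    rw [norm_inv, norm_inv] at h3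
    have h4 : ‖q (t * (ξ - z0))‖⁻¹ ≤ ‖p‖⁻¹ + 2 * M * t / (1 - t) := h3.trans (by gcongr)
    have h5 : 1 ≤ ‖q (t * (ξ - z0))‖ * (‖p‖⁻¹ + 2 * M * t / (1 - t)) := by
      have := mul_le_mul_of_nonneg_left h4 hqn.le
      rwa [mul_inv_cancel₀ hqn.ne'] at this
    have h6 : ‖q (t * (ξ - z0))‖ / (1 - t) * ((1 - t) / ‖p‖ + 2 * M * t) =
        ‖q (t * (ξ - z0))‖ * (‖p‖⁻¹ + 2 * M * t / (1 - t)) := by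
      have : 1 - t ≠ 0 := by linarith
      field_simp
    rw [h6]; exact h5
  have hder : HasDerivAt (fun t : ℝ => q (t * (ξ - z0))) (deriv Ψ ξ * (ξ - z0)) 1 := by
    have h1 : HasDerivAt (fun t : ℝ => z0 + (t:ℂ) * (ξ - z0)) (ξ - z0) 1 := by
      have := ((Complex.ofRealCLM.hasDerivAt (x := 1)).mul_const (ξ - z0)).const_add z0
      simpa using this
    have h2 : HasDerivAt Ψ (deriv Ψ ξ) (z0 + ((1:ℝ):ℂ) * (ξ - z0)) := by
      simpa using (hΨ ξ).hasDerivAt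
    exact (h2.comp (1:ℝ) h1).sub_const _
  have hsl : Tendsto (slope (fun t : ℝ => q (t * (ξ - z0))) 1) (𝓝[<] 1) (𝓝 (deriv Ψ ξ * (ξ - z0))) :=
    (hasDerivAt_iff_tendsto_slope.1 hder).mono_left
    (nhdsWithin_mono 1 (fun x (hx : x < 1) => hx.ne))
  have hq1 : q (((1:ℝ):ℂ) * (ξ - z0)) = 0 := by simp [hq]
  have hlim1 : Tendsto (fun t : ℝ => ‖q (t * (ξ - z0))‖ / (1 - t)) (𝓝[<] 1) (𝓝 (‖deriv Ψ ξ‖ * d)) := by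
    have := hsl.norm
    rw [norm_mul, hξ] at this
    refine this.congr' ?_
    filter_upwards [self_mem_nhdsWithin] with t ht
    have ht' : t < 1 := ht
    rw [slope_def_module, hq1, sub_zero, norm_smul, norm_inv, Real.norm_eq_abs,
      abs_of_neg (by linarith), neg_sub]
    field_simp
  have hlim2 : Tendsto (fun t : ℝ => ((1 - t) / ‖p‖ + 2 * M * t)) (𝓝[<] 1) (𝓝 (2 * M)) := by
    have : ContinuousAt (fun t : ℝ => ((1 - t) / ‖p‖ + 2 * M * t)) 1 := by fun_prop
    have := this.tendsto.mono_left (nhdsWithin_le_nhds (s := Set.Iio 1))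
    simpa using this
  have hfin : 1 ≤ ‖deriv Ψ ξ‖ * d * (2 * M) := by
    refine ge_of_tendsto (hlim1.mul hlim2) ?_
    filter_upwards [self_mem_nhdsWithin, nhdsWithin_le_nhds (eventually_gt_nhds (show (0:ℝ) < 1 by norm_num))] with t ht1 ht2
    exact hkey t ht2 ht1
  have hpe : p.re = (Ψ z0).re := by simp [hp, hq, h0]
  have h7 : M * p.re ≤ 1 := by
    rw [hM, div_mul_eq_mul_div, div_le_one (by positivity)]
    have := Complex.re_le_norm p
    nlinarith
  rw [← hpe]
  have : p.re * 1 ≤ p.re * (‖deriv Ψ ξ‖ * d * (2 * M)) := by gcongr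
  have h8 : 0 ≤ ‖deriv Ψ ξ‖ * d * 2 := by positivity
  nlinarith

lemma lin_re_affine {Ψ : ℂ → ℂ} (hΨ : Differentiable ℂ Ψ) {K : ℝ} (hK : 0 < K)
    (h : ∀ z, (Ψ z).re ≤ K * (1 + ‖z‖)) : ∀ z, deriv Ψ z = deriv Ψ 0 := by
  have h1 : ∀ z, ‖Ψ z‖ ≤ (4 * K + 3 * ‖Ψ 0‖) * (1 + ‖z‖) := by
    intro z
    have h2 := Complex.borelCaratheodory (f := Ψ) (M := K * (1 + (2 * ‖z‖ + 1))) (R := 2 * ‖z‖ + 1) (z := z) (by positivity)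
      hΨ.differentiableOn (fun x hx => ?_) (by positivity) (by rw [mem_ball_zero_iff]; linarith [norm_nonneg z])
    · refine h2.trans ?_
      have hz := norm_nonneg z
      have e1 : 2 * ‖z‖ + 1 - ‖z‖ = 1 + ‖z‖ := by ring
      rw [e1, ← add_div, div_le_iff₀ (by positivity)]
      nlinarith [norm_nonneg (Ψ 0), mul_nonneg hz (norm_nonneg (Ψ 0)), mul_nonneg hz hK.le, mul_nonneg (mul_nonneg hz hz) hK.le,
        mul_nonneg (mul_nonneg hz hz) (norm_nonneg (Ψ 0))]
    · rw [mem_ball_zero_iff] at hx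
      exact (h x).trans (by gcongr)
  have hd : Differentiable ℂ (deriv Ψ) := by
    intro z; exact ((hΨ.analyticAt z).deriv).differentiableAt
  intro z
  apply hd.apply_eq_apply_of_bounded
  rw [isBounded_iff_forall_norm_le]
  refine ⟨2 * (4 * K + 3 * ‖Ψ 0‖), ?_⟩
  rintro _ ⟨w, rfl⟩
  have hw := norm_nonneg w
  have h3 := Complex.norm_deriv_le_of_forall_mem_sphere_norm_le (f := Ψ) (c := w) (R := ‖w‖ + 1)
    (C := (4 * K + 3 * ‖Ψ 0‖) * (2 * (1 + ‖w‖))) (by positivity) hΨ.diffContOnCl (fun x hx => ?_)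
  · refine h3.trans (le_of_eq ?_)
    field_simp
    ring
  · rw [mem_sphere_iff_norm] at hx
    have := norm_le_norm_add_norm_sub' x w
    refine (h1 x).trans ?_
    gcongr
    linarith

lemma half_affine {Ψ : ℂ → ℂ} (hΨ : Differentiable ℂ Ψ) {τ : ℝ} (hτ : 0 ≤ τ)
    (hb : ∀ z, ‖deriv Ψ z‖ ≤ 2 * (τ + |(Ψ z).re|)) : ∀ z, deriv Ψ z = deriv Ψ 0 := by
  have hUc : Continuous (fun z => (Ψ z).re) := Complex.continuous_re.comp hΨ.continuous
  by_cases hZ : ∃ ξ, (Ψ ξ).re = 0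
  · obtain ⟨ξ0, hξ0⟩ := hZ
    refine lin_re_affine hΨ (K := 4 * τ * (1 + ‖ξ0‖) + 1) (by positivity) (fun z0 => ?_)
    rcases le_or_gt (Ψ z0).re 0 with h | h
    · exact h.trans (by positivity)
    have hcl : IsClosed {z | (Ψ z).re = 0} := isClosed_eq hUc continuous_const
    obtain ⟨ξ, hξ, hdist⟩ := hcl.exists_infDist_eq_dist ⟨ξ0, hξ0⟩ z0
    have hd : 0 < dist z0 ξ := by
      rw [dist_pos]; rintro rfl; rw [Set.mem_setOf_eq] at hξ; linarith
    have hdle : dist z0 ξ ≤ ‖z0‖ + ‖ξ0‖ := by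
      rw [← hdist]
      exact (infDist_le_dist_of_mem (show ξ0 ∈ {z | (Ψ z).re = 0} from hξ0)).trans (by
        rw [dist_eq_norm]; exact norm_sub_le _ _)
    have hpos : ∀ z ∈ ball z0 (dist z0 ξ), 0 < (Ψ z).re := by
      intro z hz
      by_contra hcon
      push Not at hcon
      have hpc : IsPreconnected (ball z0 (dist z0 ξ)) := (convex_ball _ _).isPreconnected
      obtain ⟨x, hx, hx0⟩ := hpc.intermediate_value hz (mem_ball_self hd) hUc.continuousOn ⟨hcon, h.le⟩
      have h1 := infDist_le_dist_of_mem (x := z0) (show x ∈ {z | (Ψ z).re = 0} from hx0)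
      rw [mem_ball, dist_comm] at hx
      linarith
    have h2 := hopf hΨ hd hpos (by rw [dist_comm, dist_eq_norm]) hξ
    have h3 := hb ξ
    rw [Set.mem_setOf_eq] at hξ
    rw [hξ, abs_zero, add_zero] at h3
    have h4 : 2 * dist z0 ξ * ‖deriv Ψ ξ‖ ≤ 2 * (‖z0‖ + ‖ξ0‖) * (2 * τ) := by gcongr
    have h5 := norm_nonneg z0
    have h6 := norm_nonneg ξ0
    nlinarith [mul_nonneg hτ h5, mul_nonneg hτ h6, mul_nonneg (mul_nonneg hτ h5) h6]
  · push Not at hZ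
    rcases lt_or_gt_of_ne (hZ 0) with h | h
    · refine lin_re_affine hΨ one_pos (fun z => ?_)
      have : (Ψ z).re ≤ 0 := by
        by_contra hcon
        push Not at hcon
        obtain ⟨x, _, hx⟩ := isPreconnected_univ.intermediate_value (Set.mem_univ 0) (Set.mem_univ z) hUc.continuousOn ⟨h.le, hcon.le⟩
        exact hZ x hx
      exact this.trans (by positivity)
    · have h1 := lin_re_affine hΨ.neg one_pos (fun z => ?_)
      · intro z
        have h2 := h1 z
        have e : ∀ x, deriv (-Ψ) x = - deriv Ψ x := fun x => deriv.neg
        rw [e, e] at h2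
        exact neg_injective h2
      · have : 0 ≤ (Ψ z).re := by
          by_contra hcon
          push Not at hcon
          obtain ⟨x, _, hx⟩ := isPreconnected_univ.intermediate_value (Set.mem_univ z) (Set.mem_univ 0) hUc.continuousOn ⟨hcon.le, h.le⟩
          exact hZ x hx
        have h3 : (0:ℝ) ≤ 1 * (1 + ‖z‖) := by positivity
        simp only [Pi.neg_apply, Complex.neg_re]
        linarith

lemma LimOn.mul {𝒰 : Ultrafilter ℕ} {h g : ℕ → ℂ → ℂ} {H G : ℂ → ℂ} {U : Set ℂ} (hU : IsOpen U)
    (hh : LimOn 𝒰 h H U) (hg : LimOn 𝒰 g G U) : LimOn 𝒰 (fun k z => h k z * g k z) (fun z => H z * G z) U := by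
  have hb : LocBdd 𝒰 (fun k z => h k z * g k z) U := by
    intro ζ hζ
    obtain ⟨r1, hr1, M1, h1⟩ := hh.locBdd ζ hζ
    obtain ⟨r2, hr2, M2, h2⟩ := hg.locBdd ζ hζ
    refine ⟨min r1 r2, lt_min hr1 hr2, |M1| * |M2|, ?_⟩
    filter_upwards [h1, h2] with k h1 h2
    refine ⟨(h1.1.mono (ball_subset_ball (min_le_left _ _))).mul (h2.1.mono (ball_subset_ball (min_le_right _ _))), fun w hw => ?_⟩
    rw [norm_mul]
    have e1 := (h1.2 w (ball_subset_ball (min_le_left _ _) hw)).trans (le_abs_self _)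
    have e2 := (h2.2 w (ball_subset_ball (min_le_right _ _) hw)).trans (le_abs_self _)
    gcongr
  obtain ⟨L, hL⟩ := hb.exists_lim
  refine hL.congr hU fun z hz => ?_
  exact tendsto_nhds_unique (hL.tendsto hz) ((hh.tendsto hz).mul (hg.tendsto hz))

lemma LimOn.add {𝒰 : Ultrafilter ℕ} {h g : ℕ → ℂ → ℂ} {H G : ℂ → ℂ} {U : Set ℂ} (hU : IsOpen U)
    (hh : LimOn 𝒰 h H U) (hg : LimOn 𝒰 g G U) : LimOn 𝒰 (fun k z => h k z + g k z) (fun z => H z + G z) U := by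
  have hb : LocBdd 𝒰 (fun k z => h k z + g k z) U := by
    intro ζ hζ
    obtain ⟨r1, hr1, M1, h1⟩ := hh.locBdd ζ hζ
    obtain ⟨r2, hr2, M2, h2⟩ := hg.locBdd ζ hζ
    refine ⟨min r1 r2, lt_min hr1 hr2, M1 + M2, ?_⟩
    filter_upwards [h1, h2] with k h1 h2
    refine ⟨(h1.1.mono (ball_subset_ball (min_le_left _ _))).add (h2.1.mono (ball_subset_ball (min_le_right _ _))), fun w hw => ?_⟩
    have e1 := (h1.2 w (ball_subset_ball (min_le_left _ _) hw))
    have e2 := (h2.2 w (ball_subset_ball (min_le_right _ _) hw))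
    exact (norm_add_le _ _).trans (add_le_add e1 e2)
  obtain ⟨L, hL⟩ := hb.exists_lim
  refine hL.congr hU fun z hz => ?_
  exact tendsto_nhds_unique (hL.tendsto hz) ((hh.tendsto hz).add (hg.tendsto hz))

lemma LimOn.cst {𝒰 : Ultrafilter ℕ} (c : ℂ) {U : Set ℂ} : LimOn 𝒰 (fun _ _ => c) (fun _ => c) U := by
  intro ζ _
  refine ⟨1, one_pos, Eventually.of_forall fun k => differentiableOn_const c, ?_⟩
  rw [Metric.tendstoUniformlyOn_iff]
  intro ε hε
  exact Eventually.of_forall fun k x _ => by simpa using hε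

lemma exp_sol {W : ℂ → ℂ} {A : ℂ} (hW : Differentiable ℂ W) (h : ∀ z, deriv W z = A * W z) :
    ∀ z, W z = W 0 * Complex.exp (A * z) := by
  intro z
  have hd : ∀ x, HasDerivAt (fun z => W z * Complex.exp (-(A * z))) 0 x := by
    intro x
    have h1 := (hW x).hasDerivAt
    have h2 : HasDerivAt (fun z => Complex.exp (-(A * z))) (Complex.exp (-(A*x)) * (-A)) x := by
      have := ((hasDerivAt_id x).const_mul A).neg.cexp
      simpa using this
    refine HasDerivAt.congr_deriv (f := fun z => W z * Complex.exp (-(A * z))) (h1.mul h2) ?_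
    rw [h x]; ring
  have h3 := is_const_of_deriv_eq_zero (f := fun z => W z * Complex.exp (-(A * z)))
    (fun x => (hd x).differentiableAt) (fun x => (hd x).deriv) z 0
  simp only [mul_zero, neg_zero, Complex.exp_zero, mul_one] at h3
  rw [← h3, mul_assoc, ← Complex.exp_add]; simp

lemma exp_hit {W : ℂ → ℂ} {A β : ℂ} (hA : A ≠ 0) (hβ : β ≠ 0) (hW0 : W 0 ≠ 0)
    (h : ∀ z, W z = W 0 * Complex.exp (A * z)) : ∃ ζ, W ζ = β := by
  refine ⟨Complex.log (β / W 0) / A, ?_⟩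
  rw [h, mul_div_cancel₀ _ hA, Complex.exp_log (div_ne_zero hβ hW0), mul_div_cancel₀ _ hW0]

lemma exp_derivs {W : ℂ → ℂ} {A : ℂ} (hW : Differentiable ℂ W) (h : ∀ z, deriv W z = A * W z) :
    (∀ z, deriv (deriv W) z = A^2 * W z) ∧ (∀ z, deriv (deriv (deriv W)) z = A^3 * W z) := by
  have e1 : deriv W = fun z => A * W z := funext h
  have h2 : ∀ z, deriv (deriv W) z = A^2 * W z := by
    intro z
    rw [e1, deriv_const_mul _ (hW z), h]; ring
  have e2 : deriv (deriv W) = fun z => A^2 * W z := funext h2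
  refine ⟨h2, fun z => ?_⟩
  rw [e2, deriv_const_mul _ (hW z), h]; ring

lemma hur2 {𝒰 : Ultrafilter ℕ} (hU : (𝒰 : Filter ℕ) ≤ atTop) {W : ℕ → ℂ → ℂ} {V : ℂ → ℂ} {A : ℂ} (hA : A ≠ 0)
    (hl : LimOn 𝒰 W V Set.univ) (hV : ∀ z, deriv V z = A * V z) (hV0 : V 0 ≠ 0) :
    ∃ (ζ : ℂ) (z : ℕ → ℂ), Tendsto z 𝒰 (𝓝 ζ) ∧ ∀ᶠ k in (𝒰 : Filter ℕ), W k (z k) ≠ 1 ∧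
      2 * (deriv (W k) (z k))^2 + (1 - W k (z k)) * deriv (deriv (W k)) (z k) = 0 := by
  have hVd : Differentiable ℂ V := fun z => (hl.differentiableOn z (Set.mem_univ _)).differentiableAt
  have hsol := exp_sol hVd hV
  obtain ⟨hV2, _⟩ := exp_derivs hVd hV
  obtain ⟨ζ, hζ⟩ := exp_hit (β := -1) hA (by norm_num) hV0 hsol
  have hl1 := hl.derivs
  have hl2 := hl1.derivs
  have o := isOpen_univ (X := ℂ)
  have hE := ((LimOn.cst 2).mul o (hl1.mul o hl1)).add o (((LimOn.cst 1).add o ((LimOn.cst (-1)).mul o hl)).mul o hl2)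
  obtain ⟨z, hz, hz0⟩ := hE.hurwitz hU (Set.mem_univ ζ) (by rw [hV, hV2, hζ]; ring) (by
    intro hev
    have hd : ∀ᶠ w in 𝓝 ζ, A^2 * (V w * (V w + 1)) = 0 := by
      filter_upwards [hev] with w hw
      rw [hV, hV2] at hw
      linear_combination hw
    have hc : ∀ᶠ w in 𝓝 ζ, V w = -1 := by
      have : ∀ᶠ w in 𝓝 ζ, V w ≠ 0 := hVd.continuous.continuousAt.eventually_ne (by rw [hζ]; norm_num)
      filter_upwards [hd, this] with w h1 h2
      have := (mul_eq_zero.1 ((mul_eq_zero.1 h1).resolve_left (pow_ne_zero _ hA))).resolve_left h2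
      linear_combination this
    have h3 : deriv V ζ = 0 := by
      rw [Filter.EventuallyEq.deriv_eq (f₁ := V) (f := fun _ => -1) hc]; simp
    rw [hV, hζ] at h3
    apply hA
    linear_combination -h3)
  refine ⟨ζ, z, hz, ?_⟩
  have h4 := hl.tendsto_seq (Set.mem_univ ζ) hz
  rw [hζ] at h4
  filter_upwards [hz0, h4.eventually_ne (show (-1:ℂ) ≠ 1 by norm_num)] with k h5 h6
  exact ⟨h6, by linear_combination h5⟩

lemma hur3 {𝒰 : Ultrafilter ℕ} (hU : (𝒰 : Filter ℕ) ≤ atTop) {W : ℕ → ℂ → ℂ} {V : ℂ → ℂ} {A : ℂ} (hA : A ≠ 0)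
    (hl : LimOn 𝒰 W V Set.univ) (hV : ∀ z, deriv V z = A * V z) (hV0 : V 0 ≠ 0) :
    ∃ (ζ : ℂ) (z : ℕ → ℂ), ‖V ζ‖ < 1 ∧ Tendsto z 𝒰 (𝓝 ζ) ∧ ∀ᶠ k in (𝒰 : Filter ℕ), W k (z k) ≠ 1 ∧
      6 * (deriv (W k) (z k))^3 + 6 * (1 - W k (z k)) * deriv (W k) (z k) * deriv (deriv (W k)) (z k)
        + (1 - W k (z k))^2 * deriv (deriv (deriv (W k))) (z k) = 0 := by
  have hVd : Differentiable ℂ V := fun z => (hl.differentiableOn z (Set.mem_univ _)).differentiableAt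
  have hsol := exp_sol hVd hV
  obtain ⟨hV2, hV3⟩ := exp_derivs hVd hV
  set s : ℝ := Real.sqrt 3 with hs
  have hs2 : s^2 = 3 := Real.sq_sqrt (by norm_num)
  have hs1 : 1 < s := by
    have := Real.sqrt_nonneg 3
    nlinarith
  have hs3 : s < 2 := by nlinarith
  set β : ℂ := ((s - 2 : ℝ) : ℂ) with hβ
  have hβ0 : β ≠ 0 := by rw [hβ]; norm_cast; linarith
  have hβn : ‖β‖ < 1 := by
    rw [hβ, Complex.norm_real, Real.norm_eq_abs, abs_of_neg (by linarith)]; linarith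
  have hβ4 : β^2 + 4 * β + 1 = 0 := by
    rw [hβ]; norm_cast; nlinarith
  obtain ⟨ζ, hζ⟩ := exp_hit hA hβ0 hV0 hsol
  have hl1 := hl.derivs
  have hl2 := hl1.derivs
  have hl3 := hl2.derivs
  have o := isOpen_univ (X := ℂ)
  have h1m := (LimOn.cst (𝒰 := 𝒰) 1).add o ((LimOn.cst (-1)).mul o hl)
  have hE := (((LimOn.cst 6).mul o (hl1.mul o (hl1.mul o hl1))).add o ((LimOn.cst 6).mul o (h1m.mul o (hl1.mul o hl2)))).add o
    (h1m.mul o (h1m.mul o hl3))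
  obtain ⟨z, hz, hz0⟩ := hE.hurwitz hU (Set.mem_univ ζ) (by
      rw [hV, hV2, hV3, hζ]; linear_combination A^3 * β * hβ4) (by
    intro hev
    have hd : ∀ᶠ w in 𝓝 ζ, A^3 * (V w * (V w ^2 + 4 * V w + 1)) = 0 := by
      filter_upwards [hev] with w hw
      rw [hV, hV2, hV3] at hw
      linear_combination hw
    have hc : (fun w => (V w)^2 + 4 * V w + 1) =ᶠ[𝓝 ζ] fun _ => 0 := by
      have : ∀ᶠ w in 𝓝 ζ, V w ≠ 0 := hVd.continuous.continuousAt.eventually_ne (by rw [hζ]; exact hβ0)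
      filter_upwards [hd, this] with w h1 h2
      exact (mul_eq_zero.1 ((mul_eq_zero.1 h1).resolve_left (pow_ne_zero _ hA))).resolve_left h2
    have h3 : HasDerivAt (fun w => (V w)^2 + 4 * V w + 1) (2 * V ζ * (A * V ζ) + 4 * (A * V ζ)) ζ := by
      have h5 := (hVd ζ).hasDerivAt
      rw [hV] at h5
      refine HasDerivAt.congr_deriv (f := fun w => (V w)^2 + 4 * V w + 1) (((h5.pow 2).add (h5.const_mul 4)).add_const 1) ?_
      push_cast; ring
    have h4 := hc.deriv_eq
    rw [h3.deriv] at h4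
    simp only [deriv_const] at h4
    rw [hζ] at h4
    have h6 : (2 * A * β) * (β + 2) = 0 := by linear_combination h4
    have h7 := (mul_eq_zero.1 h6).resolve_left (by simp [hA, hβ0])
    rw [hβ] at h7
    norm_cast at h7
    linarith)
  refine ⟨ζ, z, by rw [hζ]; exact hβn, hz, ?_⟩
  have h4 := hl.tendsto_seq (Set.mem_univ ζ) hz
  rw [hζ] at h4
  filter_upwards [hz0, h4.eventually_ne (show β ≠ 1 by intro h; rw [h] at hβn; simp at hβn)] with k h5 h6
  exact ⟨h6, by linear_combination h5⟩

/-- logarithm of a nonvanishing function on a ball -/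
lemma ball_log {W : ℂ → ℂ} {r : ℝ} (hr : 0 < r) (hW : ∀ z ∈ ball (0:ℂ) r, AnalyticAt ℂ W z)
    (hW0 : ∀ z ∈ ball (0:ℂ) r, W z ≠ 0) :
    ∃ Φ : ℂ → ℂ, (∀ z ∈ ball (0:ℂ) r, HasDerivAt Φ (deriv W z / W z) z) ∧
      Φ 0 = (Real.log ‖W 0‖ : ℂ) ∧ ∀ z ∈ ball (0:ℂ) r, Real.log ‖W z‖ = (Φ z).re := by
  have hd : DifferentiableOn ℂ (fun z => deriv W z / W z) (ball 0 r) := fun z hz =>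
    ((hW z hz).deriv.div (hW z hz) (hW0 z hz)).differentiableAt.differentiableWithinAt
  obtain ⟨Φ, h0, hΦ⟩ := hd.isExactOn_ball.with_val_at 0 (Real.log ‖W 0‖ : ℂ)
  refine ⟨Φ, hΦ, h0, fun z hz => ?_⟩
  have h1 : ∀ x ∈ ball (0:ℂ) r, HasDerivAt (fun z => W z * Complex.exp (-Φ z)) 0 x := by
    intro x hx
    have e1 := (hW x hx).differentiableAt.hasDerivAt
    have e2 := (hΦ x hx).neg.cexp
    refine HasDerivAt.congr_deriv (f := fun z => W z * Complex.exp (-Φ z)) (e1.mul e2) ?_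
    have := hW0 x hx
    field_simp
    simp
  have h2 : W z * Complex.exp (-Φ z) = W 0 * Complex.exp (-Φ 0) := by
    refine (convex_ball (0:ℂ) r).is_const_of_fderivWithin_eq_zero (𝕜 := ℂ) (f := fun z => W z * Complex.exp (-Φ z)) ?_ ?_ hz (mem_ball_self hr)
    · intro x hx; exact (h1 x hx).differentiableAt.differentiableWithinAt
    · intro x hx
      rw [fderivWithin_of_isOpen isOpen_ball hx]
      have := (h1 x hx).hasFDerivAt.fderiv
      rw [this]; ext; simp
  have h3 := congrArg norm h2
  have hp0 : 0 < ‖W 0‖ := norm_pos_iff.2 (hW0 0 (mem_ball_self hr))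
  have hpz : 0 < ‖W z‖ := norm_pos_iff.2 (hW0 z hz)
  rw [norm_mul, norm_mul, Complex.norm_exp, Complex.norm_exp, h0, ← Complex.ofReal_neg, Complex.ofReal_re,
    Real.exp_neg, Real.exp_log hp0, mul_inv_cancel₀ hp0.ne', Complex.neg_re, Real.exp_neg,
    mul_inv_eq_one₀ (Real.exp_pos _).ne'] at h3
  rw [h3, Real.log_exp]

lemma B1core {W : ℕ → ℂ → ℂ} {r : ℕ → ℝ} (hr : Tendsto r atTop atTop) (hrp : ∀ k, 0 < r k)
    (hW : ∀ k, ∀ z ∈ ball (0:ℂ) (r k), AnalyticAt ℂ (W k) z)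
    (hW0 : ∀ k, ∀ z ∈ ball (0:ℂ) (r k), W k z ≠ 0)
    (hb : ∀ k, ∀ z ∈ ball (0:ℂ) (r k), ‖deriv (W k) z / W k z‖ ≤ 2 * (1 + |Real.log ‖W k z‖|))
    (h1 : ∀ k, ‖deriv (W k) 0 / W k 0‖ = 1 + |Real.log ‖W k 0‖|)
    (h2 : ∀ k, ∀ z ∈ ball (0:ℂ) (r k), W k z ≠ 1 →
      2 * (deriv (W k) z)^2 + (1 - W k z) * deriv (deriv (W k)) z ≠ 0) : False := by
  set 𝒰 : Ultrafilter ℕ := hyperfilter ℕ with h𝒰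
  have hU : (𝒰 : Filter ℕ) ≤ atTop := by
    rw [← Nat.cofinite_eq_atTop]; exact hyperfilter_le_cofinite
  have hrU : Tendsto r 𝒰 atTop := hr.mono_left hU
  choose Φ hΦ hΦ0 hΦre using fun k => ball_log (hrp k) (hW k) (hW0 k)
  set X : ℕ → ℝ := fun k => |Real.log ‖W k 0‖| with hX
  have hX0 : ∀ k, 0 ≤ X k := fun k => abs_nonneg _
  set τ : ℕ → ℝ := fun k => (1 + X k)⁻¹ with hτ
  have hτp : ∀ k, 0 < τ k := fun k => by have := hX0 k; positivity
  have hτ1 : ∀ k, τ k ≤ 1 := fun k => inv_le_one_of_one_le₀ (by linarith [hX0 k])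
  set Ψ : ℕ → ℂ → ℂ := fun k z => (τ k : ℂ) * Φ k z with hΨ
  have hΨd : ∀ k, ∀ z ∈ ball (0:ℂ) (r k), HasDerivAt (Ψ k) (τ k * (deriv (W k) z / W k z)) z :=
    fun k z hz => (hΦ k z hz).const_mul _
  have hΨre : ∀ k, ∀ z ∈ ball (0:ℂ) (r k), (Ψ k z).re = τ k * Real.log ‖W k z‖ := by
    intro k z hz
    simp only [hΨ]
    rw [Complex.re_ofReal_mul, hΦre k z hz]
  have hΨb : ∀ k, ∀ z ∈ ball (0:ℂ) (r k), ‖deriv (Ψ k) z‖ ≤ 2 * (τ k + |(Ψ k z).re|) := by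
    intro k z hz
    rw [(hΨd k z hz).deriv, hΨre k z hz, norm_mul, Complex.norm_real, Real.norm_eq_abs, abs_of_pos (hτp k),
      abs_mul, abs_of_pos (hτp k)]
    have := mul_le_mul_of_nonneg_left (hb k z hz) (hτp k).le
    linarith
  have hΨ0 : ∀ k, ‖Ψ k 0‖ ≤ 1 := by
    intro k
    simp only [hΨ]
    rw [hΦ0, norm_mul, Complex.norm_real, Complex.norm_real, Real.norm_eq_abs, Real.norm_eq_abs, abs_of_pos (hτp k)]
    show (1 + X k)⁻¹ * X k ≤ 1
    have := hX0 k
    rw [inv_mul_le_one₀ (by positivity)]; linarith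
  have hΨ1 : ∀ k, ‖deriv (Ψ k) 0‖ = 1 := by
    intro k
    rw [(hΨd k 0 (mem_ball_self (hrp k))).deriv, norm_mul, Complex.norm_real, Real.norm_eq_abs, abs_of_pos (hτp k), h1]
    exact inv_mul_cancel₀ (by linarith [hX0 k])
  have hloc : LocBdd 𝒰 Ψ Set.univ := by
    intro ζ _
    refine ⟨1, one_pos, (1 + 2 * (‖ζ‖ + 1)) * Real.exp (2 * (‖ζ‖ + 1)), ?_⟩
    filter_upwards [hrU.eventually_gt_atTop (‖ζ‖ + 1)] with k hk
    have hsub : ball (0:ℂ) (‖ζ‖ + 1) ⊆ ball 0 (r k) := ball_subset_ball hk.le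
    have hsub2 : ball ζ 1 ⊆ ball (0:ℂ) (‖ζ‖ + 1) := by
      apply ball_subset_ball'
      rw [dist_zero_right]; linarith
    have hdiff : DifferentiableOn ℂ (Ψ k) (ball 0 (‖ζ‖ + 1)) := fun x hx =>
      (hΨd k x (hsub hx)).differentiableAt.differentiableWithinAt
    refine ⟨hdiff.mono hsub2, fun x hx => ?_⟩
    refine (growth_ball (A := 2) (B := 2) (by norm_num) (by norm_num) hdiff (fun y hy => ?_) x (hsub2 hx)).trans ?_
    · have e1 := hΨb k y (hsub hy)
      have e2 := Complex.abs_re_le_norm (Ψ k y)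
      have e3 := hτ1 k
      linarith
    · have := hΨ0 k
      gcongr
  obtain ⟨Ψl, hΨl⟩ := hloc.exists_lim
  have hΨla := fun z => hΨl.differentiableOn z (Set.mem_univ z)
  have hΨdiff : Differentiable ℂ Ψl := fun z => (hΨla z).differentiableAt
  obtain ⟨τl, hτl1, hτl⟩ := ultra_lim_of_bdd 𝒰 τ 1 (Eventually.of_forall fun k => by
    rw [Real.norm_eq_abs, abs_of_pos (hτp k)]; exact hτ1 k)
  have hτl0 : 0 ≤ τl := ge_of_tendsto' hτl fun k => (hτp k).le
  have hbl : ∀ z, ‖deriv Ψl z‖ ≤ 2 * (τl + |(Ψl z).re|) := by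
    intro z
    have e1 := (hΨl.derivs.tendsto (Set.mem_univ z)).norm
    have e2 : Tendsto (fun k => (Ψ k z).re) 𝒰 (𝓝 (Ψl z).re) :=
      (Complex.continuous_re.tendsto _).comp (hΨl.tendsto (Set.mem_univ z))
    have e3 := (hτl.add e2.abs).const_mul 2
    refine le_of_tendsto_of_tendsto e1 e3 ?_
    filter_upwards [hrU.eventually_gt_atTop ‖z‖] with k hk
    exact hΨb k z (by simpa using hk)
  have hα1 : ‖deriv Ψl 0‖ = 1 := by
    have e1 := (hΨl.derivs.tendsto (Set.mem_univ (0:ℂ))).norm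
    simp only [hΨ1] at e1
    exact (tendsto_nhds_unique e1 tendsto_const_nhds)
  have haff := half_affine hΨdiff hτl0 hbl
  set α := deriv Ψl 0 with hα
  have hα0 : α ≠ 0 := by intro h; rw [h] at hα1; simp at hα1
  have hform : ∀ z, Ψl z = Ψl 0 + α * z := by
    intro z
    have := affine_ball (H := Ψl) (c := 0) (p := α) (r := ‖z‖ + 1) (fun z _ => hΨla z) (fun z _ => haff z) z (by simp)
    simpa using this
  have hτ2 : 1/2 ≤ τl := by
    have e1 := hbl (- (Ψl 0).re / α)
    rw [haff, hα1, hform, mul_div_cancel₀ _ hα0] at e1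
    simp at e1
    linarith
  have hev : ∀ᶠ k in (𝒰 : Filter ℕ), 1/4 < τ k := hτl.eventually_const_lt (by linarith)
  have hWloc : LocBdd 𝒰 W Set.univ := by
    intro ζ hζ
    obtain ⟨s, hs, M, hM⟩ := hloc ζ hζ
    refine ⟨min s 1, by positivity, Real.exp (4 * |M|), ?_⟩
    filter_upwards [hrU.eventually_gt_atTop (‖ζ‖ + 1), hM, hev] with k hk hM hτk
    have hsub : ball ζ (min s 1) ⊆ ball (0:ℂ) (r k) := by
      apply ball_subset_ball'
      rw [dist_zero_right]
      have := min_le_right s 1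
      linarith
    refine ⟨fun x hx => (hW k x (hsub hx)).differentiableAt.differentiableWithinAt, fun x hx => ?_⟩
    have e1 := hΨre k x (hsub hx)
    have e2 := hM.2 x (ball_subset_ball (min_le_left _ _) hx)
    have e3 := Complex.re_le_norm (Ψ k x)
    have hpx : 0 < ‖W k x‖ := norm_pos_iff.2 (hW0 k x (hsub hx))
    rw [← Real.log_le_iff_le_exp hpx]
    have e4 : τ k * Real.log ‖W k x‖ ≤ |M| := by rw [← e1]; exact e3.trans (e2.trans (le_abs_self M))
    have e5 := abs_nonneg M
    by_contra hcon
    push Not at hcon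
    have hlogpos : 0 < Real.log ‖W k x‖ := by linarith
    nlinarith
  obtain ⟨V, hV⟩ := hWloc.exists_lim
  have hτlne : (τl : ℂ) ≠ 0 := by norm_cast; linarith
  have hVd : ∀ z, deriv V z = α / τl * V z := by
    intro z
    have e1 := hV.derivs.tendsto (Set.mem_univ z)
    have e2 := ((hΨl.derivs.tendsto (Set.mem_univ z)).div
      ((Complex.continuous_ofReal.tendsto _).comp hτl) hτlne).mul (hV.tendsto (Set.mem_univ z))
    rw [haff] at e2
    refine tendsto_nhds_unique e1 (e2.congr' ?_)
    filter_upwards [hrU.eventually_gt_atTop ‖z‖] with k hk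
    have hmem : z ∈ ball (0:ℂ) (r k) := by simpa using hk
    simp only [Pi.div_apply, Function.comp]
    rw [(hΨd k z hmem).deriv]
    have hne := hW0 k z hmem
    have hne2 : (τ k : ℂ) ≠ 0 := by norm_cast; exact (hτp k).ne'
    field_simp
  have hV0 : V 0 ≠ 0 := by
    have e1 : Real.exp (-3) ≤ ‖V 0‖ := by
      refine ge_of_tendsto (hV.tendsto (Set.mem_univ (0:ℂ))).norm ?_
      filter_upwards [hev] with k hk
      have hpx : 0 < ‖W k 0‖ := norm_pos_iff.2 (hW0 k 0 (mem_ball_self (hrp k)))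
      rw [← Real.le_log_iff_exp_le hpx]
      have e2 : X k ≤ 3 := by
        have e3 : (1 + X k)⁻¹ > 1/4 := hk
        have := hX0 k
        rw [gt_iff_lt, one_div, inv_lt_inv₀ (by norm_num) (by positivity)] at e3
        linarith
      exact (abs_le.1 e2).1
    exact norm_pos_iff.1 ((Real.exp_pos _).trans_le e1)
  obtain ⟨ζ, z, hz, hzz⟩ := hur2 hU (div_ne_zero hα0 hτlne) hV hVd hV0
  obtain ⟨k, hk1, hk2, hk3⟩ := (hzz.and ((hrU.eventually_gt_atTop (‖ζ‖ + 1)).and (hz.norm.eventually_lt_const (lt_add_one ‖ζ‖)))).exists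
  exact h2 k (z k) (by rw [mem_ball_zero_iff]; linarith) hk1.1 hk1.2

lemma sc_deriv (w : ℂ → ℂ) (c ρ : ℂ) :
    deriv (fun ζ => w (c + ρ * ζ)) = fun ζ => ρ * deriv w (c + ρ * ζ) := by
  funext ζ
  have := deriv_comp_mul_left (f := fun x => w (c + x)) ρ ζ
  simp only [smul_eq_mul] at this
  rw [this, deriv_comp_const_add]

lemma sc_deriv2 (w : ℂ → ℂ) (c ρ : ℂ) :
    deriv (deriv (fun ζ => w (c + ρ * ζ))) = fun ζ => ρ^2 * deriv (deriv w) (c + ρ * ζ) := by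
  rw [sc_deriv]; funext ζ
  rw [deriv_const_mul_field, sc_deriv]; ring

lemma sc_deriv3 (w : ℂ → ℂ) (c ρ : ℂ) :
    deriv (deriv (deriv (fun ζ => w (c + ρ * ζ)))) = fun ζ => ρ^3 * deriv (deriv (deriv w)) (c + ρ * ζ) := by
  rw [sc_deriv2]; funext ζ
  rw [deriv_const_mul_field, sc_deriv]; ring

lemma sc_analytic {w : ℂ → ℂ} {c ρ ζ : ℂ} (h : AnalyticAt ℂ w (c + ρ * ζ)) :
    AnalyticAt ℂ (fun ζ => w (c + ρ * ζ)) ζ := by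
  have h2 : AnalyticAt ℂ (fun ζ : ℂ => c + ρ * ζ) ζ := by fun_prop
  exact AnalyticAt.fun_comp h h2

lemma tB1 {w : ℂ → ℂ} {R : ℝ} (hR : 0 < R) (hw : ∀ z, R < ‖z‖ → AnalyticAt ℂ w z)
    (hw0 : ∀ z, R < ‖z‖ → w z ≠ 0)
    (h2 : ∀ z, R < ‖z‖ → z.im ≠ 0 → w z ≠ 1 → 2 * (deriv w z)^2 + (1 - w z) * deriv (deriv w) z ≠ 0) :
    ∃ C R' : ℝ, ∀ z, R' < ‖z‖ → z.im ≠ 0 →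
      ‖deriv w z / w z‖ ≤ C * (1 + |Real.log ‖w z‖|) / |z.im| := by
  by_contra hcon
  push Not at hcon
  choose z hz him hbig using fun k : ℕ => hcon ((k:ℝ) + 1) (2 * R + k)
  set q : ℂ → ℝ := fun z => ‖deriv w z / w z‖ / (1 + |Real.log ‖w z‖|) with hq
  have hLp : ∀ z, 0 < 1 + |Real.log ‖w z‖| := fun z => by positivity
  have hqc : ∀ z, R < ‖z‖ → ContinuousAt q z := by
    intro z hz
    have c1 : ContinuousAt w z := (hw z hz).continuousAt
    have c2 : ContinuousAt (deriv w) z := (hw z hz).deriv.continuousAt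
    exact ((c2.div c1 (hw0 z hz)).norm).div
      (continuousAt_const.add ((c1.norm.log (norm_ne_zero_iff.2 (hw0 z hz))).abs)) (hLp z).ne'
  have hpt : ∀ k, ∀ u, dist u (z k) ≤ |(z k).im| / 2 → R < ‖u‖ ∧ u.im ≠ 0 := by
    intro k u hu
    have hi : |(z k).im| ≤ ‖z k‖ := Complex.abs_im_le_norm _
    have h1 : ‖z k‖ - ‖u‖ ≤ dist u (z k) := by
      rw [dist_comm, dist_eq_norm]; exact norm_sub_norm_le _ _
    have hk : (0:ℝ) ≤ k := Nat.cast_nonneg k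
    have := hz k
    refine ⟨by linarith, fun h0 => ?_⟩
    have h3 : |(z k - u).im| ≤ dist u (z k) := by
      rw [dist_comm, dist_eq_norm]; exact Complex.abs_im_le_norm _
    rw [Complex.sub_im, h0, sub_zero] at h3
    have := abs_pos.2 (him k)
    linarith
  have hsel : ∀ k : ℕ, ∃ z1 r, 0 < r ∧ dist z1 (z k) + r = |(z k).im| / 2 ∧ ((k:ℝ)+1)/2 ≤ r * q z1 ∧ 0 < q z1 ∧
      ∀ z ∈ closedBall z1 (r/2), q z ≤ 2 * q z1 := by
    intro k
    have hp := abs_pos.2 (him k)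
    apply select_point q (z k) (|(z k).im| / 2) (((k:ℝ)+1)/2) (by positivity)
    · intro u hu; exact (hqc u (hpt k u hu).1).continuousWithinAt
    · positivity
    · have := hbig k
      rw [mul_div_assoc] at this
      have h5 : ((k:ℝ)+1) / |(z k).im| < q (z k) := by
        simp only [hq]
        rw [lt_div_iff₀ (hLp _)]
        calc _ = _ := by ring
          _ < _ := this
      rw [div_lt_iff₀ hp] at h5
      linarith
  choose z1 r hr hd hΛ hqp hqb using hsel
  set ρ : ℕ → ℝ := fun k => (q (z1 k))⁻¹ with hρ
  have hρp : ∀ k, 0 < ρ k := fun k => inv_pos.2 (hqp k)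
  have hmem : ∀ k : ℕ, ∀ ζ ∈ ball (0:ℂ) (((k:ℝ)+1)/4), z1 k + ρ k * ζ ∈ closedBall (z1 k) (r k / 2) := by
    intro k ζ hζ
    rw [mem_closedBall, dist_eq_norm, add_sub_cancel_left, norm_mul, Complex.norm_real, Real.norm_eq_abs,
      abs_of_pos (hρp k)]
    rw [mem_ball_zero_iff] at hζ
    have := hΛ k
    have h6 : ‖ζ‖ ≤ r k / 2 * q (z1 k) := by linarith
    calc ρ k * ‖ζ‖ ≤ ρ k * (r k / 2 * q (z1 k)) := by gcongr
      _ = r k / 2 := by simp only [hρ]; have := (hqp k).ne'; field_simp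
  have hgood : ∀ k : ℕ, ∀ ζ ∈ ball (0:ℂ) (((k:ℝ)+1)/4), R < ‖z1 k + ρ k * ζ‖ ∧ (z1 k + ρ k * ζ).im ≠ 0 := by
    intro k ζ hζ
    apply hpt k
    have h7 := hmem k ζ hζ
    rw [mem_closedBall] at h7
    have := dist_triangle (z1 k + ρ k * ζ) (z1 k) (z k)
    have := hd k
    have := hr k
    linarith
  have hone : ∀ k, ∀ ζ, deriv (fun ζ => w (z1 k + ρ k * ζ)) ζ / w (z1 k + ρ k * ζ) = ρ k * (deriv w (z1 k + ρ k * ζ) / w (z1 k + ρ k * ζ)) := by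
    intro k ζ; rw [sc_deriv]; ring
  have hnrm : ∀ k u, ‖(ρ k : ℂ) * (deriv w u / w u)‖ = ρ k * (q u * (1 + |Real.log ‖w u‖|)) := by
    intro k u
    rw [norm_mul, Complex.norm_real, Real.norm_eq_abs, abs_of_pos (hρp k)]
    simp only [hq]
    rw [div_mul_cancel₀ _ (hLp u).ne']
  apply B1core (W := fun k ζ => w (z1 k + ρ k * ζ)) (r := fun k : ℕ => ((k:ℝ)+1)/4)
  · exact (tendsto_atTop_add_const_right _ _ tendsto_natCast_atTop_atTop).atTop_div_const (by norm_num)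
  · intro k; positivity
  · intro k ζ hζ; exact sc_analytic (hw _ (hgood k ζ hζ).1)
  · intro k ζ hζ; exact hw0 _ (hgood k ζ hζ).1
  · intro k ζ hζ
    rw [hone, hnrm]
    have h8 := hqb k _ (hmem k ζ hζ)
    have : ρ k * q (z1 k + ρ k * ζ) ≤ 2 := by
      calc ρ k * q (z1 k + ρ k * ζ) ≤ ρ k * (2 * q (z1 k)) := by gcongr
        _ = 2 := by simp only [hρ]; have := (hqp k).ne'; field_simp
    rw [← mul_assoc]
    have := (hLp (z1 k + ρ k * ζ)).le
    gcongr
  · intro k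
    rw [hone, hnrm]
    simp only [mul_zero, add_zero]
    rw [← mul_assoc]
    simp only [hρ]
    rw [inv_mul_cancel₀ (hqp k).ne', one_mul]
  · intro k ζ hζ h1
    have h9 := h2 _ (hgood k ζ hζ).1 (hgood k ζ hζ).2 h1
    rw [sc_deriv2, sc_deriv]
    intro h0
    apply h9
    have hρ0 : (ρ k : ℂ)^2 ≠ 0 := by
      have : (ρ k : ℂ) ≠ 0 := by exact_mod_cast (hρp k).ne'
      positivity
    apply mul_left_cancel₀ hρ0
    rw [mul_zero, ← h0]; ring

lemma log_path {w : ℂ → ℂ} {C T : ℝ} (hC : 0 < C) (hT : 0 ≤ T) {γ γ' : ℝ → ℂ}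
    (hg : ∀ t, HasDerivAt γ (γ' t) t)
    (ha : ∀ t ∈ Set.Icc 0 T, AnalyticAt ℂ w (γ t)) (h0 : ∀ t ∈ Set.Icc 0 T, w (γ t) ≠ 0)
    (him : ∀ t ∈ Set.Icc 0 T, (γ t).im ≠ 0)
    (hb : ∀ t ∈ Set.Icc 0 T, ‖deriv w (γ t) / w (γ t)‖ ≤ C * (1 + |Real.log ‖w (γ t)‖|) / |(γ t).im|)
    (hg' : ∀ t ∈ Set.Icc 0 T, ‖γ' t‖ ≤ |(γ t).im|) :
    1 + |Real.log ‖w (γ T)‖| ≤ (1 + |Real.log ‖w (γ 0)‖|) * Real.exp (C * T) := by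
  have hd : ∀ t ∈ Set.Icc 0 T, ∃ d, HasDerivAt (fun t => Real.log ‖w (γ t)‖) d t ∧
      ‖d‖ ≤ C * ‖Real.log ‖w (γ t)‖‖ + C := by
    intro t ht
    have h1 : HasDerivAt (fun t => w (γ t)) (deriv w (γ t) * γ' t) t :=
      (ha t ht).differentiableAt.hasDerivAt.comp t (hg t)
    have h2 := h1.norm_sq
    have hp : 0 < ‖w (γ t)‖ := norm_pos_iff.2 (h0 t ht)
    have h3 := (h2.log (by positivity)).div_const 2
    refine ⟨_, HasDerivAt.congr_of_eventuallyEq h3 (Eventually.of_forall fun s => ?_), ?_⟩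
    · simp [Real.log_pow]
    · have hip := abs_real_inner_le_norm (w (γ t)) (deriv w (γ t) * γ' t)
      have hy := abs_pos.2 (him t ht)
      have h4 := hb t ht
      rw [Real.norm_eq_abs, abs_div, abs_div, abs_mul, abs_of_pos (by positivity : 0 < ‖w (γ t)‖^2)]
      simp only [abs_two]
      have h5 : ‖deriv w (γ t) / w (γ t)‖ * ‖γ' t‖ ≤ C * (1 + |Real.log ‖w (γ t)‖|) := by
        calc _ ≤ (C * (1 + |Real.log ‖w (γ t)‖|) / |(γ t).im|) * |(γ t).im| := by
              gcongr
              · exact hg' t ht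
          _ = _ := by field_simp
      rw [norm_div] at h5
      rw [norm_mul] at hip
      calc _ ≤ 2 * (‖w (γ t)‖ * (‖deriv w (γ t)‖ * ‖γ' t‖)) / ‖w (γ t)‖^2 / 2 := by gcongr
        _ = ‖deriv w (γ t)‖ / ‖w (γ t)‖ * ‖γ' t‖ := by field_simp
        _ ≤ _ := h5
        _ = _ := by rw [Real.norm_eq_abs]; ring
  choose! d hd1 hd2 using hd
  have := norm_le_gronwallBound_of_norm_deriv_right_le (f := fun t => Real.log ‖w (γ t)‖) (f' := d)
    (δ := ‖Real.log ‖w (γ 0)‖‖) (K := C) (ε := C) (a := 0) (b := T)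
    (fun t ht => (hd1 t ht).continuousAt.continuousWithinAt)
    (fun t ht => (hd1 t ⟨ht.1, ht.2.le⟩).hasDerivWithinAt) le_rfl
    (fun t ht => hd2 t ⟨ht.1, ht.2.le⟩) T ⟨hT, le_rfl⟩
  rw [gronwallBound_of_K_ne_0 hC.ne', div_self hC.ne', sub_zero] at this
  simp only [one_mul, Real.norm_eq_abs] at this
  linarith

lemma tB2 {w : ℂ → ℂ} {R C : ℝ} (hR : 1 ≤ R) (hC : 0 < C) (hw : ∀ z, R < ‖z‖ → AnalyticAt ℂ w z)
    (hw0 : ∀ z, R < ‖z‖ → w z ≠ 0)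
    (hb : ∀ z, R < ‖z‖ → z.im ≠ 0 → ‖deriv w z / w z‖ ≤ C * (1 + |Real.log ‖w z‖|) / |z.im|) :
    ∃ (K : ℝ) (N : ℕ), 0 ≤ K ∧ ∀ z, R + 1 ≤ ‖z‖ → ‖deriv w z / w z‖ * |z.im|^(N+1) ≤ K * ‖z‖^(2*N) := by
  obtain ⟨N, hN⟩ := exists_nat_ge C
  set r0 := R + 1 with hr0
  have hr0p : 0 < r0 := by linarith
  set L : ℂ → ℝ := fun z => 1 + |Real.log ‖w z‖| with hL
  have hLp : ∀ z, 0 < L z := fun z => by simp only [hL]; positivity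
  set L0 := L (r0 * I) + L (-r0 * I) with hL0
  have hL0p : 0 < L0 := add_pos (hLp _) (hLp _)
  refine ⟨C * (L0 * Real.exp C), N, by positivity, fun z hz => ?_⟩
  by_cases hy0 : z.im = 0
  · rw [hy0]; simp; positivity
  set r := ‖z‖ with hr
  have hrp : 0 < r := by linarith
  have hyp : 0 < |z.im| := abs_pos.2 hy0
  have hyr : |z.im| ≤ r := Complex.abs_im_le_norm _
  obtain ⟨σ, hσ, hσy, hLσ⟩ : ∃ σ : ℝ, |σ| = 1 ∧ z.im = σ * |z.im| ∧ L ((σ * r0 : ℝ) * I) ≤ L0 := by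
    rcases lt_or_gt_of_ne hy0 with h | h
    · refine ⟨-1, by simp, by rw [abs_of_neg h]; ring, ?_⟩
      have := hLp (r0 * I)
      have e : (((-1 * r0 : ℝ) : ℂ) * I) = -r0 * I := by push_cast; ring
      rw [e, hL0]; linarith
    · refine ⟨1, by simp, by rw [abs_of_pos h]; ring, ?_⟩
      have := hLp (-r0 * I)
      have e : (((1 * r0 : ℝ) : ℂ) * I) = r0 * I := by push_cast; ring
      rw [e, hL0]; linarith
  have hσ0 : σ ≠ 0 := by rintro rfl; simp at hσ
  -- step 1
  have s1 : L ((σ * r : ℝ) * I) ≤ L0 * Real.exp (C * Real.log (r / r0)) := by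
    have hT : 0 ≤ Real.log (r / r0) := Real.log_nonneg (by rw [le_div_iff₀ hr0p]; linarith)
    have hgi : ∀ t : ℝ, (((σ * r0 * Real.exp t : ℝ) : ℂ) * I).im = σ * r0 * Real.exp t := by intro t; simp [-Complex.ofReal_mul, -Complex.ofReal_exp]
    have hgn : ∀ t : ℝ, ‖(((σ * r0 * Real.exp t : ℝ) : ℂ) * I)‖ = r0 * Real.exp t := by
      intro t
      rw [norm_mul, Complex.norm_I, mul_one, Complex.norm_real, Real.norm_eq_abs, abs_mul, abs_mul, hσ, one_mul,
        abs_of_pos hr0p, abs_of_pos (Real.exp_pos t)]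
    have hgR : ∀ t ∈ Set.Icc 0 (Real.log (r/r0)), R < ‖(((σ * r0 * Real.exp t : ℝ) : ℂ) * I)‖ := by
      intro t ht
      rw [hgn]
      have := Real.one_le_exp ht.1
      nlinarith
    have hgi0 : ∀ t : ℝ, (((σ * r0 * Real.exp t : ℝ) : ℂ) * I).im ≠ 0 := by
      intro t; rw [hgi]; positivity
    have := log_path (w := w) (C := C) (T := Real.log (r/r0)) hC hT
      (γ := fun t => ((σ * r0 * Real.exp t : ℝ) : ℂ) * I) (γ' := fun t => ((σ * r0 * Real.exp t : ℝ) : ℂ) * I)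
      (fun t => by
        have := ((Real.hasDerivAt_exp t).const_mul (σ * r0)).ofReal_comp
        exact this.mul_const I)
      (fun t ht => hw _ (hgR t ht)) (fun t ht => hw0 _ (hgR t ht)) (fun t ht => hgi0 t)
      (fun t ht => hb _ (hgR t ht) (hgi0 t))
      (fun t ht => by
        rw [hgn, hgi, abs_mul, abs_mul, hσ, one_mul, abs_of_pos hr0p, abs_of_pos (Real.exp_pos t)])
    rw [Real.exp_log (by positivity), Real.exp_zero] at this
    have e : σ * r0 * (r / r0) = σ * r := by field_simp
    rw [e, mul_one] at this
    exact this.trans (by gcongr)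
  -- step 2
  have s2 : L ((z.re : ℂ) + (σ * r : ℝ) * I) ≤ L ((σ * r : ℝ) * I) * Real.exp (C * 1) := by
    have hgi : ∀ t : ℝ, (((t * z.re : ℝ) : ℂ) + (σ * r : ℝ) * I).im = σ * r := by intro t; simp [-Complex.ofReal_mul]
    have hgia : ∀ t : ℝ, |(((t * z.re : ℝ) : ℂ) + (σ * r : ℝ) * I).im| = r := by intro t; rw [hgi, abs_mul, hσ, one_mul, abs_of_pos hrp]
    have hgR : ∀ t : ℝ, R < ‖((t * z.re : ℝ) : ℂ) + (σ * r : ℝ) * I‖ := by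
      intro t
      have := Complex.abs_im_le_norm (((t * z.re : ℝ) : ℂ) + (σ * r : ℝ) * I)
      rw [hgia] at this; linarith
    have hgi0 : ∀ t : ℝ, (((t * z.re : ℝ) : ℂ) + (σ * r : ℝ) * I).im ≠ 0 := by
      intro t; rw [hgi]; positivity
    have := log_path (w := w) (C := C) (T := 1) hC zero_le_one
      (γ := fun t => ((t * z.re : ℝ) : ℂ) + (σ * r : ℝ) * I) (γ' := fun t => (z.re : ℂ))
      (fun t => by
        have := ((hasDerivAt_id t).mul_const z.re).ofReal_comp
        simp only [one_mul] at this
        exact this.add_const _)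
      (fun t ht => hw _ (hgR t)) (fun t ht => hw0 _ (hgR t)) (fun t ht => hgi0 t)
      (fun t ht => hb _ (hgR t) (hgi0 t))
      (fun t ht => by
        rw [hgia, Complex.norm_real]; exact Complex.abs_re_le_norm _)
    simpa [hL] using this
  have s3 : L z ≤ L ((z.re : ℂ) + (σ * r : ℝ) * I) * Real.exp (C * Real.log (r / |z.im|)) := by
    have hT : 0 ≤ Real.log (r / |z.im|) := Real.log_nonneg (by rw [le_div_iff₀ hyp]; linarith)
    have hgi : ∀ t : ℝ, ((z.re:ℂ) + ((σ * r * Real.exp (-t) : ℝ) : ℂ) * I).im = σ * r * Real.exp (-t) := by intro t; simp [-Complex.ofReal_mul, -Complex.ofReal_exp]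
    have hgia : ∀ t : ℝ, |((z.re:ℂ) + ((σ * r * Real.exp (-t) : ℝ) : ℂ) * I).im| = r * Real.exp (-t) := by
      intro t; rw [hgi, abs_mul, abs_mul, hσ, one_mul, abs_of_pos hrp, abs_of_pos (Real.exp_pos _)]
    have hgR : ∀ t ∈ Set.Icc 0 (Real.log (r/|z.im|)), R < ‖(z.re:ℂ) + ((σ * r * Real.exp (-t) : ℝ) : ℂ) * I‖ := by
      intro t ht
      have h1 : |z.im| ≤ |((z.re:ℂ) + ((σ * r * Real.exp (-t) : ℝ) : ℂ) * I).im| := by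
        rw [hgia, Real.exp_neg]
        have h2 : Real.exp t ≤ r / |z.im| := by
          rw [← Real.exp_log (by positivity : 0 < r / |z.im|)]; exact Real.exp_le_exp.2 ht.2
        rw [le_div_iff₀ hyp] at h2
        rw [← div_eq_mul_inv, le_div_iff₀ (Real.exp_pos t)]; linarith
      have h3 : r ≤ ‖(z.re:ℂ) + ((σ * r * Real.exp (-t) : ℝ) : ℂ) * I‖ := by
        rw [hr]
        apply (pow_le_pow_iff_left₀ (norm_nonneg _) (norm_nonneg _) two_ne_zero).1
        rw [Complex.sq_norm, Complex.sq_norm, Complex.normSq_apply, Complex.normSq_apply]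
        have e : ((z.re:ℂ) + ((σ * r * Real.exp (-t) : ℝ) : ℂ) * I).re = z.re := by simp [-Complex.ofReal_mul, -Complex.ofReal_exp]
        rw [e]
        have := sq_le_sq.2 h1
        nlinarith
      linarith
    have hgi0 : ∀ t : ℝ, ((z.re:ℂ) + ((σ * r * Real.exp (-t) : ℝ) : ℂ) * I).im ≠ 0 := by
      intro t; rw [hgi]; positivity
    have := log_path (w := w) (C := C) (T := Real.log (r/|z.im|)) hC hT
      (γ := fun t => (z.re:ℂ) + ((σ * r * Real.exp (-t) : ℝ) : ℂ) * I) (γ' := fun t => ((σ * r * (-Real.exp (-t)) : ℝ) : ℂ) * I)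
      (fun t => by
        have h1 : HasDerivAt (fun t => Real.exp (-t)) (-Real.exp (-t)) t := by
          have := (hasDerivAt_id t).neg.exp
          simpa using this
        have := (h1.const_mul (σ * r)).ofReal_comp
        exact (this.mul_const I).const_add _)
      (fun t ht => hw _ (hgR t ht)) (fun t ht => hw0 _ (hgR t ht)) (fun t ht => hgi0 t)
      (fun t ht => hb _ (hgR t ht) (hgi0 t))
      (fun t ht => by
        rw [hgia, norm_mul, Complex.norm_I, mul_one, Complex.norm_real, Real.norm_eq_abs, abs_mul, abs_mul, abs_neg, hσ, one_mul,
          abs_of_pos hrp, abs_of_pos (Real.exp_pos _)])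
    rw [Real.exp_neg, Real.exp_log (by positivity), neg_zero, Real.exp_zero] at this
    have e : σ * r * (r / |z.im|)⁻¹ = z.im := by rw [hσy]; rw [abs_mul, hσ, one_mul, abs_abs]; field_simp
    rw [e, mul_one, Complex.re_add_im] at this
    exact this
  have pw : ∀ x : ℝ, 1 ≤ x → Real.exp (C * Real.log x) ≤ x ^ N := by
    intro x hx
    calc Real.exp (C * Real.log x) ≤ Real.exp (N * Real.log x) := by
          gcongr; exact Real.log_nonneg hx
      _ = x ^ N := by rw [mul_comm, Real.exp_mul, Real.exp_log (by linarith), Real.rpow_natCast]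
  have t1 := pw (r/r0) (by rw [le_div_iff₀ hr0p]; linarith)
  have t3 := pw (r/|z.im|) (by rw [le_div_iff₀ hyp]; linarith)
  have t1' : (r/r0)^N ≤ r^N := by
    gcongr; exact div_le_self hrp.le (by linarith)
  have hfin : L z ≤ L0 * r^N * Real.exp C * (r/|z.im|)^N := by
    rw [mul_one] at s2
    calc L z ≤ _ := s3
      _ ≤ (L0 * Real.exp (C * Real.log (r / r0)) * Real.exp C) * Real.exp (C * Real.log (r / |z.im|)) := by
          gcongr; exact s2.trans (by gcongr)
      _ ≤ _ := by gcongr; exact t1.trans t1'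
  have := hb z (by linarith) hy0
  calc ‖deriv w z / w z‖ * |z.im|^(N+1) ≤ (C * (L0 * r^N * Real.exp C * (r/|z.im|)^N) / |z.im|) * |z.im|^(N+1) := by
        gcongr; exact this.trans (by gcongr)
    _ = _ := by rw [div_pow]; field_simp; ring

lemma tB2' {w : ℂ → ℂ} {R C : ℝ} (hR : 1 ≤ R) (hC : 0 < C) (hw : ∀ z, R < ‖z‖ → AnalyticAt ℂ w z)
    (hw0 : ∀ z, R < ‖z‖ → w z ≠ 0)
    (hb : ∀ z, R < ‖z‖ → z.im ≠ 0 → ‖deriv w z / w z‖ ≤ C * (1 + |Real.log ‖w z‖|) / |z.im|) :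
    ∃ (M : ℝ) (P : ℕ) (R' : ℝ), ∀ z, R' < ‖z‖ → ‖deriv w z / w z‖ ≤ M * ‖z‖^P := by
  obtain ⟨K, N, hK, hKb⟩ := tB2 hR hC hw hw0 hb
  set a : ℂ → ℂ := fun z => deriv w z / w z with ha
  have han : ∀ z, R < ‖z‖ → AnalyticAt ℂ a z := fun z hz => (hw z hz).deriv.div (hw z hz) (hw0 z hz)
  have hcs : ContinuousOn a (sphere 0 (R+1)) := fun z hz =>
    (han z (by rw [mem_sphere_zero_iff_norm] at hz; linarith)).continuousAt.continuousWithinAt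
  obtain ⟨A, hA⟩ := (isCompact_sphere (0:ℂ) (R+1)).exists_bound_of_continuousOn hcs
  refine ⟨(K + |A|) * 4^(N+1) * 2^(4*N+2), 4*N+2, R+1, fun z hz => ?_⟩
  set r := 2 * ‖z‖ with hr
  have hr1 : 1 ≤ r := by linarith
  have hAp := abs_nonneg A
  have hmax := annulus_max (h := fun u => a u * (u^2 - r^2)^(N+1)) (R := R) (r1 := R+1) (r2 := r)
    (M := (K + |A|) * 2^(N+1) * r^(4*N+2))
    (fun u hu => (han u hu).mul (by fun_prop)) (by linarith)
    (fun u hu => by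
      have h1 := hA u (by rw [mem_sphere_zero_iff_norm, hu])
      have h2 : ‖u^2 - (r:ℂ)^2‖ ≤ 2 * r^2 := by
        refine (norm_sub_le _ _).trans ?_
        rw [norm_pow, norm_pow, hu, Complex.norm_real, Real.norm_eq_abs, abs_of_pos (by linarith)]
        nlinarith
      rw [norm_mul, norm_pow]
      calc _ ≤ |A| * (2 * r^2)^(N+1) := by gcongr; exact h1.trans (le_abs_self A)
        _ = |A| * 2^(N+1) * r^(2*N+2) := by rw [mul_pow]; ring
        _ ≤ _ := by gcongr <;> first | linarith | omega)
    (fun u hu => by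
      have h1 := hKb u (by linarith)
      rw [hu] at h1
      have h2 : ‖u^2 - (r:ℂ)^2‖ = 2 * r * |u.im| := by
        have hn : u.re^2 + u.im^2 = r^2 := by
          rw [← hu, Complex.sq_norm, Complex.normSq_apply]; ring
        have e : u^2 - (r:ℂ)^2 = u * ((2 * u.im : ℝ) * I) := by
          rw [← Complex.ofReal_pow, ← hn]
          apply Complex.ext <;> simp [pow_two] <;> ring
        rw [e, norm_mul, norm_mul, Complex.norm_I, Complex.norm_real, Real.norm_eq_abs, abs_mul, hu]
        simp; ring
      rw [norm_mul, norm_pow, h2, mul_pow]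
      calc _ = (‖a u‖ * |u.im|^(N+1)) * (2*r)^(N+1) := by ring
        _ ≤ (K * r^(2*N)) * (2*r)^(N+1) := by gcongr
        _ = K * 2^(N+1) * r^(3*N+1) := by clear_value r; rw [mul_pow]; ring
        _ ≤ _ := by gcongr <;> first | linarith | omega)
    z hz.le (by linarith [norm_nonneg z])
  rw [norm_mul, norm_pow] at hmax
  have hlow : (1/2:ℝ) ≤ ‖z^2 - (r:ℂ)^2‖ := by
    have h1 := norm_sub_norm_le ((r:ℂ)^2) (z^2)
    rw [norm_sub_rev, norm_pow, norm_pow, Complex.norm_real, Real.norm_eq_abs, abs_of_pos (by linarith)] at h1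
    rw [hr] at h1 hr1
    nlinarith
  have hlow' : (1/2:ℝ)^(N+1) ≤ ‖z^2 - (r:ℂ)^2‖^(N+1) := by gcongr
  have h3 : ‖a z‖ * (1/2:ℝ)^(N+1) ≤ (K + |A|) * 2^(N+1) * r^(4*N+2) :=
    le_trans (by gcongr) hmax
  calc ‖a z‖ = (‖a z‖ * (1/2:ℝ)^(N+1)) * 2^(N+1) := by rw [mul_assoc, ← mul_pow]; norm_num
    _ ≤ ((K + |A|) * 2^(N+1) * r^(4*N+2)) * 2^(N+1) := by gcongr
    _ = _ := by
      rw [hr, mul_pow]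
      have : (4:ℝ)^(N+1) = 2^(N+1) * 2^(N+1) := by rw [← mul_pow]; norm_num
      rw [this]; ring

lemma ev_cob {P : ℂ → Prop} : (∀ᶠ z in Bornology.cobounded ℂ, P z) ↔ ∃ R : ℝ, ∀ z, R < ‖z‖ → P z := by
  constructor
  · intro h
    rw [← comap_norm_atTop, eventually_comap] at h
    obtain ⟨R, hR⟩ := eventually_atTop.1 h
    exact ⟨R, fun z hz => hR _ hz.le z rfl⟩
  · rintro ⟨R, hR⟩
    rw [← comap_norm_atTop, eventually_comap]
    filter_upwards [eventually_gt_atTop R] with r hr z hz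
    exact hR z (by rw [hz]; exact hr)

lemma poly_slow {a : ℂ → ℂ} {R M : ℝ} {P : ℕ} (ha : ∀ z, R < ‖z‖ → AnalyticAt ℂ a z)
    (hb : ∀ z, R < ‖z‖ → ‖a z‖ ≤ M * ‖z‖^P) :
    (∀ᶠ z in Bornology.cobounded ℂ, a z = 0) ∨ Slow a := by
  have hinv : Tendsto (fun z : ℂ => z⁻¹) (Bornology.cobounded ℂ) (𝓝[≠] 0) := tendsto_inv₀_cobounded'
  have hinv0 : Tendsto (fun z : ℂ => z⁻¹) (Bornology.cobounded ℂ) (𝓝 0) := tendsto_inv₀_cobounded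
  set H : ℂ → ℂ := fun ζ => ζ^P * a ζ⁻¹ with hH
  have hev : ∀ᶠ ζ in 𝓝[≠] (0:ℂ), R < ‖ζ⁻¹‖ ∧ ζ ≠ 0 := by
    have h1 : Tendsto (fun z : ℂ => z⁻¹) (𝓝[≠] 0) (Bornology.cobounded ℂ) := tendsto_inv₀_nhdsNE_zero
    have h2 := (tendsto_norm_atTop_iff_cobounded.2 h1).eventually_gt_atTop R
    exact h2.and self_mem_nhdsWithin
  have hHd : ∀ᶠ ζ in 𝓝[≠] (0:ℂ), DifferentiableAt ℂ H ζ := by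
    filter_upwards [hev] with ζ hζ
    exact (differentiableAt_id.pow P).mul
      ((ha _ hζ.1).differentiableAt.comp ζ (differentiableAt_inv hζ.2))
  have hHb : ∀ᶠ ζ in 𝓝[≠] (0:ℂ), ‖H ζ‖ ≤ M := by
    filter_upwards [hev] with ζ hζ
    have := hb _ hζ.1
    have hp : 0 < ‖ζ‖ := norm_pos_iff.2 hζ.2
    simp only [hH]
    rw [norm_mul, norm_pow]
    calc ‖ζ‖^P * ‖a ζ⁻¹‖ ≤ ‖ζ‖^P * (M * ‖ζ⁻¹‖^P) := by gcongr
      _ = M := by rw [norm_inv, inv_pow]; field_simp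
  obtain ⟨g, hg, hgH⟩ : ∃ g, AnalyticAt ℂ g 0 ∧ ∀ᶠ ζ in 𝓝[≠] (0:ℂ), H ζ = g ζ := by
    obtain ⟨s, hs, hsd⟩ := (hHd.and hHb).exists_mem
    have hs' : insert 0 s ∈ 𝓝 (0:ℂ) := insert_mem_nhds_iff.2 hs
    have hsub : insert 0 s \ {0} ⊆ s := by
      intro x hx; rcases hx with ⟨h1 | h1, h2⟩
      · exact absurd h1 h2
      · exact h1
    have hdif := Complex.differentiableOn_update_limUnder_of_bddAbove (f := H) (s := insert 0 s) (c := 0) hs'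
      (fun x hx => (hsd x (hsub hx)).1.differentiableWithinAt)
      ⟨M, by rintro _ ⟨x, hx, rfl⟩; exact (hsd x (hsub hx)).2⟩
    refine ⟨_, hdif.analyticAt hs', ?_⟩
    filter_upwards [self_mem_nhdsWithin] with x hx
    rw [Function.update_of_ne hx]
  have hag : ∀ᶠ z in Bornology.cobounded ℂ, a z = z^P * g z⁻¹ ∧ z ≠ 0 := by
    filter_upwards [hinv.eventually hgH, Bornology.eventually_ne_cobounded (0:ℂ)] with z hz hz0
    refine ⟨?_, hz0⟩
    rw [← hz]; simp only [hH, inv_inv]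
    rw [← mul_assoc, ← mul_pow, mul_inv_cancel₀ hz0, one_pow, one_mul]
  by_cases hg0 : ∀ᶠ ζ in 𝓝 (0:ℂ), g ζ = 0
  · left
    filter_upwards [hag, hinv0.eventually hg0] with z h1 h2
    rw [h1.1, h2, mul_zero]
  right
  obtain ⟨n, g1, hg1, hg10, hgg⟩ := (hg.exists_eventuallyEq_pow_smul_nonzero_iff).2 hg0
  simp only [sub_zero, smul_eq_mul] at hgg
  set d : ℤ := (P:ℤ) - n with hd
  have hag2 : ∀ᶠ z in Bornology.cobounded ℂ, a z = z^d * g1 z⁻¹ ∧ z ≠ 0 := by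
    filter_upwards [hag, hinv0.eventually hgg] with z h1 h2
    refine ⟨?_, h1.2⟩
    rw [h1.1, h2, hd, zpow_sub₀ h1.2, zpow_natCast, zpow_natCast, inv_pow]; field_simp
  have hg1c : Tendsto (fun z : ℂ => g1 z⁻¹) (Bornology.cobounded ℂ) (𝓝 (g1 0)) :=
    hg1.continuousAt.tendsto.comp hinv0
  have hg1c' : Tendsto (fun z : ℂ => deriv g1 z⁻¹) (Bornology.cobounded ℂ) (𝓝 (deriv g1 0)) :=
    hg1.deriv.continuousAt.tendsto.comp hinv0
  have hg1a : ∀ᶠ z : ℂ in Bornology.cobounded ℂ, AnalyticAt ℂ g1 z⁻¹ := hinv0.eventually hg1.eventually_analyticAt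
  have hg1n := hg1c.eventually_ne hg10
  refine ⟨d, g1 0, hg10, ?_, ?_, ?_⟩
  · refine hg1c.congr' ?_
    filter_upwards [hag2] with z hz
    rw [hz.1]; have := zpow_ne_zero d hz.2; field_simp
  · have hev2 : ∀ᶠ z in Bornology.cobounded ℂ, ∀ᶠ u in 𝓝 z, a u = u^d * g1 u⁻¹ ∧ u ≠ 0 := by
      obtain ⟨R1, hR1⟩ := ev_cob.1 hag2
      refine ev_cob.2 ⟨R1, fun z hz => ?_⟩
      filter_upwards [(isOpen_lt continuous_const continuous_norm).mem_nhds hz] with u hu using hR1 u hu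
    have hlim : Tendsto (fun z : ℂ => (d:ℂ) - deriv g1 z⁻¹ * z⁻¹ / g1 z⁻¹) (Bornology.cobounded ℂ) (𝓝 d) := by
      have := ((hg1c'.mul hinv0).div hg1c hg10).const_sub (d:ℂ)
      simpa using this
    refine hlim.congr' ?_
    filter_upwards [hev2, hag2, hg1a, hg1n] with z h1 h2 h3 h4
    have e1 : HasDerivAt (fun u : ℂ => u^d * g1 u⁻¹) (d * z^(d-1) * g1 z⁻¹ + z^d * (deriv g1 z⁻¹ * (-(z^2)⁻¹))) z := by
      have t1 := hasDerivAt_zpow d z (Or.inl h2.2)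
      have t2 := h3.differentiableAt.hasDerivAt.comp z (hasDerivAt_inv h2.2)
      exact t1.mul t2
    have e2 : deriv a z = _ := (e1.congr_of_eventuallyEq (h1.mono fun u hu => hu.1)).deriv
    rw [e2, h2.1, zpow_sub_one₀ h2.2]
    have h5 := zpow_ne_zero d h2.2
    have h6 := h2.2
    generalize g1 z⁻¹ = G at *
    generalize deriv g1 z⁻¹ = G' at *
    generalize z^d = Z at *
    field_simp
    ring
  · filter_upwards [hag2, hg1n, ev_cob.2 ⟨R, ha⟩] with z h1 h2 h3
    refine ⟨h3, ?_⟩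
    rw [h1.1]; exact mul_ne_zero (zpow_ne_zero d h1.2) h2

lemma Slow.bound {a : ℂ → ℂ} (h : Slow a) : ∃ (C : ℝ) (n : ℕ) (R : ℝ), 0 < C ∧ 1 ≤ R ∧ ∀ z, R < ‖z‖ →
    AnalyticAt ℂ a z ∧ a z ≠ 0 ∧ ‖a z‖ ≤ C * ‖z‖^n ∧ ‖(a z)⁻¹‖ ≤ C * ‖z‖^n := by
  obtain ⟨d, c, hc, h1, _, h3⟩ := h
  have h4 := h1.norm.eventually_le_const (lt_add_one ‖c‖)
  have hcp := norm_pos_iff.2 hc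
  have h5 := h1.norm.eventually_const_le (half_lt_self hcp)
  obtain ⟨R, hR⟩ := ev_cob.1 ((h3.and h4).and h5)
  refine ⟨(‖c‖+1) + 2/‖c‖, d.natAbs, max R 1, by positivity, le_max_right _ _, fun z hz => ?_⟩
  obtain ⟨⟨⟨g1, g2⟩, g3⟩, g4⟩ := hR z (lt_of_le_of_lt (le_max_left _ _) hz)
  have hz1 : 1 < ‖z‖ := lt_of_le_of_lt (le_max_right _ _) hz
  have hzp : 0 < ‖z‖ := by linarith
  rw [norm_div, norm_zpow] at g3 g4
  have hzd : 0 < ‖z‖^d := zpow_pos hzp d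
  rw [div_le_iff₀ hzd] at g3
  rw [le_div_iff₀ hzd] at g4
  have k1 : ‖z‖^d ≤ ‖z‖^(d.natAbs) := by
    rw [← zpow_natCast]; exact zpow_le_zpow_right₀ hz1.le (by omega)
  have k2 : (‖z‖^d)⁻¹ ≤ ‖z‖^(d.natAbs) := by
    rw [← zpow_neg, ← zpow_natCast]; exact zpow_le_zpow_right₀ hz1.le (by omega)
  refine ⟨g1, g2, ?_, ?_⟩
  · calc ‖a z‖ ≤ (‖c‖+1) * ‖z‖^d := g3
      _ ≤ _ := mul_le_mul (by linarith [show 0 < 2/‖c‖ by positivity]) k1 hzd.le (by positivity)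
  · rw [norm_inv]
    calc ‖a z‖⁻¹ ≤ (‖c‖/2 * ‖z‖^d)⁻¹ := by gcongr
      _ = 2/‖c‖ * (‖z‖^d)⁻¹ := by field_simp
      _ ≤ _ := mul_le_mul (by linarith) k2 (by positivity) (by positivity)

lemma tB {w : ℂ → ℂ} {R : ℝ} (hR : 0 < R) (hw : ∀ z, R < ‖z‖ → AnalyticAt ℂ w z)
    (hw0 : ∀ z, R < ‖z‖ → w z ≠ 0)
    (hr : ∀ z, R < ‖z‖ → z.im = 0 → ‖w z‖ = 1)
    (h2 : ∀ z, R < ‖z‖ → z.im ≠ 0 → w z ≠ 1 → 2 * (deriv w z)^2 + (1 - w z) * deriv (deriv w) z ≠ 0)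
    (h3 : ∀ z, R < ‖z‖ → z.im ≠ 0 → w z ≠ 1 →
      6 * (deriv w z)^3 + 6 * (1 - w z) * deriv w z * deriv (deriv w) z
        + (1 - w z)^2 * deriv (deriv (deriv w)) z ≠ 0) :
    ∃ C : ℝ, ∃ n : ℕ, ∃ R' : ℝ, ∀ z : ℂ, R' < ‖z‖ → ‖w z‖ ≤ C * ‖z‖ ^ n := by
  obtain ⟨C0, R0, hC0⟩ := tB1 hR hw hw0 h2
  set R1 := max (max R R0) 1 with hR1
  have hR1R : R ≤ R1 := (le_max_left _ _).trans (le_max_left _ _)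
  have hR1R0 : R0 ≤ R1 := (le_max_right _ _).trans (le_max_left _ _)
  have hR11 : 1 ≤ R1 := le_max_right _ _
  obtain ⟨M, P, R2, hM⟩ := tB2' (w := w) (R := R1) (C := |C0| + 1) hR11 (by positivity)
    (fun z hz => hw z (by linarith)) (fun z hz => hw0 z (by linarith))
    (fun z hz hi => (hC0 z (by linarith) hi).trans (by gcongr; linarith [le_abs_self C0]))
  set a : ℂ → ℂ := fun z => deriv w z / w z with ha
  have hadef : ∀ z, R < ‖z‖ → deriv w z = a z * w z := fun z hz => by
    simp only [ha]; rw [div_mul_cancel₀ _ (hw0 z hz)]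
  have han : ∀ z, R < ‖z‖ → AnalyticAt ℂ a z := fun z hz => (hw z hz).deriv.div (hw z hz) (hw0 z hz)
  have key : (∃ C, 0 ≤ C ∧ ∀ᶠ z in Bornology.cobounded ℂ, ‖a z‖ ≤ C / ‖z‖) →
      ∃ C : ℝ, ∃ n : ℕ, ∃ R' : ℝ, ∀ z : ℂ, R' < ‖z‖ → ‖w z‖ ≤ C * ‖z‖ ^ n := by
    rintro ⟨C, hCp, hC⟩
    obtain ⟨R3, hR3⟩ := ev_cob.1 hC
    refine poly_growth (R := max R R3) (A := 0) (B := C) (lt_of_lt_of_le hR (le_max_left _ _)) le_rfl hCp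
      (fun z hz => (hw z (lt_of_le_of_lt (le_max_left _ _) hz)).differentiableAt) (fun z hz => ?_)
    rw [hadef z (lt_of_le_of_lt (le_max_left _ _) hz), norm_mul, zero_add]
    calc ‖a z‖ * ‖w z‖ ≤ C / ‖z‖ * ‖w z‖ := by
          gcongr; exact hR3 z (lt_of_le_of_lt (le_max_right _ _) hz)
      _ = _ := by ring
  rcases poly_slow (a := a) (R := max R R2) (M := M) (P := P)
    (fun z hz => han z (lt_of_le_of_lt (le_max_left _ _) hz))
    (fun z hz => hM z (lt_of_le_of_lt (le_max_right _ _) hz)) with h0 | hsl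
  · apply key
    refine ⟨0, le_rfl, ?_⟩
    filter_upwards [h0] with z hz
    simp [hz]
  obtain ⟨d, c, hc, hlim, hlim2, hne⟩ := id hsl
  have hcp := norm_pos_iff.2 hc
  by_cases hd : d ≤ -1
  · apply key
    refine ⟨‖c‖ + 1, by positivity, ?_⟩
    filter_upwards [hlim.norm.eventually_le_const (lt_add_one ‖c‖), ev_cob.2 ⟨1, fun z hz => hz⟩] with z h4 h5
    have hzp : 0 < ‖z‖ := by linarith
    rw [norm_div, norm_zpow, div_le_iff₀ (zpow_pos hzp d)] at h4
    refine h4.trans ?_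
    rw [div_eq_mul_inv, ← zpow_neg_one]
    gcongr
    · exact h5.le
  exfalso
  have hd0 : 0 ≤ d := by omega
  -- |a| bounded below
  have hlow : ∀ᶠ z in Bornology.cobounded ℂ, ‖c‖/2 ≤ ‖a z‖ := by
    filter_upwards [hlim.norm.eventually_const_le (half_lt_self hcp), ev_cob.2 ⟨1, fun z hz => hz⟩] with z h4 h5
    have hzp : 0 < ‖z‖ := by linarith
    rw [norm_div, norm_zpow, le_div_iff₀ (zpow_pos hzp d)] at h4
    have : 1 ≤ ‖z‖^d := one_le_zpow₀ h5.le hd0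
    nlinarith
  obtain ⟨R4, hR4⟩ := ev_cob.1 hlow
  set R5 := max (max R R4) 1 with hR5
  set x : ℕ → ℝ := fun k => R5 + 1 + k with hx
  have hxR5 : ∀ k, R5 < x k := fun k => by simp only [hx]; have : (0:ℝ) ≤ k := Nat.cast_nonneg k; linarith
  have hR51 : 1 ≤ R5 := le_max_right _ _
  have hR5R : R ≤ R5 := (le_max_left _ _).trans (le_max_left _ _)
  have hR5R4 : R4 ≤ R5 := (le_max_right _ _).trans (le_max_left _ _)
  have hxp : ∀ k, 0 < x k := fun k => by linarith [hxR5 k]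
  have hxn : ∀ k, ‖(x k : ℂ)‖ = x k := fun k => by rw [Complex.norm_real, Real.norm_eq_abs, abs_of_pos (hxp k)]
  have hal : ∀ k, ‖c‖/2 ≤ ‖a (x k)‖ := fun k => hR4 _ (by rw [hxn]; linarith [hxR5 k])
  have hap : ∀ k, 0 < ‖a (x k)‖ := fun k => lt_of_lt_of_le (by positivity) (hal k)
  set ρ : ℕ → ℝ := fun k => ‖a (x k)‖⁻¹ with hρ
  have hρp : ∀ k, 0 < ρ k := fun k => inv_pos.2 (hap k)
  have hρb : ∀ k, ρ k ≤ 2/‖c‖ := fun k => by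
    simp only [hρ]
    calc ‖a (x k)‖⁻¹ ≤ (‖c‖/2)⁻¹ := by gcongr; exact hal k
      _ = _ := by rw [inv_div]
  set 𝒰 : Ultrafilter ℕ := hyperfilter ℕ with h𝒰
  have hU : (𝒰 : Filter ℕ) ≤ atTop := by
    rw [← Nat.cofinite_eq_atTop]; exact hyperfilter_le_cofinite
  have hxt : Tendsto x 𝒰 atTop :=
    (tendsto_atTop_add_const_left _ _ tendsto_natCast_atTop_atTop).mono_left hU
  have hxc : Tendsto (fun k => (x k : ℂ)) 𝒰 (Bornology.cobounded ℂ) := by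
    rw [← tendsto_norm_atTop_iff_cobounded]; simp only [hxn]; exact hxt
  have hρx : Tendsto (fun k => (ρ k : ℂ) / (x k : ℂ)) 𝒰 (𝓝 0) := by
    rw [tendsto_zero_iff_norm_tendsto_zero]
    have : Tendsto (fun k => (2/‖c‖) / x k) 𝒰 (𝓝 0) := hxt.const_div_atTop _
    refine squeeze_zero (fun k => norm_nonneg _) (fun k => ?_) this
    rw [norm_div, hxn, Complex.norm_real, Real.norm_eq_abs, abs_of_pos (hρp k)]
    have := hxp k
    gcongr; exact hρb k
  have hnorm : ∀ k, ‖a (x k) / ((ρ k : ℂ)⁻¹)‖ = 1 := fun k => by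
    rw [norm_div, norm_inv, Complex.norm_real, Real.norm_eq_abs, abs_of_pos (hρp k)]
    simp only [hρ, inv_inv]; exact div_self (hap k).ne'
  obtain ⟨α, hα1, hα⟩ := ultra_lim_of_bdd 𝒰 (fun k => a (x k) / ((ρ k : ℂ)⁻¹)) 1
    (Eventually.of_forall fun k => (hnorm k).le)
  have hαn : α ≠ 0 := by
    rintro rfl
    have h5 := hα.norm
    simp only [hnorm, norm_zero] at h5
    exact one_ne_zero (tendsto_nhds_unique tendsto_const_nhds h5)
  set W : ℕ → ℂ → ℂ := fun k ζ => w (x k + ρ k * ζ) with hW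
  have hWd : ∀ k ζ, deriv (W k) ζ = ρ k * deriv w (x k + ρ k * ζ) := fun k ζ => by
    simp only [hW]; rw [sc_deriv]
  have hfar : ∀ r : ℝ, ∀ᶠ k in (𝒰 : Filter ℕ), ∀ ζ ∈ ball (0:ℂ) r, R < ‖x k + ρ k * ζ‖ := by
    intro r
    apply unif_of_seq
    intro ζ hζ
    obtain ⟨h5, _⟩ := mv_seq hxc hρx (ζ := ζ) (r := r) (fun k => (mem_ball_zero_iff.1 (hζ k)).le)
    exact (tendsto_norm_atTop_iff_cobounded.2 h5).eventually_gt_atTop R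
  have hq : ∀ r : ℝ, ∀ᶠ k in (𝒰 : Filter ℕ), ∀ ζ ∈ ball (0:ℂ) r, ‖ρ k * a (x k + ρ k * ζ)‖ ≤ 2 := by
    intro r
    apply unif_of_seq
    intro ζ hζ
    obtain ⟨h5, _⟩ := slow_lims hxc hρx (ζ := ζ) (r := r) (fun k => (mem_ball_zero_iff.1 (hζ k)).le) hsl hα
    filter_upwards [h5.norm.eventually_le_const (lt_of_le_of_lt hα1 one_lt_two)] with k hk
    rw [div_inv_eq_mul, mul_comm] at hk; exact hk
  have hW0 : ∀ k, ‖W k 0‖ = 1 := fun k => by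
    simp only [hW, mul_zero, add_zero]
    exact hr _ (by rw [hxn]; linarith [hxR5 k]) (by simp)
  have hloc : LocBdd 𝒰 W Set.univ := by
    intro ζ _
    refine ⟨1, one_pos, (1 + 0 * (‖ζ‖+1)) * Real.exp (2 * (‖ζ‖+1)), ?_⟩
    have hsub : ball ζ 1 ⊆ ball (0:ℂ) (‖ζ‖+1) := ball_subset_ball' (by rw [dist_zero_right]; linarith)
    filter_upwards [hfar (‖ζ‖+1), hq (‖ζ‖+1)] with k h5 h6
    have hdW : DifferentiableOn ℂ (W k) (ball 0 (‖ζ‖+1)) := fun u hu =>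
      (sc_analytic (hw _ (h5 u hu))).differentiableAt.differentiableWithinAt
    refine ⟨hdW.mono hsub, fun u hu => ?_⟩
    have := growth_ball (h := W k) (c := 0) (r := ‖ζ‖+1) (A := 0) (B := 2) le_rfl (by norm_num) hdW
      (fun u hu => by
        rw [hWd, hadef _ (h5 u hu), ← mul_assoc, norm_mul, zero_add]
        gcongr
        exact h6 u hu) u (hsub hu)
    rwa [hW0] at this
  obtain ⟨V, hV⟩ := hloc.exists_lim
  have hVeq : ∀ ζ, deriv V ζ = α * V ζ := by
    intro ζ
    have e1 := hV.derivs.tendsto (Set.mem_univ ζ)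
    have e2 := hV.tendsto (Set.mem_univ ζ)
    obtain ⟨e3, _⟩ := slow_lims hxc hρx (ζ := fun _ => ζ) (r := ‖ζ‖) (fun k => le_rfl) hsl hα
    refine tendsto_nhds_unique e1 ((e3.mul e2).congr' ?_)
    filter_upwards [hfar (‖ζ‖+1)] with k hk
    rw [hWd, hadef _ (hk ζ (by rw [mem_ball_zero_iff]; linarith))]
    rw [div_inv_eq_mul]; simp only [hW]; ring
  have hVre : ∀ ζ : ℂ, ζ.im = 0 → ‖V ζ‖ = 1 := by
    intro ζ hζ
    have e2 := (hV.tendsto (Set.mem_univ ζ)).norm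
    refine tendsto_nhds_unique e2 (tendsto_const_nhds.congr' ?_)
    filter_upwards [hfar (‖ζ‖+1)] with k hk
    symm
    apply hr _ (hk ζ (by rw [mem_ball_zero_iff]; linarith))
    simp [hζ]
  have hV0 : V 0 ≠ 0 := by
    intro h0; have := hVre 0 (by simp); rw [h0] at this; simp at this
  obtain ⟨ζ, z, hζ, hz, hzk⟩ := hur3 hU hαn hV hVeq hV0
  have hζi : ζ.im ≠ 0 := fun h0 => by rw [hVre ζ h0] at hζ; exact lt_irrefl _ hζ
  have e1 : ∀ᶠ k in (𝒰 : Filter ℕ), (z k).im ≠ 0 :=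
    ((Complex.continuous_im.tendsto ζ).comp hz).eventually_ne hζi
  have e2 : ∀ᶠ k in (𝒰 : Filter ℕ), ‖z k‖ < ‖ζ‖ + 1 := hz.norm.eventually_lt_const (lt_add_one _)
  obtain ⟨k, ⟨h1, h5⟩, h6, h7, h8⟩ := (hzk.and (e1.and (e2.and (hfar (‖ζ‖+1))))).exists
  have h9 := h8 _ (mem_ball_zero_iff.2 h7)
  have hρ0 := (hρp k).ne'
  have hρc : (ρ k : ℂ) ≠ 0 := by exact_mod_cast hρ0
  refine h3 _ h9 ?_ h1 ?_
  · simp [hρ0, h6]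
  · simp only [hW] at h5
    rw [sc_deriv3, sc_deriv2, sc_deriv] at h5
    apply mul_left_cancel₀ (pow_ne_zero 3 hρc)
    rw [mul_zero, ← h5]; ring

/-- `P` holds off a closed discrete set. -/
def Gen (P : ℂ → Prop) : Prop := ∀ z : ℂ, ∀ᶠ w in 𝓝[≠] z, P w

lemma Gen.and {P Q : ℂ → Prop} (hP : Gen P) (hQ : Gen Q) : Gen (fun w => P w ∧ Q w) :=
  fun z => (hP z).and (hQ z)

lemma Gen.mono {P Q : ℂ → Prop} (hP : Gen P) (h : ∀ w, P w → Q w) : Gen Q :=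
  fun z => (hP z).mono h

lemma Gen.exists {P : ℂ → Prop} (hP : Gen P) : ∃ w, P w := (hP 0).exists

/-- generic statements hold generically in neighbourhoods -/
lemma Gen.nhds {P : ℂ → Prop} (hP : Gen P) : Gen (fun w => ∀ᶠ u in 𝓝 w, P u) := by
  intro z
  have h := hP z
  rw [← eventually_eventually_nhdsWithin] at h
  filter_upwards [h, self_mem_nhdsWithin] with w hw hwz
  rwa [IsOpen.nhdsWithin_eq isOpen_compl_singleton hwz] at hw

lemma Gen.of_mero {h : ℂ → ℂ} (hh : ∀ z, MeromorphicAt h z) : Gen (fun w => AnalyticAt ℂ h w) :=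
  fun z => (hh z).eventually_analyticAt

lemma conj_tendsto_ne (z : ℂ) : Tendsto (starRingEnd ℂ) (𝓝[≠] z) (𝓝[≠] (starRingEnd ℂ z)) := by
  apply tendsto_nhdsWithin_of_tendsto_nhds_of_eventually_within
  · exact Complex.continuous_conj.continuousAt.tendsto.mono_left nhdsWithin_le_nhds
  · filter_upwards [self_mem_nhdsWithin] with w hw h
    exact hw ((starRingEnd ℂ).injective h)

lemma Gen.conj {P : ℂ → Prop} (hP : Gen P) : Gen (fun w => P (starRingEnd ℂ w)) :=
  fun z => (conj_tendsto_ne z).eventually (hP _)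

lemma eq_of_ne {A B : ℂ → ℂ} {z : ℂ} (h : ∀ᶠ w in 𝓝[≠] z, A w = B w)
    (hA : ContinuousAt A z) (hB : ContinuousAt B z) : A z = B z := by
  have := (hA.eventuallyEq_nhds_iff_eventuallyEq_nhdsNE hB).1 h
  exact this.eq_of_nhds

lemma Gen.eq_at {A B : ℂ → ℂ} (h : Gen (fun w => A w = B w)) {z : ℂ}
    (hA : ContinuousAt A z) (hB : ContinuousAt B z) : A z = B z := eq_of_ne (h z) hA hB

lemma nf_an {h G : ℂ → ℂ} {z : ℂ} (hh : MeromorphicNFAt h z) (hG : AnalyticAt ℂ G z)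
    (e : ∀ᶠ w in 𝓝[≠] z, h w = G w) : h =ᶠ[𝓝 z] G :=
  (hh.eventuallyEq_nhdsNE_iff_eventuallyEq_nhds hG.meromorphicNFAt).1 e

lemma nf_an' {h G : ℂ → ℂ} {z : ℂ} (hh : MeromorphicNFAt h z) (hG : AnalyticAt ℂ G z)
    (e : ∀ᶠ w in 𝓝[≠] z, h w = G w) : AnalyticAt ℂ h z :=
  hG.congr (nf_an hh hG e).symm

/-- the normal form of a function on the plane -/
noncomputable def nfC (h : ℂ → ℂ) : ℂ → ℂ := toMeromorphicNFOn h Set.univ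

lemma nfC_nf (h : ℂ → ℂ) (z : ℂ) : MeromorphicNFAt (nfC h) z :=
  meromorphicNFOn_toMeromorphicNFOn h Set.univ (Set.mem_univ z)

lemma nfC_eq {h : ℂ → ℂ} (hh : ∀ z, MeromorphicAt h z) : Gen (fun w => nfC h w = h w) :=
  fun z => MeromorphicOn.toMeromorphicNFOn_eq_self_on_nhdsNE (fun z _ => hh z) (Set.mem_univ z)

lemma mtilde_deriv (f : ℂ → ℂ) : deriv (mtilde f) = mtilde (deriv f) := by
  funext z
  have := deriv_conj_conj (𝕜 := ℂ) (f := f)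
  have h2 := congrFun this z
  exact h2

lemma mtilde_iter (f : ℂ → ℂ) (j : ℕ) : iteratedDeriv j (mtilde f) = mtilde (iteratedDeriv j f) := by
  induction j with
  | zero => simp
  | succ j ih => rw [iteratedDeriv_succ, ih, mtilde_deriv, iteratedDeriv_succ]

lemma mtilde_mtilde (f : ℂ → ℂ) : mtilde (mtilde f) = f := by
  funext z; simp [mtilde]

lemma mtilde_an {g : ℂ → ℂ} {z : ℂ} (hg : AnalyticAt ℂ g (starRingEnd ℂ z)) :
    AnalyticAt ℂ (mtilde g) z := by
  rw [Complex.analyticAt_iff_eventually_differentiableAt] at hg ⊢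
  have := (Complex.continuous_conj.continuousAt (x := z)).tendsto.eventually hg
  filter_upwards [this] with w hw
  have := hw.conj_conj
  simpa [mtilde, Function.comp_def] using! this

lemma mtilde_an_iff {g : ℂ → ℂ} {z : ℂ} :
    AnalyticAt ℂ (mtilde g) z ↔ AnalyticAt ℂ g (starRingEnd ℂ z) := by
  refine ⟨fun h => ?_, mtilde_an⟩
  have := mtilde_an (g := mtilde g) (z := starRingEnd ℂ z) (by simpa using h)
  rwa [mtilde_mtilde] at this

lemma mtilde_nf {g : ℂ → ℂ} {z : ℂ} (hg : MeromorphicNFAt g (starRingEnd ℂ z)) :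
    MeromorphicNFAt (mtilde g) z := by
  have ht := Complex.continuous_conj.continuousAt.tendsto (x := z)
  rcases hg with h | ⟨n, u, hu, hu0, h⟩
  · left
    filter_upwards [ht.eventually h] with w hw
    simp [mtilde, hw]
  · right
    refine ⟨n, mtilde u, mtilde_an hu, by simpa [mtilde] using hu0, ?_⟩
    filter_upwards [ht.eventually h] with w hw
    simp [mtilde, hw]

/-- A family of normal-form meromorphic functions, each the derivative of the preceding one. -/
structure Fam (U : ℕ → ℂ → ℂ) : Prop where
  nf : ∀ j z, MeromorphicNFAt (U j) z
  an : ∀ j z, AnalyticAt ℂ (U j) z → AnalyticAt ℂ (U (j+1)) z ∧ deriv (U j) z = U (j+1) z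
  ne : ∀ j, Gen (fun w => U j w ≠ 0)

lemma Fam.tilde {U : ℕ → ℂ → ℂ} (h : Fam U) : Fam (fun j => mtilde (U j)) := by
  refine ⟨fun j z => mtilde_nf (h.nf j _), fun j z ha => ?_, fun j => ?_⟩
  · have := h.an j _ (mtilde_an_iff.1 ha)
    refine ⟨mtilde_an this.1, ?_⟩
    rw [mtilde_deriv]
    simp [mtilde, this.2]
  · exact (h.ne j).conj.mono fun w hw => by simpa [mtilde] using hw

lemma Fam.mer {U : ℕ → ℂ → ℂ} (h : Fam U) (j : ℕ) (z : ℂ) : MeromorphicAt (U j) z :=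
  (h.nf j z).meromorphicAt

lemma Fam.genan {U : ℕ → ℂ → ℂ} (h : Fam U) (j : ℕ) : Gen (fun w => AnalyticAt ℂ (U j) w) :=
  Gen.of_mero (h.mer j)

lemma Fam.genall {U : ℕ → ℂ → ℂ} (h : Fam U) (j : ℕ) :
    Gen (fun w => AnalyticAt ℂ (U j) w ∧ deriv (U j) w = U (j+1) w ∧ U j w ≠ 0) :=
  ((h.genan j).and (h.ne j)).mono fun w hw => ⟨hw.1, (h.an j w hw.1).2, hw.2⟩

lemma Fam.an_add {U : ℕ → ℂ → ℂ} (h : Fam U) (j i : ℕ) (z : ℂ) (ha : AnalyticAt ℂ (U j) z) :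
    AnalyticAt ℂ (U (j+i)) z := by
  induction i with
  | zero => exact ha
  | succ i ih => exact (h.an _ z ih).1

lemma Fam.hda {U : ℕ → ℂ → ℂ} (h : Fam U) {j : ℕ} {z : ℂ} (ha : AnalyticAt ℂ (U j) z) :
    HasDerivAt (U j) (U (j+1) z) z := by
  rw [← (h.an j z ha).2]; exact ha.differentiableAt.hasDerivAt

lemma Fam.deriv_ev {U : ℕ → ℂ → ℂ} (h : Fam U) {j : ℕ} {z : ℂ} (ha : AnalyticAt ℂ (U j) z) :
    deriv (U j) =ᶠ[𝓝 z] U (j+1) := by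
  filter_upwards [ha.eventually_analyticAt] with w hw
  exact (h.an j w hw).2

/-- local structure -/
lemma Fam.loc {U : ℕ → ℂ → ℂ} (h : Fam U) (j : ℕ) (z : ℂ) :
    ∃ (k : ℤ) (g : ℂ → ℂ), AnalyticAt ℂ g z ∧ g z ≠ 0 ∧ ∀ᶠ w in 𝓝 z, U j w = (w - z)^k * g w := by
  rcases h.nf j z with h1 | ⟨n, g, hg, hg0, h1⟩
  · exfalso
    have := (h.ne j z).and (h1.filter_mono nhdsWithin_le_nhds)
    obtain ⟨w, hw, hw'⟩ := this.exists
    exact hw hw'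
  · exact ⟨n, g, hg, hg0, h1⟩

/-- constancy -/
lemma mero_const {h : ℂ → ℂ} (hh : ∀ z, MeromorphicAt h z) (hd : Gen (fun w => deriv h w = 0)) :
    ∃ c : ℂ, Gen (fun w => h w = c) := by
  obtain ⟨z0, hz0, hz0'⟩ := ((Gen.of_mero hh).and hd.nhds).exists
  obtain ⟨r, hr, hb⟩ := Metric.eventually_nhds_iff_ball.1 (hz0.eventually_analyticAt.and hz0')
  have hc : ∀ w ∈ ball z0 r, h w = h z0 := by
    intro w hw
    refine IsOpen.is_const_of_deriv_eq_zero (s := ball z0 r) isOpen_ball (convex_ball z0 r).isPreconnected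
      ?_ ?_ hw (mem_ball_self hr)
    · exact fun u hu => (hb u hu).1.differentiableAt.differentiableWithinAt
    · intro u hu; exact (hb u hu).2
  refine ⟨h z0, ?_⟩
  have hm : MeromorphicOn (fun w => h w - h z0) Set.univ :=
    fun z _ => (hh z).sub (MeromorphicAt.const _ _)
  have htop : meromorphicOrderAt (fun w => h w - h z0) z0 = ⊤ := by
    rw [meromorphicOrderAt_eq_top_iff]
    have : ∀ᶠ w in 𝓝 z0, h w - h z0 = 0 := by
      filter_upwards [ball_mem_nhds z0 hr] with w hw
      rw [hc w hw, sub_self]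
    exact this.filter_mono nhdsWithin_le_nhds
  intro z
  have : meromorphicOrderAt (fun w => h w - h z0) z = ⊤ := by
    by_contra hne
    exact hm.meromorphicOrderAt_ne_top_of_isPreconnected isPreconnected_univ (Set.mem_univ z)
      (Set.mem_univ z0) hne htop
  rw [meromorphicOrderAt_eq_top_iff] at this
  filter_upwards [this] with w hw
  exact sub_eq_zero.1 hw

/-- generic nonvanishing or generic vanishing -/
lemma gen_dich {h : ℂ → ℂ} (hh : ∀ z, MeromorphicAt h z) :
    Gen (fun w => h w = 0) ∨ Gen (fun w => h w ≠ 0) := by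
  by_cases H : ∃ z, meromorphicOrderAt h z = ⊤
  · left
    obtain ⟨z0, hz0⟩ := H
    intro z
    rw [← meromorphicOrderAt_eq_top_iff]
    by_contra hne
    exact MeromorphicOn.meromorphicOrderAt_ne_top_of_isPreconnected (U := Set.univ)
      (fun z _ => hh z) isPreconnected_univ (Set.mem_univ z) (Set.mem_univ z0) hne hz0
  · right
    intro z
    push Not at H
    exact (meromorphicOrderAt_ne_top_iff_eventually_ne_zero (hh z)).1 (H z)

lemma gen_finite {P : ℂ → Prop} (h : Gen P) (R : ℝ) : ({z | ¬ P z} ∩ closedBall 0 R).Finite := by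
  have h1 : {z | P z} ∈ codiscreteWithin (closedBall (0:ℂ) R) := by
    rw [mem_codiscreteWithin_iff_forall_mem_nhdsNE]
    intro x _
    filter_upwards [h x] with w hw
    exact Or.inl hw
  have := IsCompact.finite_sdiff_of_mem_codiscreteWithin (isCompact_closedBall (0:ℂ) R) h1
  refine this.subset ?_
  rintro z ⟨h1, h2⟩
  exact ⟨h2, h1⟩

lemma fin_step {h u : ℂ → ℂ} (hh : ∀ z, MeromorphicAt h z) {R C : ℝ} {N : ℕ}
    (hu : ∀ z, R < ‖z‖ → AnalyticAt ℂ u z) (hb : ∀ z, R < ‖z‖ → ‖u z‖ ≤ Real.exp (C * ‖z‖^N))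
    (he : ∀ z, R < ‖z‖ → ∀ᶠ w in 𝓝[≠] z, deriv h w = u w) :
    ∃ (H : ℂ → ℂ) (R' C' : ℝ) (N' : ℕ), (∀ z, R' < ‖z‖ → AnalyticAt ℂ H z) ∧
      (∀ z, R' < ‖z‖ → ‖H z‖ ≤ Real.exp (C' * ‖z‖^N')) ∧
      (∀ z, R' < ‖z‖ → ∀ᶠ w in 𝓝[≠] z, h w = H w) := by
  have hHe := nfC_eq hh
  have hHa : ∀ z, R < ‖z‖ → AnalyticAt ℂ (nfC h) z := by
    intro z hz
    have ho : 0 ≤ meromorphicOrderAt h z := by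
      by_cases ht : meromorphicOrderAt h z = ⊤
      · rw [ht]; exact le_top
      · obtain ⟨n, hn⟩ := WithTop.ne_top_iff_exists.1 ht
        by_cases hn0 : n = 0
        · rw [← hn, hn0]; simp
        · have h1 := meromorphicOrderAt_deriv_eq_sub_one (f := h) (x := z) (n := n)
            (by exact_mod_cast hn0) hn.symm
          have h2 : meromorphicOrderAt (deriv h) z = meromorphicOrderAt u z :=
            meromorphicOrderAt_congr (he z hz)
          have h3 := (hu z hz).meromorphicOrderAt_nonneg
          rw [← h2, h1] at h3
          have h4 : (0:ℤ) ≤ n - 1 := by exact_mod_cast h3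
          rw [← hn]
          have : (0:ℤ) ≤ n := by omega
          exact_mod_cast this
    rw [← (nfC_nf h z).meromorphicOrderAt_nonneg_iff_analyticAt]
    rwa [meromorphicOrderAt_congr (hHe z)]
  have hHd : ∀ z, R < ‖z‖ → deriv (nfC h) z = u z := by
    intro z hz
    refine eq_of_ne ?_ (hHa z hz).deriv.continuousAt (hu z hz).continuousAt
    have := EventuallyEq.nhdsNE_deriv (hHe z)
    filter_upwards [this, he z hz] with w h1 h2
    rw [h1, h2]
  set R1 : ℝ := max R 0 + 1 with hR1
  have hR1R : R < R1 := by have := le_max_left R 0; linarith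
  have hR11 : 1 ≤ R1 := by have := le_max_right R 0; linarith
  obtain ⟨M, hM⟩ : ∃ M, ∀ z ∈ sphere (0:ℂ) R1, ‖nfC h z‖ ≤ M := by
    refine (isCompact_sphere (0:ℂ) R1).exists_bound_of_continuousOn ?_
    intro z hz
    refine (hHa z ?_).continuousAt.continuousWithinAt
    have : ‖z‖ = R1 := by simpa using hz
    rw [this]; exact hR1R
  have hM0 : 0 ≤ M := le_trans (norm_nonneg _) (hM (R1:ℂ) (by simp; linarith))
  refine ⟨nfC h, R1, M + 1 + |C|, N + 1, fun z hz => hHa z (hR1R.trans hz), ?_,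
    fun z hz => (hHe z).mono fun w hw => hw.symm⟩
  intro z hz
  have hz0 : 0 < ‖z‖ := by linarith
  have hzc : (‖z‖:ℂ) ≠ 0 := by exact_mod_cast hz0.ne'
  set e : ℂ := z / ‖z‖ with hedef
  have hen : ‖e‖ = 1 := by
    rw [hedef, norm_div]; simp [hz0.ne']
  have hn : ∀ t : ℝ, 0 ≤ t → ‖((R1 + t : ℝ) : ℂ) * e‖ = R1 + t := by
    intro t ht
    rw [norm_mul, hen, mul_one, Complex.norm_real, Real.norm_eq_abs, abs_of_nonneg (by linarith)]
  have key := gronwall_path (φ := fun t : ℝ => nfC h (((R1 + t : ℝ) : ℂ) * e))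
    (φ' := fun t : ℝ => u (((R1 + t : ℝ) : ℂ) * e) * e) (T := ‖z‖ - R1)
    (A := Real.exp (|C| * ‖z‖^N)) (B := 0) (by linarith) (Real.exp_nonneg _) le_rfl
    (by
      intro t ht
      have hlt : R < ‖((R1 + t : ℝ) : ℂ) * e‖ := by rw [hn t ht.1]; linarith [ht.1]
      have h1 : HasDerivAt (nfC h) (u (((R1 + t : ℝ) : ℂ) * e)) (((R1 + t : ℝ) : ℂ) * e) := by
        rw [← hHd _ hlt]; exact (hHa _ hlt).differentiableAt.hasDerivAt
      have h2 : HasDerivAt (fun t : ℝ => ((R1 + t : ℝ) : ℂ) * e) e t := by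
        have h3 : HasDerivAt (fun t : ℝ => ((R1 + t : ℝ) : ℂ)) ((1:ℝ):ℂ) t :=
          HasDerivAt.ofReal_comp ((hasDerivAt_id t).const_add R1)
        simpa using h3.mul_const e
      exact h1.comp t h2)
    (by
      intro t ht
      have hlt : R < ‖((R1 + t : ℝ) : ℂ) * e‖ := by rw [hn t ht.1]; linarith [ht.1]
      rw [norm_mul, hen, mul_one, zero_mul, zero_add]
      refine (hb _ hlt).trans (Real.exp_le_exp.2 ?_)
      rw [hn t ht.1]
      have h4 : (R1 + t)^N ≤ ‖z‖^N := pow_le_pow_left₀ (by linarith [ht.1]) (by linarith [ht.2]) N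
      have h5 : 0 ≤ (R1 + t)^N := pow_nonneg (by linarith [ht.1]) N
      calc C * (R1 + t)^N ≤ |C| * (R1+t)^N := mul_le_mul_of_nonneg_right (le_abs_self C) h5
        _ ≤ _ := mul_le_mul_of_nonneg_left h4 (abs_nonneg C))
  have hend : ((R1 + (‖z‖ - R1) : ℝ) : ℂ) * e = z := by
    rw [hedef]; push_cast; field_simp; ring
  simp only [hend, zero_mul, Real.exp_zero, mul_one] at key
  have h0 : ‖nfC h (((R1 + 0 : ℝ) : ℂ) * e)‖ ≤ M := hM _ (by
    rw [mem_sphere_zero_iff_norm, hn 0 le_rfl, add_zero])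
  have hz1 : 1 ≤ ‖z‖ := by linarith
  have hE1 : 1 ≤ Real.exp (|C| * ‖z‖^N) := Real.one_le_exp (by positivity)
  have hpN : ‖z‖^N ≤ ‖z‖^(N+1) := pow_le_pow_right₀ hz1 (by omega)
  have hp1 : ‖z‖ ≤ ‖z‖^(N+1) := le_self_pow₀ hz1 (by omega)
  have hp0 : 1 ≤ ‖z‖^(N+1) := one_le_pow₀ hz1
  calc ‖nfC h z‖ ≤ M + Real.exp (|C| * ‖z‖^N) * (‖z‖ - R1) := by linarith
    _ ≤ (M + ‖z‖) * Real.exp (|C| * ‖z‖^N) := by nlinarith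
    _ ≤ Real.exp (M + ‖z‖) * Real.exp (|C| * ‖z‖^N) := by
        refine mul_le_mul_of_nonneg_right ?_ (Real.exp_nonneg _)
        linarith [Real.add_one_le_exp (M + ‖z‖)]
    _ = Real.exp (M + ‖z‖ + |C| * ‖z‖^N) := (Real.exp_add _ _).symm
    _ ≤ _ := by
        apply Real.exp_le_exp.2
        have : |C| * ‖z‖^N ≤ |C| * ‖z‖^(N+1) := mul_le_mul_of_nonneg_left hpN (abs_nonneg C)
        nlinarith

lemma iter_mero {f : ℂ → ℂ} (hf : ∀ z, MeromorphicAt f z) (j : ℕ) (z : ℂ) :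
    MeromorphicAt (iteratedDeriv j f) z := by
  induction j generalizing z with
  | zero => simpa using hf z
  | succ j ih => rw [iteratedDeriv_succ]; exact (ih z).deriv

lemma fin_down {f : ℂ → ℂ} (hf : ∀ z, MeromorphicAt f z) (j : ℕ) :
    ∀ (u : ℂ → ℂ) (R C : ℝ) (N : ℕ),
    (∀ z, R < ‖z‖ → AnalyticAt ℂ u z) → (∀ z, R < ‖z‖ → ‖u z‖ ≤ Real.exp (C * ‖z‖^N)) →
    (∀ z, R < ‖z‖ → ∀ᶠ w in 𝓝[≠] z, iteratedDeriv j f w = u w) →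
    ∃ (H : ℂ → ℂ) (R' C' : ℝ) (N' : ℕ), (∀ z, R' < ‖z‖ → AnalyticAt ℂ H z) ∧
      (∀ z, R' < ‖z‖ → ‖H z‖ ≤ Real.exp (C' * ‖z‖^N')) ∧
      (∀ z, R' < ‖z‖ → ∀ᶠ w in 𝓝[≠] z, f w = H w) := by
  induction j with
  | zero => intro u R C N h1 h2 h3; exact ⟨u, R, C, N, h1, h2, by simpa using h3⟩
  | succ j ih =>
    intro u R C N h1 h2 h3
    rw [iteratedDeriv_succ] at h3
    obtain ⟨H, R', C', N', a, b, c⟩ := fin_step (iter_mero hf j) h1 h2 h3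
    exact ih H R' C' N' a b c

lemma fin_core {f u : ℂ → ℂ} (hf : ∀ z, MeromorphicAt f z) {j : ℕ} {R C : ℝ} {N : ℕ}
    (hu : ∀ z, R < ‖z‖ → AnalyticAt ℂ u z) (hb : ∀ z, R < ‖z‖ → ‖u z‖ ≤ Real.exp (C * ‖z‖^N))
    (he : ∀ z, R < ‖z‖ → ∀ᶠ w in 𝓝[≠] z, iteratedDeriv j f w = u w) :
    FiniteOrder f ∧ {z | meroOrder f z < 0}.Finite := by
  obtain ⟨H, R, C, N, hH, hHb, hHe⟩ := fin_down hf j u R C N hu hb he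
  have hmo : ∀ z, meroOrder f z = meromorphicOrderAt f z := fun z => by simp [meroOrder, hf z]
  have hnp : ∀ z, R < ‖z‖ → 0 ≤ meroOrder f z := by
    intro z hz
    rw [hmo, meromorphicOrderAt_congr (hHe z hz)]
    exact (hH z hz).meromorphicOrderAt_nonneg
  have hfin : {z | meroOrder f z < 0}.Finite := by
    refine (gen_finite (Gen.of_mero hf) R).subset ?_
    intro z hz
    refine ⟨?_, ?_⟩
    · intro ha
      have := ha.meromorphicOrderAt_nonneg
      rw [← hmo] at this
      exact absurd hz (not_lt.2 this)
    · rw [mem_closedBall_zero_iff]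
      by_contra hlt
      exact absurd hz (not_lt.2 (hnp z (not_le.1 hlt)))
  refine ⟨?_, hfin⟩
  have hsupp : ∀ z, z ∉ hfin.toFinset → poleMult f z = 0 := by
    intro z hz
    have hz : ¬ meroOrder f z < 0 := by simpa using hz
    have hz : 0 ≤ meroOrder f z := not_lt.1 hz
    unfold poleMult
    have : 0 ≤ (meroOrder f z).untopD 0 := by
      cases hh : meroOrder f z with
      | top => simp
      | coe n => rw [hh] at hz; simpa using hz
    omega
  set n : ℝ := ∑ z ∈ hfin.toFinset, (poleMult f z : ℝ) with hndef
  have hn0 : 0 ≤ n := Finset.sum_nonneg fun _ _ => Nat.cast_nonneg _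
  have hpc : ∀ t, 0 ≤ poleCount f t ∧ poleCount f t ≤ n := by
    intro t
    have h1 : poleCount f t = ∑ z ∈ hfin.toFinset.filter (fun z => z ∈ closedBall (0:ℂ) t), (poleMult f z : ℝ) := by
      unfold poleCount
      rw [finsum_mem_eq_sum_of_inter_support_eq]
      ext z
      simp only [Set.mem_inter_iff, Function.mem_support, Finset.coe_filter, Set.mem_setOf_eq]
      constructor
      · rintro ⟨h1, h2⟩
        refine ⟨⟨?_, h1⟩, h2⟩
        by_contra h3
        exact h2 (by rw [hsupp z h3]; simp)
      · rintro ⟨⟨h1, h2⟩, h3⟩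
        exact ⟨h2, h3⟩
    rw [h1]
    exact ⟨Finset.sum_nonneg fun _ _ => Nat.cast_nonneg _,
      Finset.sum_le_sum_of_subset_of_nonneg (Finset.filter_subset _ _) fun _ _ _ => Nat.cast_nonneg _⟩
  have hN : ∀ r : ℝ, 1 ≤ r → NCount f r ≤ n * r := by
    intro r hr
    have h1 : ‖NCount f r‖ ≤ n * |r - 1| := by
      unfold NCount
      refine intervalIntegral.norm_integral_le_of_norm_le_const fun t ht => ?_
      rw [Set.uIoc_of_le hr] at ht
      have ht1 : 1 ≤ t := ht.1.le
      rw [Real.norm_eq_abs, abs_div, abs_of_nonneg (hpc t).1, abs_of_nonneg (by linarith)]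
      exact (div_le_self (hpc t).1 ht1).trans (hpc t).2
    rw [abs_of_nonneg (by linarith)] at h1
    have := (le_abs_self _).trans h1
    nlinarith
  have hP : ∀ r : ℝ, max R 0 + 1 < r → proximity f r ≤ |C| * r^N := by
    intro r hr
    have hRr : R + 1 < r := by have := le_max_left R 0; linarith
    have hr0 : 0 < r := by have := le_max_right R 0; linarith
    have hS : {z : ℂ | R + 1 < ‖z‖ → f z = H z} ∈ codiscreteWithin (sphere (0:ℂ) |r|) := by
      rw [mem_codiscreteWithin_iff_forall_mem_nhdsNE]
      intro x _
      by_cases hx : R < ‖x‖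
      · filter_upwards [hHe x hx] with w hw
        exact Or.inl fun _ => hw
      · have : ∀ᶠ w in 𝓝 x, ‖w‖ < R + 1 :=
          continuous_norm.continuousAt.eventually_lt continuousAt_const (by linarith)
        filter_upwards [this.filter_mono nhdsWithin_le_nhds] with w hw
        exact Or.inl fun h => absurd h (not_lt.2 hw.le)
    have h1 := circleMap_preimage_codiscrete (c := (0:ℂ)) hr0.ne' hS
    have h2 : ∀ᵐ θ : ℝ, θ ∈ Set.uIoc 0 (2 * Real.pi) → ‖logPlus ‖f ((r : ℂ) * Complex.exp (θ * Complex.I))‖‖ ≤ |C| * r^N := by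
      rw [← ae_restrict_iff' measurableSet_uIoc]
      have h3 := ae_restrict_le_codiscreteWithin (μ := volume) (U := Set.uIoc 0 (2 * Real.pi)) measurableSet_uIoc
        (codiscreteWithin_mono (by simp) h1)
      filter_upwards [h3] with θ hθ
      have hnm : ‖(r : ℂ) * Complex.exp (θ * Complex.I)‖ = r := by
        rw [norm_mul, Complex.norm_exp_ofReal_mul_I, mul_one, Complex.norm_real, Real.norm_eq_abs, abs_of_pos hr0]
      have h4 : f ((r : ℂ) * Complex.exp (θ * Complex.I)) = H ((r : ℂ) * Complex.exp (θ * Complex.I)) := by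
        have : R + 1 < ‖circleMap 0 r θ‖ → f (circleMap 0 r θ) = H (circleMap 0 r θ) := hθ
        simp only [circleMap, zero_add] at this
        exact this (by rw [hnm]; exact hRr)
      have h5 := hHb ((r : ℂ) * Complex.exp (θ * Complex.I)) (by rw [hnm]; linarith)
      rw [hnm] at h5
      rw [h4]
      generalize H ((r : ℂ) * Complex.exp (θ * Complex.I)) = v at h5
      have hnn : 0 ≤ |C| * r^N := by positivity
      unfold logPlus
      rw [Real.norm_eq_abs, abs_of_nonneg (le_max_right _ _)]
      refine max_le ?_ hnn
      by_cases hv : ‖v‖ = 0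
      · rw [hv]; simpa using hnn
      · have hvp : 0 < ‖v‖ := lt_of_le_of_ne (norm_nonneg _) (Ne.symm hv)
        refine ((Real.log_le_iff_le_exp hvp).2 h5).trans ?_
        exact mul_le_mul_of_nonneg_right (le_abs_self C) (by positivity)
    have h6 := intervalIntegral.norm_integral_le_of_norm_le_const_ae h2
    have hpi := Real.pi_pos
    rw [sub_zero, abs_of_pos (by positivity : (0:ℝ) < 2 * Real.pi)] at h6
    have h7 := (le_abs_self _).trans h6
    unfold proximity
    calc _ ≤ (2 * Real.pi)⁻¹ * (|C| * r^N * (2 * Real.pi)) := mul_le_mul_of_nonneg_left h7 (by positivity)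
      _ = _ := by field_simp
  refine ⟨((N + 2 : ℕ) : ℝ), ?_⟩
  filter_upwards [eventually_gt_atTop (max R 0 + 1), eventually_ge_atTop (|C| + n + 1)] with r h1 h2
  have hr1 : 1 ≤ r := by have := le_max_right R 0; linarith
  rw [Real.rpow_natCast]
  unfold TChar
  have h3 := hP r h1
  have h4 := hN r hr1
  have hC := abs_nonneg C
  have h5 : r^N ≤ r^(N+1) := pow_le_pow_right₀ hr1 (by omega)
  have h6 : r ≤ r^(N+1) := le_self_pow₀ hr1 (by omega)
  calc _ ≤ |C| * r^(N+1) + n * r^(N+1) :=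
        add_le_add (h3.trans (mul_le_mul_of_nonneg_left h5 hC)) (h4.trans (mul_le_mul_of_nonneg_left h6 hn0))
    _ = (|C| + n) * r^(N+1) := by ring
    _ ≤ r * r^(N+1) := mul_le_mul_of_nonneg_right (by linarith) (by positivity)
    _ = r^(N+2) := by ring

structure Dat (U : ℕ → ℂ → ℂ) : Prop where
  fam : Fam U
  fin : ∀ (j : ℕ) (R C : ℝ) (N : ℕ), (∀ z, R < ‖z‖ → AnalyticAt ℂ (U j) z) →
    (∀ z, R < ‖z‖ → ‖U j z‖ ≤ Real.exp (C * ‖z‖^N)) → False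
  nrz : ∃ R0 : ℝ, ∀ j ≤ 14, ∀ z : ℂ, R0 < ‖z‖ → z.im ≠ 0 → AnalyticAt ℂ (U j) z → U j z ≠ 0
  snr : ¬ ∃ c : ℂ, Gen (fun w => mtilde (U 0) w = c * U 0 w)

/-- `h` is in normal form with order `k` at `z`. -/
def ordP (h : ℂ → ℂ) (z : ℂ) (k : ℤ) : Prop :=
  ∃ g : ℂ → ℂ, AnalyticAt ℂ g z ∧ g z ≠ 0 ∧ ∀ᶠ w in 𝓝 z, h w = (w - z)^k * g w

lemma ordP.uniq {h : ℂ → ℂ} {z : ℂ} {k l : ℤ} (h1 : ordP h z k) (h2 : ordP h z l) : k = l := by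
  have key : ∀ k, ordP h z k → meromorphicOrderAt h z = k := by
    rintro k ⟨g, hg, hg0, he⟩
    have hm : MeromorphicAt h z := by
      have : MeromorphicAt (fun w => (w - z)^k * g w) z := by fun_prop
      exact this.congr (EventuallyEq.filter_mono (EventuallyEq.symm he) nhdsWithin_le_nhds)
    rw [meromorphicOrderAt_eq_int_iff hm]
    exact ⟨g, hg, hg0, he.filter_mono nhdsWithin_le_nhds⟩
  have := (key k h1).symm.trans (key l h2)
  exact_mod_cast this

lemma ordP.nf {h : ℂ → ℂ} {z : ℂ} {k : ℤ} (h1 : ordP h z k) : MeromorphicNFAt h z := by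
  obtain ⟨g, hg, hg0, he⟩ := h1
  exact Or.inr ⟨k, g, hg, hg0, he⟩

lemma ordP.an {h : ℂ → ℂ} {z : ℂ} {k : ℤ} (h1 : ordP h z k) (hk : 0 ≤ k) : AnalyticAt ℂ h z := by
  obtain ⟨g, hg, hg0, he⟩ := h1
  obtain ⟨n, rfl⟩ := Int.eq_ofNat_of_zero_le hk
  have : AnalyticAt ℂ (fun w => (w - z)^n * g w) z := by fun_prop
  refine this.congr ?_
  filter_upwards [he] with w hw
  rw [hw]; simp

lemma ordP.val_ne {h : ℂ → ℂ} {z : ℂ} (h1 : ordP h z 0) : h z ≠ 0 := by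
  obtain ⟨g, hg, hg0, he⟩ := h1
  rw [he.self_of_nhds]; simpa using hg0

lemma ordP.val_zero {h : ℂ → ℂ} {z : ℂ} {k : ℤ} (h1 : ordP h z k) (hk : k ≠ 0) : h z = 0 := by
  obtain ⟨g, hg, hg0, he⟩ := h1
  rw [he.self_of_nhds]; simp [zero_zpow k hk]

lemma ordP.nonneg {h : ℂ → ℂ} {z : ℂ} {k : ℤ} (h1 : ordP h z k) (ha : AnalyticAt ℂ h z) : 0 ≤ k := by
  have h2 := ha.meromorphicOrderAt_nonneg
  obtain ⟨g, hg, hg0, he⟩ := h1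
  have : meromorphicOrderAt h z = k := by
    rw [meromorphicOrderAt_eq_int_iff ha.meromorphicAt]
    exact ⟨g, hg, hg0, he.filter_mono nhdsWithin_le_nhds⟩
  rw [this] at h2
  exact_mod_cast h2

lemma ordP.conj {h : ℂ → ℂ} {z : ℂ} {k : ℤ} (h1 : ordP h z k) : ordP (mtilde h) (starRingEnd ℂ z) k := by
  obtain ⟨g, hg, hg0, he⟩ := h1
  refine ⟨mtilde g, mtilde_an (by simpa using hg), by simpa [mtilde] using hg0, ?_⟩
  have ht := Complex.continuous_conj.continuousAt.tendsto (x := starRingEnd ℂ z)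
  rw [Complex.conj_conj] at ht
  filter_upwards [ht.eventually he] with w hw
  simp [mtilde, hw]

lemma ordP.conj_real {h : ℂ → ℂ} {z : ℂ} {k : ℤ} (h1 : ordP h z k) (hz : z.im = 0) : ordP (mtilde h) z k := by
  have := h1.conj
  rwa [Complex.conj_eq_iff_im.2 hz] at this

lemma Fam.ex_ord {U : ℕ → ℂ → ℂ} (h : Fam U) (j : ℕ) (z : ℂ) : ∃ k, ordP (U j) z k := by
  obtain ⟨k, g, h1⟩ := h.loc j z
  exact ⟨k, g, h1⟩

/-- The quotient `U_m / U_(m+1)` in normal form. -/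
noncomputable def Yf (U : ℕ → ℂ → ℂ) (m : ℕ) : ℂ → ℂ := nfC (fun w => U m w / U (m+1) w)

lemma Yf_nf (U : ℕ → ℂ → ℂ) (m : ℕ) (z : ℂ) : MeromorphicNFAt (Yf U m) z := nfC_nf _ z

lemma Yf_gen {U : ℕ → ℂ → ℂ} (h : Fam U) (m : ℕ) : Gen (fun w => Yf U m w = U m w / U (m+1) w) :=
  nfC_eq fun z => (h.mer m z).div (h.mer (m+1) z)

lemma Yf_Mer (U : ℕ → ℂ → ℂ) (m : ℕ) (z : ℂ) : Mer (Yf U m) z := by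
  by_cases ha : AnalyticAt ℂ (Yf U m) z
  · exact Or.inl ha
  · right
    rcases Yf_nf U m z with h1 | ⟨n, g, hg, hg0, h1⟩
    · exact absurd (analyticAt_const.congr (EventuallyEq.symm h1)) ha
    · have hn : n < 0 := by
        by_contra hn
        refine ha (ordP.an (k := n) ⟨g, hg, hg0, h1⟩ (by omega))
      refine ⟨ha, ?_, ordP.val_zero (k := n) ⟨g, hg, hg0, h1⟩ (by omega)⟩
      have h2 : ordP (fun w => (Yf U m w)⁻¹) z (-n) := by
        refine ⟨fun w => (g w)⁻¹, hg.inv hg0, inv_ne_zero hg0, ?_⟩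
        filter_upwards [h1] with w hw
        rw [hw]
        simp [mul_comm]
      exact h2.an (by omega)

lemma Fam.loc_deriv {U : ℕ → ℂ → ℂ} (h : Fam U) {j : ℕ} {z : ℂ} {k : ℤ} {g : ℂ → ℂ}
    (hg : AnalyticAt ℂ g z) (he : ∀ᶠ w in 𝓝 z, U j w = (w - z)^k * g w) :
    ∀ᶠ w in 𝓝[≠] z, U (j+1) w = (w - z)^(k-1) * (k * g w + (w - z) * deriv g w) := by
  filter_upwards [h.genan j z, self_mem_nhdsWithin,
    (eventually_eventually_nhds.2 he).filter_mono nhdsWithin_le_nhds,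
    hg.eventually_analyticAt.filter_mono nhdsWithin_le_nhds] with w hw hwz hew hgw
  have hwz' : w - z ≠ 0 := sub_ne_zero.2 hwz
  rw [← (h.an j w hw).2, EventuallyEq.deriv_eq hew]
  have h1 : HasDerivAt (fun w => w - z) 1 w := (hasDerivAt_id w).sub_const z
  have h2 := (hasDerivAt_zpow k (w - z) (Or.inl hwz')).comp w h1
  have h3 := h2.mul hgw.differentiableAt.hasDerivAt
  have h4 : deriv (fun w => (w - z)^k * g w) w = _ := h3.deriv
  rw [h4]
  have h5 : (w - z)^k = (w - z)^(k-1) * (w - z) := by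
    rw [← zpow_add_one₀ hwz']; congr 1; ring
  simp only [Function.comp]
  rw [h5]
  ring

lemma Fam.ord_succ {U : ℕ → ℂ → ℂ} (h : Fam U) {j : ℕ} {z : ℂ} {k : ℤ} (ho : ordP (U j) z k) (hk : k ≠ 0) :
    ordP (U (j+1)) z (k-1) := by
  obtain ⟨g, hg, hg0, he⟩ := ho
  have h1 := h.loc_deriv hg he
  have hG : AnalyticAt ℂ (fun w => k * g w + (w - z) * deriv g w) z := by fun_prop
  have hG0 : (fun w => k * g w + (w - z) * deriv g w) z ≠ 0 := by
    simp [hk, hg0]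
  refine ⟨_, hG, hG0, ?_⟩
  exact ((h.nf (j+1) z).eventuallyEq_nhdsNE_iff_eventuallyEq_nhds
    (ordP.nf (k := k - 1) ⟨_, hG, hG0, Eventually.of_forall fun w => rfl⟩)).1 h1

lemma Fam.ord_ne {U : ℕ → ℂ → ℂ} (h : Fam U) {j : ℕ} {z : ℂ} {k : ℤ} (hj : 1 ≤ j) (ho : ordP (U j) z k) :
    k ≠ -1 := by
  rintro rfl
  obtain ⟨i, rfl⟩ : ∃ i, j = i + 1 := ⟨j - 1, by omega⟩
  obtain ⟨l, hl⟩ := h.ex_ord i z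
  by_cases hl0 : l = 0
  · have := ho.nonneg (h.an i z (hl.an hl0.ge)).1
    omega
  · have := ho.uniq (h.ord_succ hl hl0)
    omega

lemma Fam.Y_ord {U : ℕ → ℂ → ℂ} (h : Fam U) {j : ℕ} {z : ℂ} {k : ℤ} (ho : ordP (U j) z k) (hk : k ≠ 0) :
    AnalyticAt ℂ (Yf U j) z ∧ Yf U j z = 0 ∧ deriv (Yf U j) z = 1 / k := by
  obtain ⟨g, hg, hg0, he⟩ := ho
  have h1 := h.loc_deriv hg he
  have hG : AnalyticAt ℂ (fun w => k * g w + (w - z) * deriv g w) z := by fun_prop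
  have hG0 : (k:ℂ) * g z + (z - z) * deriv g z ≠ 0 := by
    simp [hk, hg0]
  have hQ : AnalyticAt ℂ (fun w => (w - z) * (g w / (k * g w + (w - z) * deriv g w))) z := by
    refine AnalyticAt.mul (by fun_prop) (hg.div hG hG0)
  have hnz := hG.continuousAt.eventually_ne hG0
  have h2 : Yf U j =ᶠ[𝓝 z] fun w => (w - z) * (g w / (k * g w + (w - z) * deriv g w)) := by
    refine nf_an (Yf_nf U j z) hQ ?_
    filter_upwards [Yf_gen h j z, h1, he.filter_mono nhdsWithin_le_nhds, self_mem_nhdsWithin,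
      hnz.filter_mono nhdsWithin_le_nhds] with w a b c d e
    have d' : w - z ≠ 0 := sub_ne_zero.2 d
    rw [a, b, c]
    have h5 : (w - z)^k = (w - z)^(k-1) * (w - z) := by
      rw [← zpow_add_one₀ d']; congr 1; ring
    have h6 : (w - z)^(k-1) ≠ 0 := zpow_ne_zero _ d'
    rw [h5]
    generalize (w - z)^(k-1) = s at *
    generalize (k:ℂ) * g w + (w - z) * deriv g w = t at *
    field_simp
  refine ⟨hQ.congr h2.symm, by rw [h2.self_of_nhds]; simp, ?_⟩
  rw [h2.deriv_eq]
  have h3 : HasDerivAt (fun w => w - z) 1 z := (hasDerivAt_id z).sub_const z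
  have h4 := h3.mul (hg.div hG hG0).differentiableAt.hasDerivAt
  have h5 : deriv (fun w => (w - z) * (g w / (k * g w + (w - z) * deriv g w))) z = _ := h4.deriv
  rw [h5]
  have : (k:ℂ) ≠ 0 := by exact_mod_cast hk
  simp
  field_simp

lemma Fam.Y_zero {U : ℕ → ℂ → ℂ} (h : Fam U) {j : ℕ} {z : ℂ} (ho : ordP (U j) z 0) (h1 : U (j+1) z ≠ 0) :
    AnalyticAt ℂ (Yf U j) z ∧ Yf U j =ᶠ[𝓝 z] (fun w => U j w / U (j+1) w) ∧ Yf U j z ≠ 0 := by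
  have ha := ho.an le_rfl
  have hQ : AnalyticAt ℂ (fun w => U j w / U (j+1) w) z := ha.div (h.an j z ha).1 h1
  have h2 := nf_an (Yf_nf U j z) hQ (Yf_gen h j z)
  exact ⟨hQ.congr h2.symm, h2, by rw [h2.self_of_nhds]; exact div_ne_zero ho.val_ne h1⟩

/-- `U_j = Y U_(j+1)` at points of analyticity -/
lemma Fam.Y_mul {U : ℕ → ℂ → ℂ} (h : Fam U) {j : ℕ} {z : ℂ} (ha : AnalyticAt ℂ (U j) z)
    (hy : AnalyticAt ℂ (Yf U j) z) : U j z = Yf U j z * U (j+1) z := by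
  refine eq_of_ne (B := fun w => Yf U j w * U (j+1) w) ?_ ha.continuousAt (hy.mul (h.an j z ha).1).continuousAt
  filter_upwards [Yf_gen h j z, h.ne (j+1) z] with w h1 h2
  simp only [h1]; field_simp

lemma Fam.Y_root {U : ℕ → ℂ → ℂ} (h : Fam U) {j : ℕ} {z : ℂ}
    (hy : AnalyticAt ℂ (Yf U j) z) (hy0 : Yf U j z = 0) :
    ∃ k : ℤ, k ≠ 0 ∧ ordP (U j) z k ∧ deriv (Yf U j) z = 1 / k := by
  obtain ⟨k, hk⟩ := h.ex_ord j z
  have hk0 : k ≠ 0 := by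
    rintro rfl
    have := h.Y_mul (hk.an le_rfl) hy
    rw [hy0, zero_mul] at this
    exact hk.val_ne this
  exact ⟨k, hk0, hk, (h.Y_ord hk hk0).2.2⟩

lemma Fam.Y_an {U : ℕ → ℂ → ℂ} (h : Fam U) {j : ℕ} {z : ℂ}
    (h1 : AnalyticAt ℂ (U (j+1)) z → U (j+1) z ≠ 0) : AnalyticAt ℂ (Yf U j) z := by
  obtain ⟨k, hk⟩ := h.ex_ord j z
  by_cases hk0 : k = 0
  · subst hk0
    exact (h.Y_zero hk (h1 (h.an j z (hk.an le_rfl)).1)).1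
  · exact (h.Y_ord hk hk0).1

lemma Fam.Y_genan {U : ℕ → ℂ → ℂ} (_h : Fam U) (j : ℕ) : Gen (fun w => AnalyticAt ℂ (Yf U j) w) :=
  Gen.of_mero fun z => (Yf_nf U j z).meromorphicAt

/-- generic relations: nonvanishing, and `Y_(j+1) = Y_j / (1 - Y_j')`. -/
lemma Fam.Y_rel {U : ℕ → ℂ → ℂ} (h : Fam U) (j : ℕ) :
    Gen (fun w => AnalyticAt ℂ (Yf U j) w ∧ AnalyticAt ℂ (Yf U (j+1)) w ∧ Yf U j w ≠ 0 ∧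
      1 - deriv (Yf U j) w ≠ 0 ∧ Yf U (j+1) w = Yf U j w / (1 - deriv (Yf U j) w)) := by
  have h0 := (h.Y_genan j).and ((h.Y_genan (j+1)).and ((Yf_gen h j).nhds.and ((Yf_gen h (j+1)).and
    ((h.genall j).and ((h.genall (j+1)).and (h.genall (j+2)))))))
  refine h0.mono ?_
  rintro w ⟨a, b, c, d, ⟨e1, e2, e3⟩, ⟨f1, f2, f3⟩, ⟨g1, g2, g3⟩⟩
  have c0 := c.self_of_nhds
  have hd : deriv (Yf U j) w = (U (j+1) w * U (j+1) w - U j w * U (j+2) w) / (U (j+1) w)^2 := by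
    rw [EventuallyEq.deriv_eq c]
    have := (e1.differentiableAt.hasDerivAt.div f1.differentiableAt.hasDerivAt f3).deriv
    rw [e2, f2] at this
    exact this
  have hs : 1 - deriv (Yf U j) w = U j w * U (j+2) w / (U (j+1) w)^2 := by
    rw [hd]; field_simp; ring
  refine ⟨a, b, by rw [c0]; exact div_ne_zero e3 f3, ?_, ?_⟩
  · rw [hs]; exact div_ne_zero (mul_ne_zero e3 g3) (pow_ne_zero 2 f3)
  · rw [hs, d, c0]; field_simp

lemma Dat.fin_poly {U : ℕ → ℂ → ℂ} (D : Dat U) {j : ℕ} {R C : ℝ} {n : ℕ}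
    (h1 : ∀ z, R < ‖z‖ → AnalyticAt ℂ (U j) z) (h2 : ∀ z, R < ‖z‖ → ‖U j z‖ ≤ C * ‖z‖^n) : False := by
  refine D.fin j (max R 1) (|C| + 1) n (fun z hz => h1 z ((le_max_left _ _).trans_lt hz)) fun z hz => ?_
  have hz1 : 1 ≤ ‖z‖ := ((le_max_right R 1).trans_lt hz).le
  refine (h2 z ((le_max_left _ _).trans_lt hz)).trans ?_
  have hx : 1 ≤ ‖z‖^n := one_le_pow₀ hz1
  generalize ‖z‖^n = x at hx
  have h3 := Real.add_one_le_exp |C|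
  have h4 := Real.add_one_le_exp x
  have h5 := abs_nonneg C
  calc C * x ≤ |C| * x := mul_le_mul_of_nonneg_right (le_abs_self C) (by linarith)
    _ ≤ Real.exp |C| * Real.exp x := mul_le_mul (by linarith) (by linarith) (by linarith) (Real.exp_nonneg _)
    _ = Real.exp (|C| + x) := (Real.exp_add _ _).symm
    _ ≤ _ := Real.exp_le_exp.2 (by nlinarith)

lemma Dat.fin_inv {U : ℕ → ℂ → ℂ} (D : Dat U) {j : ℕ} {R C : ℝ} {n : ℕ} {E : ℂ → ℂ}
    (h1 : ∀ z, R < ‖z‖ → AnalyticAt ℂ E z) (h2 : ∀ z, R < ‖z‖ → ‖E z‖ ≤ C * ‖z‖^n)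
    (h3 : ∀ z, R < ‖z‖ → ∀ᶠ w in 𝓝[≠] z, E w * U j w = 1) : False := by
  rcases poly_slow h1 h2 with h | h
  · rw [ev_cob] at h
    obtain ⟨R', hR'⟩ := h
    set z : ℂ := ((|R| + |R'| + 1 : ℝ) : ℂ) with hz
    have hzn : ‖z‖ = |R| + |R'| + 1 := by
      rw [hz, Complex.norm_real, Real.norm_eq_abs, abs_of_nonneg (by positivity)]
    have h4 := h3 z (by rw [hzn]; linarith [le_abs_self R, abs_nonneg R'])
    have h5 : ∀ᶠ w in 𝓝 z, R' < ‖w‖ :=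
      continuousAt_const.eventually_lt continuous_norm.continuousAt (by rw [hzn]; linarith [le_abs_self R', abs_nonneg R])
    obtain ⟨w, hw1, hw2⟩ := (h4.and (h5.filter_mono nhdsWithin_le_nhds)).exists
    rw [hR' w hw2] at hw1
    simp at hw1
  · obtain ⟨C', n', R', hC', hR', hb⟩ := h.bound
    have key : ∀ z, max R R' < ‖z‖ → U j =ᶠ[𝓝 z] fun w => (E w)⁻¹ := by
      intro z hz
      have hz1 := (le_max_left _ _).trans_lt hz
      have hz2 := (le_max_right _ _).trans_lt hz
      refine nf_an (D.fam.nf j z) ((hb z hz2).1.inv (hb z hz2).2.1) ?_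
      filter_upwards [h3 z hz1] with w hw
      exact eq_inv_of_mul_eq_one_right hw
    refine D.fin_poly (j := j) (R := max R R') (C := C') (n := n') (fun z hz => ?_) fun z hz => ?_
    · have hz2 := (le_max_right _ _).trans_lt hz
      exact ((hb z hz2).1.inv (hb z hz2).2.1).congr (key z hz).symm
    · rw [(key z hz).self_of_nhds]
      exact (hb z ((le_max_right _ _).trans_lt hz)).2.2.2

lemma Dat.fin_y' {U : ℕ → ℂ → ℂ} (D : Dat U) {j : ℕ} {R C : ℝ} {n : ℕ}
    (h1 : ∀ z, R < ‖z‖ → AnalyticAt ℂ (Yf U j) z) (h0 : ∀ z, R < ‖z‖ → Yf U j z ≠ 0)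
    (h2 : ∀ z, R < ‖z‖ → ‖(Yf U j z)⁻¹‖ ≤ C * ‖z‖^n) : False := by
  have hUa : ∀ z, R < ‖z‖ → AnalyticAt ℂ (U j) z := by
    intro z hz
    obtain ⟨k, hk⟩ := D.fam.ex_ord j z
    by_cases hk0 : k = 0
    · exact hk.an hk0.ge
    · exact absurd (D.fam.Y_ord hk hk0).2.1 (h0 z hz)
  set R1 : ℝ := max R 0 + 1 with hR1
  have hR1R : R < R1 := by have := le_max_left R 0; linarith
  have hR11 : 1 ≤ R1 := by have := le_max_right R 0; linarith
  obtain ⟨M, hM⟩ : ∃ M, ∀ z ∈ sphere (0:ℂ) R1, ‖U j z‖ ≤ M := by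
    refine (isCompact_sphere (0:ℂ) R1).exists_bound_of_continuousOn ?_
    intro z hz
    refine (hUa z ?_).continuousAt.continuousWithinAt
    have : ‖z‖ = R1 := by simpa using hz
    rw [this]; exact hR1R
  have hM0 : 0 ≤ M := le_trans (norm_nonneg _) (hM (R1:ℂ) (by simp; linarith))
  refine D.fin j R1 (M + |C|) (n+1) (fun z hz => hUa z (hR1R.trans hz)) ?_
  intro z hz
  have hz0 : 0 < ‖z‖ := by linarith
  have hzc : (‖z‖:ℂ) ≠ 0 := by exact_mod_cast hz0.ne'
  set e : ℂ := z / ‖z‖ with hedef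
  have hen : ‖e‖ = 1 := by
    rw [hedef, norm_div]; simp [hz0.ne']
  have hn : ∀ t : ℝ, 0 ≤ t → ‖((R1 + t : ℝ) : ℂ) * e‖ = R1 + t := by
    intro t ht
    rw [norm_mul, hen, mul_one, Complex.norm_real, Real.norm_eq_abs, abs_of_nonneg (by linarith)]
  have key := gronwall_path (φ := fun t : ℝ => U j (((R1 + t : ℝ) : ℂ) * e))
    (φ' := fun t : ℝ => U (j+1) (((R1 + t : ℝ) : ℂ) * e) * e) (T := ‖z‖ - R1)
    (A := 0) (B := |C| * ‖z‖^n) (by linarith) le_rfl (by positivity)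
    (by
      intro t ht
      have hlt : R < ‖((R1 + t : ℝ) : ℂ) * e‖ := by rw [hn t ht.1]; linarith [ht.1]
      have h1 := D.fam.hda (hUa _ hlt)
      have h2 : HasDerivAt (fun t : ℝ => ((R1 + t : ℝ) : ℂ) * e) e t := by
        have h3 : HasDerivAt (fun t : ℝ => ((R1 + t : ℝ) : ℂ)) ((1:ℝ):ℂ) t :=
          HasDerivAt.ofReal_comp ((hasDerivAt_id t).const_add R1)
        simpa using h3.mul_const e
      exact h1.comp t h2)
    (by
      intro t ht
      have hlt : R < ‖((R1 + t : ℝ) : ℂ) * e‖ := by rw [hn t ht.1]; linarith [ht.1]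
      rw [norm_mul, hen, mul_one, add_zero]
      have h3 := D.fam.Y_mul (hUa _ hlt) (h1 _ hlt)
      have h4 := h2 _ hlt
      have h5 := h0 _ hlt
      rw [hn t ht.1] at h4
      generalize ((R1 + t : ℝ) : ℂ) * e = p at *
      have h6 : U (j+1) p = (Yf U j p)⁻¹ * U j p := by rw [h3]; field_simp
      rw [h6, norm_mul]
      refine mul_le_mul_of_nonneg_right (h4.trans ?_) (norm_nonneg _)
      have h7 : (R1 + t)^n ≤ ‖z‖^n := pow_le_pow_left₀ (by linarith [ht.1]) (by linarith [ht.2]) n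
      have h8 : 0 ≤ (R1 + t)^n := pow_nonneg (by linarith [ht.1]) n
      calc C * (R1 + t)^n ≤ |C| * (R1+t)^n := mul_le_mul_of_nonneg_right (le_abs_self C) h8
        _ ≤ _ := mul_le_mul_of_nonneg_left h7 (abs_nonneg C))
  have hend : ((R1 + (‖z‖ - R1) : ℝ) : ℂ) * e = z := by
    rw [hedef]; push_cast; field_simp; ring
  simp only [hend, zero_mul, add_zero] at key
  have h9 : ‖U j ((R1 : ℂ) * e)‖ ≤ M := hM _ (by
    have := hn 0 le_rfl
    rw [mem_sphere_zero_iff_norm]; simpa using this)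
  have hz1 : 1 ≤ ‖z‖ := by linarith
  have hp0 : 1 ≤ ‖z‖^(n+1) := one_le_pow₀ hz1
  refine key.trans ?_
  calc _ ≤ Real.exp M * Real.exp (|C| * ‖z‖^n * (‖z‖ - R1)) := by
        refine mul_le_mul_of_nonneg_right (h9.trans ?_) (Real.exp_nonneg _)
        linarith [Real.add_one_le_exp M]
    _ = Real.exp (M + |C| * ‖z‖^n * (‖z‖ - R1)) := (Real.exp_add _ _).symm
    _ ≤ _ := by
        apply Real.exp_le_exp.2
        have h10 : 0 ≤ |C| * ‖z‖^n := by positivity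
        have h11 : |C| * ‖z‖^n * (‖z‖ - R1) ≤ |C| * ‖z‖^n * ‖z‖ :=
          mul_le_mul_of_nonneg_left (by linarith) h10
        have h12 : |C| * ‖z‖^n * ‖z‖ = |C| * ‖z‖^(n+1) := by ring
        nlinarith

lemma Dat.fin_y {U : ℕ → ℂ → ℂ} (D : Dat U) {j : ℕ} {R C : ℝ} {n : ℕ}
    (h1 : ∀ z, R < ‖z‖ → AnalyticAt ℂ (Yf U j) z)
    (h2 : ∀ z, R < ‖z‖ → ‖Yf U j z‖ ≤ C * ‖z‖^n) : False := by
  rcases poly_slow h1 h2 with h | h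
  · rw [ev_cob] at h
    obtain ⟨R', hR'⟩ := h
    set z : ℂ := ((|R'| + 1 : ℝ) : ℂ) with hz
    have hzn : ‖z‖ = |R'| + 1 := by
      rw [hz, Complex.norm_real, Real.norm_eq_abs, abs_of_nonneg (by positivity)]
    have h4 := D.fam.Y_rel j z
    have h5 : ∀ᶠ w in 𝓝 z, R' < ‖w‖ :=
      continuousAt_const.eventually_lt continuous_norm.continuousAt (by rw [hzn]; linarith [le_abs_self R'])
    obtain ⟨w, hw1, hw2⟩ := (h4.and (h5.filter_mono nhdsWithin_le_nhds)).exists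
    exact hw1.2.2.1 (hR' w hw2)
  · obtain ⟨C', n', R', hC', hR', hb⟩ := h.bound
    exact D.fin_y' (R := R') (fun z hz => (hb z hz).1) (fun z hz => (hb z hz).2.1) (fun z hz => (hb z hz).2.2.2)

/-- rational `Y` is impossible -/
lemma Dat.fin_rat {U : ℕ → ℂ → ℂ} (D : Dat U) {j : ℕ} {p q : Polynomial ℂ} (hp : p ≠ 0)
    (h : Gen (fun w => p.eval w * Yf U j w = q.eval w)) : False := by
  have hq : q ≠ 0 := by
    rintro rfl
    have hz := poly_ev_ne hp
    rw [ev_cob] at hz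
    obtain ⟨R', hR'⟩ := hz
    set z : ℂ := ((|R'| + 1 : ℝ) : ℂ) with hz
    have hzn : ‖z‖ = |R'| + 1 := by
      rw [hz, Complex.norm_real, Real.norm_eq_abs, abs_of_nonneg (by positivity)]
    have h5 : ∀ᶠ w in 𝓝 z, R' < ‖w‖ :=
      continuousAt_const.eventually_lt continuous_norm.continuousAt (by rw [hzn]; linarith [le_abs_self R'])
    obtain ⟨w, ⟨hw1, hw3⟩, hw2⟩ := (((D.fam.Y_rel j z).and (h z)).and (h5.filter_mono nhdsWithin_le_nhds)).exists
    exact mul_ne_zero (hR' w hw2) hw1.2.2.1 (by simpa using hw3)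
  obtain ⟨C', n', R', hC', hR', hb⟩ := (slow_rat hq hp).bound
  have hz := poly_ev_ne hp
  rw [ev_cob] at hz
  obtain ⟨R2, hR2⟩ := hz
  have key : ∀ z, max R' R2 < ‖z‖ → Yf U j =ᶠ[𝓝 z] fun w => q.eval w / p.eval w := by
    intro z hz
    refine nf_an (Yf_nf U j z) (hb z ((le_max_left _ _).trans_lt hz)).1 ?_
    have h5 : ∀ᶠ w in 𝓝 z, R2 < ‖w‖ :=
      continuousAt_const.eventually_lt continuous_norm.continuousAt ((le_max_right _ _).trans_lt hz)
    filter_upwards [h z, h5.filter_mono nhdsWithin_le_nhds] with w hw hw2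
    rw [eq_div_iff (hR2 w hw2), ← hw]; ring
  refine D.fin_y (j := j) (R := max R' R2) (C := C') (n := n') (fun z hz => ?_) fun z hz => ?_
  · exact (hb z ((le_max_left _ _).trans_lt hz)).1.congr (key z hz).symm
  · rw [(key z hz).self_of_nhds]
    exact (hb z ((le_max_left _ _).trans_lt hz)).2.2.1

lemma poly_an (p : Polynomial ℂ) (z : ℂ) : AnalyticAt ℂ (fun w => p.eval w) z :=
  p.differentiable.analyticAt z

lemma poly_gen {p : Polynomial ℂ} (hp : p ≠ 0) : Gen (fun w => p.eval w ≠ 0) := by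
  rcases gen_dich (h := fun w => p.eval w) (fun z => (poly_an p z).meromorphicAt) with h | h
  · exfalso
    apply hp
    apply Polynomial.eq_zero_of_infinite_isRoot
    have h0 := h 0
    by_contra hfin
    rw [Set.not_infinite] at hfin
    have h1 : ∀ᶠ w in 𝓝[≠] (0:ℂ), w ∉ {x | p.IsRoot x} \ {0} := by
      have : ({x | p.IsRoot x} \ {(0:ℂ)})ᶜ ∈ 𝓝 (0:ℂ) :=
        (hfin.subset Set.sdiff_subset).isClosed.isOpen_compl.mem_nhds (by simp)
      exact mem_nhdsWithin_of_mem_nhds this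
    obtain ⟨w, ⟨hw1, hw2⟩, hw3⟩ := ((h0.and h1).and self_mem_nhdsWithin).exists
    exact hw2 ⟨hw1, hw3⟩
  · exact h

/-- the function `p / q` -/
noncomputable def rfn (p q : Polynomial ℂ) : ℂ → ℂ := fun z => p.eval z / q.eval z

lemma rfn_an {p q : Polynomial ℂ} {z : ℂ} (h : q.eval z ≠ 0) : AnalyticAt ℂ (rfn p q) z :=
  (poly_an p z).div (poly_an q z) h

lemma rfn_gen (p : Polynomial ℂ) {q : Polynomial ℂ} (hq : q ≠ 0) : Gen (fun w => AnalyticAt ℂ (rfn p q) w) :=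
  (poly_gen hq).mono fun _ hw => rfn_an hw

lemma gen_e1 {U V : ℕ → ℂ → ℂ} (hU : Fam U) (hV : Fam V) {m : ℕ} {K : ℂ → ℂ}
    (hKa : Gen (fun w => AnalyticAt ℂ K w))
    (h1 : Gen (fun w => 1 - deriv (Yf V m) w = K w * (1 - deriv (Yf U m) w))) :
    Gen (fun w => deriv (fun z => Yf V m z - K z * Yf U m z) w = (1 - K w) - deriv K w * Yf U m w) := by
  refine ((hU.Y_genan m).and ((hV.Y_genan m).and (hKa.and h1))).mono ?_
  rintro w ⟨a, b, c, d⟩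
  have h2 := b.differentiableAt.hasDerivAt.sub
    (c.differentiableAt.hasDerivAt.mul a.differentiableAt.hasDerivAt)
  have h3 : deriv (fun z => Yf V m z - K z * Yf U m z) w = _ := h2.deriv
  rw [h3]
  linear_combination -d

lemma gen_e2 {U V : ℕ → ℂ → ℂ} (hU : Fam U) (hV : Fam V) {m : ℕ} {K b : ℂ → ℂ}
    (hKa : Gen (fun w => AnalyticAt ℂ K w)) (hK0 : Gen (fun w => K w ≠ 0))
    (hba : Gen (fun w => AnalyticAt ℂ b w))
    (h1 : Gen (fun w => 1 - deriv (Yf V m) w = K w * (1 - deriv (Yf U m) w)))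
    (h2 : Gen (fun w => 1 - deriv (Yf V (m+1)) w = (1 + b w) * (1 - deriv (Yf U (m+1)) w))) :
    Gen (fun z => (deriv (fun z => Yf V m z - K z * Yf U m z) z / K z
        - (Yf V m z - K z * Yf U m z) * deriv K z / K z ^ 2 - deriv b z * Yf U m z - b z * deriv (Yf U m) z)
        * (1 - deriv (Yf U m) z)
        + ((Yf V m z - K z * Yf U m z) / K z - b z * Yf U m z) * deriv (deriv (Yf U m)) z
      = - b z * (1 - deriv (Yf U m) z)^2 - deriv b z * Yf U m z * (1 - deriv (Yf U m) z)) := by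
  refine ((hU.Y_rel m).nhds.and ((hV.Y_rel m).nhds.and (hKa.and (hK0.nhds.and (hba.and (h1.nhds.and h2)))))).mono ?_
  rintro w ⟨a, b', c, d, e, f, g⟩
  obtain ⟨y0, y1, y2, y3, y4⟩ := a.self_of_nhds
  obtain ⟨x0, x1, x2, x3, x4⟩ := b'.self_of_nhds
  set y := Yf U m with hy
  set x := Yf V m with hx
  set Y1 := Yf U (m+1) with hY1
  set X1 := Yf V (m+1) with hX1
  clear_value y x Y1 X1
  have hd0 := d.self_of_nhds
  -- the function N / s
  have hη : AnalyticAt ℂ (fun z => x z - K z * y z) w := x0.sub (c.mul y0)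
  generalize hηd : (fun z => x z - K z * y z) = η at hη ⊢
  have hηz : ∀ z, x z - K z * y z = η z := fun z => congrFun hηd z
  have hev : (fun z => X1 z - Y1 z - b z * Y1 z) =ᶠ[𝓝 w] fun z => (η z / K z - b z * y z) / (1 - deriv y z) := by
    filter_upwards [a, b', d, f] with z hz hz' hKz hfz
    rw [hz.2.2.2.2, hz'.2.2.2.2, hfz, ← hηz]
    have := hz.2.2.2.1
    generalize 1 - deriv y z = s at *
    field_simp
  have hdl := (x1.differentiableAt.hasDerivAt.sub y1.differentiableAt.hasDerivAt).sub
    (e.differentiableAt.hasDerivAt.mul y1.differentiableAt.hasDerivAt)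
  have hdl' : deriv (fun z => X1 z - Y1 z - b z * Y1 z) w = _ := hdl.deriv
  have hdN := ((hη.differentiableAt.hasDerivAt.div c.differentiableAt.hasDerivAt hd0).sub
    (e.differentiableAt.hasDerivAt.mul y0.differentiableAt.hasDerivAt)).div
    ((hasDerivAt_const w (1:ℂ)).sub y0.deriv.differentiableAt.hasDerivAt) y3
  have hdN' : deriv (fun z => (η z / K z - b z * y z) / (1 - deriv y z)) w = _ := hdN.deriv
  have hfin := hev.deriv_eq
  rw [hdl', hdN'] at hfin
  rw [hηz]
  have hX1d : deriv X1 w = 1 - (1 + b w) * (1 - deriv Y1 w) := by linear_combination -g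
  rw [hX1d, y4] at hfin
  simp only [Pi.div_apply, Pi.sub_apply, Pi.mul_apply] at hfin
  rw [eq_div_iff (pow_ne_zero 2 y3)] at hfin
  generalize deriv Y1 w = dY1 at *
  generalize deriv (deriv y) w = y'' at *
  generalize hs : 1 - deriv y w = s at *
  have hyd : deriv y w = 1 - s := by rw [← hs]; ring
  rw [hyd] at hfin ⊢
  have hfs : y w / s * s = y w := by field_simp
  field_simp at hfin ⊢
  linear_combination -hfin

lemma rfn_deriv {p q : Polynomial ℂ} {z : ℂ} (h : p.eval z ≠ 0) :
    deriv (rfn q p) z = (q.derivative * p - q * p.derivative).eval z / (p.eval z)^2 := by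
  have h1 := ((q.hasDerivAt z).div (p.hasDerivAt z) h).deriv
  have h2 : deriv (rfn q p) z = _ := h1
  rw [h2]; simp

/-- the 1 - Y' formula -/
lemma Fam.Y_sub {U : ℕ → ℂ → ℂ} (h : Fam U) (j : ℕ) :
    Gen (fun w => U (j+1) w ≠ 0 ∧ 1 - deriv (Yf U j) w = U j w * U (j+2) w / (U (j+1) w)^2) := by
  have h0 := ((Yf_gen h j).nhds.and ((h.genall j).and (h.genall (j+1))))
  refine h0.mono ?_
  rintro w ⟨c, ⟨e1, e2, e3⟩, ⟨f1, f2, f3⟩⟩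
  have hd : deriv (Yf U j) w = (U (j+1) w * U (j+1) w - U j w * U (j+2) w) / (U (j+1) w)^2 := by
    rw [EventuallyEq.deriv_eq c]
    have := (e1.differentiableAt.hasDerivAt.div f1.differentiableAt.hasDerivAt f3).deriv
    rw [e2, f2] at this
    exact this
  refine ⟨f3, ?_⟩
  rw [hd]; field_simp; ring

/-- equal slopes force `K = 1`. -/
lemma slope_one {U V : ℕ → ℂ → ℂ} (hU : Fam U) (hV : Fam V) {m : ℕ} {K : ℂ → ℂ} {z : ℂ} {k : ℤ}
    (hKa : AnalyticAt ℂ K z)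
    (h1 : Gen (fun w => 1 - deriv (Yf V m) w = K w * (1 - deriv (Yf U m) w)))
    (hu : ordP (U m) z k) (hv : ordP (V m) z k) (hk0 : k ≠ 0) (hk1 : k ≠ 1) : K z = 1 := by
  obtain ⟨a1, a2, a3⟩ := hU.Y_ord hu hk0
  obtain ⟨b1, b2, b3⟩ := hV.Y_ord hv hk0
  have h2 := Gen.eq_at h1 (z := z) (continuousAt_const.sub b1.deriv.continuousAt)
    (hKa.continuousAt.mul (continuousAt_const.sub a1.deriv.continuousAt))
  rw [a3, b3] at h2
  have hkc : (k:ℂ) ≠ 0 := by exact_mod_cast hk0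
  have hkc1 : (k:ℂ) - 1 ≠ 0 := by
    intro h; apply hk1
    have : (k:ℂ) = 1 := by linear_combination h
    exact_mod_cast this
  have h3 : (1 - 1/(k:ℂ)) ≠ 0 := by
    have e : 1 - 1/(k:ℂ) = (k-1)/k := by field_simp
    rw [e]; exact div_ne_zero hkc1 hkc
  have h4 : (K z - 1) * (1 - 1/(k:ℂ)) = 0 := by linear_combination -h2
  rcases mul_eq_zero.1 h4 with h | h
  · exact sub_eq_zero.1 h
  · exact absurd h h3

/-- simple zeros of `U_(m+1)` force `K' = 0`. -/
lemma simple_zero {U V : ℕ → ℂ → ℂ} (hU : Fam U) (hV : Fam V) {m : ℕ} {K : ℂ → ℂ} {z : ℂ}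
    (hKa : AnalyticAt ℂ K z)
    (h1 : Gen (fun w => 1 - deriv (Yf V m) w = K w * (1 - deriv (Yf U m) w)))
    (hu : ordP (U m) z 0) (hv : ordP (V m) z 0) (hu1 : ordP (U (m+1)) z 1) (hv1 : ordP (V (m+1)) z 1) :
    deriv K z = 0 := by
  have hua := hu.an le_rfl
  have hva := hv.an le_rfl
  have hud := (hU.an m z hua).2
  have hvd := (hV.an m z hva).2
  rw [hu1.val_zero one_ne_zero] at hud
  rw [hv1.val_zero one_ne_zero] at hvd
  have hu0 := hu.val_ne
  have hv0 := hv.val_ne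
  obtain ⟨g, hg, hg0, hge⟩ := hu1
  obtain ⟨h, hh, hh0, hhe⟩ := hv1
  have hu2 := hU.loc_deriv hg hge
  have hv2 := hV.loc_deriv hh hhe
  have hAg : AnalyticAt ℂ (fun w => g w + (w - z) * deriv g w) z := by fun_prop
  have hAh : AnalyticAt ℂ (fun w => h w + (w - z) * deriv h w) z := by fun_prop
  have hL : AnalyticAt ℂ (fun w => V m w * (h w + (w - z) * deriv h w) * (g w * g w)) z :=
    (hva.mul hAh).mul (hg.mul hg)
  have hR : AnalyticAt ℂ (fun w => K w * U m w * (g w + (w - z) * deriv g w) * (h w * h w)) z :=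
    ((hKa.mul hua).mul hAg).mul (hh.mul hh)
  have hev : (fun w => V m w * (h w + (w - z) * deriv h w) * (g w * g w)) =ᶠ[𝓝 z]
      fun w => K w * U m w * (g w + (w - z) * deriv g w) * (h w * h w) := by
    refine nf_an hL.meromorphicNFAt hR ?_
    filter_upwards [hu2, hv2, hge.filter_mono nhdsWithin_le_nhds, hhe.filter_mono nhdsWithin_le_nhds,
      h1 z, hU.Y_sub m z, hV.Y_sub m z, self_mem_nhdsWithin] with w a1 a2 a3 a4 a5 a6 a7 a8
    have a8' : w - z ≠ 0 := sub_ne_zero.2 a8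
    rw [a6.2, a7.2] at a5
    have n1 := a6.1
    have n2 := a7.1
    have a1' : U (m+2) w = g w + (w - z) * deriv g w := by rw [show m + 2 = m + 1 + 1 by rfl, a1]; simp
    have a2' : V (m+2) w = h w + (w - z) * deriv h w := by rw [show m + 2 = m + 1 + 1 by rfl, a2]; simp
    rw [zpow_one] at a3 a4
    rw [a1', a2', a3, a4] at a5
    rw [a3] at n1
    rw [a4] at n2
    have n3 := right_ne_zero_of_mul n1
    have n4 := right_ne_zero_of_mul n2
    generalize g w + (w - z) * deriv g w = A at *
    generalize h w + (w - z) * deriv h w = B at *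
    field_simp at a5
    linear_combination a5
  have e0 := hev.self_of_nhds
  have e1 := hev.deriv_eq
  have hid : HasDerivAt (fun w => w - z) 1 z := (hasDerivAt_id z).sub_const z
  have dg := hg.differentiableAt.hasDerivAt
  have dh := hh.differentiableAt.hasDerivAt
  have dAg := dg.add (hid.mul hg.deriv.differentiableAt.hasDerivAt)
  have dAh := dh.add (hid.mul hh.deriv.differentiableAt.hasDerivAt)
  have dL := ((hva.differentiableAt.hasDerivAt.mul dAh).mul (dg.mul dg)).deriv
  have dR := (((hKa.differentiableAt.hasDerivAt.mul hua.differentiableAt.hasDerivAt).mul dAg).mul (dh.mul dh)).deriv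
  have e2 : deriv (fun w => V m w * (h w + (w - z) * deriv h w) * (g w * g w)) z = _ := dL
  have e3 : deriv (fun w => K w * U m w * (g w + (w - z) * deriv g w) * (h w * h w)) z = _ := dR
  rw [e2, e3] at e1
  simp only [Pi.mul_apply, Pi.add_apply, hud, hvd, sub_self, zero_mul, add_zero, one_mul, mul_zero, zero_add] at e0 e1
  have e4 : V m z * g z = K z * U m z * h z := by
    have : (V m z * g z - K z * U m z * h z) * (g z * h z) = 0 := by linear_combination e0
    rcases mul_eq_zero.1 this with h' | h'
    · exact sub_eq_zero.1 h'
    · exact absurd h' (mul_ne_zero hg0 hh0)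
  have e5 : deriv K z * (U m z * g z * (h z * h z)) = 0 := by
    generalize deriv K z = K' at *
    generalize deriv g z = g' at *
    generalize deriv h z = h' at *
    linear_combination -e1 + (2 * h' * g z + 2 * h z * g') * e4
  rcases mul_eq_zero.1 e5 with h' | h'
  · exact h'
  · exact absurd h' (mul_ne_zero (mul_ne_zero hu0 hg0) (mul_ne_zero hh0 hh0))

lemma caseF_nz {U : ℕ → ℂ → ℂ} (D : Dat U) {V : ℕ → ℂ → ℂ} (hV : Fam V) {m : ℕ}
    (hVr : ∀ j z k, z.im = 0 → ordP (U j) z k → ordP (V j) z k)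
    {p q p1 q1 : Polynomial ℂ} (hp : p ≠ 0) (hp1 : p1 ≠ 0)
    (hK : Gen (fun w => 1 - deriv (Yf V m) w = rfn q p w * (1 - deriv (Yf U m) w)))
    (hK1 : Gen (fun w => 1 - deriv (Yf V (m+1)) w = rfn q1 p1 w * (1 - deriv (Yf U (m+1)) w)))
    (hW : q.derivative * p - q * p.derivative ≠ 0) {z : ℂ} (n1 : p.eval z ≠ 0)
    (n3 : (q - p).eval z ≠ 0) (n4 : p1.eval z ≠ 0) (n5 : (q.derivative * p - q * p.derivative).eval z ≠ 0)
    (n6 : q1 - p1 ≠ 0 → (q1 - p1).eval z ≠ 0) (hre : z.im = 0)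
    (ha : AnalyticAt ℂ (U (m+1)) z) (h0 : U (m+1) z = 0) : False := by
  have hU := D.fam
  have hKgen := rfn_gen q hp
  obtain ⟨o, ho⟩ := hU.ex_ord m z
  obtain ⟨k, hk⟩ := hU.ex_ord (m+1) z
  have hk1 : 0 ≤ k := hk.nonneg ha
  have hk0 : k ≠ 0 := by rintro rfl; exact hk.val_ne h0
  have hov : ordP (V m) z o := hVr _ _ _ hre ho
  have hkv : ordP (V (m+1)) z k := hVr _ _ _ hre hk
  by_cases ho0 : o = 0
  · subst ho0
    by_cases hk2 : k = 1
    · subst hk2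
      have h1 := simple_zero hU hV (rfn_an n1) hK ho hov hk hkv
      rw [rfn_deriv n1] at h1
      exact div_ne_zero n5 (pow_ne_zero 2 n1) h1
    · have h1 := slope_one hU hV (rfn_an n4) hK1 hk hkv hk0 hk2
      have h2 : q1 - p1 = 0 := by
        by_contra hne
        have := n6 hne
        rw [rfn, div_eq_one_iff_eq n4] at h1
        apply this; rw [Polynomial.eval_sub, h1, sub_self]
      have h3 : q1 = p1 := sub_eq_zero.1 h2
      obtain ⟨a1, a2, a3⟩ := hU.Y_ord hk hk0
      obtain ⟨b1, b2, b3⟩ := hV.Y_ord hkv hk0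
      obtain ⟨c, hc⟩ := mero_const (h := fun w => Yf V (m+1) w - Yf U (m+1) w)
        (fun z => (Yf_nf V (m+1) z).meromorphicAt.sub (Yf_nf U (m+1) z).meromorphicAt) (by
          refine ((hU.Y_genan (m+1)).and ((hV.Y_genan (m+1)).and (hK1.and (poly_gen hp1)))).mono ?_
          rintro w ⟨c1, c2, c3, c4⟩
          have := (c2.differentiableAt.hasDerivAt.sub c1.differentiableAt.hasDerivAt).deriv
          have e : deriv (fun w => Yf V (m+1) w - Yf U (m+1) w) w = _ := this
          rw [e]
          rw [h3] at c3
          have c5 : rfn p1 p1 w = 1 := div_self c4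
          rw [c5] at c3
          linear_combination -c3)
      have hc0 : c = 0 := by
        have := Gen.eq_at (B := fun _ => c) hc (z := z) (b1.sub a1).continuousAt continuousAt_const
        simp only [a2, b2, sub_self] at this
        exact this.symm
      have hη : Gen (fun w => Yf V m w - rfn q p w * Yf U m w = 0) := by
        refine (hc.and ((hU.Y_rel m).and ((hV.Y_rel m).and hK))).mono ?_
        rintro w ⟨c1, ⟨-, -, -, c2, c3⟩, ⟨-, -, -, d2, d3⟩, c4⟩
        rw [hc0, c3, d3, sub_eq_zero] at c1
        rw [c4] at c1 d2
        have d4 := left_ne_zero_of_mul d2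
        field_simp at c1
        linear_combination c1
      have h5 : Gen (fun w => (q.derivative * p - q * p.derivative).eval w * Yf U m w = ((p - q) * p).eval w) := by
        refine (hη.nhds.and ((gen_e1 hU hV hKgen hK).and (poly_gen hp))).mono ?_
        rintro w ⟨c1, c2, c3⟩
        have c4 : (fun z => Yf V m z - rfn q p z * Yf U m z) =ᶠ[𝓝 w] fun _ => 0 := c1
        rw [c4.deriv_eq, deriv_const, rfn_deriv c3, rfn] at c2
        rw [Polynomial.eval_mul, Polynomial.eval_sub (p := p)]
        field_simp at c2
        linear_combination c2
      exact D.fin_rat hW h5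
  · have hok := hk.uniq (hU.ord_succ ho ho0)
    have h1 := slope_one hU hV (rfn_an n1) hK ho hov ho0 (by omega)
    rw [rfn, div_eq_one_iff_eq n1] at h1
    apply n3; rw [Polynomial.eval_sub, h1, sub_self]

set_option maxHeartbeats 1000000 in
lemma caseF {U : ℕ → ℂ → ℂ} (D : Dat U) {m : ℕ} (hm : 1 ≤ m) (hm9 : m + 1 ≤ 14)
    {p q p1 q1 : Polynomial ℂ} (hp : p ≠ 0) (hq : q ≠ 0) (hp1 : p1 ≠ 0)
    (hK : Gen (fun w => 1 - deriv (Yf (fun j => mtilde (U j)) m) w = rfn q p w * (1 - deriv (Yf U m) w)))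
    (hK1 : Gen (fun w => 1 - deriv (Yf (fun j => mtilde (U j)) (m+1)) w
      = rfn q1 p1 w * (1 - deriv (Yf U (m+1)) w)))
    (hW : q.derivative * p - q * p.derivative ≠ 0) : False := by
  have hU := D.fam
  have hV := D.fam.tilde
  obtain ⟨V, hVe⟩ : ∃ V : ℕ → ℂ → ℂ, V = fun j => mtilde (U j) := ⟨_, rfl⟩
  rw [← hVe] at hV hK hK1
  have hVr : ∀ j z k, z.im = 0 → ordP (U j) z k → ordP (V j) z k := by
    intro j z k hre h
    rw [hVe]; exact h.conj_real hre
  have hVz : ∀ j z, AnalyticAt ℂ (V j) z → V j z = 0 →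
      AnalyticAt ℂ (U j) (starRingEnd ℂ z) ∧ U j (starRingEnd ℂ z) = 0 := by
    intro j z ha h0
    rw [hVe] at ha h0
    exact ⟨mtilde_an_iff.1 ha, by simpa [mtilde] using h0⟩
  clear hVe
  have hqp : q - p ≠ 0 := by
    intro h
    have : q = p := sub_eq_zero.1 h
    apply hW; rw [this]; ring
  obtain ⟨R0, hR0⟩ := D.nrz
  have hb1 : ∀ᶠ z in Bornology.cobounded ℂ, q1 - p1 ≠ 0 → (q1 - p1).eval z ≠ 0 := by
    by_cases h : q1 - p1 = 0
    · exact Eventually.of_forall fun z h' => absurd h h'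
    · exact (poly_ev_ne h).mono fun z hz _ => hz
  have hall := (poly_ev_ne hp).and ((poly_ev_ne hq).and ((poly_ev_ne hqp).and ((poly_ev_ne hp1).and
    ((poly_ev_ne hW).and hb1))))
  rw [ev_cob] at hall
  obtain ⟨R1, hR1⟩ := hall
  set R : ℝ := max (max R0 R1) 1 with hRdef
  have hRpos : 0 < R := lt_of_lt_of_le one_pos (le_max_right _ _)
  have hRR0 : ∀ z : ℂ, R < ‖z‖ → R0 < ‖z‖ := fun z hz =>
    ((le_max_left _ _).trans (le_max_left _ _)).trans_lt hz
  have hRR1 : ∀ z : ℂ, R < ‖z‖ → R1 < ‖z‖ := fun z hz =>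
    ((le_max_right _ _).trans (le_max_left _ _)).trans_lt hz
  have hK1' : Gen (fun w => 1 - deriv (Yf V (m+1)) w = (1 + rfn (q1 - p1) p1 w) * (1 - deriv (Yf U (m+1)) w)) := by
    refine (hK1.and (poly_gen hp1)).mono ?_
    rintro w ⟨h1, h2⟩
    rw [h1]; congr 1
    simp only [rfn, Polynomial.eval_sub]; field_simp; ring
  have hKgen := rfn_gen q hp
  have hK0gen : Gen (fun w => rfn q p w ≠ 0) := ((poly_gen hq).and (poly_gen hp)).mono
    fun w hw => div_ne_zero hw.1 hw.2
  have hnz : ∀ z, R < ‖z‖ → AnalyticAt ℂ (U (m+1)) z → U (m+1) z ≠ 0 := by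
    intro z hz ha h0
    obtain ⟨n1, n2, n3, n4, n5, n6⟩ := hR1 z (hRR1 z hz)
    have hre : z.im = 0 := by
      by_contra hne
      exact hR0 (m+1) hm9 z (hRR0 z hz) hne ha h0
    exact caseF_nz D hV hVr hp hp1 hK hK1 hW n1 n3 n4 n5 n6 hre ha h0
  have hya : ∀ z, R < ‖z‖ → AnalyticAt ℂ (Yf U m) z := fun z hz => hU.Y_an (hnz z hz)
  have hxa : ∀ z, R < ‖z‖ → AnalyticAt ℂ (Yf V m) z := by
    intro z hz
    refine hV.Y_an fun ha h0 => ?_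
    obtain ⟨c1, c2⟩ := hVz _ _ ha h0
    exact hnz (starRingEnd ℂ z) (by simpa using hz) c1 c2
  have hKa : ∀ z, R < ‖z‖ → AnalyticAt ℂ (rfn q p) z := fun z hz => rfn_an (hR1 z (hRR1 z hz)).1
  have hba : ∀ z, R < ‖z‖ → AnalyticAt ℂ (rfn (q1 - p1) p1) z := fun z hz => rfn_an (hR1 z (hRR1 z hz)).2.2.2.1
  have hK0 : ∀ z, R < ‖z‖ → rfn q p z ≠ 0 := fun z hz =>
    div_ne_zero (hR1 z (hRR1 z hz)).2.1 (hR1 z (hRR1 z hz)).1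
  have hηa : ∀ z, R < ‖z‖ → AnalyticAt ℂ (fun z => Yf V m z - rfn q p z * Yf U m z) z :=
    fun z hz => (hxa z hz).sub ((hKa z hz).mul (hya z hz))
  have hb : Slow (rfn (q1 - p1) p1) ∨ ∀ z, rfn (q1 - p1) p1 z = 0 := by
    by_cases h : q1 - p1 = 0
    · right; intro z; rw [rfn, h]; simp
    · exact Or.inl (slow_rat h hp1)
  have hGe1 := gen_e1 hU hV hKgen hK
  have hGe2 := gen_e2 hU hV hKgen hK0gen (rfn_gen (q1 - p1) hp1) hK hK1'
  obtain ⟨C, R2, hmarty⟩ := tF1 (y := Yf U m) (η := fun z => Yf V m z - rfn q p z * Yf U m z)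
    (a := rfn (q - p) p) (b := rfn (q1 - p1) p1) (K := rfn q p) hRpos hya hηa hK0
    (slow_rat hqp hp) (slow_rat hq hp) hb
    (by
      intro z hz
      have h1 := Gen.eq_at hGe1 (z := z) (hηa z hz).deriv.continuousAt
        ((continuousAt_const.sub (hKa z hz).continuousAt).sub
          ((hKa z hz).deriv.continuousAt.mul (hya z hz).continuousAt))
      have hpz := (hR1 z (hRR1 z hz)).1
      have h2 : deriv (rfn (q - p) p) z = deriv (rfn q p) z := by
        rw [rfn_deriv hpz, rfn_deriv hpz]; congr 1
        simp only [Polynomial.eval_sub, Polynomial.eval_mul, Polynomial.derivative_sub]; ring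
      have h3 : rfn (q - p) p z = rfn q p z - 1 := by
        simp only [rfn, Polynomial.eval_sub]; field_simp
      rw [h1, h2, h3]; ring)
    (by
      intro z hz
      have c1 := (hηa z hz).continuousAt
      have c2 := (hηa z hz).deriv.continuousAt
      have c3 := (hya z hz).continuousAt
      have c4 := (hya z hz).deriv.continuousAt
      have c5 := (hya z hz).deriv.deriv.continuousAt
      have c6 := (hKa z hz).continuousAt
      have c7 := (hKa z hz).deriv.continuousAt
      have c8 := (hba z hz).continuousAt
      have c9 := (hba z hz).deriv.continuousAt
      have k0 := hK0 z hz
      refine Gen.eq_at hGe2 (z := z) ?_ ?_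
      · exact ((((c2.div c6 k0).sub ((c1.mul c7).div (c6.pow 2) (pow_ne_zero 2 k0))).sub (c9.mul c3)).sub
          (c8.mul c4)).mul (continuousAt_const.sub c4) |>.add (((c1.div c6 k0).sub (c8.mul c3)).mul c5)
      · exact (c8.neg.mul ((continuousAt_const.sub c4).pow 2)).sub
          ((c9.mul c3).mul (continuousAt_const.sub c4)))
    (by
      intro z hz h0
      obtain ⟨k, hk0, hk, hd⟩ := hU.Y_root (hya z hz) h0
      rw [hd]
      have hk1 := hU.ord_ne hm hk
      have hsucc := hU.ord_succ hk hk0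
      by_cases hk2 : k = 1
      · left; rw [hk2]; simp
      · by_cases hkpos : 0 < k
        · exact absurd (hsucc.val_zero (by omega)) (hnz z hz (hsucc.an (by omega)))
        · right
          refine ⟨(-k).toNat, by omega, ?_⟩
          have : ((-k).toNat : ℤ) = -k := Int.toNat_of_nonneg (by omega)
          have h2 : (((-k).toNat : ℕ) : ℂ) = -(k:ℂ) := by
            rw [← Int.cast_neg, ← this]; norm_cast
          rw [h2, div_neg, neg_div, neg_neg])
  obtain ⟨M, R3, h⟩ := tF2 (C := C) (R := max R R2) (lt_of_lt_of_le hRpos (le_max_left _ _))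
    (fun z hz => hya z ((le_max_left _ _).trans_lt hz)) (fun z hz => hmarty z ((le_max_right _ _).trans_lt hz))
  rcases h with h | h
  · refine D.fin_y (j := m) (R := max R R3) (C := M) (n := 1)
      (fun z hz => hya z ((le_max_left _ _).trans_lt hz)) fun z hz => ?_
    rw [pow_one]; exact h z ((le_max_right _ _).trans_lt hz)
  · refine D.fin_y' (j := m) (R := max R R3) (C := 1) (n := 0)
      (fun z hz => hya z ((le_max_left _ _).trans_lt hz)) (fun z hz h0 => ?_) fun z hz => ?_
    · have := h z ((le_max_right _ _).trans_lt hz)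
      rw [h0, norm_zero] at this; linarith
    · have := h z ((le_max_right _ _).trans_lt hz)
      rw [norm_inv, pow_zero, mul_one]
      exact inv_le_one_of_one_le₀ this

lemma ordP.inv {h : ℂ → ℂ} {z : ℂ} {k : ℤ} (h1 : ordP h z k) : ordP (fun w => (h w)⁻¹) z (-k) := by
  obtain ⟨g, hg, hg0, he⟩ := h1
  refine ⟨fun w => (g w)⁻¹, hg.inv hg0, inv_ne_zero hg0, ?_⟩
  filter_upwards [he] with w hw
  rw [hw, mul_inv, zpow_neg]

/-- poly bound contradiction for a family member without zeros, case of large log derivative quotient. -/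
lemma caseM_end {U : ℕ → ℂ → ℂ} (D : Dat U) {m : ℕ} {R c : ℝ} (hR : 0 < R) (hc : 0 < c)
    (hk : ∀ z k, R < ‖z‖ → ordP (U m) z k → k ≤ 0)
    (h : ∀ r0 : ℝ, ∃ r, r0 < r ∧ ∀ z, ‖z‖ = r → AnalyticAt ℂ (Yf U m) z → c * ‖z‖ ≤ ‖Yf U m z‖) : False := by
  have hU := D.fam
  have hE : ∀ z, R < ‖z‖ → AnalyticAt ℂ (fun w => (U m w)⁻¹) z := by
    intro z hz
    obtain ⟨k, ho⟩ := hU.ex_ord m z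
    have := hk z k hz ho
    exact ho.inv.an (by omega)
  obtain ⟨M, N, hb⟩ := circ_growth (C := 1 / c) hR.le hE (by
    intro r0
    obtain ⟨r, hr, hr'⟩ := h (max r0 R)
    refine ⟨r, (le_max_left _ _).trans_lt hr, ?_⟩
    intro z hz
    have hzR : R < ‖z‖ := by rw [hz]; exact (le_max_right _ _).trans_lt hr
    have hzpos : 0 < ‖z‖ := hR.trans hzR
    obtain ⟨k, ho⟩ := hU.ex_ord m z
    by_cases hk0 : k = 0
    · subst hk0
      have ha := ho.an le_rfl
      have hv := ho.val_ne
      have hd : deriv (fun w => (U m w)⁻¹) z = -U (m+1) z / (U m z)^2 := ((hU.hda ha).inv hv).deriv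
      rw [hd]
      by_cases h1 : U (m+1) z = 0
      · rw [h1]; simp; positivity
      · obtain ⟨y1, y2, y3⟩ := hU.Y_zero ho h1
        have h2 := hr' z hz y1
        rw [y2.self_of_nhds] at h2
        rw [norm_div] at h2
        have p1 : 0 < ‖U (m+1) z‖ := norm_pos_iff.2 h1
        have p2 : 0 < ‖U m z‖ := norm_pos_iff.2 hv
        rw [le_div_iff₀ p1] at h2
        rw [norm_mul, norm_div, norm_neg, norm_pow, norm_inv]
        generalize ‖U (m+1) z‖ = A at *
        generalize ‖U m z‖ = B at *
        generalize ‖z‖ = t at *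
        rw [mul_div_assoc', div_le_iff₀ (by positivity)]
        have : 1 / c * B⁻¹ * B^2 = B / c := by field_simp
        rw [this, le_div_iff₀ hc]
        linarith
    · obtain ⟨y1, y2, y3⟩ := hU.Y_ord ho hk0
      have h2 := hr' z hz y1
      rw [y2, norm_zero] at h2
      have : 0 < c * ‖z‖ := by positivity
      linarith)
  refine D.fin_inv (j := m) (R := R + 1) (C := M) (n := N) (E := fun w => (U m w)⁻¹)
    (fun z hz => hE z (by linarith)) hb ?_
  intro z hz
  exact (hU.ne m z).mono fun w hw => inv_mul_cancel₀ hw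

/-- the generic `e2` in case M -/
lemma gen_e2M {U V : ℕ → ℂ → ℂ} (hU : Fam U) (hV : Fam V) {m : ℕ} {κ : ℂ} {b ℓ : ℂ → ℂ} (hκ : κ ≠ 0)
    (hba : Gen (fun w => AnalyticAt ℂ b w))
    (h1 : Gen (fun w => 1 - deriv (Yf V m) w = κ * (1 - deriv (Yf U m) w)))
    (h2 : Gen (fun w => 1 - deriv (Yf V (m+1)) w = (1 + b w) * (1 - deriv (Yf U (m+1)) w)))
    (hℓ : Gen (fun w => Yf V m w - κ * Yf U m w = ℓ w)) :
    Gen (fun z => (ℓ z - κ * b z * Yf U m z) * deriv (deriv (Yf U m)) z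
      = - (1 - deriv (Yf U m) z) * (deriv ℓ z + κ * b z * (1 - 2 * deriv (Yf U m) z))) := by
  have g := gen_e2 (K := fun _ => κ) hU hV (Gen.of_mero fun z => analyticAt_const.meromorphicAt)
    (fun z => Eventually.of_forall fun w => hκ) hba h1 h2
  refine (g.and hℓ.nhds).mono ?_
  rintro w ⟨a1, a2⟩
  have e1 : (fun z => Yf V m z - κ * Yf U m z) =ᶠ[𝓝 w] ℓ := a2
  rw [e1.deriv_eq, a2.self_of_nhds, deriv_const] at a1
  generalize deriv (deriv (Yf U m)) w = y2 at *
  generalize deriv (Yf U m) w = y1 at *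
  generalize Yf U m w = y at *
  generalize deriv ℓ w = l1 at *
  generalize deriv b w = b1 at *
  generalize ℓ w = l at *
  generalize b w = b0 at *
  field_simp at a1
  apply mul_left_cancel₀ hκ
  linear_combination a1

lemma caseM {U : ℕ → ℂ → ℂ} (D : Dat U) {m : ℕ} (hm : 1 ≤ m) (hm9 : m ≤ 14)
    {V : ℕ → ℂ → ℂ} (hV : Fam V)
    (hVr : ∀ j z k, z.im = 0 → ordP (U j) z k → ordP (V j) z k)
    {κ : ℂ} {p1 q1 : Polynomial ℂ} (hκ : κ ≠ 0) (hp1 : p1 ≠ 0)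
    (hK : Gen (fun w => 1 - deriv (Yf V m) w = κ * (1 - deriv (Yf U m) w)))
    (hK1 : Gen (fun w => 1 - deriv (Yf V (m+1)) w = rfn q1 p1 w * (1 - deriv (Yf U (m+1)) w)))
    (hne : ¬ Gen (fun w => Yf V m w = Yf U m w)) : False := by
  have hU := D.fam
  obtain ⟨R0, hR0⟩ := D.nrz
  obtain ⟨c, hc⟩ := mero_const (h := fun w => Yf V m w - κ * Yf U m w - (1 - κ) * w)
    (fun z => ((Yf_nf V m z).meromorphicAt.sub
      (analyticAt_const.meromorphicAt.mul (Yf_nf U m z).meromorphicAt)).sub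
      (analyticAt_const.mul analyticAt_id).meromorphicAt) (by
      refine ((hU.Y_genan m).and ((hV.Y_genan m).and hK)).mono ?_
      rintro w ⟨a, b, d⟩
      have h2 := (b.differentiableAt.hasDerivAt.sub
        (a.differentiableAt.hasDerivAt.const_mul κ)).sub ((hasDerivAt_id w).const_mul (1 - κ))
      have h3 : deriv (fun w => Yf V m w - κ * Yf U m w - (1 - κ) * w) w = _ := h2.deriv
      rw [h3]
      linear_combination -d)
  set P : Polynomial ℂ := Polynomial.C (1 - κ) * Polynomial.X + Polynomial.C c with hPdef
  have hPe : ∀ z, P.eval z = (1 - κ) * z + c := by intro z; simp [hPdef]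
  have hP : P ≠ 0 := by
    intro h0
    apply hne
    have e0 : c = 0 := by have := hPe 0; rw [h0] at this; simpa using this.symm
    have e1 : κ = 1 := by
      have := hPe 1; rw [h0, e0] at this
      simp only [Polynomial.eval_zero, mul_one, add_zero] at this
      linear_combination this
    refine hc.mono fun w hw => ?_
    rw [e0, e1] at hw
    linear_combination hw
  have hℓ : Gen (fun w => Yf V m w - κ * Yf U m w = rfn P 1 w) := by
    refine hc.mono fun w hw => ?_
    rw [rfn, hPe, Polynomial.eval_one, div_one]
    linear_combination hw
  have hK1' : Gen (fun w => 1 - deriv (Yf V (m+1)) w = (1 + rfn (q1 - p1) p1 w) * (1 - deriv (Yf U (m+1)) w)) := by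
    refine (hK1.and (poly_gen hp1)).mono ?_
    rintro w ⟨h1, h2⟩
    rw [h1]; congr 1
    simp only [rfn, Polynomial.eval_sub]; field_simp; ring
  have hGe2 := gen_e2M hU hV hκ (rfn_gen (q1 - p1) hp1) hK hK1' hℓ
  have hall := (poly_ev_ne hP).and (poly_ev_ne hp1)
  rw [ev_cob] at hall
  obtain ⟨R1, hR1⟩ := hall
  set R : ℝ := max (max R0 R1) 1 with hRdef
  have hRpos : 0 < R := lt_of_lt_of_le one_pos (le_max_right _ _)
  have hRR0 : ∀ z : ℂ, R < ‖z‖ → R0 < ‖z‖ := fun z hz =>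
    ((le_max_left _ _).trans (le_max_left _ _)).trans_lt hz
  have hRR1 : ∀ z : ℂ, R < ‖z‖ → R1 < ‖z‖ := fun z hz =>
    ((le_max_right _ _).trans (le_max_left _ _)).trans_lt hz
  have hk : ∀ z k, R < ‖z‖ → ordP (U m) z k → k ≤ 0 := by
    intro z k hz ho
    by_contra hkpos
    have hk0 : k ≠ 0 := by omega
    by_cases hre : z.im = 0
    · have hov := hVr _ _ _ hre ho
      obtain ⟨a1, a2, a3⟩ := hU.Y_ord ho hk0
      obtain ⟨b1, b2, b3⟩ := hV.Y_ord hov hk0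
      have hla : AnalyticAt ℂ (rfn P 1) z := rfn_an (by simp)
      have h1 := Gen.eq_at hℓ (z := z)
        (b1.continuousAt.sub (continuousAt_const.mul a1.continuousAt)) hla.continuousAt
      rw [a2, b2, rfn, Polynomial.eval_one, div_one, mul_zero, sub_zero] at h1
      exact (hR1 z (hRR1 z hz)).1 h1.symm
    · exact hR0 m hm9 z (hRR0 z hz) hre (ho.an (by omega)) (ho.val_zero hk0)
  have hβe : ∀ z, rfn (Polynomial.C κ * (q1 - p1)) p1 z = κ * rfn (q1 - p1) p1 z := by
    intro z; simp only [rfn, Polynomial.eval_mul, Polynomial.eval_C]; ring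
  have hb : Slow (rfn (Polynomial.C κ * (q1 - p1)) p1) ∨ ∀ z, rfn (Polynomial.C κ * (q1 - p1)) p1 z = 0 := by
    by_cases h : q1 - p1 = 0
    · right; intro z; rw [rfn, h]; simp
    · exact Or.inl (slow_rat (mul_ne_zero (by simpa using hκ) h) hp1)
  have he2 : ∀ z, R < ‖z‖ → AnalyticAt ℂ (Yf U m) z →
      (rfn P 1 z - rfn (Polynomial.C κ * (q1 - p1)) p1 z * Yf U m z) * deriv (deriv (Yf U m)) z
      = - (1 - deriv (Yf U m) z) * (deriv (rfn P 1) z +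
        rfn (Polynomial.C κ * (q1 - p1)) p1 z * (1 - 2 * deriv (Yf U m) z)) := by
    intro z hz hy
    have hla : AnalyticAt ℂ (rfn P 1) z := rfn_an (by simp)
    have hbz : AnalyticAt ℂ (rfn (q1 - p1) p1) z := rfn_an (hR1 z (hRR1 z hz)).2
    have c1 := hla.continuousAt
    have c2 := hla.deriv.continuousAt
    have c3 := hbz.continuousAt
    have c4 := hy.continuousAt
    have c5 := hy.deriv.continuousAt
    have c6 := hy.deriv.deriv.continuousAt
    rw [hβe]
    refine Gen.eq_at hGe2 (z := z) ?_ ?_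
    · exact (c1.sub ((continuousAt_const.mul c3).mul c4)).mul c6
    · exact (continuousAt_const.sub c5).neg.mul (c2.add ((continuousAt_const.mul c3).mul
        (continuousAt_const.sub (continuousAt_const.mul c5))))
  have hs : ∀ z, R < ‖z‖ → AnalyticAt ℂ (Yf U m) z → Yf U m z = 0 → SlM (deriv (Yf U m) z) := by
    intro z hz hy h0
    obtain ⟨k, hk0, ho, hd⟩ := hU.Y_root hy h0
    rw [hd]
    have hk1 := hU.ord_ne hm ho
    have hk2 := hk z k hz ho
    refine ⟨(-k).toNat, by omega, ?_⟩
    have : ((-k).toNat : ℤ) = -k := Int.toNat_of_nonneg (by omega)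
    have h2 : (((-k).toNat : ℕ) : ℂ) = -(k:ℂ) := by
      rw [← Int.cast_neg, ← this]; norm_cast
    rw [h2, div_neg, neg_div, neg_neg]
  obtain ⟨C, R2, hmarty⟩ := tM1 hRpos (fun z _ => Yf_Mer U m z) (slow_rat hP one_ne_zero) hb he2 hs
  rcases tM2 hmarty with ⟨R', h⟩ | ⟨c', hc', h⟩
  · exact D.fin_y (j := m) (R := R') (C := 1) (n := 1) (fun z hz => (h z hz).1)
      fun z hz => by rw [pow_one, one_mul]; exact (h z hz).2
  · exact caseM_end D hRpos hc' hk h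

lemma inv_ders {w h : ℂ → ℂ} {z Q : ℂ} (hw : AnalyticAt ℂ w z) (h1 : w z ≠ 1)
    (hh : h =ᶠ[𝓝 z] fun u => Q / (1 - w u)) :
    deriv (deriv h) z = Q * (2 * (deriv w z)^2 + (1 - w z) * deriv (deriv w) z) / (1 - w z)^3 ∧
    deriv (deriv (deriv h)) z = Q * (6 * (deriv w z)^3 + 6 * (1 - w z) * deriv w z * deriv (deriv w) z
        + (1 - w z)^2 * deriv (deriv (deriv w)) z) / (1 - w z)^4 := by
  have hev : ∀ᶠ u in 𝓝 z, AnalyticAt ℂ w u ∧ 1 - w u ≠ 0 := by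
    refine hw.eventually_analyticAt.and ?_
    have : ContinuousAt (fun u => 1 - w u) z := continuousAt_const.sub hw.continuousAt
    exact this.eventually_ne (sub_ne_zero.2 (Ne.symm h1))
  have d1 : ∀ᶠ u in 𝓝 z, deriv h u = Q * deriv w u / (1 - w u)^2 := by
    filter_upwards [hh.deriv, hev] with u hu hv
    rw [hu]
    have a := ((hasDerivAt_const u Q).div ((hasDerivAt_const u (1:ℂ)).sub hv.1.differentiableAt.hasDerivAt) hv.2).deriv
    have e : deriv (fun u => Q / (1 - w u)) u = _ := a
    rw [e]; simp only [Pi.sub_apply]; congr 1; ring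
  have d1' : deriv h =ᶠ[𝓝 z] fun u => Q * deriv w u / (1 - w u)^2 := d1
  have d2 : ∀ᶠ u in 𝓝 z, deriv (deriv h) u = Q * (2 * (deriv w u)^2 + (1 - w u) * deriv (deriv w) u) / (1 - w u)^3 := by
    filter_upwards [d1'.deriv, hev] with u hu hv
    rw [hu]
    have a := ((hv.1.deriv.differentiableAt.hasDerivAt.const_mul Q).div
      (((hasDerivAt_const u (1:ℂ)).sub hv.1.differentiableAt.hasDerivAt).pow 2) (pow_ne_zero 2 hv.2)).deriv
    have e : deriv (fun u => Q * deriv w u / (1 - w u)^2) u = _ := a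
    rw [e]; simp only [Pi.sub_apply, Pi.pow_apply]
    have hv2 := hv.2
    generalize hA : 1 - w u = A at *
    generalize deriv (deriv w) u = w2 at *
    generalize deriv w u = w1 at *
    field_simp
    push_cast
    ring
  have d2' : deriv (deriv h) =ᶠ[𝓝 z] fun u => Q * (2 * (deriv w u)^2 + (1 - w u) * deriv (deriv w) u) / (1 - w u)^3 := d2
  refine ⟨d2.self_of_nhds, ?_⟩
  rw [d2'.deriv_eq]
  have hv := hev.self_of_nhds
  have w0 := hw.differentiableAt.hasDerivAt
  have w1 := hw.deriv.differentiableAt.hasDerivAt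
  have w2 := hw.deriv.deriv.differentiableAt.hasDerivAt
  have a := (((((w1.pow 2).const_mul 2).add (((hasDerivAt_const z (1:ℂ)).sub w0).mul w2)).const_mul Q).div
      (((hasDerivAt_const z (1:ℂ)).sub w0).pow 3) (pow_ne_zero 3 hv.2)).deriv
  have e : deriv (fun u => Q * (2 * (deriv w u)^2 + (1 - w u) * deriv (deriv w) u) / (1 - w u)^3) z = _ := a
  rw [e]; simp only [Pi.sub_apply, Pi.pow_apply, Pi.add_apply, Pi.mul_apply]
  have hv2 := hv.2
  generalize hA : 1 - w z = A at *
  generalize deriv (deriv (deriv w)) z = w3 at *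
  generalize deriv (deriv w) z = w2 at *
  generalize deriv w z = w1 at *
  field_simp
  push_cast
  ring

lemma caseB_core {U : ℕ → ℂ → ℂ} (D : Dat U) {n : ℕ} (hn : n + 3 ≤ 14) {c q : ℂ} (hc : c ≠ 0) (hc1 : ‖c‖ = 1)
    (hq : q ≠ 0) (h : Gen (fun w => mtilde (U n) w = c * U n w + q)) : False := by
  have hU := D.fam
  obtain ⟨R0, hR0⟩ := D.nrz
  set R := max R0 1 with hR
  have hRpos : 0 < R := lt_of_lt_of_le one_pos (le_max_right _ _)
  have hRR0 : ∀ z : ℂ, R < ‖z‖ → R0 < ‖z‖ := fun z hz => (le_max_left _ _).trans_lt hz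
  have heq : ∀ z, AnalyticAt ℂ (U n) z → mtilde (U n) =ᶠ[𝓝 z] fun w => c * U n w + q := fun z ha =>
    nf_an (hU.tilde.nf n z) ((analyticAt_const.mul ha).add analyticAt_const) (h z)
  have hnz : ∀ z, R < ‖z‖ → AnalyticAt ℂ (U n) z → U n z ≠ 0 := by
    intro z hz ha h0
    by_cases hre : z.im = 0
    · have h1 : mtilde (U n) z = c * U n z + q := (heq z ha).self_of_nhds
      have h2 : starRingEnd ℂ z = z := Complex.conj_eq_iff_im.2 hre
      rw [mtilde, h2, h0, map_zero, mul_zero, zero_add] at h1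
      exact hq h1.symm
    · exact hR0 n (by omega) z (hRR0 z hz) hre ha h0
  have hk : ∀ z k, R < ‖z‖ → ordP (U n) z k → k ≤ 0 := by
    intro z k hz ho
    by_contra hk
    exact hnz z hz (ho.an (by omega)) (ho.val_zero (by omega))
  have hE : ∀ z, R < ‖z‖ → AnalyticAt ℂ (fun w => (U n w)⁻¹) z := by
    intro z hz
    obtain ⟨k, ho⟩ := hU.ex_ord n z
    have := hk z k hz ho
    exact ho.inv.an (by omega)
  -- points where the inverse is nonzero
  have hgood : ∀ z, R < ‖z‖ → U n z ≠ 0 → AnalyticAt ℂ (U n) z := by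
    intro z hz h0
    obtain ⟨k, ho⟩ := hU.ex_ord n z
    by_cases hk0 : k = 0
    · exact ho.an (by omega)
    · exact absurd (ho.val_zero hk0) h0
  set w : ℂ → ℂ := fun z => 1 + q / c * (U n z)⁻¹ with hw
  have hwa : ∀ z, R < ‖z‖ → AnalyticAt ℂ w z := fun z hz =>
    analyticAt_const.add (analyticAt_const.mul (hE z hz))
  have hwV : ∀ z, AnalyticAt ℂ (U n) z → U n z ≠ 0 → w z = mtilde (U n) z / (c * U n z) := by
    intro z ha h0
    rw [(heq z ha).self_of_nhds, hw]; field_simp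
  have hw0 : ∀ z, R < ‖z‖ → w z ≠ 0 := by
    intro z hz hwz
    by_cases h0 : U n z = 0
    · simp [hw, h0] at hwz
    · have ha := hgood z hz h0
      rw [hwV z ha h0] at hwz
      have h1 : mtilde (U n) z = 0 := by
        rcases div_eq_zero_iff.1 hwz with h' | h'
        · exact h'
        · exact absurd h' (mul_ne_zero hc h0)
      have hva : AnalyticAt ℂ (mtilde (U n)) z :=
        ((analyticAt_const.mul ha).add analyticAt_const).congr (heq z ha).symm
      refine hnz (starRingEnd ℂ z) (by simpa using hz) (mtilde_an_iff.1 hva) ?_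
      simpa [mtilde] using h1
  have hr : ∀ z, R < ‖z‖ → z.im = 0 → ‖w z‖ = 1 := by
    intro z hz hre
    by_cases h0 : U n z = 0
    · simp [hw, h0]
    · have ha := hgood z hz h0
      rw [hwV z ha h0, mtilde, Complex.conj_eq_iff_im.2 hre, norm_div, norm_mul, hc1, one_mul, RCLike.norm_conj]
      exact div_self (norm_ne_zero_iff.2 h0)
  have hders : ∀ z, R < ‖z‖ → w z ≠ 1 → AnalyticAt ℂ (U n) z ∧
      deriv (deriv (U n)) z = (-(q/c)) * (2 * (deriv w z)^2 + (1 - w z) * deriv (deriv w) z) / (1 - w z)^3 ∧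
      deriv (deriv (deriv (U n))) z = (-(q/c)) * (6 * (deriv w z)^3 + 6 * (1 - w z) * deriv w z * deriv (deriv w) z
        + (1 - w z)^2 * deriv (deriv (deriv w)) z) / (1 - w z)^4 := by
    intro z hz h1
    have h0 : U n z ≠ 0 := by intro h0; apply h1; simp [hw, h0]
    have ha := hgood z hz h0
    refine ⟨ha, inv_ders (hwa z hz) h1 ?_⟩
    filter_upwards [ha.continuousAt.eventually_ne h0] with u hu
    have : 1 - w u = -(q/c) * (U n u)⁻¹ := by simp only [hw]; ring
    rw [this]
    field_simp
  have hd2 : ∀ z, AnalyticAt ℂ (U n) z → deriv (deriv (U n)) z = U (n+2) z ∧ deriv (deriv (deriv (U n))) z = U (n+3) z := by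
    intro z ha
    have e1 := hU.deriv_ev ha
    have a1 := (hU.an n z ha).1
    have e2 := hU.deriv_ev a1
    have a2 := (hU.an _ z a1).1
    have e3 := hU.deriv_ev a2
    refine ⟨?_, ?_⟩
    · rw [e1.deriv_eq]; exact e2.self_of_nhds
    · rw [e1.deriv.deriv_eq, e2.deriv_eq]; exact e3.self_of_nhds
  obtain ⟨C, N, R', hb⟩ := tB (w := w) hRpos hwa hw0 hr
    (by
      intro z hz hre h1 h0
      obtain ⟨ha, e1, e2⟩ := hders z hz h1
      rw [h0, mul_zero, zero_div, (hd2 z ha).1] at e1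
      exact hR0 (n+2) (by omega) z (hRR0 z hz) hre (hU.an_add n 2 z ha) e1)
    (by
      intro z hz hre h1 h0
      obtain ⟨ha, e1, e2⟩ := hders z hz h1
      rw [h0, mul_zero, zero_div, (hd2 z ha).2] at e2
      exact hR0 (n+3) (by omega) z (hRR0 z hz) hre (hU.an_add n 3 z ha) e2)
  refine D.fin_inv (j := n) (R := max R R') (C := ‖c / q‖ * (|C| + 1)) (n := N) (E := fun w => (U n w)⁻¹)
    (fun z hz => hE z ((le_max_left _ _).trans_lt hz)) (fun z hz => ?_) fun z hz =>
      (hU.ne n z).mono fun w hw => inv_mul_cancel₀ hw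
  have e : (U n z)⁻¹ = c / q * (w z - 1) := by simp only [hw]; field_simp; ring
  rw [e, norm_mul, mul_assoc]
  have hzz : R < ‖z‖ := (le_max_left _ _).trans_lt hz
  have hz1 : 1 ≤ ‖z‖ := ((le_max_right R0 1).trans hzz.le)
  have h1 : 1 ≤ ‖z‖^N := one_le_pow₀ hz1
  refine mul_le_mul_of_nonneg_left ?_ (norm_nonneg _)
  calc ‖w z - 1‖ ≤ ‖w z‖ + ‖(1:ℂ)‖ := norm_sub_le _ _
    _ ≤ C * ‖z‖^N + 1 := by rw [norm_one]; linarith [hb z ((le_max_right _ _).trans_lt hz)]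
    _ ≤ |C| * ‖z‖^N + ‖z‖^N := by
        have := mul_le_mul_of_nonneg_right (le_abs_self C) (by positivity : 0 ≤ ‖z‖^N)
        linarith
    _ = (|C| + 1) * ‖z‖^N := by ring

lemma caseB {U : ℕ → ℂ → ℂ} (D : Dat U) {m : ℕ} (hm : m + 2 ≤ 14)
    (h : Gen (fun w => Yf (fun j => mtilde (U j)) m w = Yf U m w)) : False := by
  have hU := D.fam
  have hV := D.fam.tilde
  have hex : ∃ n, n ≤ m ∧ ∃ c : ℂ, Gen (fun w => mtilde (U n) w = c * U n w) := by
    obtain ⟨c, hc⟩ := mero_const (h := fun w => mtilde (U m) w / U m w)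
      (fun z => (hV.mer m z).div (hU.mer m z)) (by
        refine (h.and ((Yf_gen hU m).and ((Yf_gen hV m).and ((hU.genall m).and ((hV.genall m).and
          ((hU.ne (m+1)).and (hV.ne (m+1)))))))).mono ?_
        rintro w ⟨a, b, c, ⟨d1, d2, d3⟩, ⟨e1, e2, e3⟩, f, g⟩
        rw [b, c] at a
        have a0 := ((hV.hda e1).div (hU.hda d1) d3).deriv
        have a1 : deriv (fun w => mtilde (U m) w / U m w) w = _ := a0
        rw [a1]
        rw [div_eq_div_iff g f] at a
        rw [div_eq_zero_iff]; left
        linear_combination -a)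
    refine ⟨m, le_rfl, c, (hc.and (hU.ne m)).mono fun w hw => ?_⟩
    rw [← hw.1, div_mul_cancel₀ _ hw.2]
  classical
  obtain ⟨hn, c, hc⟩ := Nat.find_spec hex
  have hmin := fun k hk => Nat.find_min hex (m := k) hk
  generalize Nat.find hex = n at *
  obtain _ | n := n
  · exact D.snr ⟨c, hc⟩
  have hcc : ‖c‖ = 1 := by
    obtain ⟨w, ⟨a, b⟩, d⟩ := ((hc.and hc.conj).and (hU.ne (n+1))).exists
    simp only [mtilde, Complex.conj_conj] at a b
    have h1 := congrArg norm a
    have h2 := congrArg norm b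
    rw [norm_mul, RCLike.norm_conj] at h1 h2
    have p : 0 < ‖U (n+1) w‖ := norm_pos_iff.2 d
    rw [h1] at h2
    have h3 : (‖c‖ * ‖c‖ - 1) * ‖U (n+1) w‖ = 0 := by linarith
    rcases mul_eq_zero.1 h3 with h4 | h4
    · have h5 : (‖c‖ - 1) * (‖c‖ + 1) = 0 := by linarith
      rcases mul_eq_zero.1 h5 with h6 | h6
      · linarith
      · linarith [norm_nonneg c]
    · linarith
  have hc0 : c ≠ 0 := by rw [← norm_ne_zero_iff, hcc]; exact one_ne_zero
  obtain ⟨q, hq⟩ := mero_const (h := fun w => mtilde (U n) w - c * U n w)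
    (fun z => (hV.mer n z).sub (analyticAt_const.meromorphicAt.mul (hU.mer n z))) (by
      refine (hc.and ((hU.genan n).and (hV.genan n))).mono ?_
      rintro w ⟨a, b, d⟩
      have a0 := ((hV.hda d).sub ((hU.hda b).const_mul c)).deriv
      have a1 : deriv (fun w => mtilde (U n) w - c * U n w) w = _ := a0
      rw [a1, a, sub_self])
  have hq0 : q ≠ 0 := by
    rintro rfl
    exact hmin n (by omega) ⟨by omega, c, hq.mono fun w hw => sub_eq_zero.1 hw⟩
  exact caseB_core D (n := n) (by omega) hc0 hcc hq0 (hq.mono fun w hw => by rw [← hw]; ring)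

lemma mkDat {f : ℂ → ℂ} (hs : Setup 11 f)
    (hio : ¬ FiniteOrder f ∨ {z : ℂ | meroOrder f z < 0}.Infinite) :
    ∃ U : ℕ → ℂ → ℂ, Dat U ∧ ∀ j, Gen (fun w => iteratedDeriv j f w = U j w) := by
  obtain ⟨-, hf, hsnr, hfin⟩ := hs
  have hcore : ∀ {j : ℕ} {u : ℂ → ℂ} {R C : ℝ} {N : ℕ}, (∀ z, R < ‖z‖ → AnalyticAt ℂ u z) →
      (∀ z, R < ‖z‖ → ‖u z‖ ≤ Real.exp (C * ‖z‖^N)) →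
      (∀ z, R < ‖z‖ → ∀ᶠ w in 𝓝[≠] z, iteratedDeriv j f w = u w) → False := by
    intro j u R C N h1 h2 h3
    have := fin_core hf h1 h2 h3
    rcases hio with h | h
    · exact h this.1
    · exact h this.2
  have hg : ∀ j, Gen (fun w => iteratedDeriv j f w = nfC (iteratedDeriv j f) w) := fun j =>
    (nfC_eq (iter_mero hf j)).mono fun w hw => hw.symm
  refine ⟨fun j => nfC (iteratedDeriv j f), ⟨⟨fun j z => nfC_nf _ z, ?_, ?_⟩, ?_, ?_, ?_⟩, hg⟩
  · intro j z ha
    have hev : ∀ᶠ w in 𝓝[≠] z, nfC (iteratedDeriv (j+1) f) w = deriv (nfC (iteratedDeriv j f)) w := by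
      have h1 : iteratedDeriv j f =ᶠ[𝓝[≠] z] nfC (iteratedDeriv j f) := hg j z
      filter_upwards [h1.nhdsNE_deriv, hg (j+1) z] with w a b
      rw [← b, ← a, iteratedDeriv_succ]
    have h2 := nf_an (nfC_nf _ z) ha.deriv hev
    exact ⟨ha.deriv.congr h2.symm, h2.self_of_nhds.symm⟩
  · intro j
    rcases gen_dich (h := nfC (iteratedDeriv j f)) (fun z => (nfC_nf _ z).meromorphicAt) with h | h
    · exfalso
      refine hcore (j := j) (u := fun _ => 0) (R := 0) (C := 0) (N := 0) (fun z _ => analyticAt_const)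
        (fun z _ => by simp) fun z _ => ?_
      filter_upwards [h z, hg j z] with w a b
      rw [b, a]
    · exact h
  · intro j R C N h1 h2
    exact hcore h1 h2 fun z _ => hg j z
  · have hF : (⋃ j ∈ Finset.range 15, {z : ℂ | 0 < meroOrder (iteratedDeriv j f) z ∧ z.im ≠ 0}).Finite :=
      Set.Finite.biUnion (Finset.finite_toSet _) fun j hj => hfin j (by
        have := Finset.mem_range.1 (Finset.mem_coe.1 hj); omega)
    obtain ⟨R0, hR0⟩ := hF.isBounded.exists_norm_le
    refine ⟨R0, fun j hj z hz hre ha h0 => ?_⟩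
    have hmem : z ∈ ⋃ j ∈ Finset.range 15, {z : ℂ | 0 < meroOrder (iteratedDeriv j f) z ∧ z.im ≠ 0} := by
      refine Set.mem_biUnion (Finset.mem_coe.2 (Finset.mem_range.2 (by omega : j < 15))) ⟨?_, hre⟩
      rw [meroOrder, dif_pos (iter_mero hf j z), meromorphicOrderAt_congr (hg j z),
        ← tendsto_zero_iff_meromorphicOrderAt_pos ha.meromorphicAt]
      have := ha.continuousAt.tendsto
      rw [h0] at this
      exact this.mono_left nhdsWithin_le_nhds
    linarith [hR0 z hmem]
  · rintro ⟨c, hc⟩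
    apply hsnr
    refine ⟨c, ?_⟩
    have h0 := hg 0
    have h1 : Gen (fun w => mtilde f w = c * f w) := by
      refine (hc.and (h0.and h0.conj)).mono ?_
      rintro w ⟨a, b, d⟩
      rw [iteratedDeriv_zero] at a b d
      rw [mtilde] at a ⊢
      rw [d, a, ← b]
    exact h1

lemma rat_rel {f : ℂ → ℂ} {U : ℕ → ℂ → ℂ} (hU : Fam U)
    (hg : ∀ j, Gen (fun w => iteratedDeriv j f w = U j w)) {m : ℕ} {K : ℂ → ℂ}
    (hK : IsKm f m K) (hr : IsRatFn K) :
    ∃ p q : Polynomial ℂ, p ≠ 0 ∧ q ≠ 0 ∧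
      Gen (fun w => 1 - deriv (Yf (fun j => mtilde (U j)) m) w = rfn q p w * (1 - deriv (Yf U m) w)) := by
  have hV := hU.tilde
  obtain ⟨p, q, hq, hpq⟩ := hr
  have hpq' : Gen (fun w => K w = p.eval w / q.eval w) := hpq
  have hE : Gen (fun w => deriv (Fm f m) w = K w * deriv (Fm (mtilde f) m) w) := hK.2.2.2
  have key : ∀ (F : ℂ → ℂ) (W : ℕ → ℂ → ℂ), Fam W → (∀ j, Gen (fun w => iteratedDeriv j F w = W j w)) →
      Gen (fun w => deriv (Fm F m) w = 1 - deriv (Yf W m) w) := by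
    intro F W hW hFW
    have h1 : Gen (fun w => Fm F m w = w - Yf W m w) := by
      refine ((hFW m).and ((hFW (m+1)).and (Yf_gen hW m))).mono ?_
      rintro w ⟨a, b, c⟩
      rw [Fm, a, b, c]
    refine (h1.nhds.and (hW.Y_genan m)).mono ?_
    rintro w ⟨a, b⟩
    have e : Fm F m =ᶠ[𝓝 w] fun w => w - Yf W m w := a
    rw [e.deriv_eq]
    exact ((hasDerivAt_id w).sub b.differentiableAt.hasDerivAt).deriv
  have k1 := key f U hU hg
  have k2 := key (mtilde f) (fun j => mtilde (U j)) hV (fun j => by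
    refine (hg j).conj.mono fun w hw => ?_
    rw [mtilde_iter, mtilde, mtilde, hw])
  have hrel : Gen (fun w => 1 - deriv (Yf U m) w =
      p.eval w / q.eval w * (1 - deriv (Yf (fun j => mtilde (U j)) m) w)) := by
    refine (hpq'.and (hE.and (k1.and k2))).mono ?_
    rintro w ⟨a, b, c, d⟩
    rw [← c, ← d, b, a]
  have hp : p ≠ 0 := by
    rintro rfl
    obtain ⟨w, a, b⟩ := (hrel.and (hU.Y_rel m)).exists
    apply b.2.2.2.1
    rw [a]; simp
  refine ⟨p, q, hp, hq, (hrel.and ((poly_gen hp).and (poly_gen hq))).mono ?_⟩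
  rintro w ⟨a, b, c⟩
  rw [a, rfn]
  field_simp

lemma main_false {f : ℂ → ℂ} (hs : Setup 11 f)
    (hio : ¬ FiniteOrder f ∨ {z : ℂ | meroOrder f z < 0}.Infinite)
    {m : ℕ} (h1 : 1 ≤ m) (h2 : m ≤ 9)
    (hdm : ∃ Km Km' : ℂ → ℂ, IsKm f m Km ∧ IsKm f (m + 1) Km' ∧ IsRatFn Km ∧ IsRatFn Km') : False := by
  obtain ⟨U, D, hg⟩ := mkDat hs hio
  obtain ⟨K, K', hK, hK', hr, hr'⟩ := hdm
  obtain ⟨p, q, hp, hq, hrel⟩ := rat_rel D.fam hg hK hr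
  obtain ⟨p1, q1, hp1, hq1, hrel1⟩ := rat_rel D.fam hg hK' hr'
  by_cases hW : q.derivative * p - q * p.derivative = 0
  · obtain ⟨κ, hκ⟩ := mero_const (h := rfn q p)
      (fun z => (poly_an q z).meromorphicAt.div (poly_an p z).meromorphicAt) (by
        refine (poly_gen hp).mono fun w hw => ?_
        rw [rfn_deriv hw, hW]; simp)
    have hκ0 : κ ≠ 0 := by
      obtain ⟨w, a, b, c⟩ := (hκ.and ((poly_gen hp).and (poly_gen hq))).exists
      rw [← a]; exact div_ne_zero c b
    by_cases hB : Gen (fun w => Yf (fun j => mtilde (U j)) m w = Yf U m w)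
    · exact caseB D (by omega) hB
    · exact caseM D h1 (by omega) D.fam.tilde (fun j z k hre h => h.conj_real hre) hκ0 hp1
        ((hrel.and hκ).mono fun w hw => by rw [hw.1, hw.2]) hrel1 hB
  · exact caseF D h1 (by omega) hp hq hp1 hrel hrel1 hW

/-- Lemma 4.1 of the paper: under the Setup with `M = 11`, if `f` has
infinite order or infinitely many poles, and `m < m'` in `{1, ..., 10}` are both defective
(i.e. `K_m` and `K_{m+1}` are both rational), then `m' ≤ m + 2`. -/
theorem statement_17 (f : ℂ → ℂ) (hs : Setup 11 f)
    (hio : ¬ FiniteOrder f ∨ {z : ℂ | meroOrder f z < 0}.Infinite)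
    (m m' : ℕ) (h1 : 1 ≤ m) (h2 : m < m') (h3 : m' ≤ 10)
    (hdm : ∃ Km Km' : ℂ → ℂ, IsKm f m Km ∧ IsKm f (m + 1) Km' ∧ IsRatFn Km ∧ IsRatFn Km')
    (hdm' : ∃ Km Km' : ℂ → ℂ, IsKm f m' Km ∧ IsKm f (m' + 1) Km' ∧ IsRatFn Km ∧
      IsRatFn Km') :
    m' ≤ m + 2 := by
  exfalso
  exact main_false hs hio h1 (by omega) hdm
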